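/- (Burau, Zariski) Let f, g : (ℂ²,0) → (ℂ,0) be germs of holomorphic functions with isolated singularity at the origin. If the germs of plane curves V_f and V_g are topologically equisingular, then the algebraic multiplicities of f and g are equal: m_f = m_g. -/

import Mathlib

open scoped Topology

set_option synthInstance.maxHeartbeats 1000000
set_option maxHeartbeats 1000000

noncomputable section

/-- `ℂⁿ` with the Euclidean norm. -/
abbrev En (n : ℕ) := EuclideanSpace ℂ (Fin n)

instance germAlgebra {α : Type*} (l : Filter α) : Algebra ℂ (Filter.Germ l ℂ) :=
  ((Filter.Germ.coeRingHom l).comp (Pi.constRingHom α ℂ)).toAlgebra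

/-- The ring `𝒪ₙ` of germs at `0` of holomorphic functions on `ℂⁿ`. -/
def AnalyticGerms (n : ℕ) : Subalgebra ℂ ((𝓝 (0 : En n)).Germ ℂ) where
  carrier := {g | ∃ f : En n → ℂ, AnalyticAt ℂ f 0 ∧ g = (f : (𝓝 (0 : En n)).Germ ℂ)}
  add_mem' := by
    rintro a b ⟨f, hf, rfl⟩ ⟨g, hg, rfl⟩
    exact ⟨f + g, hf.add hg, rfl⟩
  mul_mem' := by
    rintro a b ⟨f, hf, rfl⟩ ⟨g, hg, rfl⟩
    exact ⟨f * g, hf.mul hg, rfl⟩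
  algebraMap_mem' := fun c => ⟨fun _ => c, analyticAt_const, rfl⟩

/-- The germ at `0` of the `i`-th partial derivative `∂f/∂zᵢ` of `f`. -/
def partialGerm {n : ℕ} (f : En n → ℂ) (i : Fin n) : (𝓝 (0 : En n)).Germ ℂ :=
  (↑(fun z => fderiv ℂ f z (EuclideanSpace.single i 1)) : (𝓝 (0 : En n)).Germ ℂ)

/-- The Jacobian ideal `⟨∂f/∂z₁, …, ∂f/∂zₙ⟩` of `f` in the ring `𝒪ₙ` of holomorphic
germs at `0`. -/
def jacobianIdeal {n : ℕ} (f : En n → ℂ) : Ideal (AnalyticGerms n) :=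
  Ideal.span {g : AnalyticGerms n | ∃ i : Fin n, (g : (𝓝 (0 : En n)).Germ ℂ) = partialGerm f i}

/-- The Milnor number `μ_f` of `f` at the origin: the complex dimension of
`𝒪ₙ/⟨∂f/∂z₁, …, ∂f/∂zₙ⟩`. -/
def milnorNumber {n : ℕ} (f : En n → ℂ) : ℕ :=
  Module.finrank ℂ ((AnalyticGerms n) ⧸ jacobianIdeal f)

/-- `f` has algebraic multiplicity `ν` with initial homogeneous term `P`:
in the Taylor expansion `f = f_ν + f_{ν+1} + ⋯` of `f` at `0`, the homogeneous
components of degree `< ν` vanish and the one of degree `ν` is `P ≠ 0`. -/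
def HasInitialTerm {n : ℕ} (f : En n → ℂ) (ν : ℕ) (P : En n → ℂ) : Prop :=
  ∃ p : FormalMultilinearSeries ℂ (En n) ℂ, HasFPowerSeriesAt f p 0 ∧
    (∀ k < ν, ∀ z : En n, (p k fun _ => z) = 0) ∧
    (∀ z : En n, P z = p ν fun _ => z) ∧ P ≠ 0

/-- The origin is an isolated singularity of `f`: the gradient of `f` vanishes at `0`
and at no other point of some neighborhood of `0`. -/
def IsolatedSingularityAt0 {n : ℕ} (f : En n → ℂ) : Prop :=
  fderiv ℂ f 0 = 0 ∧ ∃ U ∈ 𝓝 (0 : En n), ∀ z ∈ U, z ≠ 0 → fderiv ℂ f z ≠ 0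

/-- The germs at `0` of the hypersurfaces `V_f = f⁻¹(0)` and `V_g = g⁻¹(0)` are
topologically equisingular: some homeomorphism between neighborhoods of `0`
fixes `0` and sends `f⁻¹(0) ∩ U` onto `g⁻¹(0) ∩ U'`. -/
def TopEquisingular {n : ℕ} (f g : En n → ℂ) : Prop :=
  ∃ U U' : Set (En n), U ∈ 𝓝 (0 : En n) ∧ U' ∈ 𝓝 (0 : En n) ∧
    ∃ φ ψ : En n → En n, φ 0 = 0 ∧ ContinuousOn φ U ∧ ContinuousOn ψ U' ∧
      Set.MapsTo φ U U' ∧ Set.MapsTo ψ U' U ∧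
      (∀ z ∈ U, ψ (φ z) = z) ∧ (∀ z ∈ U', φ (ψ z) = z) ∧
      φ '' (f ⁻¹' {0} ∩ U) = g ⁻¹' {0} ∩ U'

/-- `φ` is a germ of homeomorphism of `(X, 0)`: a homeomorphism between neighborhoods
of `0` fixing `0`. -/
def IsGermHomeoAt0 {X : Type*} [TopologicalSpace X] [Zero X] (φ : X → X) : Prop :=
  ∃ U V : Set X, U ∈ 𝓝 (0 : X) ∧ V ∈ 𝓝 (0 : X) ∧ φ 0 = 0 ∧ ContinuousOn φ U ∧
    Set.MapsTo φ U V ∧ ∃ ψ : X → X, ContinuousOn ψ V ∧ Set.MapsTo ψ V U ∧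
      (∀ x ∈ U, ψ (φ x) = x) ∧ (∀ y ∈ V, φ (ψ y) = y)

/-- `f` and `g` are topologically right-left equivalent:
`f = ψ ∘ g ∘ φ` near `0` for germs of homeomorphisms `φ` of `(ℂⁿ,0)` and `ψ` of `(ℂ,0)`. -/
def TopRightLeftEquiv {n : ℕ} (f g : En n → ℂ) : Prop :=
  ∃ φ : En n → En n, ∃ ψ : ℂ → ℂ, IsGermHomeoAt0 φ ∧ IsGermHomeoAt0 ψ ∧
    ∀ᶠ z in 𝓝 (0 : En n), f z = ψ (g (φ z))

/-- Evaluation of a polynomial in `n` variables at a point of `ℂⁿ`. -/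
def evalE {n : ℕ} (f : MvPolynomial (Fin n) ℂ) : En n → ℂ :=
  fun z => MvPolynomial.eval (fun i => z i) f
namespace BurauZariski

open Set Filter Metric
open FreeGroup (lift of)
open Complex (I exp exp_ne_zero)
open scoped Real

set_option linter.unusedSectionVars false

section Cocycles

variable {P Q G K : Type*} [TopologicalSpace P] [TopologicalSpace Q] [Group G] [Group K]

/-- A two-point function that satisfies the cocycle identity locally on `E`. -/
def LocCoc (E : Set P) (c : P → P → G) : Prop :=
  ∀ p ∈ E, ∃ N ∈ 𝓝[E] p, ∀ a ∈ N, ∀ b ∈ N, ∀ d ∈ N, c a b * c b d = c a d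

/-- `c'` is locally obtained from `c` by the change of gauge `b`. -/
def Gauge (E : Set P) (b : P → G) (c c' : P → P → G) : Prop :=
  ∀ p ∈ E, ∃ N ∈ 𝓝[E] p, ∀ a ∈ N, ∀ d ∈ N, c' a d = (b a)⁻¹ * c a d * b d

lemma LocCoc.mono {E E' : Set P} {c : P → P → G} (h : LocCoc E c) (hE : E' ⊆ E) :
    LocCoc E' c := fun p hp =>
  let ⟨N, hN, h'⟩ := h p (hE hp)
  ⟨N, nhdsWithin_mono p hE hN, h'⟩

lemma Gauge.mono {E E' : Set P} {b : P → G} {c c' : P → P → G} (h : Gauge E b c c')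
    (hE : E' ⊆ E) : Gauge E' b c c' := fun p hp =>
  let ⟨N, hN, h'⟩ := h p (hE hp)
  ⟨N, nhdsWithin_mono p hE hN, h'⟩

lemma LocCoc.comp {E : Set P} {S : Set Q} {c : P → P → G} (h : LocCoc E c) {γ : Q → P}
    (hγ : ContinuousOn γ S) (hm : MapsTo γ S E) : LocCoc S (fun a d => c (γ a) (γ d)) := by
  intro q hq
  obtain ⟨N, hN, h'⟩ := h (γ q) (hm hq)
  exact ⟨γ ⁻¹' N, (hγ q hq).tendsto_nhdsWithin hm hN,
    fun a ha b hb d hd => h' _ ha _ hb _ hd⟩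

lemma Gauge.comp {E : Set P} {S : Set Q} {b : P → G} {c c' : P → P → G} (h : Gauge E b c c')
    {γ : Q → P} (hγ : ContinuousOn γ S) (hm : MapsTo γ S E) :
    Gauge S (fun a => b (γ a)) (fun a d => c (γ a) (γ d)) (fun a d => c' (γ a) (γ d)) := by
  intro q hq
  obtain ⟨N, hN, h'⟩ := h (γ q) (hm hq)
  exact ⟨γ ⁻¹' N, (hγ q hq).tendsto_nhdsWithin hm hN, fun a ha d hd => h' _ ha _ hd⟩

lemma LocCoc.map {E : Set P} {c : P → P → G} (h : LocCoc E c) (φ : G →* K) :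
    LocCoc E (fun a d => φ (c a d)) := by
  intro p hp
  obtain ⟨N, hN, h'⟩ := h p hp
  exact ⟨N, hN, fun a ha b hb d hd => by rw [← map_mul, h' a ha b hb d hd]⟩

lemma Gauge.map {E : Set P} {b : P → G} {c c' : P → P → G} (h : Gauge E b c c') (φ : G →* K) :
    Gauge E (fun a => φ (b a)) (fun a d => φ (c a d)) (fun a d => φ (c' a d)) := by
  intro p hp
  obtain ⟨N, hN, h'⟩ := h p hp
  exact ⟨N, hN, fun a ha d hd => by simp [h' a ha d hd]⟩

lemma Gauge.refl (E : Set P) (c : P → P → G) : Gauge E (fun _ => 1) c c :=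
  fun _ _ => ⟨univ, univ_mem, by simp⟩

lemma Gauge.symm {E : Set P} {b : P → G} {c c' : P → P → G} (h : Gauge E b c c') :
    Gauge E (fun a => (b a)⁻¹) c' c := by
  intro p hp
  obtain ⟨N, hN, h'⟩ := h p hp
  exact ⟨N, hN, fun a ha d hd => by rw [h' a ha d hd]; group⟩

lemma Gauge.trans {E : Set P} {b b' : P → G} {c c' c'' : P → P → G} (h : Gauge E b c c')
    (h1 : Gauge E b' c' c'') : Gauge E (fun a => b a * b' a) c c'' := by
  intro p hp
  obtain ⟨N, hN, h'⟩ := h p hp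
  obtain ⟨N1, hN1, h1'⟩ := h1 p hp
  exact ⟨N ∩ N1, inter_mem hN hN1, fun a ha d hd => by
    rw [h1' a ha.2 d hd.2, h' a ha.1 d hd.1]; group⟩

lemma Gauge.locCoc {E : Set P} {b : P → G} {c c' : P → P → G} (h : Gauge E b c c')
    (hc : LocCoc E c) : LocCoc E c' := by
  intro p hp
  obtain ⟨N, hN, h'⟩ := h p hp
  obtain ⟨N1, hN1, h1'⟩ := hc p hp
  refine ⟨N ∩ N1, inter_mem hN hN1, fun x hx y hy z hz => ?_⟩
  rw [h' x hx.1 y hy.1, h' y hy.1 z hz.1, h' x hx.1 z hz.1, ← h1' x hx.2 y hy.2 z hz.2]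
  group

lemma gauge_self (E : Set P) (b : P → G) (c : P → P → G) :
    Gauge E b c (fun a d => (b a)⁻¹ * c a d * b d) :=
  fun _ _ => ⟨univ, univ_mem, by simp⟩

lemma LocCoc.self {E : Set P} {c : P → P → G} (h : LocCoc E c) {p : P} (hp : p ∈ E) :
    c p p = 1 := by
  obtain ⟨N, hN, h'⟩ := h p hp
  have := mem_of_mem_nhdsWithin hp hN
  have := h' p this p this p this
  simpa using this

/-- Functions locally constant on a preconnected set are constant there. -/
lemma const_of_locConst {α : Type*} {E : Set P} (hE : IsPreconnected E) {f : P → α}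
    (hf : ∀ p ∈ E, ∃ N ∈ 𝓝[E] p, ∀ a ∈ N, f a = f p) {x y : P} (hx : x ∈ E) (hy : y ∈ E) :
    f x = f y := by
  let _ : TopologicalSpace α := ⊥
  have : DiscreteTopology α := ⟨rfl⟩
  have hc : ContinuousOn f E := by
    intro p hp
    obtain ⟨N, hN, h⟩ := hf p hp
    rw [ContinuousWithinAt, nhds_discrete]
    exact tendsto_pure.2 (mem_of_superset hN h)
  exact hE.constant hc hx hy

/-- Two gauges which agree at a point of a preconnected set on which they trivialise the
same cocycle agree. -/
lemma Gauge.unique {E : Set P} (hE : IsPreconnected E) {b b' : P → G} {c : P → P → G}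
    (h : Gauge E b (fun _ _ => 1) c) (h' : Gauge E b' (fun _ _ => 1) c) {x y : P}
    (hx : x ∈ E) (hy : y ∈ E) : b' x * (b x)⁻¹ = b' y * (b y)⁻¹ := by
  refine const_of_locConst hE (f := fun z => b' z * (b z)⁻¹) (fun p hp => ?_) hx hy
  obtain ⟨N, hN, h1⟩ := h p hp
  obtain ⟨N', hN', h1'⟩ := h' p hp
  have hp1 := mem_of_mem_nhdsWithin hp hN
  have hp2 := mem_of_mem_nhdsWithin hp hN'
  refine ⟨N ∩ N', inter_mem hN hN', fun a ha => ?_⟩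
  have e := (h1 p hp1 a ha.1).symm.trans (h1' p hp2 a ha.2)
  simp only [mul_one] at e
  have : b' a = b' p * ((b p)⁻¹ * b a) := by rw [e]; group
  simp only [this]; group

/-- Uniqueness for self-gauges at points where the cocycle is conjugated by a constant. -/
lemma Gauge.const_of_one {E : Set P} (hE : IsPreconnected E) {b : P → G}
    (h : Gauge E b (fun _ _ => 1) (fun _ _ => 1)) {x y : P}
    (hx : x ∈ E) (hy : y ∈ E) : b x = b y := by
  simpa using Gauge.unique hE (Gauge.refl E _) h hx hy

/-- Gluing of trivialisations over adjacent intervals. -/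
lemma Gauge.glue_Icc {a m b : ℝ} (ham : a ≤ m) (hmb : m ≤ b) {c : ℝ → ℝ → G}
    (hc : LocCoc (Icc a b) c) {β₁ β₂ : ℝ → G} (h₁ : Gauge (Icc a m) β₁ (fun _ _ => 1) c)
    (h₂ : Gauge (Icc m b) β₂ (fun _ _ => 1) c) (h : β₁ m = β₂ m) :
    Gauge (Icc a b) (fun s => if s ≤ m then β₁ s else β₂ s) (fun _ _ => 1) c := by
  intro p hp
  rcases lt_trichotomy p m with hpm | rfl | hpm
  · obtain ⟨N, hN, h'⟩ := h₁ p ⟨hp.1, hpm.le⟩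
    rw [mem_nhdsWithin_iff_eventually] at hN
    refine ⟨{x | x ∈ N ∧ x < m}, ?_, fun x hx y hy => ?_⟩
    · rw [mem_nhdsWithin_iff_eventually]
      filter_upwards [hN, eventually_lt_nhds hpm] with x hx hx' hx''
      exact ⟨hx ⟨hx''.1, hx'.le⟩, hx'⟩
    · simp [hx.2.le, hy.2.le, h' x hx.1 y hy.1]
  · obtain ⟨N, hN, h'⟩ := h₁ p ⟨hp.1, le_rfl⟩
    obtain ⟨N₂, hN₂, h₂'⟩ := h₂ p ⟨le_rfl, hp.2⟩
    obtain ⟨N₃, hN₃, h₃'⟩ := hc p hp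
    rw [mem_nhdsWithin_iff_eventually] at hN hN₂ hN₃
    have hpN := hN.self_of_nhds ⟨hp.1, le_rfl⟩
    have hpN₂ := hN₂.self_of_nhds ⟨le_rfl, hp.2⟩
    have hpN₃ := hN₃.self_of_nhds hp
    refine ⟨{x | (x ≤ p → x ∈ N) ∧ (p ≤ x → x ∈ N₂) ∧ x ∈ N₃}, ?_, fun x hx y hy => ?_⟩
    · rw [mem_nhdsWithin_iff_eventually]
      filter_upwards [hN, hN₂, hN₃] with x hx hx' hx'' hx3
      exact ⟨fun hle => hx ⟨hx3.1, hle⟩, fun hle => hx' ⟨hle, hx3.2⟩, hx'' hx3⟩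
    · rw [← h₃' x hx.2.2 p hpN₃ y hy.2.2]
      have e1 : c x p = (if x ≤ p then β₁ x else β₂ x)⁻¹ * β₁ p := by
        split_ifs with hle
        · simpa using h' x (hx.1 hle) p hpN
        · rw [h]; simpa using h₂' x (hx.2.1 (not_le.1 hle).le) p hpN₂
      have e2 : c p y = (β₁ p)⁻¹ * (if y ≤ p then β₁ y else β₂ y) := by
        split_ifs with hle
        · simpa using h' p hpN y (hy.1 hle)
        · rw [h]; simpa using h₂' p hpN₂ y (hy.2.1 (not_le.1 hle).le)
      rw [e1, e2]; group
  · obtain ⟨N, hN, h'⟩ := h₂ p ⟨hpm.le, hp.2⟩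
    rw [mem_nhdsWithin_iff_eventually] at hN
    refine ⟨{x | x ∈ N ∧ m < x}, ?_, fun x hx y hy => ?_⟩
    · rw [mem_nhdsWithin_iff_eventually]
      filter_upwards [hN, eventually_gt_nhds hpm] with x hx hx' hx''
      exact ⟨hx ⟨hx'.le, hx''.2⟩, hx'⟩
    · simp [not_le.2 hx.2, not_le.2 hy.2, h' x hx.1 y hy.1]

/-- Left translates of trivialisations are trivialisations. -/
lemma Gauge.const_mul {E : Set P} {β : P → G} {c : P → P → G}
    (h : Gauge E β (fun _ _ => 1) c) (g : G) : Gauge E (fun s => g * β s) (fun _ _ => 1) c := by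
  intro p hp
  obtain ⟨N, hN, h'⟩ := h p hp
  exact ⟨N, hN, fun a ha d hd => by rw [h' a ha d hd]; group⟩

/-- A cocycle on the unit interval is trivial. -/
lemma exists_gauge_Icc {c : ℝ → ℝ → G} (hc : LocCoc (Icc 0 1) c) :
    ∃ β : ℝ → G, β 0 = 1 ∧ Gauge (Icc 0 1) β (fun _ _ => 1) c := by
  have key : ∃ β : ℝ → G, Gauge (Icc (0:ℝ) 1) β (fun _ _ => 1) c := by
    choose! N hN hN' using hc
    simp_rw [mem_nhdsWithin_iff_eventually] at hN
    obtain ⟨t, ht0, htm, ⟨m, htm1⟩, hti⟩ := exists_monotone_Icc_subset_open_cover_Icc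
      (a := (0:ℝ)) (b := 1) zero_le_one (ι := Icc (0:ℝ) 1)
      (c := fun p => Subtype.val ⁻¹' (interior {x | x ∈ Icc (0:ℝ) 1 → x ∈ N p}))
      (fun p => isOpen_interior.preimage continuous_subtype_val)
      (fun x _ => mem_iUnion.2 ⟨x, mem_interior_iff_mem_nhds.2 (hN x x.2)⟩)
    have coc : ∀ n, ∀ a ∈ Icc (t n : ℝ) (t (n+1)), ∀ b ∈ Icc (t n : ℝ) (t (n+1)),
        ∀ d ∈ Icc (t n : ℝ) (t (n+1)), c a b * c b d = c a d := by
      intro n a ha b hb d hd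
      obtain ⟨p, hp⟩ := hti n
      have hsub : ∀ x ∈ Icc (t n : ℝ) (t (n+1)), x ∈ N p := fun x hx => by
        have hx' : x ∈ Icc (0:ℝ) 1 := ⟨(t n).2.1.trans hx.1, hx.2.trans (t (n+1)).2.2⟩
        have : (⟨x, hx'⟩ : Icc (0:ℝ) 1) ∈ Icc (t n) (t (n+1)) := hx
        exact interior_subset (hp this) hx'
      exact hN' p p.2 a (hsub a ha) b (hsub b hb) d (hsub d hd)
    have loc : LocCoc (Icc (0:ℝ) 1) c := fun p hp => ⟨_, mem_nhdsWithin_iff_eventually.2 (hN p hp),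
      fun a ha b hb d hd => hN' p hp a ha b hb d hd⟩
    have ind : ∀ n, ∃ β : ℝ → G, Gauge (Icc (0:ℝ) (t n)) β (fun _ _ => 1) c := by
      intro n
      induction n with
      | zero =>
        refine ⟨fun _ => 1, fun p hp => ⟨{0}, ?_, ?_⟩⟩
        · rw [ht0]; exact mem_of_superset self_mem_nhdsWithin (by simp)
        · rintro a rfl d rfl
          simpa using loc.self (p := (0:ℝ)) (by simp)
      | succ n ih =>
        obtain ⟨β, hβ⟩ := ih
        have hle : (t n : ℝ) ≤ t (n+1) := htm n.le_succ
        refine ⟨_, hβ.glue_Icc (t n).2.1 hle (loc.mono (Icc_subset_Icc le_rfl (t (n+1)).2.2))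
          (β₂ := fun s => β (t n) * c (t n) s) ?_ ?_⟩
        · refine fun p hp => ⟨Icc (t n) (t (n+1)), self_mem_nhdsWithin, fun a ha d hd => ?_⟩
          have h1 : (t n : ℝ) ∈ Icc (t n : ℝ) (t (n+1)) := ⟨le_rfl, hle⟩
          simp only [← coc n _ h1 a ha d hd]; group
        · simp [loc.self (t n).2]
    simpa [htm1 m le_rfl] using ind m
  obtain ⟨β, h⟩ := key
  exact ⟨fun s => (β 0)⁻¹ * β s, by simp, h.const_mul _⟩

/-- `g` is the holonomy of the cocycle `c` along the path `γ`. -/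
def Hol (c : P → P → G) (γ : ℝ → P) (g : G) : Prop :=
  ∃ β : ℝ → G, β 0 = 1 ∧ β 1 = g ∧ Gauge (Icc 0 1) β (fun _ _ => 1) (fun s t => c (γ s) (γ t))

lemma LocCoc.exists_hol {E : Set P} {c : P → P → G} (hc : LocCoc E c) {γ : ℝ → P}
    (hγ : ContinuousOn γ (Icc 0 1)) (hm : MapsTo γ (Icc 0 1) E) : ∃ g, Hol c γ g := by
  obtain ⟨β, h0, hβ⟩ := exists_gauge_Icc (hc.comp hγ hm)
  exact ⟨β 1, β, h0, rfl, hβ⟩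

lemma Hol.unique {c : P → P → G} {γ : ℝ → P} {g g' : G} (h : Hol c γ g) (h' : Hol c γ g') :
    g = g' := by
  obtain ⟨β, h0, h1, hβ⟩ := h
  obtain ⟨β', h0', h1', hβ'⟩ := h'
  have := Gauge.unique isPreconnected_Icc hβ hβ' (x := 0) (y := 1) (by simp) (by simp)
  rw [h0, h0', h1, h1', inv_one, mul_one] at this
  exact (mul_inv_eq_one.1 this.symm).symm

lemma Hol.map {c : P → P → G} {γ : ℝ → P} {g : G} (h : Hol c γ g) (φ : G →* K) :
    Hol (fun a d => φ (c a d)) γ (φ g) := by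
  obtain ⟨β, h0, h1, hβ⟩ := h
  refine ⟨fun s => φ (β s), by simp [h0], by simp [h1], ?_⟩
  simpa using hβ.map φ

lemma Hol.gauge {E : Set P} {b : P → G} {c c' : P → P → G} {γ : ℝ → P} {g : G}
    (h : Hol c γ g) (hb : Gauge E b c c') (hγ : ContinuousOn γ (Icc 0 1))
    (hm : MapsTo γ (Icc 0 1) E) : Hol c' γ ((b (γ 0))⁻¹ * g * b (γ 1)) := by
  obtain ⟨β, h0, h1, hβ⟩ := h
  refine ⟨fun s => (b (γ 0))⁻¹ * (β s * b (γ s)), by simp [h0], by simp [h1, mul_assoc], ?_⟩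
  exact (hβ.trans (hb.comp hγ hm)).const_mul _

/-- The holonomy is trivial along a path where the cocycle is trivial. -/
lemma Hol.one {c : P → P → G} {γ : ℝ → P}
    (h : ∀ s ∈ Icc (0:ℝ) 1, ∃ N ∈ 𝓝[Icc 0 1] s, ∀ a ∈ N, ∀ d ∈ N, c (γ a) (γ d) = 1) :
    Hol c γ 1 := by
  refine ⟨fun _ => 1, rfl, rfl, fun p hp => ?_⟩
  obtain ⟨N, hN, h'⟩ := h p hp
  exact ⟨N, hN, fun a ha d hd => by simp [h' a ha d hd]⟩

/-- Tube lemma for cocycles. -/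
lemma LocCoc.tube {E : Set P} {c : P × ℝ → P × ℝ → G} (hc : LocCoc (E ×ˢ Icc (0:ℝ) 1) c)
    {p : P} (hp : p ∈ E) : ∃ N ∈ 𝓝[E] p, ∀ s ∈ Icc (0:ℝ) 1, ∃ J ∈ 𝓝[Icc (0:ℝ) 1] s,
      ∀ x ∈ N ×ˢ J, ∀ y ∈ N ×ˢ J, ∀ z ∈ N ×ˢ J, c x y * c y z = c x z := by
  have := isCompact_Icc.induction_on (s := Icc (0:ℝ) 1)
    (p := fun S => ∃ N ∈ 𝓝[E] p, ∀ s ∈ S, s ∈ Icc (0:ℝ) 1 → ∃ J ∈ 𝓝[Icc (0:ℝ) 1] s,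
      ∀ x ∈ N ×ˢ J, ∀ y ∈ N ×ˢ J, ∀ z ∈ N ×ˢ J, c x y * c y z = c x z)
    ⟨univ, univ_mem, by simp⟩ ?_ ?_ ?_
  · obtain ⟨N, hN, h⟩ := this
    exact ⟨N, hN, fun s hs => h s hs hs⟩
  · rintro S T hST ⟨N, hN, h⟩
    exact ⟨N, hN, fun s hs => h s (hST hs)⟩
  · rintro S T ⟨N, hN, h⟩ ⟨N', hN', h'⟩
    refine ⟨N ∩ N', inter_mem hN hN', ?_⟩
    rintro s (hs | hs) hs1
    · obtain ⟨J, hJ, hJ'⟩ := h s hs hs1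
      exact ⟨J, hJ, fun x hx y hy z hz => hJ' x ⟨hx.1.1, hx.2⟩ y ⟨hy.1.1, hy.2⟩ z ⟨hz.1.1, hz.2⟩⟩
    · obtain ⟨J, hJ, hJ'⟩ := h' s hs hs1
      exact ⟨J, hJ, fun x hx y hy z hz => hJ' x ⟨hx.1.2, hx.2⟩ y ⟨hy.1.2, hy.2⟩ z ⟨hz.1.2, hz.2⟩⟩
  · intro s hs
    obtain ⟨M, hM, h⟩ := hc (p, s) ⟨hp, hs⟩
    rw [nhdsWithin_prod_eq] at hM
    obtain ⟨N, hN, J, hJ, hNJ⟩ := mem_prod_iff.1 hM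
    obtain ⟨W, hW, hsW, hWJ⟩ := mem_nhdsWithin.1 hJ
    refine ⟨W ∩ Icc 0 1, inter_mem (mem_nhdsWithin_of_mem_nhds (hW.mem_nhds hsW))
      self_mem_nhdsWithin, N, hN, fun r hr hr1 => ?_⟩
    refine ⟨J, mem_nhdsWithin.2 ⟨W, hW, hr.1, hWJ⟩, ?_⟩
    exact fun x hx y hy z hz => h x (hNJ hx) y (hNJ hy) z (hNJ hz)

/-- Homotopy invariance. -/
lemma LocCoc.homotopy {E : Set P} {E' : Set Q} {c : Q → Q → G} (hc : LocCoc E' c)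
    {h : P → ℝ → Q} (hh : ContinuousOn (fun x : P × ℝ => h x.1 x.2) (E ×ˢ Icc (0:ℝ) 1))
    (hm : ∀ p ∈ E, ∀ s ∈ Icc (0:ℝ) 1, h p s ∈ E') :
    ∃ b : P → G, (∀ p ∈ E, Hol c (h p) (b p)) ∧
      Gauge E b (fun a d => c (h a 0) (h d 0)) (fun a d => c (h a 1) (h d 1)) := by
  have i0 : (0:ℝ) ∈ Icc (0:ℝ) 1 := by simp
  have i1 : (1:ℝ) ∈ Icc (0:ℝ) 1 := by simp
  have hex : ∀ p ∈ E, ∃ g, Hol c (h p) g := fun p hp =>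
    hc.exists_hol (hh.comp (f := fun s : ℝ => (p, s)) (by fun_prop) (fun s hs => ⟨hp, hs⟩)) (fun s hs => hm p hp s hs)
  choose! b hb using hex
  refine ⟨b, hb, fun p hp => ?_⟩
  obtain ⟨N, hN, hNt⟩ := (hc.comp hh (fun x hx => hm x.1 hx.1 x.2 hx.2)).tube hp
  have hpN := mem_of_mem_nhdsWithin hp hN
  obtain ⟨β, hβ0, hβ1, hβ⟩ := hb p hp
  have key : ∀ a ∈ E ∩ N, b a = c (h a 0) (h p 0) * b p * c (h p 1) (h a 1) := by
    rintro a ⟨haE, haN⟩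
    refine (hb a haE).unique ⟨fun s => c (h a 0) (h p 0) * (β s * c (h p s) (h a s)), ?_, ?_, ?_⟩
    · obtain ⟨J, hJ, h'⟩ := hNt 0 i0
      have := mem_of_mem_nhdsWithin i0 hJ
      have e := h' (a, 0) ⟨haN, this⟩ (p, 0) ⟨hpN, this⟩ (a, 0) ⟨haN, this⟩
      simp only at e
      simp only [hβ0, one_mul, e, hc.self (hm a haE 0 i0)]
    · simp only [hβ1, mul_assoc]
    · refine Gauge.const_mul ?_ _
      intro s hs
      obtain ⟨J, hJ, h'⟩ := hNt s hs
      obtain ⟨J', hJ', h''⟩ := hβ s hs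
      refine ⟨J ∩ J' ∩ Icc 0 1, inter_mem (inter_mem hJ hJ') self_mem_nhdsWithin,
        fun x hx y hy => ?_⟩
      have e1 := h' (a, x) ⟨haN, hx.1.1⟩ (p, x) ⟨hpN, hx.1.1⟩ (a, x) ⟨haN, hx.1.1⟩
      have e2 := h' (a, x) ⟨haN, hx.1.1⟩ (p, x) ⟨hpN, hx.1.1⟩ (p, y) ⟨hpN, hy.1.1⟩
      have e3 := h' (a, x) ⟨haN, hx.1.1⟩ (p, y) ⟨hpN, hy.1.1⟩ (a, y) ⟨haN, hy.1.1⟩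
      have e4 := h'' x hx.1.2 y hy.1.2
      simp only [mul_one] at e1 e2 e3 e4 ⊢
      rw [hc.self (hm a haE x hx.2)] at e1
      rw [← e3, ← e2, e4, eq_inv_of_mul_eq_one_left e1]
      group
  refine ⟨E ∩ N, inter_mem self_mem_nhdsWithin hN, fun a ha d hd => ?_⟩
  rw [key a ha, key d hd]
  obtain ⟨J, hJ, h'⟩ := hNt 0 i0
  obtain ⟨J1, hJ1, h1'⟩ := hNt 1 i1
  have j0 := mem_of_mem_nhdsWithin i0 hJ
  have j1 := mem_of_mem_nhdsWithin i1 hJ1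
  have e1 := h' (a, 0) ⟨ha.2, j0⟩ (d, 0) ⟨hd.2, j0⟩ (p, 0) ⟨hpN, j0⟩
  have e2 := h' (d, 0) ⟨hd.2, j0⟩ (p, 0) ⟨hpN, j0⟩ (d, 0) ⟨hd.2, j0⟩
  have e3 := h1' (a, 1) ⟨ha.2, j1⟩ (p, 1) ⟨hpN, j1⟩ (d, 1) ⟨hd.2, j1⟩
  have e4 := h1' (a, 1) ⟨ha.2, j1⟩ (p, 1) ⟨hpN, j1⟩ (a, 1) ⟨ha.2, j1⟩
  simp only at e1 e2 e3 e4
  rw [hc.self (hm a ha.1 1 i1)] at e4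
  simp only [← e3, eq_inv_of_mul_eq_one_left e4, ← e1]
  group

/-- A cocycle on a star-shaped set is trivial. -/
lemma LocCoc.exists_gauge_of_star {F : Type*} [AddCommGroup F] [Module ℝ F]
    [TopologicalSpace F] [ContinuousAdd F] [ContinuousSMul ℝ F] {E : Set F} {x : F}
    (hE : StarConvex ℝ x E) {c : F → F → G} (hc : LocCoc E c) :
    ∃ b : F → G, Gauge E b (fun _ _ => 1) c := by
  by_cases hx : x ∈ E
  · obtain ⟨b, -, hb⟩ := hc.homotopy (E := E) (h := fun p s => (1 - s) • x + s • p)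
      (by fun_prop) (fun p hp s hs => hE hp (by linarith [hs.2]) hs.1 (by ring))
    refine ⟨b, ?_⟩
    simpa [hc.self hx] using hb
  · refine ⟨1, fun p hp => absurd (hE hp zero_le_one le_rfl (by simp) : _) ?_⟩
    simpa using hx

/-- A cocycle on a star-shaped set, locally trivial near `T`, is trivial relative to `T`. -/
lemma LocCoc.exists_gauge_of_star' {F : Type*} [AddCommGroup F] [Module ℝ F]
    [TopologicalSpace F] [ContinuousAdd F] [ContinuousSMul ℝ F] {E T : Set F} {x : F}
    (hE : StarConvex ℝ x E) (hT : IsPreconnected T) (hTE : T ⊆ E) {c : F → F → G}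
    (hc : LocCoc E c) (hcT : ∀ p ∈ T, ∃ N ∈ 𝓝[T] p, ∀ a ∈ N, ∀ d ∈ N, c a d = 1) :
    ∃ b : F → G, (∀ p ∈ T, b p = 1) ∧ Gauge E b (fun _ _ => 1) c := by
  obtain ⟨b, hb⟩ := hc.exists_gauge_of_star hE
  rcases T.eq_empty_or_nonempty with rfl | ⟨q, hq⟩
  · exact ⟨b, by simp, hb⟩
  · refine ⟨fun p => (b q)⁻¹ * b p, fun p hp => ?_, hb.const_mul _⟩
    have : Gauge T b (fun _ _ => 1) (fun _ _ => 1) := fun r hr => by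
      obtain ⟨N, hN, h⟩ := hb r (hTE hr)
      obtain ⟨N', hN', h'⟩ := hcT r hr
      exact ⟨N ∩ N', inter_mem (nhdsWithin_mono _ hTE hN) hN', fun a ha d hd => by
        rw [← h a ha.1 d hd.1, h' a ha.2 d hd.2]⟩
    simp only [Gauge.const_of_one hT this hp hq, inv_mul_cancel]

end Cocycles

section Relative

variable {P Q G K : Type*} [TopologicalSpace P] [TopologicalSpace Q] [Group G] [Group K]
  {E E' T T' Z : Set P}

/-- `c` is trivial near the points of `Z`. -/
def TrivOn (E Z : Set P) (c : P → P → G) : Prop :=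
  ∀ p ∈ Z, ∃ N ∈ 𝓝[E] p, ∀ a ∈ N, ∀ d ∈ N, c a d = 1

/-- A cocycle on `E` which is trivial near the points of `T`. -/
def RCoc (E T : Set P) (c : P → P → G) : Prop := LocCoc E c ∧ TrivOn E T c

/-- Equivalence of cocycles relative to `T`. -/
def REq (E T : Set P) (c c' : P → P → G) : Prop := ∃ b : P → G, (∀ p ∈ T, b p = 1) ∧ Gauge E b c c'

lemma REq.refl (c : P → P → G) : REq E T c c := ⟨fun _ => 1, fun _ _ => rfl, Gauge.refl E c⟩

lemma REq.symm {c c' : P → P → G} : REq E T c c' → REq E T c' c := fun ⟨b, hb, h⟩ =>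
  ⟨_, fun p hp => by simp [hb p hp], h.symm⟩

lemma REq.trans {c c' c'' : P → P → G} : REq E T c c' → REq E T c' c'' → REq E T c c'' :=
  fun ⟨b, hb, h⟩ ⟨b', hb', h'⟩ => ⟨_, fun p hp => by simp [hb p hp, hb' p hp], h.trans h'⟩

lemma REq.map {c c' : P → P → G} (φ : G →* K) :
    REq E T c c' → REq E T (fun a d => φ (c a d)) (fun a d => φ (c' a d)) :=
  fun ⟨b, hb, h⟩ => ⟨fun a => φ (b a), fun p hp => by simp [hb p hp], h.map φ⟩

lemma REq.comp {S S' : Set Q} {c c' : P → P → G} {γ : Q → P} (hγ : ContinuousOn γ S)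
    (hm : MapsTo γ S E) (hT : MapsTo γ S' T) :
    REq E T c c' → REq S S' (fun a d => c (γ a) (γ d)) (fun a d => c' (γ a) (γ d)) :=
  fun ⟨b, hb, h⟩ => ⟨fun a => b (γ a), fun _ hp => hb _ (hT hp), h.comp hγ hm⟩

lemma REq.mono {c c' : P → P → G} (hE : E' ⊆ E) (hT : T' ⊆ T) :
    REq E T c c' → REq E' T' c c' :=
  fun ⟨b, hb, h⟩ => ⟨b, fun p hp => hb p (hT hp), h.mono hE⟩

lemma TrivOn.map {c : P → P → G} (h : TrivOn E Z c) (φ : G →* K) :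
    TrivOn E Z (fun a d => φ (c a d)) := fun p hp =>
  let ⟨N, hN, h'⟩ := h p hp
  ⟨N, hN, fun a ha d hd => by simp [h' a ha d hd]⟩

lemma TrivOn.mono {c : P → P → G} (h : TrivOn E Z c) (hE : E' ⊆ E) :
    TrivOn E' Z c := fun p hp =>
  let ⟨N, hN, h'⟩ := h p hp
  ⟨N, nhdsWithin_mono p hE hN, h'⟩

lemma TrivOn.comp {S S' : Set Q} {c : P → P → G} (h : TrivOn E Z c) {γ : Q → P}
    (hγ : ContinuousOn γ S) (hm : MapsTo γ S E) (hZ : MapsTo γ S' Z) (hS : S' ⊆ S) :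
    TrivOn S S' (fun a d => c (γ a) (γ d)) := by
  intro q hq
  obtain ⟨N, hN, h'⟩ := h (γ q) (hZ hq)
  exact ⟨γ ⁻¹' N, (hγ q (hS hq)).tendsto_nhdsWithin hm hN, fun a ha d hd => h' _ ha _ hd⟩

lemma RCoc.comp {S S' : Set Q} {c : P → P → G} (h : RCoc E T c) {γ : Q → P}
    (hγ : ContinuousOn γ S) (hm : MapsTo γ S E) (hZ : MapsTo γ S' T) (hS : S' ⊆ S) :
    RCoc S S' (fun a d => c (γ a) (γ d)) := ⟨h.1.comp hγ hm, h.2.comp hγ hm hZ hS⟩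

lemma TrivOn.reEq {c c' : P → P → G} (h : TrivOn E Z c) (hZ : ∀ p ∈ Z, Z ∈ 𝓝[E] p)
    {b : P → G} (hb : ∀ p ∈ Z, b p = 1) (hg : Gauge E b c c') (hZE : Z ⊆ E) : TrivOn E Z c' := by
  intro p hp
  obtain ⟨N, hN, h1⟩ := h p hp
  obtain ⟨M, hM, h2⟩ := hg p (hZE hp)
  refine ⟨N ∩ M ∩ Z, inter_mem (inter_mem hN hM) (hZ p hp), fun a ha d hd => ?_⟩
  rw [h2 a ha.1.2 d hd.1.2, h1 a ha.1.1 d hd.1.1, hb a ha.2, hb d hd.2]; simp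

/-- A gauge between cocycles trivial near a preconnected set is constant there. -/
lemma Gauge.const_of_triv {c c' : P → P → G} {b : P → G} (hg : Gauge E b c c')
    (hZ : IsPreconnected Z) (hZE : Z ⊆ E) (h : TrivOn E Z c) (h' : TrivOn E Z c') {x y : P}
    (hx : x ∈ Z) (hy : y ∈ Z) : b x = b y := by
  refine Gauge.const_of_one hZ (fun p hp => ?_) hx hy
  obtain ⟨N, hN, h1⟩ := h p hp
  obtain ⟨M, hM, h2⟩ := hg p (hZE hp)
  obtain ⟨L, hL, h3⟩ := h' p hp
  refine ⟨N ∩ M ∩ L, nhdsWithin_mono _ hZE (inter_mem (inter_mem hN hM) hL), fun a ha d hd => ?_⟩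
  have := h2 a ha.1.2 d hd.1.2
  rwa [h1 a ha.1.1 d hd.1.1, h3 a ha.2 d hd.2] at this

lemma Gauge.one_of_triv {c c' : P → P → G} {b : P → G} (hg : Gauge E b c c')
    (hZ : IsPreconnected Z) (hZE : Z ⊆ E) (h : TrivOn E Z c) (h' : TrivOn E Z c') {x : P}
    (hx : x ∈ Z) (hb : b x = 1) {y : P} (hy : y ∈ Z) : b y = 1 :=
  (hg.const_of_triv hZ hZE h h' hy hx).trans hb

end Relative

section Representable

variable {P : Type} [TopologicalSpace P] {ι : Type}

/-- `u` is a universal cocycle on `E` relative to `T`, with free generators indexed by `I`. -/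
structure Repr (E T : Set P) (I : Finset ι) (u : P → P → FreeGroup ι) : Prop where
  rcoc : RCoc E T u
  exists_lift : ∀ {G : Type} [Group G] (c : P → P → G), RCoc E T c →
    ∃ g : ι → G, REq E T (fun a d => lift g (u a d)) c
  unique : ∀ {G : Type} [Group G] (g g' : ι → G),
    REq E T (fun a d => lift g (u a d)) (fun a d => lift g' (u a d)) → ∀ i ∈ I, g i = g' i
  supp : ∀ a d, u a d ∈ Subgroup.closure (of '' (I : Set ι))

lemma lift_congr {I : Finset ι} {G : Type*} [Group G] {g g' : ι → G} (h : ∀ i ∈ I, g i = g' i)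
    {w : FreeGroup ι} (hw : w ∈ Subgroup.closure (of '' (I : Set ι))) : lift g w = lift g' w := by
  refine MonoidHom.eqOn_closure (f := lift g) (g := lift g') ?_ hw
  rintro _ ⟨i, hi, rfl⟩
  simpa using h i hi

lemma lift_of_eq (w : FreeGroup ι) : lift (fun i => of i) w = w := by
  have : lift (fun i : ι => of i) = MonoidHom.id _ := by ext; simp
  exact DFunLike.congr_fun this w

lemma lift_lift {G : Type*} [Group G] (g : ι → G) (b : ι → FreeGroup ι) (w : FreeGroup ι) :
    lift g (lift b w) = lift (fun i => lift g (b i)) w := by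
  have : (lift g).comp (lift b) = lift (fun i => lift g (b i)) := by ext; simp
  exact DFunLike.congr_fun this w

lemma map_lift {G K : Type*} [Group G] [Group K] (φ : G →* K) (g : ι → G) (w : FreeGroup ι) :
    φ (lift g w) = lift (fun i => φ (g i)) w := by
  have : φ.comp (lift g) = lift (fun i => φ (g i)) := by ext; simp
  exact DFunLike.congr_fun this w

/-- The endomorphism of the free group that kills the generators outside `I`. -/
def killHom (I : Finset ι) : FreeGroup ι →* FreeGroup ι :=
  open Classical in lift (fun i => if i ∈ I then of i else 1)

lemma killHom_mem (I : Finset ι) (w : FreeGroup ι) :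
    killHom I w ∈ Subgroup.closure (of '' (I : Set ι)) := by
  induction w using FreeGroup.induction_on with
  | C1 => simp
  | of i =>
    by_cases h : i ∈ I
    · have : of i ∈ Subgroup.closure (of '' (I : Set ι)) :=
        Subgroup.subset_closure ⟨i, by simpa using h, rfl⟩
      simpa [killHom, h] using this
    · simp [killHom, h]
  | inv_of i ih => simpa using ih
  | mul x y hx hy => simpa using mul_mem hx hy

lemma killHom_eq {I : Finset ι} {w : FreeGroup ι}
    (hw : w ∈ Subgroup.closure (of '' (I : Set ι))) : killHom I w = w := by
  conv_rhs => rw [← lift_of_eq w]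
  exact lift_congr (fun i hi => by simp [hi]) hw

lemma Repr.of_reEq {E T : Set P} {I : Finset ι} {u u' : P → P → FreeGroup ι}
    (h : Repr E T I u) (hr : RCoc E T u') (he : REq E T u u')
    (hs : ∀ a d, u' a d ∈ Subgroup.closure (of '' (I : Set ι))) : Repr E T I u' where
  rcoc := hr
  exists_lift c hc := by
    obtain ⟨g, hg⟩ := h.exists_lift c hc
    exact ⟨g, (he.symm.map (lift g)).trans hg⟩
  unique g g' hg := h.unique g g' (((he.map (lift g)).trans hg).trans (he.symm.map (lift g')))
  supp := hs

/-- A universal cocycle may be normalised to be trivial over a convex open part. -/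
lemma Repr.normalize {F : Type} [AddCommGroup F] [Module ℝ F]
    [TopologicalSpace F] [ContinuousAdd F] [ContinuousSMul ℝ F] {E T Z : Set F} {I : Finset ι}
    {u : F → F → FreeGroup ι} (h : Repr E T I u) (hZE : Z ⊆ E) (hTE : T ⊆ E)
    (hTo : ∀ p ∈ T, T ∈ 𝓝[E] p)
    (hZ : Convex ℝ Z) (hZo : ∀ p ∈ Z, Z ∈ 𝓝[E] p) (hT : Convex ℝ T) :
    ∃ u', Repr E T I u' ∧ REq E T u u' ∧ TrivOn E Z u' := by
  obtain ⟨b, hb1, hb⟩ : ∃ b : F → FreeGroup ι, (∀ p ∈ T ∩ Z, b p = 1) ∧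
      Gauge Z b (fun _ _ => 1) u := by
    rcases Z.eq_empty_or_nonempty with rfl | ⟨x, hx⟩
    · exact ⟨1, by simp, fun p hp => hp.elim⟩
    · refine (h.rcoc.1.mono hZE).exists_gauge_of_star' (hZ.starConvex hx)
        (hT.inter hZ).isPreconnected inter_subset_right ?_
      intro p hp
      obtain ⟨N, hN, h'⟩ := h.rcoc.2 p hp.1
      exact ⟨N, nhdsWithin_mono _ (inter_subset_left.trans hTE) hN, h'⟩
  classical
  let B : F → FreeGroup ι := fun p => if p ∈ Z then killHom I (b p)⁻¹ else 1
  have hB1 : ∀ p ∈ T, B p = 1 := fun p hp => by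
    by_cases hpZ : p ∈ Z
    · simp [B, hpZ, hb1 p ⟨hp, hpZ⟩]
    · simp [B, hpZ]
  have hBm : ∀ p, B p ∈ Subgroup.closure (of '' (I : Set ι)) := fun p => by
    by_cases hpZ : p ∈ Z
    · simpa only [B, hpZ, if_true] using killHom_mem I _
    · simp [B, hpZ]
  have hg := gauge_self E B u
  refine ⟨_, h.of_reEq ⟨hg.locCoc h.rcoc.1, h.rcoc.2.reEq hTo hB1 hg hTE⟩ ⟨B, hB1, hg⟩
    (fun a d => mul_mem (mul_mem (inv_mem (hBm a)) (h.supp a d)) (hBm d)), ⟨B, hB1, hg⟩, ?_⟩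
  intro p hp
  obtain ⟨N, hN, h'⟩ := hb p hp
  refine ⟨N ∩ Z, inter_mem (nhdsWithin_le_of_mem (hZo p hp) hN) (hZo p hp), fun a ha d hd => ?_⟩
  have e : u a d = (killHom I (b a))⁻¹ * killHom I (b d) := by
    rw [← killHom_eq (h.supp a d), h' a ha.1 d hd.1]; simp
  simp only [B, ha.2, hd.2, if_true, e, map_inv]
  group

end Representable

section Wedge

variable {F : Type} [AddCommGroup F] [Module ℝ F] [TopologicalSpace F] [ContinuousAdd F]
  [ContinuousSMul ℝ F] {E E' T Z : Set F} {G : Type} [Group G]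

/-- A relative cocycle may be normalised to be trivial over a convex open part. -/
lemma RCoc.normalize {c : F → F → G} (h : RCoc E T c) (hZE : Z ⊆ E) (hTE : T ⊆ E)
    (hTo : ∀ p ∈ T, T ∈ 𝓝[E] p)
    (hZ : Convex ℝ Z) (hZo : ∀ p ∈ Z, Z ∈ 𝓝[E] p) (hT : Convex ℝ T) :
    ∃ c', RCoc E T c' ∧ REq E T c c' ∧ TrivOn E Z c' := by
  obtain ⟨b, hb1, hb⟩ : ∃ b : F → G, (∀ p ∈ T ∩ Z, b p = 1) ∧
      Gauge Z b (fun _ _ => 1) c := by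
    rcases Z.eq_empty_or_nonempty with rfl | ⟨x, hx⟩
    · exact ⟨1, by simp, fun p hp => hp.elim⟩
    · refine (h.1.mono hZE).exists_gauge_of_star' (hZ.starConvex hx)
        (hT.inter hZ).isPreconnected inter_subset_right ?_
      intro p hp
      obtain ⟨N, hN, h'⟩ := h.2 p hp.1
      exact ⟨N, nhdsWithin_mono _ (inter_subset_left.trans hTE) hN, h'⟩
  classical
  let B : F → G := fun p => if p ∈ Z then (b p)⁻¹ else 1
  have hB1 : ∀ p ∈ T, B p = 1 := fun p hp => by
    by_cases hpZ : p ∈ Z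
    · simp [B, hpZ, hb1 p ⟨hp, hpZ⟩]
    · simp [B, hpZ]
  have hg := gauge_self E B c
  refine ⟨_, ⟨hg.locCoc h.1, h.2.reEq hTo hB1 hg hTE⟩, ⟨B, hB1, hg⟩, ?_⟩
  intro p hp
  obtain ⟨N, hN, h'⟩ := hb p hp
  refine ⟨N ∩ Z, inter_mem (nhdsWithin_le_of_mem (hZo p hp) hN) (hZo p hp), fun a ha d hd => ?_⟩
  simp only [B, ha.2, hd.2, if_true, h' a ha.1 d hd.1]
  group

/-- Configuration of two open sets whose complements lie on two sides of a convex strip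
`Z₁ ∩ Z₂`. -/
structure WedgeData (E₁ E₂ Z₁ Z₂ T L : Set F) : Prop where
  oE₁ : IsOpen E₁
  oE₂ : IsOpen E₂
  oZ₁ : IsOpen Z₁
  oZ₂ : IsOpen Z₂
  oT : IsOpen T
  cZ₁ : Convex ℝ Z₁
  cZ₂ : Convex ℝ Z₂
  cT : Convex ℝ T
  sZ₁ : Z₁ ⊆ E₂
  sZ₂ : Z₂ ⊆ E₁
  sE₁ : E₁ ⊆ Z₁ ∪ Z₂
  sE₂ : E₂ ⊆ Z₁ ∪ Z₂
  sT₁ : T ⊆ E₁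
  sT₂ : T ⊆ E₂
  ne : (Z₁ ∩ Z₂ ∩ T).Nonempty
  hL : ∀ p ∈ Z₁, p ∉ Z₂ → L ∈ 𝓝 p
  hLc : ∀ p ∈ Z₂, p ∉ Z₁ → Lᶜ ∈ 𝓝 p

variable {E₁ E₂ Z₁ Z₂ L : Set F}

lemma WedgeData.symm (w : WedgeData E₁ E₂ Z₁ Z₂ T L) : WedgeData E₂ E₁ Z₂ Z₁ T Lᶜ :=
  ⟨w.oE₂, w.oE₁, w.oZ₂, w.oZ₁, w.oT, w.cZ₂, w.cZ₁, w.cT, w.sZ₂, w.sZ₁,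
    w.sE₂.trans_eq (union_comm _ _), w.sE₁.trans_eq (union_comm _ _), w.sT₂, w.sT₁,
    by simpa [inter_comm Z₂ Z₁] using w.ne, w.hLc, by simpa using w.hL⟩

lemma TrivOn.ev {c : F → F → G} (h : TrivOn E Z c) (hE : IsOpen E) (hZE : Z ⊆ E) {p : F}
    (hp : p ∈ Z) : ∃ N ∈ 𝓝 p, ∀ a ∈ N, ∀ d ∈ N, c a d = 1 := by
  obtain ⟨N, hN, h'⟩ := h p hp
  exact ⟨N, by rwa [hE.nhdsWithin_eq (hZE hp)] at hN, h'⟩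

lemma Gauge.ev {b : F → G} {c c' : F → F → G} (h : Gauge E b c c') (hE : IsOpen E) {p : F}
    (hp : p ∈ E) : ∃ N ∈ 𝓝 p, ∀ a ∈ N, ∀ d ∈ N, c' a d = (b a)⁻¹ * c a d * b d := by
  obtain ⟨N, hN, h'⟩ := h p hp
  exact ⟨N, by rwa [hE.nhdsWithin_eq hp] at hN, h'⟩

lemma LocCoc.ev {c : F → F → G} (h : LocCoc E c) (hE : IsOpen E) {p : F}
    (hp : p ∈ E) : ∃ N ∈ 𝓝 p, ∀ a ∈ N, ∀ b ∈ N, ∀ d ∈ N, c a b * c b d = c a d := by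
  obtain ⟨N, hN, h'⟩ := h p hp
  exact ⟨N, by rwa [hE.nhdsWithin_eq hp] at hN, h'⟩

lemma WedgeData.gauge_one (w : WedgeData E₁ E₂ Z₁ Z₂ T L) {c c' : F → F → G}
    (h : TrivOn E₁ Z₂ c) (h' : TrivOn E₁ Z₂ c') {b : F → G} (hb : ∀ p ∈ T, b p = 1)
    (hg : Gauge E₁ b c c') : ∀ p ∈ Z₂, b p = 1 := by
  obtain ⟨x, hx⟩ := w.ne
  exact fun p hp => hg.one_of_triv w.cZ₂.isPreconnected w.sZ₂ h h' hx.1.2 (hb x hx.2) hp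

lemma WedgeData.reEq (w : WedgeData E₁ E₂ Z₁ Z₂ T L) {c₁ c₂ c₁' c₂' : F → F → G}
    (h₁ : TrivOn E₁ Z₂ c₁) (h₂ : TrivOn E₂ Z₁ c₂) (h₁' : TrivOn E₁ Z₂ c₁')
    (h₂' : TrivOn E₂ Z₁ c₂') (e₁ : REq E₁ T c₁ c₁') (e₂ : REq E₂ T c₂ c₂') :
    REq (E₁ ∩ E₂) T (fun a d => c₁ a d * c₂ a d) (fun a d => c₁' a d * c₂' a d) := by
  obtain ⟨b₁, hb₁, hg₁⟩ := e₁
  obtain ⟨b₂, hb₂, hg₂⟩ := e₂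
  have k₁ := w.gauge_one h₁ h₁' hb₁ hg₁
  have k₂ := w.symm.gauge_one h₂ h₂' hb₂ hg₂
  refine ⟨fun a => b₁ a * b₂ a, fun p hp => by simp [hb₁ p hp, hb₂ p hp], fun p hp => ?_⟩
  rcases w.sE₁ hp.1 with hz | hz
  · obtain ⟨N, hN, n⟩ := h₂.ev w.oE₂ w.sZ₁ hz
    obtain ⟨N', hN', n'⟩ := h₂'.ev w.oE₂ w.sZ₁ hz
    obtain ⟨M, hM, m⟩ := hg₁.ev w.oE₁ hp.1
    refine ⟨N ∩ N' ∩ M ∩ Z₁, mem_nhdsWithin_of_mem_nhds (inter_mem (inter_mem (inter_mem hN hN')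
      hM) (w.oZ₁.mem_nhds hz)), ?_⟩
    rintro a ⟨⟨⟨a1, a2⟩, a3⟩, a4⟩ d ⟨⟨⟨d1, d2⟩, d3⟩, d4⟩
    simp [n a a1 d d1, n' a a2 d d2, m a a3 d d3, k₂ a a4, k₂ d d4]
  · obtain ⟨N, hN, n⟩ := h₁.ev w.oE₁ w.sZ₂ hz
    obtain ⟨N', hN', n'⟩ := h₁'.ev w.oE₁ w.sZ₂ hz
    obtain ⟨M, hM, m⟩ := hg₂.ev w.oE₂ hp.2
    refine ⟨N ∩ N' ∩ M ∩ Z₂, mem_nhdsWithin_of_mem_nhds (inter_mem (inter_mem (inter_mem hN hN')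
      hM) (w.oZ₂.mem_nhds hz)), ?_⟩
    rintro a ⟨⟨⟨a1, a2⟩, a3⟩, a4⟩ d ⟨⟨⟨d1, d2⟩, d3⟩, d4⟩
    simp [n a a1 d d1, n' a a2 d d2, m a a3 d d3, k₁ a a4, k₁ d d4]

lemma WedgeData.rcoc (w : WedgeData E₁ E₂ Z₁ Z₂ T L) {c₁ c₂ : F → F → G}
    (h₁ : TrivOn E₁ Z₂ c₁) (h₂ : TrivOn E₂ Z₁ c₂) (r₁ : RCoc E₁ T c₁) (r₂ : RCoc E₂ T c₂) :
    RCoc (E₁ ∩ E₂) T (fun a d => c₁ a d * c₂ a d) := by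
  constructor
  · intro p hp
    rcases w.sE₁ hp.1 with hz | hz
    · obtain ⟨N, hN, n⟩ := h₂.ev w.oE₂ w.sZ₁ hz
      obtain ⟨M, hM, m⟩ := r₁.1.ev w.oE₁ hp.1
      refine ⟨N ∩ M, mem_nhdsWithin_of_mem_nhds (inter_mem hN hM), ?_⟩
      rintro a ⟨a1, a2⟩ b ⟨b1, b2⟩ d ⟨d1, d2⟩
      simp [n a a1 d d1, n a a1 b b1, n b b1 d d1, m a a2 b b2 d d2]
    · obtain ⟨N, hN, n⟩ := h₁.ev w.oE₁ w.sZ₂ hz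
      obtain ⟨M, hM, m⟩ := r₂.1.ev w.oE₂ hp.2
      refine ⟨N ∩ M, mem_nhdsWithin_of_mem_nhds (inter_mem hN hM), ?_⟩
      rintro a ⟨a1, a2⟩ b ⟨b1, b2⟩ d ⟨d1, d2⟩
      simp [n a a1 d d1, n a a1 b b1, n b b1 d d1, m a a2 b b2 d d2]
  · intro p hp
    obtain ⟨N, hN, n⟩ := r₁.2.ev w.oE₁ w.sT₁ hp
    obtain ⟨M, hM, m⟩ := r₂.2.ev w.oE₂ w.sT₂ hp
    exact ⟨N ∩ M, mem_nhdsWithin_of_mem_nhds (inter_mem hN hM), fun a ha d hd => by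
      simp [n a ha.1 d hd.1, m a ha.2 d hd.2]⟩

open Classical in
/-- The part of a cocycle supported in `L`. -/
def cutOff (L : Set F) (c : F → F → G) : F → F → G := fun a d => if a ∈ L ∧ d ∈ L then c a d else 1

lemma WedgeData.cutOff (w : WedgeData E₁ E₂ Z₁ Z₂ T L) {c : F → F → G}
    (r : RCoc (E₁ ∩ E₂) T c) (h : TrivOn (E₁ ∩ E₂) (Z₁ ∩ Z₂) c) :
    RCoc E₁ T (cutOff L c) ∧ TrivOn E₁ Z₂ (cutOff L c) := by
  have hS : Z₁ ∩ Z₂ ⊆ E₁ ∩ E₂ := fun p hp => ⟨w.sZ₂ hp.2, w.sZ₁ hp.1⟩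
  have tZ : TrivOn E₁ Z₂ (BurauZariski.cutOff L c) := by
    intro p hp
    by_cases hz : p ∈ Z₁
    · obtain ⟨N, hN, n⟩ := h.ev (w.oE₁.inter w.oE₂) hS ⟨hz, hp⟩
      exact ⟨N, mem_nhdsWithin_of_mem_nhds hN, fun a ha d hd => by simp [BurauZariski.cutOff, n a ha d hd]⟩
    · exact ⟨_, mem_nhdsWithin_of_mem_nhds (w.hLc p hp hz), fun a ha d hd => by
        simp only [mem_compl_iff] at ha
        simp [BurauZariski.cutOff, ha]⟩
  refine ⟨⟨fun p hp => ?_, fun p hp => ?_⟩, tZ⟩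
  · by_cases hz : p ∈ Z₂
    · obtain ⟨N, hN, n⟩ := tZ p hz
      exact ⟨N, hN, fun a ha b hb d hd => by rw [n a ha b hb, n b hb d hd, n a ha d hd, one_mul]⟩
    · have hz1 := (w.sE₁ hp).resolve_right hz
      obtain ⟨N, hN, n⟩ := r.1.ev (w.oE₁.inter w.oE₂) ⟨hp, w.sZ₁ hz1⟩
      refine ⟨N ∩ L, mem_nhdsWithin_of_mem_nhds (inter_mem hN (w.hL p hz1 hz)),
        fun a ha b hb d hd => ?_⟩
      simp [BurauZariski.cutOff, ha.2, hb.2, hd.2, n a ha.1 b hb.1 d hd.1]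
  · obtain ⟨N, hN, n⟩ := r.2.ev (w.oE₁.inter w.oE₂) (subset_inter w.sT₁ w.sT₂) hp
    exact ⟨N, mem_nhdsWithin_of_mem_nhds hN, fun a ha d hd => by simp [BurauZariski.cutOff, n a ha d hd]⟩

lemma WedgeData.split (w : WedgeData E₁ E₂ Z₁ Z₂ T L) {c : F → F → G}
    (r : RCoc (E₁ ∩ E₂) T c) : ∃ c₁ c₂ : F → F → G, RCoc E₁ T c₁ ∧ TrivOn E₁ Z₂ c₁ ∧
      RCoc E₂ T c₂ ∧ TrivOn E₂ Z₁ c₂ ∧ REq (E₁ ∩ E₂) T (fun a d => c₁ a d * c₂ a d) c := by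
  have hS : Z₁ ∩ Z₂ ⊆ E₁ ∩ E₂ := fun p hp => ⟨w.sZ₂ hp.2, w.sZ₁ hp.1⟩
  have oE := w.oE₁.inter w.oE₂
  obtain ⟨c', r', e, t⟩ := r.normalize (Z := Z₁ ∩ Z₂) hS (subset_inter w.sT₁ w.sT₂)
    (fun p hp => mem_nhdsWithin_of_mem_nhds (w.oT.mem_nhds hp)) (w.cZ₁.inter w.cZ₂)
    (fun p hp => mem_nhdsWithin_of_mem_nhds ((w.oZ₁.inter w.oZ₂).mem_nhds hp)) w.cT
  obtain ⟨r₁, t₁⟩ := w.cutOff r' t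
  obtain ⟨r₂, t₂⟩ := w.symm.cutOff (c := c') (by rwa [inter_comm]) (by
    rwa [inter_comm E₂, inter_comm Z₂])
  refine ⟨_, _, r₁, t₁, r₂, t₂, REq.trans ⟨fun _ => 1, fun _ _ => rfl, fun p hp => ?_⟩ e.symm⟩
  by_cases h1 : p ∈ Z₁
  · by_cases h2 : p ∈ Z₂
    · obtain ⟨N, hN, n⟩ := t.ev oE hS ⟨h1, h2⟩
      exact ⟨N, mem_nhdsWithin_of_mem_nhds hN, fun a ha d hd => by
        simp [BurauZariski.cutOff, n a ha d hd]⟩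
    · exact ⟨_, mem_nhdsWithin_of_mem_nhds (w.hL p h1 h2), fun a ha d hd => by
        simp [BurauZariski.cutOff, ha, hd]⟩
  · exact ⟨_, mem_nhdsWithin_of_mem_nhds (w.hLc p ((w.sE₁ hp.1).resolve_left h1) h1),
      fun a ha d hd => by
        simp only [mem_compl_iff] at ha hd
        simp [BurauZariski.cutOff, ha, hd]⟩

variable {ι : Type} {I₁ I₂ : Finset ι} {u₁ u₂ : F → F → FreeGroup ι}

lemma WedgeData.unique (w : WedgeData E₁ E₂ Z₁ Z₂ T L) (h₁ : Repr E₁ T I₁ u₁)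
    (t₁ : TrivOn E₁ Z₂ u₁) (t₂ : TrivOn E₂ Z₁ u₂) (g g' : ι → G)
    (h : REq (E₁ ∩ E₂) T (fun a d => lift g (u₁ a d * u₂ a d))
      (fun a d => lift g' (u₁ a d * u₂ a d))) : ∀ i ∈ I₁, g i = g' i := by
  classical
  have hS : Z₁ ∩ Z₂ ⊆ E₁ ∩ E₂ := fun p hp => ⟨w.sZ₂ hp.2, w.sZ₁ hp.1⟩
  have oE := w.oE₁.inter w.oE₂
  obtain ⟨b, hb, hg⟩ := h
  have tS : ∀ g : ι → G, TrivOn (E₁ ∩ E₂) (Z₁ ∩ Z₂) (fun a d => lift g (u₁ a d * u₂ a d)) := by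
    intro g p hp
    obtain ⟨N, hN, n⟩ := t₁ p hp.2
    obtain ⟨M, hM, m⟩ := t₂ p hp.1
    exact ⟨N ∩ M, inter_mem (nhdsWithin_mono _ inter_subset_left hN)
      (nhdsWithin_mono _ inter_subset_right hM), fun a ha d hd => by
        simp [n a ha.1 d hd.1, m a ha.2 d hd.2]⟩
  have hbS : ∀ p ∈ Z₁ ∩ Z₂, b p = 1 := by
    obtain ⟨x, hx⟩ := w.ne
    exact fun p hp => hg.one_of_triv (w.cZ₁.inter w.cZ₂).isPreconnected hS (tS g) (tS g') hx.1
      (hb x hx.2) hp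
  refine h₁.unique g g' ⟨fun a => if a ∈ L then b a else 1, fun p hp => by simp [hb p hp],
    fun p hp => ?_⟩
  by_cases h2 : p ∈ Z₂
  · obtain ⟨N, hN, n⟩ := t₁ p h2
    have : ∃ M ∈ 𝓝 p, ∀ a ∈ M, (if a ∈ L then b a else 1) = 1 := by
      by_cases h1 : p ∈ Z₁
      · exact ⟨Z₁ ∩ Z₂, (w.oZ₁.inter w.oZ₂).mem_nhds ⟨h1, h2⟩, fun a ha => by simp [hbS a ha]⟩
      · exact ⟨_, w.hLc p h2 h1, fun a ha => if_neg ha⟩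
    obtain ⟨M, hM, m⟩ := this
    refine ⟨N ∩ M, inter_mem hN (mem_nhdsWithin_of_mem_nhds hM), fun a ha d hd => ?_⟩
    simp only [n a ha.1 d hd.1, m a ha.2, m d hd.2]; simp
  · have h1 := (w.sE₁ hp).resolve_right h2
    obtain ⟨N, hN, n⟩ := t₂.ev w.oE₂ w.sZ₁ h1
    obtain ⟨M, hM, m⟩ := hg.ev oE ⟨hp, w.sZ₁ h1⟩
    refine ⟨N ∩ M ∩ L, mem_nhdsWithin_of_mem_nhds (inter_mem (inter_mem hN hM)
      (w.hL p h1 h2)), fun a ha d hd => ?_⟩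
    have := m a ha.1.2 d hd.1.2
    rw [n a ha.1.1 d hd.1.1, mul_one] at this
    simp only [ha.2, hd.2, if_true, this]

lemma WedgeData.repr [DecidableEq ι] (w : WedgeData E₁ E₂ Z₁ Z₂ T L) (h₁ : Repr E₁ T I₁ u₁)
    (h₂ : Repr E₂ T I₂ u₂) (t₁ : TrivOn E₁ Z₂ u₁) (t₂ : TrivOn E₂ Z₁ u₂)
    (hI : Disjoint I₁ I₂) : Repr (E₁ ∩ E₂) T (I₁ ∪ I₂) (fun a d => u₁ a d * u₂ a d) where
  rcoc := w.rcoc t₁ t₂ h₁.rcoc h₂.rcoc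
  exists_lift c hc := by
    obtain ⟨c₁, c₂, r₁, s₁, r₂, s₂, e⟩ := w.split hc
    obtain ⟨g₁, hg₁⟩ := h₁.exists_lift c₁ r₁
    obtain ⟨g₂, hg₂⟩ := h₂.exists_lift c₂ r₂
    refine ⟨fun i => if i ∈ I₁ then g₁ i else g₂ i, REq.trans ?_ e⟩
    have := w.reEq (t₁.map (lift g₁)) (t₂.map (lift g₂)) s₁ s₂ hg₁ hg₂
    convert this using 4 with a d
    rw [map_mul]
    congr 1
    · exact lift_congr (fun i hi => by simp [hi]) (h₁.supp a d)
    · exact lift_congr (fun i hi => by simp [Finset.disjoint_right.1 hI hi]) (h₂.supp a d)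
  unique := by
    intro G _ g g' h i hi
    rcases Finset.mem_union.1 hi with hi | hi
    · exact w.unique h₁ t₁ t₂ g g' h i hi
    · refine w.symm.unique h₂ t₂ t₁ g g' ?_ i hi
      have swap (g : ι → G) : REq (E₂ ∩ E₁) T (fun a d => lift g (u₁ a d * u₂ a d))
          (fun a d => lift g (u₂ a d * u₁ a d)) := by
        refine ⟨fun _ => 1, fun _ _ => rfl, fun p hp => ?_⟩
        rcases w.sE₁ hp.2 with hz | hz
        · obtain ⟨N, hN, n⟩ := t₂.ev w.oE₂ w.sZ₁ hz
          exact ⟨N, mem_nhdsWithin_of_mem_nhds hN, fun a ha d hd => by simp [n a ha d hd]⟩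
        · obtain ⟨N, hN, n⟩ := t₁.ev w.oE₁ w.sZ₂ hz
          exact ⟨N, mem_nhdsWithin_of_mem_nhds hN, fun a ha d hd => by simp [n a ha d hd]⟩
      rw [inter_comm] at h
      exact ((swap g).symm.trans h).trans (swap g')
  supp a d := by
    refine mul_mem (Subgroup.closure_mono (image_mono ?_) (h₁.supp a d))
      (Subgroup.closure_mono (image_mono ?_) (h₂.supp a d)) <;> simp

end Wedge

section Single

/-- The indicator of the right half-plane. -/
def rightInd (z : ℂ) : ℤ := open Classical in if 0 < z.re then 1 else 0

/-- Signed number of crossings of the negative imaginary axis by a short segment. -/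
def wnd (a d : ℂ) : ℤ := open Classical in if a.im < 0 then rightInd d - rightInd a else 0

lemma wnd_cases {z : ℂ} (hz : z ≠ 0) :
    (∃ N ∈ 𝓝 z, (∀ a ∈ N, ∀ d ∈ N, wnd a d = 0)) ∨ z.im < 0 := by
  rcases lt_trichotomy z.im 0 with h | h | h
  · exact Or.inr h
  · left
    have hr : z.re ≠ 0 := fun h' => hz (Complex.ext h' h)
    rcases lt_or_gt_of_ne hr with h' | h'
    · refine ⟨{w | w.re < 0}, (isOpen_lt Complex.continuous_re continuous_const).mem_nhds h', ?_⟩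
      intro a ha d hd
      simp only [mem_ofPred_eq] at ha hd
      simp [wnd, rightInd, not_lt.2 ha.le, not_lt.2 hd.le]
    · refine ⟨{w | 0 < w.re}, (isOpen_lt continuous_const Complex.continuous_re).mem_nhds h', ?_⟩
      intro a ha d hd
      simp only [mem_ofPred_eq] at ha hd
      simp [wnd, rightInd, ha, hd]
  · left
    refine ⟨{w | 0 < w.im}, (isOpen_lt continuous_const Complex.continuous_im).mem_nhds h, ?_⟩
    intro a ha d hd
    simp only [mem_ofPred_eq] at ha
    simp [wnd, not_lt.2 ha.le]

lemma wnd_loc {z : ℂ} (hz : z ≠ 0) :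
    ∃ N ∈ 𝓝 z, ∀ a ∈ N, ∀ b ∈ N, ∀ d ∈ N, wnd a b + wnd b d = wnd a d := by
  rcases wnd_cases hz with ⟨N, hN, h⟩ | h
  · exact ⟨N, hN, fun a ha b hb d hd => by rw [h a ha b hb, h b hb d hd, h a ha d hd, add_zero]⟩
  · refine ⟨{w | w.im < 0}, (isOpen_lt Complex.continuous_im continuous_const).mem_nhds h, ?_⟩
    intro a ha b hb d hd
    simp only [mem_ofPred_eq] at ha hb
    simp [wnd, ha, hb]

/-- The winding cocycle of a nonvanishing function. -/
def wcoc {P : Type*} (f : P → ℂ) (a d : P) : Multiplicative ℤ := Multiplicative.ofAdd (wnd (f a) (f d))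

lemma wcoc_locCoc_compl : LocCoc ({0}ᶜ : Set ℂ) (wcoc fun z => z) := by
  intro z hz
  obtain ⟨N, hN, h⟩ := wnd_loc hz
  exact ⟨N, mem_nhdsWithin_of_mem_nhds hN, fun a ha b hb d hd => by
    rw [wcoc, wcoc, wcoc, ← ofAdd_add, h a ha b hb d hd]⟩

lemma wcoc_locCoc {P : Type*} [TopologicalSpace P] {E : Set P} {f : P → ℂ} (hf : ContinuousOn f E)
    (h0 : ∀ p ∈ E, f p ≠ 0) : LocCoc E (wcoc f) :=
  wcoc_locCoc_compl.comp hf h0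

/-- The complement of the strands `y i`, `i ∈ J`, over a left half-plane. -/
def Efib {ι : Type} (J : Finset ι) (y : ι → ℂ → ℂ) (s : ℝ) : Set (ℂ × ℂ) :=
  {p | p.1.re < s ∧ ∀ i ∈ J, p.2 ≠ y i p.1}

/-- The region at infinity used for normalisation. -/
def Tfib (s : ℝ) : Set (ℂ × ℂ) := {p | p.1.re < s ∧ 3 < p.2.im}

/-- The counterclockwise circle of radius `4` in the fibre over `ω`, based at `4 * I`. -/
def circ (ω : ℂ) (t : ℝ) : ℂ × ℂ := (ω, 4 * I * exp (2 * π * I * t))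

lemma circ_eq (ω : ℂ) (t : ℝ) : (circ ω t).2 = 4 * I * exp ((2 * π * t : ℝ) * I) := by
  rw [circ, Complex.ofReal_mul, Complex.ofReal_mul, Complex.ofReal_ofNat]
  dsimp only
  ring_nf

lemma circ_re (ω : ℂ) (t : ℝ) : (circ ω t).2.re = -4 * Real.sin (2 * π * t) := by
  rw [circ_eq]
  generalize 2 * π * t = θ
  rw [Complex.exp_mul_I, ← Complex.ofReal_cos, ← Complex.ofReal_sin]
  simp [-Complex.ofReal_cos, -Complex.ofReal_sin]

lemma circ_im (ω : ℂ) (t : ℝ) : (circ ω t).2.im = 4 * Real.cos (2 * π * t) := by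
  rw [circ_eq]
  generalize 2 * π * t = θ
  rw [Complex.exp_mul_I, ← Complex.ofReal_cos, ← Complex.ofReal_sin]
  simp [-Complex.ofReal_cos, -Complex.ofReal_sin]

lemma circ_norm (ω : ℂ) (t : ℝ) : ‖(circ ω t).2‖ = 4 := by
  rw [circ_eq, norm_mul, Complex.norm_exp_ofReal_mul_I]
  simp

lemma continuous_circ (ω : ℂ) : Continuous (circ ω) := by
  unfold circ; fun_prop

lemma circ_zero (ω : ℂ) : circ ω 0 = (ω, 4 * I) := by simp [circ]

lemma circ_one (ω : ℂ) : circ ω 1 = (ω, 4 * I) := by simp [circ, Complex.exp_two_pi_mul_I]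

lemma hol_wcoc_circ (ω : ℂ) : Hol (wcoc (fun p : ℂ × ℂ => p.2)) (circ ω) (Multiplicative.ofAdd 1) := by
  classical
  refine ⟨fun t => if 1 / 2 < t then Multiplicative.ofAdd 1 else 1, by norm_num, by norm_num, ?_⟩
  have pi := Real.pi_pos
  have hk1 : ∀ t : ℝ, 0 ≤ t → t ≤ 1 / 2 → rightInd (circ ω t).2 = 0 := by
    intro t h0 h1
    have : 0 ≤ Real.sin (2 * π * t) :=
      Real.sin_nonneg_of_nonneg_of_le_pi (by positivity) (by nlinarith)
    simp [rightInd, circ_re, this]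
  have hk2 : ∀ t : ℝ, 1 / 2 < t → t < 1 → rightInd (circ ω t).2 = 1 := by
    intro t h0 h1
    have : Real.sin (2 * π * t) < 0 := by
      rw [← Real.sin_sub_two_pi]
      exact Real.sin_neg_of_neg_of_neg_pi_lt (by nlinarith) (by nlinarith)
    simp [rightInd, circ_re, this]
  have hc1 : ∀ t : ℝ, 1 / 4 < t → t < 3 / 4 → (circ ω t).2.im < 0 := by
    intro t h0 h1
    have := Real.cos_neg_of_pi_div_two_lt_of_lt (x := 2 * π * t) (by nlinarith) (by nlinarith)
    rw [circ_im]; linarith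
  have hc2 : ∀ t : ℝ, 3 / 4 < t → t ≤ 1 → ¬ (circ ω t).2.im < 0 := by
    intro t h0 h1
    have := Real.cos_nonneg_of_mem_Icc (x := 2 * π * t - 2 * π)
      ⟨by nlinarith, by nlinarith⟩
    rw [Real.cos_sub_two_pi] at this
    rw [circ_im]; linarith
  intro t ht
  rcases lt_trichotomy t (1 / 2) with h | rfl | h
  · refine ⟨Icc 0 1 ∩ Iio (1 / 2), inter_mem self_mem_nhdsWithin
      (mem_nhdsWithin_of_mem_nhds (Iio_mem_nhds h)), fun a ha d hd => ?_⟩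
    have ha2 : a < 1 / 2 := ha.2
    have hd2 : d < 1 / 2 := hd.2
    simp [wcoc, wnd, hk1 a ha.1.1 ha2.le, hk1 d hd.1.1 hd2.le, not_lt.2 ha2.le, not_lt.2 hd2.le, -one_div]
  · refine ⟨Ioo (1 / 4) (3 / 4), mem_nhdsWithin_of_mem_nhds (Ioo_mem_nhds (by norm_num)
      (by norm_num)), fun a ha d hd => ?_⟩
    have key : ∀ t : ℝ, t ∈ Ioo (1 / 4 : ℝ) (3 / 4) →
        rightInd (circ ω t).2 = if 1 / 2 < t then 1 else 0 := by
      intro t ht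
      split_ifs with h
      · exact hk2 t h (by linarith [ht.2])
      · exact hk1 t (by linarith [ht.1]) (not_lt.1 h)
    simp only [wcoc, wnd, hc1 a ha.1 ha.2, if_true, key a ha, key d hd]
    split_ifs <;> simp
  · by_cases h1 : t < 1
    · refine ⟨Ioo (1 / 2) 1, mem_nhdsWithin_of_mem_nhds (Ioo_mem_nhds h h1), fun a ha d hd => ?_⟩
      have ha2 : 1 / 2 < a := ha.1
      have hd2 : 1 / 2 < d := hd.1
      simp [wcoc, wnd, hk2 a ha.1 ha.2, hk2 d hd.1 hd.2, ha2, hd2, -one_div]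
    · refine ⟨Ioi (3 / 4) ∩ Icc 0 1, inter_mem (mem_nhdsWithin_of_mem_nhds (Ioi_mem_nhds
        (by linarith))) self_mem_nhdsWithin, fun a ha d hd => ?_⟩
      have ha2 : 3 / 4 < a := ha.1
      have hd2 : 3 / 4 < d := hd.1
      have ha3 : 1 / 2 < a := by linarith
      have hd3 : 1 / 2 < d := by linarith
      simp [wcoc, wnd, hc2 a ha2 ha.2.2, ha3, hd3, -one_div]

/-- Equivalent cocycles have the same holonomy along paths with ends in `T`. -/
lemma REq.hol_eq {P : Type*} [TopologicalSpace P] {G : Type*} [Group G] {E T : Set P}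
    {c c' : P → P → G} (h : REq E T c c') {γ : ℝ → P} (hγ : ContinuousOn γ (Icc 0 1))
    (hm : MapsTo γ (Icc 0 1) E) (h0 : γ 0 ∈ T) (h1 : γ 1 ∈ T) {g g' : G} (hg : Hol c γ g)
    (hg' : Hol c' γ g') : g = g' := by
  obtain ⟨b, hb, hB⟩ := h
  have := hg.gauge hB hγ hm
  rw [hb _ h0, hb _ h1, inv_one, one_mul, mul_one] at this
  exact this.unique hg'

lemma REq.hol {P : Type*} [TopologicalSpace P] {G : Type*} [Group G] {E T : Set P}
    {c c' : P → P → G} (h : REq E T c c') {γ : ℝ → P} (hγ : ContinuousOn γ (Icc 0 1))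
    (hm : MapsTo γ (Icc 0 1) E) (h0 : γ 0 ∈ T) (h1 : γ 1 ∈ T) {g : G} (hg : Hol c γ g) :
    Hol c' γ g := by
  obtain ⟨b, hb, hB⟩ := h
  have := hg.gauge hB hγ hm
  rwa [hb _ h0, hb _ h1, inv_one, one_mul, mul_one] at this

variable {ι : Type} {i : ι} {y : ι → ℂ → ℂ} {s : ℝ}

lemma isOpen_Tfib (s : ℝ) : IsOpen (Tfib s) :=
  (isOpen_lt (Complex.continuous_re.comp continuous_fst) continuous_const).inter
    (isOpen_lt continuous_const (Complex.continuous_im.comp continuous_snd))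

lemma convex_Tfib (s : ℝ) : Convex ℝ (Tfib s) := by
  intro a ha b hb x y hx hy hxy
  refine ⟨?_, ?_⟩
  · have h1 : a.1.re < s := ha.1
    have h2 : b.1.re < s := hb.1
    have := convex_Iio s h1 h2 hx hy hxy
    simpa using this
  · have h1 : 3 < a.2.im := ha.2
    have h2 : 3 < b.2.im := hb.2
    have := convex_Ioi (3:ℝ) h1 h2 hx hy hxy
    simpa using this

lemma circ_mem_Tfib {ω : ℂ} (h : ω.re < s) : circ ω 0 ∈ Tfib s ∧ circ ω 1 ∈ Tfib s := by
  rw [circ_zero, circ_one, and_self]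
  exact ⟨h, by norm_num⟩

/-- The universal cocycle for a single strand. -/
def singleCoc (i : ι) : ℂ × ℂ → ℂ × ℂ → FreeGroup ι := fun a d => of i ^ wnd a.2 d.2

lemma repr_single (hy : ∀ ω, y i ω = 0) : Repr (Efib {i} y s) (Tfib s) {i} (singleCoc i) := by
  classical
  have hE : Efib {i} y s = {p | p.1.re < s ∧ p.2 ≠ 0} := by simp [Efib, hy]
  have eqw : ∀ {G : Type} [Group G] (g : ι → G) (a d : ℂ × ℂ), lift g (singleCoc i a d) =
      zpowersHom G (g i) (wcoc (fun p : ℂ × ℂ => p.2) a d) := by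
    intro G _ g a d
    simp [singleCoc, wcoc]
  have hloc : LocCoc (Efib {i} y s) (wcoc (fun p : ℂ × ℂ => p.2)) :=
    wcoc_locCoc continuous_snd.continuousOn (by rw [hE]; exact fun p hp => hp.2)
  have htriv : ∀ a ∈ Tfib s, ∀ d : ℂ × ℂ, wnd a.2 d.2 = 0 := fun a ha d => by
    have : (3:ℝ) < a.2.im := ha.2
    simp [wnd, (by linarith : (0:ℝ) ≤ a.2.im)]
  have hcirc : ∀ ω : ℂ, ω.re < s → MapsTo (circ ω) (Icc 0 1) (Efib {i} y s) := by
    intro ω hω t _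
    rw [hE]
    refine ⟨hω, fun h => ?_⟩
    have := circ_norm ω t
    rw [h] at this; norm_num at this
  have hTE : Tfib s ⊆ Efib {i} y s := by
    rw [hE]
    rintro p ⟨h1, h2⟩
    refine ⟨h1, fun h => ?_⟩
    rw [h] at h2
    norm_num at h2
  refine ⟨⟨?_, ?_⟩, ?_, ?_, ?_⟩
  · have := hloc.map (zpowersHom _ (of i))
    simp only [wcoc, zpowersHom_apply, toAdd_ofAdd] at this
    exact this
  · exact fun p hp => ⟨Tfib s, mem_nhdsWithin_of_mem_nhds ((isOpen_Tfib s).mem_nhds hp),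
      fun a ha d _ => by simp [singleCoc, htriv a ha d]⟩
  · intro G _ c hc
    let A : Set (ℂ × ℂ) := {p | p.1.re < s ∧ (0 < p.2.im ∨ p.2.re ≠ 0)}
    let B : Set (ℂ × ℂ) := {p | p.1.re < s ∧ p.2.im < 0}
    have oA : IsOpen A := (isOpen_lt (Complex.continuous_re.comp continuous_fst) continuous_const).inter
      ((isOpen_lt continuous_const (Complex.continuous_im.comp continuous_snd)).union
        ((isClosed_singleton (x := (0:ℝ))).isOpen_compl.preimage
          (Complex.continuous_re.comp continuous_snd)))
    have oB : IsOpen B := (isOpen_lt (Complex.continuous_re.comp continuous_fst)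
      continuous_const).inter (isOpen_lt (Complex.continuous_im.comp continuous_snd)
      continuous_const)
    have sA : StarConvex ℝ (((s - 1 : ℝ) : ℂ), 4 * I) A := by
      rintro p ⟨h1, h2⟩ x z hx hz hxz
      refine ⟨?_, ?_⟩
      · have := convex_Iio s (by simp : (s - 1) ∈ Iio s) h1 hx hz hxz
        simpa using this
      · rcases hz.eq_or_lt with rfl | hz
        · left; simp [show x = 1 by linarith]
        · rcases h2 with h2 | h2
          · left
            have : 0 < x * 4 + z * p.2.im := by positivity
            simpa using this
          · right; simp [hz.ne', h2]
    have cB : Convex ℝ B := by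
      rintro p ⟨h1, h2⟩ q ⟨h3, h4⟩ x z hx hz hxz
      have e1 := convex_Iio s h1 h3 hx hz hxz
      have e2 := convex_Iio (0:ℝ) h2 h4 hx hz hxz
      exact ⟨by simpa using e1, by simpa using e2⟩
    have AE : A ⊆ Efib {i} y s := by
      rw [hE]
      rintro p ⟨h1, h2⟩
      refine ⟨h1, fun h => ?_⟩
      simp [h] at h2
    have BE : B ⊆ Efib {i} y s := by
      rw [hE]
      rintro p ⟨h1, h2⟩
      refine ⟨h1, fun h => ?_⟩
      simp [h] at h2
    have TA : Tfib s ⊆ A := fun p hp => ⟨hp.1, Or.inl (by linarith [show (3:ℝ) < p.2.im from hp.2])⟩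
    obtain ⟨b₁, hb₁, hg₁⟩ := (hc.1.mono AE).exists_gauge_of_star' sA
      (convex_Tfib s).isPreconnected TA (fun p hp => by
        obtain ⟨N, hN, h⟩ := hc.2 p hp
        exact ⟨N, nhdsWithin_mono _ hTE hN, h⟩)
    obtain ⟨b₂, hg₂⟩ := (hc.1.mono BE).exists_gauge_of_star
      (cB.starConvex (x := (((s - 1 : ℝ) : ℂ), -I)) ⟨by simp, by simp⟩)
    let BR : Set (ℂ × ℂ) := {p | p ∈ B ∧ 0 < p.2.re}
    let BL : Set (ℂ × ℂ) := {p | p ∈ B ∧ p.2.re < 0}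
    have cBR : Convex ℝ BR := by
      rintro p ⟨h1, h2⟩ q ⟨h3, h4⟩ x z hx hz hxz
      have e2 := convex_Ioi (0:ℝ) h2 h4 hx hz hxz
      exact ⟨cB h1 h3 hx hz hxz, by simpa using e2⟩
    have cBL : Convex ℝ BL := by
      rintro p ⟨h1, h2⟩ q ⟨h3, h4⟩ x z hx hz hxz
      have e2 := convex_Iio (0:ℝ) h2 h4 hx hz hxz
      exact ⟨cB h1 h3 hx hz hxz, by simpa using e2⟩
    have hBRA : BR ⊆ A := fun p hp => ⟨hp.1.1, Or.inr hp.2.ne'⟩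
    have hBLA : BL ⊆ A := fun p hp => ⟨hp.1.1, Or.inr hp.2.ne⟩
    obtain ⟨gR, hR⟩ : ∃ gR : G, ∀ p ∈ BR, b₁ p = gR * b₂ p := by
      refine ⟨b₁ (((s - 1 : ℝ) : ℂ), 1 - I) * (b₂ (((s - 1 : ℝ) : ℂ), 1 - I))⁻¹, fun p hp => ?_⟩
      rw [← Gauge.unique cBR.isPreconnected (hg₂.mono (fun p hp => hp.1)) (hg₁.mono hBRA) hp
        ⟨⟨by simp, by simp⟩, by simp⟩]
      group
    obtain ⟨gL, hL⟩ : ∃ gL : G, ∀ p ∈ BL, b₁ p = gL * b₂ p := by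
      refine ⟨b₁ (((s - 1 : ℝ) : ℂ), -1 - I) * (b₂ (((s - 1 : ℝ) : ℂ), -1 - I))⁻¹, fun p hp => ?_⟩
      rw [← Gauge.unique cBL.isPreconnected (hg₂.mono (fun p hp => hp.1)) (hg₁.mono hBLA) hp
        ⟨⟨by simp, by simp⟩, by simp⟩]
      group
    let b : ℂ × ℂ → G := fun p => if p ∈ A then b₁ p else gL * b₂ p
    have hbB : ∀ p ∈ B, b₂ p = (if 0 < p.2.re then gR else gL)⁻¹ * b p := by
      intro p hp
      rcases lt_trichotomy p.2.re 0 with h | h | h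
      · simp [b, hBLA (show p ∈ BL from ⟨hp, h⟩), hL p ⟨hp, h⟩, not_lt.2 h.le]
      · have : p ∉ A := by
          rintro ⟨-, h1 | h1⟩
          · exact lt_asymm h1 hp.2
          · exact h1 h
        simp [b, this, h]
      · simp [b, hBRA (show p ∈ BR from ⟨hp, h⟩), hR p ⟨hp, h⟩, h]
    refine ⟨fun _ => gL * gR⁻¹, b, fun p hp => by simp [b, TA hp, hb₁ p hp], fun p hp => ?_⟩
    simp only [eqw]
    rw [hE] at hp
    by_cases him : p.2.im < 0
    · have hpB : p ∈ B := ⟨hp.1, him⟩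
      obtain ⟨M, hM, hm⟩ := hg₂.ev oB hpB
      refine ⟨M ∩ B, mem_nhdsWithin_of_mem_nhds (inter_mem hM (oB.mem_nhds hpB)),
        fun a ha d hd => ?_⟩
      have h1 : a.2.im < 0 := ha.2.2
      rw [hm a ha.1 d hd.1, hbB a ha.2, hbB d hd.2]
      simp only [wcoc, wnd, rightInd, h1, if_true]
      split_ifs <;> simp <;> group
    · obtain ⟨N, hN, hn⟩ := (wnd_cases hp.2).resolve_right him
      have hpA : p ∈ A := by
        refine ⟨hp.1, ?_⟩
        by_contra! hcon
        exact hp.2 (Complex.ext hcon.2 (le_antisymm hcon.1 (not_lt.1 him)))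
      obtain ⟨M, hM, hm⟩ := hg₁.ev oA hpA
      refine ⟨Prod.snd ⁻¹' N ∩ M ∩ A, mem_nhdsWithin_of_mem_nhds (inter_mem (inter_mem
        (continuous_snd.continuousAt hN) hM) (oA.mem_nhds hpA)), fun a ha d hd => ?_⟩
      simp [hm a ha.1.2 d hd.1.2, b, ha.2, hd.2, wcoc, hn _ ha.1.1 _ hd.1.1]
  · intro G _ g g' h j hj
    obtain rfl : j = i := by simpa using hj
    simp only [eqw] at h
    have hω : ((s - 1 : ℝ) : ℂ).re < s := by simp
    have hH := hol_wcoc_circ ((s - 1 : ℝ) : ℂ)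
    have := h.hol_eq (continuous_circ _).continuousOn (hcirc _ hω) (circ_mem_Tfib hω).1
      (circ_mem_Tfib hω).2 (hH.map (zpowersHom G (g j))) (hH.map (zpowersHom G (g' j)))
    simpa using this
  · intro a d
    exact zpow_mem (Subgroup.subset_closure (mem_image_of_mem of (by simp))) _

end Single

section Recursion

variable {ι : Type}

/-- The exponent homomorphism data of the generator `i`. -/
def dl (i : ι) : ι → Multiplicative ℤ :=
  open Classical in fun j => if j = i then Multiplicative.ofAdd 1 else 1

/-- The deck transformation of the exponential covering. -/
def tau (p : ℂ × ℂ) : ℂ × ℂ := (p.1 + 2 * π * I, p.2)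

/-- A universal cocycle for the complement of the strands, with its circle element, its monodromy
and its winding property. -/
structure Good (J : Finset ι) (y : ι → ℂ → ℂ) (s : ℝ) (u : ℂ × ℂ → ℂ × ℂ → FreeGroup ι)
    (C : FreeGroup ι) (b : ι → FreeGroup ι) : Prop where
  repr : Repr (Efib J y s) (Tfib s) J u
  circ : ∀ ω : ℂ, ω.re < s → Hol u (circ ω) C
  tau : REq (Efib J y s) (Tfib s) (fun a d => u (tau a) (tau d)) (fun a d => lift b (u a d))
  wind : ∀ i ∈ J, ∃ β, Gauge (Efib J y s) β (fun a d => lift (dl i) (u a d))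
    (wcoc fun p => p.2 - y i p.1)

/-- Existence of a universal cocycle with positive monodromy. -/
def Claim (J : Finset ι) (y : ι → ℂ → ℂ) : Prop :=
  ∃ (s₀ : ℝ) (u : ℂ × ℂ → ℂ × ℂ → FreeGroup ι) (C : FreeGroup ι) (b : ι → FreeGroup ι),
    (∀ s ≤ s₀, Good J y s u C b) ∧
    (∃ l : List ι, l.Nodup ∧ (∀ i, i ∈ l ↔ i ∈ J) ∧ C = (l.map of).prod) ∧
    ∀ i ∈ J, ∃ P ∈ Submonoid.closure (range (of (α := ι))), b i = P⁻¹ * of i * P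

lemma lift_of_dl (i : ι) (n : ℤ) : lift (dl i) (of i ^ n) = Multiplicative.ofAdd n := by
  rw [map_zpow, FreeGroup.lift_apply_of, dl, if_pos rfl, ← ofAdd_zsmul]
  simp

lemma claim_single {i : ι} {y : ι → ℂ → ℂ} (hy : ∀ ω, y i ω = 0) : Claim {i} y := by
  refine ⟨0, singleCoc i, of i, of, fun s _ => ⟨repr_single hy, fun ω _ => ?_, ?_, ?_⟩,
    ⟨[i], by simp, by simp, by simp⟩, fun i _ => ⟨1, one_mem _, by simp⟩⟩
  · have := (hol_wcoc_circ ω).map (zpowersHom _ (of i))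
    simp only [wcoc, zpowersHom_apply, toAdd_ofAdd, zpow_one] at this
    exact this
  · have : (fun a d => singleCoc i (tau a) (tau d)) = fun a d => lift of (singleCoc i a d) := by
      ext a d
      rw [lift_of_eq]
      rfl
    rw [this]
    exact REq.refl _
  · intro j hj
    obtain rfl : j = i := by simpa using hj
    refine ⟨fun _ => 1, fun p _ => ⟨univ, univ_mem, fun a _ d _ => ?_⟩⟩
    simp only [singleCoc, lift_of_dl, wcoc, hy]
    simp

/-- Holonomy of a product whose factors live on two halves of a path. -/
lemma hol_mul {P G : Type*} [TopologicalSpace P] [Group G] {c₁ c₂ : P → P → G} {γ : ℝ → P}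
    {g₁ g₂ : G} (h₁ : Hol c₁ γ g₁) (h₂ : Hol c₂ γ g₂)
    (t₁ : ∀ t ∈ Icc (1 / 2 : ℝ) 1, ∃ N ∈ 𝓝[Icc 0 1] t, ∀ a ∈ N, ∀ d ∈ N, c₁ (γ a) (γ d) = 1)
    (t₂ : ∀ t ∈ Icc (0 : ℝ) (1 / 2), ∃ N ∈ 𝓝[Icc 0 1] t, ∀ a ∈ N, ∀ d ∈ N, c₂ (γ a) (γ d) = 1) :
    Hol (fun a d => c₁ a d * c₂ a d) γ (g₁ * g₂) := by
  obtain ⟨β₁, z₁, o₁, hβ₁⟩ := h₁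
  obtain ⟨β₂, z₂, o₂, hβ₂⟩ := h₂
  have s1 : Icc (1 / 2 : ℝ) 1 ⊆ Icc 0 1 := Icc_subset_Icc_left (by norm_num)
  have s2 : Icc (0 : ℝ) (1 / 2) ⊆ Icc 0 1 := Icc_subset_Icc_right (by norm_num)
  have k₁ : ∀ t ∈ Icc (1 / 2 : ℝ) 1, β₁ t = g₁ := by
    intro t ht
    rw [← o₁]
    refine Gauge.const_of_triv (c := fun _ _ => 1) (hβ₁.mono s1) isPreconnected_Icc subset_rfl
      (fun p hp => ⟨univ, univ_mem, by simp⟩)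
      (fun p hp => ?_) ht (by norm_num)
    obtain ⟨N, hN, n⟩ := t₁ p hp
    exact ⟨N, nhdsWithin_mono _ s1 hN, n⟩
  have k₂ : ∀ t ∈ Icc (0 : ℝ) (1 / 2), β₂ t = 1 := by
    intro t ht
    rw [← z₂]
    refine Gauge.const_of_triv (c := fun _ _ => 1) (hβ₂.mono s2) isPreconnected_Icc subset_rfl
      (fun p hp => ⟨univ, univ_mem, by simp⟩)
      (fun p hp => ?_) ht (by norm_num)
    obtain ⟨N, hN, n⟩ := t₂ p hp
    exact ⟨N, nhdsWithin_mono _ s2 hN, n⟩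
  refine ⟨fun t => β₁ t * β₂ t, by simp [z₁, z₂], by simp [o₁, o₂], fun t ht => ?_⟩
  obtain ⟨N, hN, n⟩ := hβ₁ t ht
  obtain ⟨M, hM, m⟩ := hβ₂ t ht
  rcases le_total t (1 / 2) with h | h
  · obtain ⟨L, hL, l⟩ := t₂ t ⟨ht.1, h⟩
    have e : ∀ a ∈ M ∩ L, β₂ a = 1 := by
      intro a ha
      have := m a ha.1 t (mem_of_mem_nhdsWithin ht hM)
      simp only [l a ha.2 t (mem_of_mem_nhdsWithin ht hL), k₂ t ⟨ht.1, h⟩, mul_one] at this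
      exact inv_eq_one.1 this.symm
    refine ⟨N ∩ (M ∩ L), inter_mem hN (inter_mem hM hL), fun a ha d hd => ?_⟩
    simp only [e a ha.2, e d hd.2, l a ha.2.2 d hd.2.2, n a ha.1 d hd.1]
    group
  · obtain ⟨L, hL, l⟩ := t₁ t ⟨h, ht.2⟩
    have e : ∀ a ∈ N ∩ L, β₁ a = g₁ := by
      intro a ha
      have := n a ha.1 t (mem_of_mem_nhdsWithin ht hN)
      simp only [l a ha.2 t (mem_of_mem_nhdsWithin ht hL), k₁ t ⟨h, ht.2⟩, mul_one] at this
      exact (inv_mul_eq_one.1 this.symm)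
    refine ⟨M ∩ (N ∩ L), inter_mem hM (inter_mem hN hL), fun a ha d hd => ?_⟩
    simp only [e a ha.2, e d hd.2, l a ha.2.2 d hd.2.2, m a ha.1 d hd.1]
    group

lemma isOpen_Efib {J : Finset ι} {y : ι → ℂ → ℂ} {s : ℝ}
    (hy : ∀ i ∈ J, ContinuousOn (y i) {ω | ω.re < s}) : IsOpen (Efib J y s) := by
  have h0 : IsOpen {p : ℂ × ℂ | p.1.re < s} :=
    isOpen_lt (Complex.continuous_re.comp continuous_fst) continuous_const
  have e : Efib J y s = {p : ℂ × ℂ | p.1.re < s} ∩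
      ⋂ i ∈ J, {p : ℂ × ℂ | p.1.re < s} ∩ (fun p : ℂ × ℂ => p.2 - y i p.1) ⁻¹' {0}ᶜ := by
    ext p
    simp only [Efib, mem_inter_iff, mem_iInter, mem_preimage, mem_compl_iff, mem_singleton_iff,
      sub_eq_zero, mem_ofPred_eq]
    exact ⟨fun h => ⟨h.1, fun i hi => ⟨h.1, h.2 i hi⟩⟩, fun h => ⟨h.1, fun i hi => (h.2 i hi).2⟩⟩
  rw [e]
  refine h0.inter (isOpen_biInter_finset fun i hi => ?_)
  refine ContinuousOn.isOpen_inter_preimage ?_ h0 isOpen_compl_singleton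
  exact continuous_snd.continuousOn.sub ((hy i hi).comp continuous_fst.continuousOn (fun p hp => hp))

lemma Tfib_subset_Efib {J : Finset ι} {y : ι → ℂ → ℂ} {s : ℝ}
    (hb : ∀ i ∈ J, ∀ ω : ℂ, ω.re < s → ‖y i ω‖ ≤ 3) : Tfib s ⊆ Efib J y s := by
  rintro p ⟨h1, h2⟩
  refine ⟨h1, fun i hi h => ?_⟩
  have := (Complex.abs_im_le_norm p.2).trans (h ▸ hb i hi p.1 h1)
  exact absurd h2 (not_lt.2 ((le_abs_self _).trans this))

lemma Efib_anti {J : Finset ι} {y : ι → ℂ → ℂ} {s s' : ℝ} (h : s ≤ s') :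
    Efib J y s ⊆ Efib J y s' := fun _ hp => ⟨hp.1.trans_le h, hp.2⟩

lemma Tfib_anti {s s' : ℝ} (h : s ≤ s') : Tfib s ⊆ Tfib s' := fun _ hp => ⟨hp.1.trans_le h, hp.2⟩

lemma circ_mem_Efib {J : Finset ι} {y : ι → ℂ → ℂ} {s : ℝ}
    (hb : ∀ i ∈ J, ∀ ω : ℂ, ω.re < s → ‖y i ω‖ ≤ 3) {ω : ℂ} (hω : ω.re < s) (t : ℝ) :
    circ ω t ∈ Efib J y s := by
  refine ⟨hω, fun i hi h => ?_⟩
  have := hb i hi ω hω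
  rw [show y i ω = (BurauZariski.circ ω t).2 from h.symm, circ_norm] at this
  norm_num at this

lemma Efib_union [DecidableEq ι] (J₁ J₂ : Finset ι) (y : ι → ℂ → ℂ) (s : ℝ) :
    Efib (J₁ ∪ J₂) y s = Efib J₁ y s ∩ Efib J₂ y s := by
  ext p
  simp only [Efib, mem_inter_iff, Finset.mem_union, mem_ofPred_eq]
  constructor
  · exact fun h => ⟨⟨h.1, fun i hi => h.2 i (Or.inl hi)⟩, h.1, fun i hi => h.2 i (Or.inr hi)⟩
  · exact fun h => ⟨h.1.1, fun i hi => hi.elim (h.1.2 i) (h.2.2 i)⟩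

lemma wedgeData_fib {J₁ J₂ : Finset ι} {y : ι → ℂ → ℂ} {s δ : ℝ} (hδ : 0 < δ)
    (hc₁ : ∀ i ∈ J₁, ContinuousOn (y i) {ω | ω.re < s})
    (hc₂ : ∀ i ∈ J₂, ContinuousOn (y i) {ω | ω.re < s})
    (hb₁ : ∀ i ∈ J₁, ∀ ω : ℂ, ω.re < s → ‖y i ω‖ ≤ 3)
    (hb₂ : ∀ i ∈ J₂, ∀ ω : ℂ, ω.re < s → ‖y i ω‖ ≤ 3)
    (hr₁ : ∀ i ∈ J₁, ∀ ω : ℂ, ω.re < s → (y i ω).re ≤ -δ)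
    (hr₂ : ∀ i ∈ J₂, ∀ ω : ℂ, ω.re < s → δ ≤ (y i ω).re) :
    WedgeData (Efib J₁ y s) (Efib J₂ y s) {p | p.1.re < s ∧ p.2.re < δ}
      {p | p.1.re < s ∧ -δ < p.2.re} (Tfib s) {p | p.2.re < 0} where
  oE₁ := isOpen_Efib hc₁
  oE₂ := isOpen_Efib hc₂
  oZ₁ := (isOpen_lt (Complex.continuous_re.comp continuous_fst) continuous_const).inter
    (isOpen_lt (Complex.continuous_re.comp continuous_snd) continuous_const)
  oZ₂ := (isOpen_lt (Complex.continuous_re.comp continuous_fst) continuous_const).inter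
    (isOpen_lt continuous_const (Complex.continuous_re.comp continuous_snd))
  oT := isOpen_Tfib s
  cZ₁ := by
    rintro p ⟨h1, h2⟩ q ⟨h3, h4⟩ x z hx hz hxz
    have e1 := convex_Iio s h1 h3 hx hz hxz
    have e2 := convex_Iio δ h2 h4 hx hz hxz
    exact ⟨by simpa using e1, by simpa using e2⟩
  cZ₂ := by
    rintro p ⟨h1, h2⟩ q ⟨h3, h4⟩ x z hx hz hxz
    have e1 := convex_Iio s h1 h3 hx hz hxz
    have e2 := convex_Ioi (-δ) h2 h4 hx hz hxz
    exact ⟨by simpa using e1, by simpa using e2⟩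
  cT := convex_Tfib s
  sZ₁ := fun p hp => ⟨hp.1, fun i hi h => by
    have := hr₂ i hi p.1 hp.1
    rw [← h] at this
    exact absurd hp.2 (not_lt.2 this)⟩
  sZ₂ := fun p hp => ⟨hp.1, fun i hi h => by
    have := hr₁ i hi p.1 hp.1
    rw [← h] at this
    exact absurd hp.2 (not_lt.2 this)⟩
  sE₁ := fun p hp => by
    rcases lt_or_ge p.2.re δ with h | h
    · exact Or.inl ⟨hp.1, h⟩
    · exact Or.inr ⟨hp.1, by linarith⟩
  sE₂ := fun p hp => by
    rcases lt_or_ge p.2.re δ with h | h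
    · exact Or.inl ⟨hp.1, h⟩
    · exact Or.inr ⟨hp.1, by linarith⟩
  sT₁ := Tfib_subset_Efib hb₁
  sT₂ := Tfib_subset_Efib hb₂
  ne := ⟨(((s - 1 : ℝ) : ℂ), 4 * I), ⟨⟨by simp, by simpa using hδ⟩, ⟨by simp, by simpa using hδ⟩⟩,
    by simp, by norm_num⟩
  hL := fun p hp hp' => (isOpen_lt (Complex.continuous_re.comp continuous_snd)
    continuous_const).mem_nhds (by
      by_contra h
      exact hp' ⟨hp.1, by
        have : ¬ p.2.re < 0 := h
        linarith⟩)
  hLc := fun p hp hp' => by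
    have h0 : 0 < p.2.re := by
      by_contra h
      exact hp' ⟨hp.1, by linarith⟩
    refine mem_of_superset ((isOpen_lt continuous_const (Complex.continuous_re.comp
      continuous_snd)).mem_nhds h0) (fun q hq => ?_)
    have : 0 < q.2.re := hq
    exact not_lt.2 this.le

lemma RCoc.mono {P G : Type*} [TopologicalSpace P] [Group G] {E E' T T' : Set P} {c : P → P → G}
    (h : RCoc E T c) (hE : E' ⊆ E) (hT : T' ⊆ T) : RCoc E' T' c :=
  ⟨h.1.mono hE, fun p hp => h.2.mono hE p (hT hp)⟩

lemma continuous_tau : Continuous tau := by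
  unfold tau; fun_prop

lemma tau_mem_Tfib {s : ℝ} : MapsTo tau (Tfib s) (Tfib s) := fun p hp =>
  ⟨by simpa [tau] using hp.1, hp.2⟩

lemma tau_mem_Efib {J : Finset ι} {y : ι → ℂ → ℂ} {s : ℝ}
    (hp : ∀ i ∈ J, ∀ ω : ℂ, ω.re < s → y i (ω + 2 * π * I) = y i ω) :
    MapsTo tau (Efib J y s) (Efib J y s) := fun p hq =>
  ⟨by simpa [tau] using hq.1, fun i hi h => hq.2 i hi (by
    rw [← hp i hi p.1 hq.1]; exact h)⟩

/-- Standing assumptions on the strands. -/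
structure Strands (J : Finset ι) (y : ι → ℂ → ℂ) (s : ℝ) : Prop where
  cont : ∀ i ∈ J, ContinuousOn (y i) {ω | ω.re < s}
  bound : ∀ i ∈ J, ∀ ω : ℂ, ω.re < s → ‖y i ω‖ ≤ 3
  per : ∀ i ∈ J, ∀ ω : ℂ, ω.re < s → y i (ω + 2 * π * I) = y i ω

lemma Strands.anti {J : Finset ι} {y : ι → ℂ → ℂ} {s s' : ℝ} (h : Strands J y s) (hs : s' ≤ s) :
    Strands J y s' :=
  ⟨fun i hi => (h.cont i hi).mono fun _ hω => lt_of_lt_of_le hω hs,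
    fun i hi ω hω => h.bound i hi ω (lt_of_lt_of_le hω hs),
    fun i hi ω hω => h.per i hi ω (lt_of_lt_of_le hω hs)⟩

/-- Replacing the universal cocycle by an equivalent one. -/
lemma Good.of_reEq {J : Finset ι} {y : ι → ℂ → ℂ} {s s' : ℝ} {u u' : ℂ × ℂ → ℂ × ℂ → FreeGroup ι}
    {C : FreeGroup ι} {b : ι → FreeGroup ι} (h : Good J y s' u C b) (hs : s' ≤ s)
    (hy : Strands J y s) (hu : Repr (Efib J y s) (Tfib s) J u')
    (e : REq (Efib J y s) (Tfib s) u u') : Good J y s' u' C b := by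
  have e' := e.mono (Efib_anti (J := J) (y := y) hs) (Tfib_anti hs)
  have hy' := hy.anti hs
  refine ⟨h.repr.of_reEq (hu.rcoc.mono (Efib_anti hs) (Tfib_anti hs)) e' hu.supp, fun ω hω => ?_,
    ((e'.symm.comp continuous_tau.continuousOn (tau_mem_Efib hy'.per) tau_mem_Tfib).trans
      h.tau).trans (e'.map _), fun i hi => ?_⟩
  · exact e'.hol (continuous_circ ω).continuousOn (fun t _ => circ_mem_Efib hy'.bound hω t)
      (circ_mem_Tfib hω).1 (circ_mem_Tfib hω).2 (h.circ ω hω)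
  · obtain ⟨β, hβ⟩ := h.wind i hi
    obtain ⟨b', -, hb'⟩ := e'
    exact ⟨_, ((hb'.map (lift (dl i))).symm).trans hβ⟩

lemma lift_eq_one {J : Finset ι} {G : Type*} [Group G] {g : ι → G} (h : ∀ i ∈ J, g i = 1)
    {w : FreeGroup ι} (hw : w ∈ Subgroup.closure (of '' (J : Set ι))) : lift g w = 1 := by
  rw [lift_congr (g' := fun _ => 1) h hw]
  have : lift (fun _ : ι => (1 : G)) = 1 := by ext; simp
  rw [this]; rfl

lemma claim_wedge [DecidableEq ι] {J₁ J₂ : Finset ι} {y : ι → ℂ → ℂ} {s δ : ℝ} (hδ : 0 < δ)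
    (hJ : Disjoint J₁ J₂) (hy₁ : Strands J₁ y s) (hy₂ : Strands J₂ y s)
    (hr₁ : ∀ i ∈ J₁, ∀ ω : ℂ, ω.re < s → (y i ω).re ≤ -δ)
    (hr₂ : ∀ i ∈ J₂, ∀ ω : ℂ, ω.re < s → δ ≤ (y i ω).re)
    (h₁ : Claim J₁ y) (h₂ : Claim J₂ y) : Claim (J₁ ∪ J₂) y := by
  obtain ⟨s₁, u₁, C₁, b₁, g₁, ⟨l₁, nd₁, ml₁, e₁⟩, p₁⟩ := h₁
  obtain ⟨s₂, u₂, C₂, b₂, g₂, ⟨l₂, nd₂, ml₂, e₂⟩, p₂⟩ := h₂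
  have wd : ∀ s' ≤ s, _ := fun s' hs' => wedgeData_fib (s := s') hδ (hy₁.anti hs').cont
    (hy₂.anti hs').cont (hy₁.anti hs').bound (hy₂.anti hs').bound
    (fun i hi ω hω => hr₁ i hi ω (lt_of_lt_of_le hω hs'))
    (fun i hi ω hω => hr₂ i hi ω (lt_of_lt_of_le hω hs'))
  set s₀ := min s (min s₁ s₂) with hs₀
  have k : s₀ ≤ s := min_le_left _ _
  have w := wd s₀ k
  have k1 : s₀ ≤ s₁ := (min_le_right _ _).trans (min_le_left _ _)
  have k2 : s₀ ≤ s₂ := (min_le_right _ _).trans (min_le_right _ _)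
  have nT : ∀ p ∈ Tfib s₀, ∀ E : Set (ℂ × ℂ), Tfib s₀ ∈ 𝓝[E] p := fun p hp E =>
    mem_nhdsWithin_of_mem_nhds ((isOpen_Tfib s₀).mem_nhds hp)
  obtain ⟨v₁, r₁, q₁, t₁⟩ := (g₁ s₀ k1).repr.normalize w.sZ₂ w.sT₁ (fun p hp => nT p hp _) w.cZ₂
    (fun p hp => mem_nhdsWithin_of_mem_nhds (w.oZ₂.mem_nhds hp)) w.cT
  obtain ⟨v₂, r₂, q₂, t₂⟩ := (g₂ s₀ k2).repr.normalize w.sZ₁ w.sT₂ (fun p hp => nT p hp _) w.cZ₁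
    (fun p hp => mem_nhdsWithin_of_mem_nhds (w.oZ₁.mem_nhds hp)) w.cT
  have hb : ∀ i ∈ J₂, i ∉ J₁ := fun i h2 h1 => Finset.disjoint_left.1 hJ h1 h2
  refine ⟨s₀, fun a d => v₁ a d * v₂ a d, C₁ * C₂, fun i => if i ∈ J₁ then b₁ i else b₂ i,
    fun s' hs' => ?_, ⟨l₁ ++ l₂, ?_, ?_, by simp [e₁, e₂]⟩, fun i hi => ?_⟩
  · have w' := wd s' (hs'.trans k)
    have G₁ := (g₁ s' (hs'.trans k1)).of_reEq hs' (hy₁.anti k) r₁ q₁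
    have G₂ := (g₂ s' (hs'.trans k2)).of_reEq hs' (hy₂.anti k) r₂ q₂
    have m₁ := (hy₁.anti (hs'.trans k))
    have m₂ := (hy₂.anti (hs'.trans k))
    have t₁' : TrivOn (Efib J₁ y s') {p | p.1.re < s' ∧ -δ < p.2.re} v₁ := fun p hp =>
      t₁.mono (Efib_anti hs') p ⟨hp.1.trans_le hs', hp.2⟩
    have t₂' : TrivOn (Efib J₂ y s') {p | p.1.re < s' ∧ p.2.re < δ} v₂ := fun p hp =>
      t₂.mono (Efib_anti hs') p ⟨hp.1.trans_le hs', hp.2⟩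
    refine ⟨?_, fun ω hω => ?_, ?_, fun i hi => ?_⟩
    · rw [Efib_union]
      exact w'.repr G₁.repr G₂.repr t₁' t₂' hJ
    · refine hol_mul (G₁.circ ω hω) (G₂.circ ω hω) (fun t ht => ?_) (fun t ht => ?_)
      · have hre : -δ < (circ ω t).2.re := by
          have : Real.sin (2 * π * t) ≤ 0 := by
            rw [← Real.sin_sub_two_pi]
            exact Real.sin_nonpos_of_nonpos_of_neg_pi_le (by nlinarith [Real.pi_pos, ht.2])
              (by nlinarith [Real.pi_pos, ht.1])
          rw [circ_re]; linarith
        obtain ⟨N, hN, n⟩ := t₁'.ev w'.oE₁ w'.sZ₂ (show circ ω t ∈ _ from ⟨hω, hre⟩)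
        exact ⟨circ ω ⁻¹' N, mem_nhdsWithin_of_mem_nhds ((continuous_circ ω).continuousAt hN),
          fun a ha d hd => n _ ha _ hd⟩
      · have hre : (circ ω t).2.re < δ := by
          have : 0 ≤ Real.sin (2 * π * t) :=
            Real.sin_nonneg_of_nonneg_of_le_pi (by nlinarith [Real.pi_pos, ht.1])
              (by nlinarith [Real.pi_pos, ht.2])
          rw [circ_re]; linarith
        obtain ⟨N, hN, n⟩ := t₂'.ev w'.oE₂ w'.sZ₁ (show circ ω t ∈ _ from ⟨hω, hre⟩)
        exact ⟨circ ω ⁻¹' N, mem_nhdsWithin_of_mem_nhds ((continuous_circ ω).continuousAt hN),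
          fun a ha d hd => n _ ha _ hd⟩
    · rw [Efib_union]
      have c₁ : (fun a d => lift (fun i => if i ∈ J₁ then b₁ i else b₂ i) (v₁ a d)) =
          fun a d => lift b₁ (v₁ a d) := by
        ext a d
        rw [lift_congr (g' := b₁) (fun i hi => by simp [hi]) (r₁.supp a d)]
      have c₂ : (fun a d => lift (fun i => if i ∈ J₁ then b₁ i else b₂ i) (v₂ a d)) =
          fun a d => lift b₂ (v₂ a d) := by
        ext a d
        rw [lift_congr (g' := b₂) (fun i hi => by simp [hb i hi]) (r₂.supp a d)]
      simp only [map_mul]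
      have := w'.reEq (t₁'.comp continuous_tau.continuousOn (tau_mem_Efib m₁.per)
          (fun p hp => ⟨by simpa [tau] using hp.1, hp.2⟩) w'.sZ₂)
        (t₂'.comp continuous_tau.continuousOn (tau_mem_Efib m₂.per)
          (fun p hp => ⟨by simpa [tau] using hp.1, hp.2⟩) w'.sZ₁)
        (t₁'.map (lift fun i => if i ∈ J₁ then b₁ i else b₂ i))
        (t₂'.map (lift fun i => if i ∈ J₁ then b₁ i else b₂ i))
        (by simpa only [c₁] using G₁.tau) (by simpa only [c₂] using G₂.tau)
      exact this
    · rw [Efib_union]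
      simp only [map_mul]
      by_cases h1 : i ∈ J₁
      · obtain ⟨β, hβ⟩ := G₁.wind i h1
        refine ⟨β, ?_⟩
        have : ∀ a d, lift (dl i) (v₂ a d) = 1 := fun a d => lift_eq_one (J := J₂)
          (fun j hj => if_neg (by rintro rfl; exact hb _ hj h1)) (r₂.supp a d)
        simpa only [this, mul_one] using hβ.mono inter_subset_left
      · have h2 : i ∈ J₂ := (Finset.mem_union.1 hi).resolve_left h1
        obtain ⟨β, hβ⟩ := G₂.wind i h2
        refine ⟨β, ?_⟩
        have : ∀ a d, lift (dl i) (v₁ a d) = 1 := fun a d => lift_eq_one (J := J₁)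
          (fun j hj => if_neg (by rintro rfl; exact h1 hj)) (r₁.supp a d)
        simpa only [this, one_mul] using hβ.mono inter_subset_right
  · rw [List.nodup_append]
    refine ⟨nd₁, nd₂, fun a h1 b h2 hab => ?_⟩
    exact hb b ((ml₂ b).1 h2) (hab ▸ (ml₁ a).1 h1)
  · intro i
    rw [List.mem_append, ml₁, ml₂, Finset.mem_union]
  · by_cases h1 : i ∈ J₁
    · simpa [h1] using p₁ i h1
    · simpa [h1] using p₂ i ((Finset.mem_union.1 hi).resolve_left h1)

end Recursion

section Moves

variable {ι : Type}

lemma REq.congr {P G : Type*} [TopologicalSpace P] [Group G] {E T : Set P} {c c' : P → P → G}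
    (h : ∀ a ∈ E, ∀ d ∈ E, c a d = c' a d) : REq E T c c' :=
  ⟨fun _ => 1, fun _ _ => rfl, fun _ _ => ⟨E, self_mem_nhdsWithin, fun a ha d hd => by
    simp [h a ha d hd]⟩⟩

/-- Transport of a universal cocycle by a homeomorphism. -/
lemma Repr.transport {P : Type} [TopologicalSpace P] {E E' T T' : Set P} {J : Finset ι}
    {u : P → P → FreeGroup ι} (h : Repr E T J u) {F H : P → P} (hF : ContinuousOn F E)
    (hH : ContinuousOn H E') (mF : MapsTo F E E') (mH : MapsTo H E' E) (mFT : MapsTo F T T')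
    (mHT : MapsTo H T' T) (hT : T ⊆ E) (hT' : T' ⊆ E') (FH : ∀ p ∈ E', F (H p) = p)
    (HF : ∀ p ∈ E, H (F p) = p) : Repr E' T' J (fun a d => u (H a) (H d)) where
  rcoc := h.rcoc.comp hH mH mHT hT'
  exists_lift c hc := by
    obtain ⟨g, hg⟩ := h.exists_lift _ (hc.comp hF mF mFT hT)
    exact ⟨g, (hg.comp hH mH mHT).trans (REq.congr fun a ha d hd => by rw [FH a ha, FH d hd])⟩
  unique g g' e := by
    refine h.unique g g' (((REq.congr fun a ha d hd => ?_).trans (e.comp hF mF mFT)).trans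
      (REq.congr fun a ha d hd => ?_))
    · rw [HF a ha, HF d hd]
    · rw [HF a ha, HF d hd]
  supp a d := h.supp _ _

/-- Homotopic nonvanishing functions have equivalent winding cocycles. -/
lemma exists_gauge_wcoc {P : Type*} [TopologicalSpace P] {E : Set P} {f : P → ℝ → ℂ}
    (hf : ContinuousOn (fun x : P × ℝ => f x.1 x.2) (E ×ˢ Icc (0:ℝ) 1))
    (h0 : ∀ p ∈ E, ∀ r ∈ Icc (0:ℝ) 1, f p r ≠ 0) :
    ∃ β, Gauge E β (wcoc fun p => f p 0) (wcoc fun p => f p 1) := by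
  obtain ⟨β, -, h⟩ := wcoc_locCoc_compl.homotopy hf h0
  exact ⟨β, h⟩

/-- A fibrewise isotopy moving the strands `y` to the strands `U`. -/
structure Move (J : Finset ι) (y U : ι → ℂ → ℂ) (s : ℝ) (H : ℝ → ℂ → ℂ → ℂ) (F : ℂ → ℂ → ℂ) :
    Prop where
  hy : Strands J y s
  hU : Strands J U s
  cH : ContinuousOn (fun x : (ℂ × ℂ) × ℝ => H x.2 x.1.1 x.1.2)
    ({p : ℂ × ℂ | p.1.re < s} ×ˢ Icc (0:ℝ) 1)
  cF : ContinuousOn (fun p : ℂ × ℂ => F p.1 p.2) {p : ℂ × ℂ | p.1.re < s}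
  h0 : ∀ ω w, H 0 ω w = w
  inj : ∀ ω : ℂ, ω.re < s → ∀ r ∈ Icc (0:ℝ) 1, ∀ w w', H r ω w = H r ω w' → w = w'
  FH : ∀ ω : ℂ, ω.re < s → ∀ w, F ω (H 1 ω w) = w
  HF : ∀ ω : ℂ, ω.re < s → ∀ v, H 1 ω (F ω v) = v
  idT : ∀ r ∈ Icc (0:ℝ) 1, ∀ ω : ℂ, ω.re < s → ∀ w : ℂ, 3 < w.im → H r ω w = w
  far : ∀ r ∈ Icc (0:ℝ) 1, ∀ ω : ℂ, ω.re < s → ∀ w : ℂ, ‖w‖ = 4 → 3 < ‖H r ω w‖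
  strand : ∀ i ∈ J, ∀ ω : ℂ, ω.re < s → H 1 ω (y i ω) = U i ω

variable {J : Finset ι} {y U : ι → ℂ → ℂ} {s : ℝ} {H : ℝ → ℂ → ℂ → ℂ} {F : ℂ → ℂ → ℂ}

lemma Move.anti {s' : ℝ} (m : Move J y U s H F) (hs : s' ≤ s) : Move J y U s' H F :=
  ⟨m.hy.anti hs, m.hU.anti hs, m.cH.mono fun _ h => ⟨lt_of_lt_of_le h.1 hs, h.2⟩,
    m.cF.mono fun _ h => lt_of_lt_of_le h hs, m.h0, fun ω h => m.inj ω (h.trans_le hs),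
    fun ω h => m.FH ω (h.trans_le hs), fun ω h => m.HF ω (h.trans_le hs),
    fun r hr ω h => m.idT r hr ω (h.trans_le hs), fun r hr ω h => m.far r hr ω (h.trans_le hs),
    fun i hi ω h => m.strand i hi ω (h.trans_le hs)⟩

lemma Move.contH (m : Move J y U s H F) :
    ContinuousOn (fun p : ℂ × ℂ => (p.1, H 1 p.1 p.2)) {p : ℂ × ℂ | p.1.re < s} :=
  continuous_fst.continuousOn.prodMk (m.cH.comp (f := fun p : ℂ × ℂ => (p, (1:ℝ)))
    (by fun_prop) fun p hp => ⟨hp, by simp⟩)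

lemma Move.mapsH (m : Move J y U s H F) :
    MapsTo (fun p : ℂ × ℂ => (p.1, H 1 p.1 p.2)) (Efib J y s) (Efib J U s) := fun p hp =>
  ⟨hp.1, fun i hi h => hp.2 i hi (m.inj p.1 hp.1 1 (by simp) _ _
    (by rw [m.strand i hi p.1 hp.1]; exact h))⟩

lemma Move.mapsF (m : Move J y U s H F) :
    MapsTo (fun p : ℂ × ℂ => (p.1, F p.1 p.2)) (Efib J U s) (Efib J y s) := fun p hp =>
  ⟨hp.1, fun i hi h => hp.2 i hi (by
    have : F p.1 p.2 = y i p.1 := h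
    rw [← m.strand i hi p.1 hp.1, ← this, m.HF _ hp.1])⟩

lemma Move.mapsHT (m : Move J y U s H F) :
    MapsTo (fun p : ℂ × ℂ => (p.1, H 1 p.1 p.2)) (Tfib s) (Tfib s) := fun p hp =>
  ⟨hp.1, by
    have := m.idT 1 (by simp) p.1 hp.1 p.2 hp.2
    simpa only [this] using hp.2⟩

lemma Move.mapsFT (m : Move J y U s H F) :
    MapsTo (fun p : ℂ × ℂ => (p.1, F p.1 p.2)) (Tfib s) (Tfib s) := fun p hp =>
  ⟨hp.1, by
    have := m.FH p.1 hp.1 p.2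
    rw [m.idT 1 (by simp) p.1 hp.1 p.2 hp.2] at this
    simpa only [this] using hp.2⟩

lemma Efib_subset : Efib J y s ⊆ {p : ℂ × ℂ | p.1.re < s} := fun _ hp => hp.1

lemma Move.good (m : Move J y U s H F) {u : ℂ × ℂ → ℂ × ℂ → FreeGroup ι}
    {C : FreeGroup ι} {b b' : ι → FreeGroup ι} (g : Good J U s u C b)
    (ht : REq (Efib J y s) (Tfib s)
      (fun a d => u ((tau a).1, H 1 (tau a).1 (tau a).2) ((tau d).1, H 1 (tau d).1 (tau d).2))
      (fun a d => lift b' (u (a.1, H 1 a.1 a.2) (d.1, H 1 d.1 d.2)))) :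
    Good J y s (fun a d => u (a.1, H 1 a.1 a.2) (d.1, H 1 d.1 d.2)) C b' where
  repr := g.repr.transport (F := fun p => (p.1, F p.1 p.2))
    (continuous_fst.continuousOn.prodMk (m.cF.mono Efib_subset)) (m.contH.mono Efib_subset) m.mapsF m.mapsH m.mapsFT m.mapsHT
    (Tfib_subset_Efib m.hU.bound) (Tfib_subset_Efib m.hy.bound)
    (fun p hp => Prod.ext rfl (m.FH p.1 hp.1 p.2)) (fun p hp => Prod.ext rfl (m.HF p.1 hp.1 p.2))
  tau := ht
  circ ω hω := by
    have hom := g.repr.rcoc.1.homotopy (P := ℝ) (E := Icc (0:ℝ) 1)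
      (h := fun t r => (ω, H r ω (circ ω t).2))
      (by
        refine continuousOn_const.prodMk (m.cH.comp (f := fun x : ℝ × ℝ => (circ ω x.1, x.2))
          ?_ fun x hx => ⟨hω, hx.2⟩)
        exact (((continuous_circ ω).comp continuous_fst).prodMk continuous_snd).continuousOn)
      (fun t _ r hr => ⟨hω, fun i hi h => by
        have h1 := m.far r hr ω hω _ (circ_norm ω t)
        have h2 := m.hU.bound i hi ω hω
        have : H r ω (circ ω t).2 = U i ω := h
        rw [this] at h1
        linarith⟩)
    obtain ⟨β, hβ, hg⟩ := hom
    have ends : ∀ t ∈ Icc (0:ℝ) 1, circ ω t = (ω, 4 * I) → β t = 1 := fun t h01 ht => by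
      refine (hβ t h01).unique (Hol.one fun r hr => ⟨Icc 0 1, self_mem_nhdsWithin, ?_⟩)
      have e : ∀ r ∈ Icc (0:ℝ) 1, H r ω (circ ω t).2 = 4 * I := fun r hr => by
        rw [ht]
        exact m.idT r hr ω hω _ (by norm_num)
      intro a ha d hd
      rw [e a ha, e d hd]
      refine g.repr.rcoc.1.self (Tfib_subset_Efib m.hU.bound ⟨hω, ?_⟩)
      norm_num
    obtain ⟨α, a0, a1, hα⟩ := g.circ ω hω
    refine ⟨fun t => α t * β t, by simp [a0, ends 0 (by simp) (circ_zero ω)],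
      by simp [a1, ends 1 (by simp) (circ_one ω)], ?_⟩
    have := hα.trans (c'' := fun a d => u (ω, H 1 ω (circ ω a).2) (ω, H 1 ω (circ ω d).2))
      (by
        have : ∀ t, (ω, H 0 ω (circ ω t).2) = circ ω t := fun t => by rw [m.h0]; rfl
        simpa only [this] using hg)
    exact this
  wind i hi := by
    obtain ⟨β, hβ⟩ := g.wind i hi
    have h1 := hβ.comp (m.contH.mono Efib_subset) m.mapsH
    obtain ⟨β', h2⟩ := exists_gauge_wcoc (E := Efib J y s)
      (f := fun p r => H r p.1 p.2 - H r p.1 (y i p.1))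
      (by
        refine ContinuousOn.sub (m.cH.mono (prod_mono Efib_subset subset_rfl))
          (m.cH.comp (f := fun x : (ℂ × ℂ) × ℝ => ((x.1.1, y i x.1.1), x.2)) ?_
            (fun x hx => ⟨hx.1.1, hx.2⟩))
        refine ((continuous_fst.comp continuous_fst).continuousOn.prodMk ((m.hy.cont i hi).comp
          (continuous_fst.comp continuous_fst).continuousOn fun x hx => hx.1.1)).prodMk
          continuous_snd.continuousOn)
      (fun p hp r hr h => hp.2 i hi (m.inj p.1 hp.1 r hr _ _ (sub_eq_zero.1 h)))
    refine ⟨_, h1.trans (Gauge.trans (c' := wcoc fun p : ℂ × ℂ => H 1 p.1 p.2 - H 1 p.1 (y i p.1))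
      (b := fun _ => 1) (fun p hp => ⟨Efib J y s, self_mem_nhdsWithin, fun a ha d hd => ?_⟩)
      (by simpa only [m.h0] using h2.symm))⟩
    simp [wcoc, m.strand i hi a.1 ha.1, m.strand i hi d.1 hd.1]

/-- Clamping to the unit interval. -/
def clamp (x : ℝ) : ℝ := max 0 (min 1 x)

lemma continuous_clamp : Continuous clamp := by unfold clamp; fun_prop

lemma clamp_of_le {x : ℝ} (h : x ≤ 0) : clamp x = 0 :=
  max_eq_left ((min_le_right _ _).trans h)

lemma clamp_of_ge {x : ℝ} (h : 1 ≤ x) : clamp x = 1 := by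
  rw [clamp, min_eq_left h]; norm_num

lemma clamp_of_mem {x : ℝ} (h : 0 ≤ x) (h' : x ≤ 1) : clamp x = x := by
  rw [clamp, min_eq_right h', max_eq_right h]

/-- Truncated translation. -/
def transF (q v : ℂ) : ℂ := v + q * clamp (3 - v.im)

/-- Inverse of the truncated translation. -/
def transH (q w : ℂ) : ℂ := w - q * clamp ((3 - w.im) / (1 - q.im))

lemma transH_transF {q : ℂ} (hq : q.im < 1) (v : ℂ) : transH q (transF q v) = v := by
  have h1 : 0 < 1 - q.im := by linarith
  have key : clamp ((3 - (transF q v).im) / (1 - q.im)) = clamp (3 - v.im) := by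
    have im : (transF q v).im = v.im + q.im * clamp (3 - v.im) := by simp [transF]
    rw [im]
    rcases le_total v.im 2 with h | h
    · rw [clamp_of_ge (x := 3 - v.im) (by linarith), clamp_of_ge]
      rw [le_div_iff₀ h1]; linarith
    · rcases le_total v.im 3 with h' | h'
      · rw [clamp_of_mem (x := 3 - v.im) (by linarith) (by linarith),
          show 3 - (v.im + q.im * (3 - v.im)) = (3 - v.im) * (1 - q.im) by ring,
          mul_div_cancel_right₀ _ h1.ne', clamp_of_mem (by linarith) (by linarith)]
      · rw [clamp_of_le (x := 3 - v.im) (by linarith), clamp_of_le]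
        exact div_nonpos_of_nonpos_of_nonneg (by linarith) h1.le
  rw [transH, key, transF, add_sub_cancel_right]

lemma transF_transH {q : ℂ} (hq : q.im < 1) (w : ℂ) : transF q (transH q w) = w := by
  have h1 : 0 < 1 - q.im := by linarith
  have key : clamp (3 - (transH q w).im) = clamp ((3 - w.im) / (1 - q.im)) := by
    have im : (transH q w).im = w.im - q.im * clamp ((3 - w.im) / (1 - q.im)) := by simp [transH]
    rw [im]
    generalize hk : (3 - w.im) / (1 - q.im) = k
    have e : 3 - w.im = k * (1 - q.im) := by rw [← hk, div_mul_cancel₀ _ h1.ne']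
    rcases le_total 1 k with h | h
    · rw [clamp_of_ge h, clamp_of_ge]; nlinarith
    · rcases le_total 0 k with h' | h'
      · rw [clamp_of_mem h' h, show 3 - (w.im - q.im * k) = k by linarith, clamp_of_mem h' h]
      · rw [clamp_of_le h', clamp_of_le]; nlinarith
  rw [transF, key, transH, sub_add_cancel]

end Moves

section Scaling

variable {ι : Type}

/-- Existence of a universal cocycle whose monodromy contains `e` full twists. -/
def ClaimE (J : Finset ι) (y : ι → ℂ → ℂ) (e : ℕ) : Prop :=
  ∃ (s₀ : ℝ) (u : ℂ × ℂ → ℂ × ℂ → FreeGroup ι) (C : FreeGroup ι) (b : ι → FreeGroup ι),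
    (∀ s ≤ s₀, Good J y s u C b) ∧
    (∃ l : List ι, l.Nodup ∧ (∀ i, i ∈ l ↔ i ∈ J) ∧ C = (l.map of).prod) ∧
    ∀ i ∈ J, ∃ P ∈ Submonoid.closure (range (of (α := ι))),
      b i = (P * C ^ e)⁻¹ * of i * (P * C ^ e)

lemma ClaimE.claim {J : Finset ι} {y : ι → ℂ → ℂ} {e : ℕ} (h : ClaimE J y e) : Claim J y := by
  obtain ⟨s₀, u, C, b, hg, ⟨l, hl, hl', hC⟩, hP⟩ := h
  refine ⟨s₀, u, C, b, hg, ⟨l, hl, hl', hC⟩, fun i hi => ?_⟩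
  obtain ⟨P, hP, h⟩ := hP i hi
  refine ⟨P * C ^ e, mul_mem hP (pow_mem ?_ e), h⟩
  rw [hC]
  refine Submonoid.list_prod_mem _ fun x hx => ?_
  obtain ⟨j, -, rfl⟩ := List.mem_map.1 hx
  exact Submonoid.subset_closure ⟨j, rfl⟩

variable {J : Finset ι} {y V U : ι → ℂ → ℂ} {s : ℝ} {q lam : ℂ → ℂ}

lemma clamp_nonneg (x : ℝ) : 0 ≤ clamp x := le_max_left _ _

lemma clamp_le_one (x : ℝ) : clamp x ≤ 1 := max_le zero_le_one (min_le_left _ _)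

lemma abs_clamp_le (x : ℝ) : |clamp x| ≤ 1 := by
  rw [abs_of_nonneg (clamp_nonneg x)]; exact clamp_le_one x

lemma norm_mul_clamp_le (q : ℂ) (x : ℝ) : ‖q * clamp x‖ ≤ ‖q‖ := by
  rw [norm_mul, Complex.norm_real, Real.norm_eq_abs]
  exact mul_le_of_le_one_right (norm_nonneg q) (abs_clamp_le x)

lemma norm_ofReal_mul_le {r : ℝ} (hr : r ∈ Icc (0:ℝ) 1) (q : ℂ) : ‖(r : ℂ) * q‖ ≤ ‖q‖ := by
  rw [norm_mul, Complex.norm_real, Real.norm_eq_abs, abs_of_nonneg hr.1]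
  exact mul_le_of_le_one_left (norm_nonneg q) hr.2

lemma move_trans (hy : Strands J y s) (hV : Strands J V s)
    (hVb : ∀ i ∈ J, ∀ ω : ℂ, ω.re < s → (V i ω).im ≤ 2)
    (hq : ContinuousOn q {ω | ω.re < s}) (hq1 : ∀ ω : ℂ, ω.re < s → ‖q ω‖ < 1)
    (e : ∀ i ∈ J, ∀ ω : ℂ, ω.re < s → y i ω = V i ω + q ω) :
    Move J y V s (fun r ω w => transH (r * q ω) w) (fun ω v => transF (q ω) v) := by
  have him : ∀ ω : ℂ, ω.re < s → ∀ r ∈ Icc (0:ℝ) 1, ((r : ℂ) * q ω).im < 1 := fun ω hω r hr =>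
    (Complex.im_le_norm _).trans_lt ((norm_ofReal_mul_le hr _).trans_lt (hq1 ω hω))
  have him1 : ∀ ω : ℂ, ω.re < s → (q ω).im < 1 := fun ω hω =>
    (Complex.im_le_norm _).trans_lt (hq1 ω hω)
  refine ⟨hy, hV, ?_, ?_, fun ω w => by simp [transH], fun ω hω r hr w w' h => ?_,
    fun ω hω w => ?_, fun ω hω v => ?_, fun r hr ω hω w hw => ?_, fun r hr ω hω w hw => ?_,
    fun i hi ω hω => ?_⟩
  · have h1 : ContinuousOn (fun x : (ℂ × ℂ) × ℝ => (x.2 : ℂ) * q x.1.1)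
        ({p : ℂ × ℂ | p.1.re < s} ×ˢ Icc (0:ℝ) 1) :=
      (Complex.continuous_ofReal.comp continuous_snd).continuousOn.mul
        (hq.comp (continuous_fst.comp continuous_fst).continuousOn fun x hx => hx.1)
    refine (by fun_prop : Continuous fun x : (ℂ × ℂ) × ℝ => x.1.2).continuousOn.sub
      (h1.mul (Complex.continuous_ofReal.comp_continuousOn (continuous_clamp.comp_continuousOn
        (ContinuousOn.div (Continuous.continuousOn ?_) (continuousOn_const.sub
          (Complex.continuous_im.comp_continuousOn h1)) fun x hx => ?_))))
    · exact continuous_const.sub (Complex.continuous_im.comp (continuous_snd.comp continuous_fst))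
    · have := him x.1.1 hx.1 x.2 hx.2
      exact (sub_pos.2 this).ne'
  · refine continuous_snd.continuousOn.add ((hq.comp continuous_fst.continuousOn fun x hx => hx).mul
      (Continuous.continuousOn ?_))
    exact Complex.continuous_ofReal.comp (continuous_clamp.comp
      (continuous_const.sub (Complex.continuous_im.comp continuous_snd)))
  · rw [← transF_transH (him ω hω r hr) w, ← transF_transH (him ω hω r hr) w', h]
  · simpa using transF_transH (him1 ω hω) w
  · simpa using transH_transF (him1 ω hω) v
  · have := him ω hω r hr
    rw [transH, clamp_of_le]
    · simp
    · exact div_nonpos_of_nonpos_of_nonneg (by linarith) (by linarith)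
  · rw [transH]
    have h1 := norm_sub_norm_le w ((r : ℂ) * q ω * clamp ((3 - w.im) / (1 - ((r : ℂ) * q ω).im)))
    have h2 := (norm_mul_clamp_le (r * q ω) ((3 - w.im) / (1 - ((r : ℂ) * q ω).im))).trans
      (norm_ofReal_mul_le hr _)
    have h3 := hq1 ω hω
    linarith
  · have : transF (q ω) (V i ω) = y i ω := by
      have := hVb i hi ω hω
      rw [transF, clamp_of_ge (by linarith), e i hi ω hω]
      simp
    rw [← this]
    simpa using transH_transF (him1 ω hω) (V i ω)

lemma claim_trans {n : ℕ} (hy : Strands J y s) (hV : Strands J V s)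
    (hVb : ∀ i ∈ J, ∀ ω : ℂ, ω.re < s → (V i ω).im ≤ 2)
    (hq : ContinuousOn q {ω | ω.re < s}) (hq1 : ∀ ω : ℂ, ω.re < s → ‖q ω‖ < 1)
    (hqp : ∀ ω : ℂ, ω.re < s → q (ω + 2 * π * I) = q ω)
    (e : ∀ i ∈ J, ∀ ω : ℂ, ω.re < s → y i ω = V i ω + q ω) (h : ClaimE J V n) :
    ClaimE J y n := by
  obtain ⟨s₀, u, C, b, hg, hl, hP⟩ := h
  refine ⟨min s₀ s, fun a d => u (a.1, transH ((1 : ℝ) * q a.1) a.2)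
    (d.1, transH ((1 : ℝ) * q d.1) d.2), C, b, fun s' hs' => ?_, hl, hP⟩
  have m := (move_trans hy hV hVb hq hq1 e).anti (hs'.trans (min_le_right _ _))
  have g := hg s' (hs'.trans (min_le_left _ _))
  refine m.good g (REq.trans ?_ (g.tau.comp (m.contH.mono Efib_subset) m.mapsH m.mapsHT))
  refine REq.congr fun a ha d hd => ?_
  have h1 := hqp a.1 (ha.1.trans_le (hs'.trans (min_le_right _ _)))
  have h2 := hqp d.1 (hd.1.trans_le (hs'.trans (min_le_right _ _)))
  simp only [tau, h1, h2]

end Scaling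

section Twist

variable {ι : Type} {J : Finset ι} {y U : ι → ℂ → ℂ} {s : ℝ} {lam : ℂ → ℂ}
  {u : ℂ × ℂ → ℂ × ℂ → FreeGroup ι} {C : FreeGroup ι} {b : ι → FreeGroup ι}

/-- The monodromy fixes the circle element. -/
lemma Good.lift_circ (g : Good J y s u C b) (hy : Strands J y s) : lift b C = C := by
  have hω : (((s - 1 : ℝ) : ℂ)).re < s := by simp
  have h1 := (g.circ _ hω).map (lift b)
  have h2 := g.circ (((s - 1 : ℝ) : ℂ) + 2 * π * I) (by simp)
  exact (g.tau.hol_eq (continuous_circ _).continuousOn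
    (fun t _ => circ_mem_Efib hy.bound hω t) (circ_mem_Tfib hω).1 (circ_mem_Tfib hω).2 h2 h1).symm

/-- The radial cut-off. -/
def kap (v : ℂ) : ℝ := clamp (1 - Real.log (max 1 ‖v‖))

lemma continuous_kap : Continuous kap := by
  refine continuous_clamp.comp (continuous_const.sub ?_)
  refine Continuous.log (by fun_prop) fun v => ?_
  exact (lt_max_of_lt_left one_pos).ne'

lemma kap_congr {v w : ℂ} (h : ‖v‖ = ‖w‖) : kap v = kap w := by rw [kap, kap, h]

lemma kap_of_le {v : ℂ} (h : ‖v‖ ≤ 1) : kap v = 1 := by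
  rw [kap, max_eq_left h, Real.log_one, sub_zero, clamp_of_ge le_rfl]

lemma one_le_log {x : ℝ} (h : 3 ≤ x) : 1 ≤ Real.log x := by
  rw [Real.le_log_iff_exp_le (by linarith)]
  exact Real.exp_one_lt_three.le.trans h

lemma kap_of_ge {v : ℂ} (h : 3 ≤ ‖v‖) : kap v = 0 := by
  rw [kap, max_eq_right (by linarith), clamp_of_le]
  linarith [one_le_log h]

lemma kap_eq (v : ℂ) : kap v = clamp (1 - Real.log ‖v‖) := by
  rcases le_total ‖v‖ 1 with h1 | h1
  · rw [kap_of_le h1, clamp_of_ge]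
    linarith [Real.log_nonpos (norm_nonneg v) h1]
  · rw [kap, max_eq_right h1]

/-- The Dehn twist between the circles of radii `1` and `e`, iterated `n` times. -/
def twist (n : ℕ) (p : ℂ × ℂ) : ℂ × ℂ := (p.1, p.2 * exp (-(2 * π * n * kap p.2 : ℝ) * I))

lemma norm_mul_exp_neg (v : ℂ) (x : ℝ) : ‖v * exp (-(x : ℂ) * I)‖ = ‖v‖ := by
  rw [← Complex.ofReal_neg, norm_mul, Complex.norm_exp_ofReal_mul_I, mul_one]

lemma continuous_twist (n : ℕ) : Continuous (twist n) := by
  have := continuous_kap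
  unfold twist
  fun_prop

lemma kap_twist (n : ℕ) (p : ℂ × ℂ) : kap (twist n p).2 = kap p.2 :=
  kap_congr (norm_mul_exp_neg _ _)

lemma twist_succ (n : ℕ) (p : ℂ × ℂ) : twist (n + 1) p = twist n (twist 1 p) := by
  refine Prod.ext rfl ?_
  have h : (twist n (twist 1 p)).2 = (twist 1 p).2 *
    exp (-(2 * π * n * kap (twist 1 p).2 : ℝ) * I) := rfl
  rw [h, kap_twist]
  simp only [twist]
  rw [mul_assoc p.2 (exp _), ← Complex.exp_add]
  congr 2
  push_cast
  ring

lemma twist_mem_Tfib (n : ℕ) : MapsTo (twist n) (Tfib s) (Tfib s) := fun p hp => by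
  refine ⟨hp.1, ?_⟩
  have : (3:ℝ) ≤ ‖p.2‖ := hp.2.le.trans (Complex.im_le_norm _)
  simpa [twist, kap_of_ge this] using hp.2

lemma twist_mem_Efib (hU : ∀ i ∈ J, ∀ ω : ℂ, ω.re < s → ‖U i ω‖ ≤ 1) (n : ℕ) :
    MapsTo (twist n) (Efib J U s) (Efib J U s) := fun p hp => by
  refine ⟨hp.1, fun i hi h => hp.2 i hi ?_⟩
  have h1 : ‖p.2‖ ≤ 1 := by
    rw [← norm_mul_exp_neg p.2 (2 * π * n * kap p.2)]
    have := hU i hi p.1 hp.1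
    rwa [← (show (twist n p).2 = U i p.1 from h)] at this
  have h2 : (twist n p).2 = U i p.1 := h
  rw [← h2, twist, kap_of_le h1]
  dsimp only
  rw [show -((2 * π * n * 1 : ℝ) : ℂ) * I = -(n * (2 * π * I)) by push_cast; ring,
    Complex.exp_neg, Complex.exp_nat_mul_two_pi_mul_I]
  simp

lemma twist_one_reEq (g : Good J U s u C b) (hS : Strands J U s)
    (hU : ∀ i ∈ J, ∀ ω : ℂ, ω.re < s → ‖U i ω‖ ≤ 1) :
    REq (Efib J U s) (Tfib s) (fun a d => C⁻¹ * u a d * C)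
      (fun a d => u (twist 1 a) (twist 1 d)) := by
  have cont : Continuous fun x : (ℂ × ℂ) × ℝ => (x.1.1, x.1.2 *
      exp (((2 * π * x.2 * (1 - kap x.1.2) : ℝ)) * I)) := by
    have := continuous_kap
    fun_prop
  have nrm : ∀ (v : ℂ) (x : ℝ), ‖v * exp ((x : ℂ) * I)‖ = ‖v‖ := fun v x => by
    rw [norm_mul, Complex.norm_exp_ofReal_mul_I, mul_one]
  obtain ⟨β, hβ, hg⟩ := g.repr.rcoc.1.homotopy (E := Efib J U s)
    (h := fun p r => (p.1, p.2 * exp (((2 * π * r * (1 - kap p.2) : ℝ)) * I)))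
    cont.continuousOn (fun p hp r hr => by
      refine ⟨hp.1, fun i hi h => hp.2 i hi ?_⟩
      have h2 : p.2 * exp (((2 * π * r * (1 - kap p.2) : ℝ)) * I) = U i p.1 := h
      have h1 : ‖p.2‖ ≤ 1 := by
        have := hU i hi p.1 hp.1
        rwa [← h2, nrm] at this
      rw [← h2, kap_of_le h1]
      simp)
  have e0 : ∀ p : ℂ × ℂ, (p.1, p.2 * exp (((2 * π * 0 * (1 - kap p.2) : ℝ)) * I)) = p :=
    fun p => by simp
  have e1 : ∀ p : ℂ × ℂ, (p.1, p.2 * exp (((2 * π * 1 * (1 - kap p.2) : ℝ)) * I)) =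
      twist 1 p := fun p => by
    refine Prod.ext rfl ?_
    simp only [twist]
    rw [show (((2 * π * 1 * (1 - kap p.2) : ℝ)) : ℂ) * I =
      2 * π * I + -((2 * π * (1 : ℕ) * kap p.2 : ℝ) : ℂ) * I by push_cast; ring,
      Complex.exp_add, Complex.exp_two_pi_mul_I, one_mul]
  simp only [e0, e1] at hg
  have hT : Tfib s ⊆ Efib J U s := Tfib_subset_Efib hS.bound
  have hC : ∀ p ∈ Tfib s, β p = C := fun p hp => by
    have hx := (circ_mem_Tfib (show p.1.re < s from hp.1)).1
    rw [hg.const_of_triv (convex_Tfib s).isPreconnected hT g.repr.rcoc.2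
      (g.repr.rcoc.comp (continuous_twist 1).continuousOn (twist_mem_Efib hU 1)
        (twist_mem_Tfib 1) hT).2 hp hx]
    refine (hβ _ (hT hx)).unique ?_
    have : (fun r : ℝ => ((circ p.1 0).1, (circ p.1 0).2 * exp
        (((2 * π * r * (1 - kap (circ p.1 0).2) : ℝ)) * I))) = circ p.1 := by
      ext r : 1
      rw [kap_of_ge (by rw [circ_norm]; norm_num)]
      simp only [circ]
      congr 1
      simp only [Complex.ofReal_zero, mul_zero, Complex.exp_zero, mul_one]
      congr 2
      push_cast
      ring
    rw [this]
    exact g.circ p.1 hp.1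
  refine ⟨fun p => C⁻¹ * β p, fun p hp => by simp [hC p hp], fun p hp => ?_⟩
  obtain ⟨N, hN, h⟩ := hg p hp
  refine ⟨N, hN, fun a ha d hd => ?_⟩
  rw [h a ha d hd]
  group

lemma twist_reEq (g : Good J U s u C b) (hS : Strands J U s)
    (hU : ∀ i ∈ J, ∀ ω : ℂ, ω.re < s → ‖U i ω‖ ≤ 1) (n : ℕ) :
    REq (Efib J U s) (Tfib s) (fun a d => (C ^ n)⁻¹ * u a d * C ^ n)
      (fun a d => u (twist n a) (twist n d)) := by
  induction n with
  | zero =>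
    refine REq.congr fun a _ d _ => ?_
    simp [twist]
  | succ n ih =>
    have h1 := (twist_one_reEq g hS hU).map (MulAut.conj (C ^ n)⁻¹).toMonoidHom
    have h2 := ih.comp (continuous_twist 1).continuousOn (twist_mem_Efib hU 1) (twist_mem_Tfib 1)
    simp only [MulEquiv.toMonoidHom_eq_coe, MonoidHom.coe_coe, MulAut.conj_apply, inv_inv] at h1
    simp only [← twist_succ] at h2
    refine REq.trans (REq.congr fun a _ d _ => ?_) (h1.trans h2)
    simp [pow_succ', mul_assoc]

lemma clamp_forward {m : ℝ} (hm : m < 1) (x : ℝ) :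
    clamp ((x - m * clamp x) / (1 - m)) = clamp x := by
  have h1 : 0 < 1 - m := by linarith
  rcases le_total x 0 with h | h
  · rw [clamp_of_le h, clamp_of_le]
    exact div_nonpos_of_nonpos_of_nonneg (by linarith) h1.le
  rcases le_total x 1 with h' | h'
  · rw [clamp_of_mem h h', show x - m * x = x * (1 - m) by ring, mul_div_cancel_right₀ _ h1.ne',
      clamp_of_mem h h']
  · rw [clamp_of_ge h', clamp_of_ge]
    rw [le_div_iff₀ h1]; linarith

lemma clamp_backward {m : ℝ} (hm : m < 1) (x : ℝ) :
    clamp (x + m * clamp (x / (1 - m))) = clamp (x / (1 - m)) := by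
  have h1 : 0 < 1 - m := by linarith
  generalize hk : x / (1 - m) = k
  have e : x = k * (1 - m) := by rw [← hk, div_mul_cancel₀ _ h1.ne']
  rcases le_total 1 k with h | h
  · rw [clamp_of_ge h, clamp_of_ge]; nlinarith
  rcases le_total 0 k with h' | h'
  · rw [clamp_of_mem h' h, show x + m * k = k by linarith, clamp_of_mem h' h]
  · rw [clamp_of_le h', clamp_of_le]; nlinarith

/-- Truncated multiplication by `exp l`. -/
def scaleF (l v : ℂ) : ℂ := v * exp (l * kap v)

/-- The cut-off of the inverse of truncated multiplication. -/
def kapH (m : ℝ) (w : ℂ) : ℝ := clamp ((1 - Real.log (max (Real.exp m) ‖w‖)) / (1 - m))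

/-- Inverse of truncated multiplication by `exp l`. -/
def scaleH (l w : ℂ) : ℂ := w * exp (-(l * kapH l.re w))

lemma kapH_of_ne {m : ℝ} (hm : m < 1) {w : ℂ} (hw : w ≠ 0) :
    kapH m w = clamp ((1 - Real.log ‖w‖) / (1 - m)) := by
  have h1 : 0 < 1 - m := by linarith
  rcases le_total ‖w‖ (Real.exp m) with h | h
  · rw [kapH, max_eq_left h, Real.log_exp, div_self h1.ne', clamp_of_ge le_rfl, clamp_of_ge]
    rw [le_div_iff₀ h1]
    have := Real.log_le_log (norm_pos_iff.2 hw) h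
    rw [Real.log_exp] at this
    linarith
  · rw [kapH, max_eq_right h]

lemma log_norm_mul_exp {v : ℂ} (hv : v ≠ 0) (l : ℂ) :
    Real.log ‖v * exp l‖ = Real.log ‖v‖ + l.re := by
  rw [norm_mul, Complex.norm_exp, Real.log_mul (norm_ne_zero_iff.2 hv) (Real.exp_pos _).ne',
    Real.log_exp]

lemma scaleH_scaleF {l : ℂ} (hl : l.re < 1) (v : ℂ) : scaleH l (scaleF l v) = v := by
  rcases eq_or_ne v 0 with rfl | hv
  · simp [scaleH, scaleF]
  have hw : scaleF l v ≠ 0 := mul_ne_zero hv (exp_ne_zero _)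
  have key : kapH l.re (scaleF l v) = kap v := by
    rw [kapH_of_ne hl hw, scaleF, log_norm_mul_exp hv, kap_eq]
    refine Eq.trans ?_ (clamp_forward hl (1 - Real.log ‖v‖))
    congr 2
    simp
    ring
  rw [scaleH, key, scaleF, mul_assoc, ← Complex.exp_add, add_neg_cancel, Complex.exp_zero, mul_one]

lemma kap_scaleH {l : ℂ} (hl : l.re < 1) {w : ℂ} (hw : w ≠ 0) :
    kap (scaleH l w) = kapH l.re w := by
  have hv : scaleH l w ≠ 0 := mul_ne_zero hw (exp_ne_zero _)
  rw [kap_eq, scaleH, log_norm_mul_exp hw, kapH_of_ne hl hw]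
  refine Eq.trans ?_ (clamp_backward hl (1 - Real.log ‖w‖))
  congr 1
  simp
  ring

lemma scaleF_scaleH {l : ℂ} (hl : l.re < 1) (w : ℂ) : scaleF l (scaleH l w) = w := by
  rcases eq_or_ne w 0 with rfl | hw
  · simp [scaleH, scaleF]
  rw [scaleF, kap_scaleH hl hw, scaleH, mul_assoc, ← Complex.exp_add, neg_add_cancel,
    Complex.exp_zero, mul_one]

lemma scaleH_of_ge {l : ℂ} (hl : l.re < 1) {w : ℂ} (hw : 3 ≤ ‖w‖) : scaleH l w = w := by
  have : w ≠ 0 := norm_pos_iff.1 (by linarith)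
  rw [scaleH, kapH_of_ne hl this, clamp_of_le]
  · simp
  · exact div_nonpos_of_nonpos_of_nonneg (by linarith [one_le_log hw]) (by linarith)

lemma log_two_lt_one : Real.log 2 < 1 := by linarith [Real.log_two_lt_d9]

lemma move_scale (hy : Strands J y s) (hS : Strands J U s)
    (hU : ∀ i ∈ J, ∀ ω : ℂ, ω.re < s → ‖U i ω‖ ≤ 1)
    (hl : ContinuousOn lam {ω | ω.re < s}) (hl1 : ∀ ω : ℂ, ω.re < s → (lam ω).re ≤ Real.log 2)
    (e : ∀ i ∈ J, ∀ ω : ℂ, ω.re < s → y i ω = exp (lam ω) * U i ω) :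
    Move J y U s (fun r ω w => scaleH (r * lam ω) w) (fun ω v => scaleF (lam ω) v) := by
  have hr1 : ∀ ω : ℂ, ω.re < s → ∀ r ∈ Icc (0:ℝ) 1, ((r : ℂ) * lam ω).re < 1 := fun ω hω r hr => by
    have h := hl1 ω hω
    have h2 := log_two_lt_one
    rw [Complex.re_ofReal_mul]
    rcases le_total (lam ω).re 0 with h0 | h0
    · nlinarith [hr.1]
    · nlinarith [hr.2]
  have h1 : ∀ ω : ℂ, ω.re < s → (lam ω).re < 1 := fun ω hω => (hl1 ω hω).trans_lt log_two_lt_one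
  refine ⟨hy, hS, ?_, ?_, fun ω w => by simp [scaleH], fun ω hω r hr w w' h => ?_,
    fun ω hω w => ?_, fun ω hω v => ?_, fun r hr ω hω w hw => ?_, fun r hr ω hω w hw => ?_,
    fun i hi ω hω => ?_⟩
  · have c1 : ContinuousOn (fun x : (ℂ × ℂ) × ℝ => (x.2 : ℂ) * lam x.1.1)
        ({p : ℂ × ℂ | p.1.re < s} ×ˢ Icc (0:ℝ) 1) :=
      (Complex.continuous_ofReal.comp continuous_snd).continuousOn.mul
        (hl.comp (continuous_fst.comp continuous_fst).continuousOn fun x hx => hx.1)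
    have c2 := Complex.continuous_re.comp_continuousOn c1
    have c3 : Continuous fun x : (ℂ × ℂ) × ℝ => x.1.2 := by fun_prop
    have c4 : ContinuousOn (fun x : (ℂ × ℂ) × ℝ => kapH ((x.2 : ℂ) * lam x.1.1).re x.1.2)
        ({p : ℂ × ℂ | p.1.re < s} ×ˢ Icc (0:ℝ) 1) := by
      refine continuous_clamp.comp_continuousOn ((continuousOn_const.sub
        (ContinuousOn.log ?_ fun x _ => ?_)).div (continuousOn_const.sub c2) fun x hx => ?_)
      · exact ContinuousOn.sup (Real.continuous_exp.comp_continuousOn c2)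
          (continuous_norm.comp c3).continuousOn
      · exact (lt_max_of_lt_left (Real.exp_pos _)).ne'
      · exact (sub_pos.2 (hr1 x.1.1 hx.1 x.2 hx.2)).ne'
    exact c3.continuousOn.mul (Complex.continuous_exp.comp_continuousOn
      (c1.mul (Complex.continuous_ofReal.comp_continuousOn c4)).neg)
  · exact continuous_snd.continuousOn.mul (Complex.continuous_exp.comp_continuousOn
      ((hl.comp continuous_fst.continuousOn fun x hx => hx).mul
        (Complex.continuous_ofReal.comp (continuous_kap.comp continuous_snd)).continuousOn))
  · rw [← scaleF_scaleH (hr1 ω hω r hr) w, ← scaleF_scaleH (hr1 ω hω r hr) w', h]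
  · simpa using scaleF_scaleH (h1 ω hω) w
  · simpa using scaleH_scaleF (h1 ω hω) v
  · exact scaleH_of_ge (hr1 ω hω r hr) (hw.le.trans (Complex.im_le_norm _))
  · rw [scaleH_of_ge (hr1 ω hω r hr) (by rw [hw]; norm_num), hw]
    norm_num
  · have : scaleF (lam ω) (U i ω) = y i ω := by
      rw [scaleF, kap_of_le (hU i hi ω hω), e i hi ω hω]
      simp [mul_comm]
    rw [← this]
    simpa using scaleH_scaleF (h1 ω hω) (U i ω)

lemma claim_scale {n : ℕ} (hy : Strands J y s) (hS : Strands J U s)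
    (hU : ∀ i ∈ J, ∀ ω : ℂ, ω.re < s → ‖U i ω‖ ≤ 1)
    (hl : ContinuousOn lam {ω | ω.re < s}) (hl1 : ∀ ω : ℂ, ω.re < s → (lam ω).re ≤ Real.log 2)
    (hlp : ∀ ω : ℂ, ω.re < s → lam (ω + 2 * π * I) = lam ω + 2 * π * I * n)
    (e : ∀ i ∈ J, ∀ ω : ℂ, ω.re < s → y i ω = exp (lam ω) * U i ω) (h : Claim J U) :
    ClaimE J y n := by
  obtain ⟨s₀, u, C, b, hg, hlist, hP⟩ := h
  refine ⟨min s₀ s, fun a d => u (a.1, scaleH ((1 : ℝ) * lam a.1) a.2)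
    (d.1, scaleH ((1 : ℝ) * lam d.1) d.2), C, fun i => (C ^ n)⁻¹ * b i * C ^ n,
    fun s' hs' => ?_, hlist, fun i hi => ?_⟩
  · have hss := hs'.trans (min_le_right _ _)
    have m := (move_scale hy hS hU hl hl1 e).anti hss
    have g := hg s' (hs'.trans (min_le_left _ _))
    have hU' : ∀ i ∈ J, ∀ ω : ℂ, ω.re < s' → ‖U i ω‖ ≤ 1 := fun i hi ω hω =>
      hU i hi ω (hω.trans_le hss)
    have hm := m.mapsH
    have t1 := (g.tau.comp (continuous_twist n).continuousOn (twist_mem_Efib hU' n)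
      (twist_mem_Tfib n)).comp (m.contH.mono Efib_subset) m.mapsH m.mapsHT
    have t2 := ((twist_reEq g (hS.anti hss) hU' n).map (lift b)).comp
      (m.contH.mono Efib_subset) m.mapsH m.mapsHT
    refine m.good g (REq.trans (REq.congr fun a ha d hd => ?_) (t1.trans (t2.symm.trans
      (REq.congr fun a ha d hd => ?_))))
    · have key : ∀ a ∈ Efib J y s', ((tau a).1, scaleH ((1 : ℝ) * lam (tau a).1) (tau a).2) =
          tau (twist n (a.1, scaleH ((1 : ℝ) * lam a.1) a.2)) := fun a ha => by
        have h1 : (lam a.1).re < 1 := (hl1 a.1 (ha.1.trans_le hss)).trans_lt log_two_lt_one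
        refine Prod.ext rfl ?_
        simp only [tau, twist, Complex.ofReal_one, one_mul, hlp a.1 (ha.1.trans_le hss)]
        rcases eq_or_ne a.2 0 with h0 | h0
        · simp [scaleH, h0]
        · have hre : (lam a.1 + 2 * π * I * n).re = (lam a.1).re := by simp
          rw [kap_scaleH h1 h0, scaleH, hre, scaleH, mul_assoc a.2 (exp _), ← Complex.exp_add]
          congr 2
          push_cast
          ring
      rw [key a ha, key d hd]
    · have hc := g.lift_circ (hS.anti hss)
      have h := map_lift (MulAut.conj (C ^ n)⁻¹).toMonoidHom b
      simp only [MulEquiv.toMonoidHom_eq_coe, MonoidHom.coe_coe, MulAut.conj_apply, inv_inv] at h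
      rw [← h]
      simp only [map_mul, map_inv, map_pow, hc]
  · obtain ⟨P, hP, h⟩ := hP i hi
    exact ⟨P, hP, by simp only [h]; group⟩

end Twist

section Puiseux

variable {ι : Type} {J : Finset ι} {η U : ι → ℂ → ℂ} {q : ℂ → ℂ}

/-- A property of small nonzero numbers, read on a half plane of logarithms. -/
lemma exists_re_lt {p : ℂ → Prop} (h : ∀ᶠ ξ in 𝓝[≠] 0, p ξ) :
    ∃ s : ℝ, ∀ ω : ℂ, ω.re < s → p (exp ω) := by
  obtain ⟨ε, hε, h⟩ := Metric.mem_nhdsWithin_iff.1 h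
  refine ⟨Real.log ε, fun ω hω => h ⟨?_, exp_ne_zero _⟩⟩
  rw [mem_ball_zero_iff, Complex.norm_exp]
  exact (Real.lt_log_iff_exp_lt hε).1 hω

lemma exp_add_two_pi (ω : ℂ) : exp (ω + 2 * π * I) = exp ω :=
  Complex.exp_periodic ω

lemma exists_continuousOn_exp {g : ℂ → ℂ} (hg : AnalyticAt ℂ g 0) {R : ℝ} (hR : ‖g 0‖ < R) :
    ∃ s : ℝ, ContinuousOn (fun ω => g (exp ω)) {ω | ω.re < s} ∧
      ∀ ω : ℂ, ω.re < s → ‖g (exp ω)‖ < R := by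
  have h1 : ∀ᶠ ξ in 𝓝[≠] (0:ℂ), AnalyticAt ℂ g ξ ∧ ‖g ξ‖ < R :=
    (hg.eventually_analyticAt.and
      (hg.continuousAt.norm.eventually (gt_mem_nhds hR))).filter_mono nhdsWithin_le_nhds
  obtain ⟨s, hs⟩ := exists_re_lt h1
  refine ⟨s, fun ω hω => ?_, fun ω hω => (hs ω hω).2⟩
  exact ((hs ω hω).1.continuousAt.comp Complex.continuous_exp.continuousAt).continuousWithinAt

lemma exists_forall_re_lt {p : ι → ℂ → Prop} (h : ∀ i ∈ J, ∃ s : ℝ, ∀ ω : ℂ, ω.re < s → p i ω) :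
    ∃ s : ℝ, ∀ i ∈ J, ∀ ω : ℂ, ω.re < s → p i ω := by
  classical
  choose! s hs using h
  rcases J.eq_empty_or_nonempty with rfl | hJ
  · exact ⟨0, by simp⟩
  · exact ⟨J.inf' hJ s, fun i hi ω hω => hs i hi ω (hω.trans_le (Finset.inf'_le _ hi))⟩

lemma exists_strands (h : ∀ i ∈ J, AnalyticAt ℂ (η i) 0) {R : ℝ} (hR : R ≤ 3)
    (h0 : ∀ i ∈ J, ‖η i 0‖ < R) : ∃ s : ℝ, Strands J (fun i ω => η i (exp ω)) s ∧
      ∀ i ∈ J, ∀ ω : ℂ, ω.re < s → ‖η i (exp ω)‖ < R := by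
  choose! s hs using fun i hi => exists_continuousOn_exp (h i hi) (h0 i hi)
  obtain ⟨s', hs'⟩ := exists_forall_re_lt (J := J) (p := fun i ω => ω.re < s i)
    fun i _ => ⟨s i, fun ω h => h⟩
  refine ⟨s', ⟨fun i hi => (hs i hi).1.mono fun ω hω => hs' i hi ω hω,
    fun i hi ω hω => ((hs i hi).2 ω (hs' i hi ω hω)).le.trans hR,
    fun i _ ω _ => by rw [exp_add_two_pi]⟩, fun i hi ω hω => (hs i hi).2 ω (hs' i hi ω hω)⟩

lemma claimE_of_affine {n : ℕ} {l : ℂ} (hη : ∀ i ∈ J, AnalyticAt ℂ (η i) 0)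
    (h0 : ∀ i ∈ J, ‖η i 0‖ < 1 / 2) (hU : ∀ i ∈ J, AnalyticAt ℂ (U i) 0)
    (hU0 : ∀ i ∈ J, ‖U i 0‖ < 1 / 2) (hq : AnalyticAt ℂ q 0) (hq0 : ‖q 0‖ < 1 / 2)
    (hl : 1 ≤ n ∨ l.re ≤ Real.log 2)
    (e : ∀ i ∈ J, ∀ᶠ ξ in 𝓝[≠] 0, η i ξ = ξ ^ n * exp l * U i ξ + q ξ)
    (h : Claim J fun i ω => U i (exp ω)) :
    ClaimE J (fun i ω => η i (exp ω)) n := by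
  obtain ⟨s₁, S₁, b₁⟩ := exists_strands hη (R := 1 / 2) (by norm_num) h0
  obtain ⟨s₂, S₂, b₂⟩ := exists_strands hU (R := 1 / 2) (by norm_num) hU0
  obtain ⟨s₃, c₃, b₃⟩ := exists_continuousOn_exp hq hq0
  obtain ⟨s₄, b₄⟩ := exists_forall_re_lt fun i hi => exists_re_lt (e i hi)
  obtain ⟨s₅, b₅⟩ : ∃ s₅ : ℝ, ∀ ω : ℂ, ω.re < s₅ → (n * ω + l).re ≤ Real.log 2 := by
    rcases hl with hn | hl
    · refine ⟨min 0 (Real.log 2 - l.re), fun ω hω => ?_⟩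
      have h1 := hω.trans_le (min_le_left _ _)
      have h2 := hω.trans_le (min_le_right _ _)
      have h3 : (1 : ℝ) ≤ n := by exact_mod_cast hn
      have : (n * ω + l).re = n * ω.re + l.re := by simp
      nlinarith
    · refine ⟨0, fun ω hω => ?_⟩
      have : (n * ω + l).re = n * ω.re + l.re := by simp
      have h3 : (0 : ℝ) ≤ n := n.cast_nonneg
      nlinarith
  set s := min s₁ (min s₂ (min s₃ (min s₄ s₅)))
  have l₁ : s ≤ s₁ := min_le_left _ _
  have l₂ : s ≤ s₂ := (min_le_right _ _).trans (min_le_left _ _)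
  have l₃ : s ≤ s₃ := (min_le_right _ _).trans ((min_le_right _ _).trans (min_le_left _ _))
  have l₄ : s ≤ s₄ := (min_le_right _ _).trans ((min_le_right _ _).trans
    ((min_le_right _ _).trans (min_le_left _ _)))
  have l₅ : s ≤ s₅ := (min_le_right _ _).trans ((min_le_right _ _).trans
    ((min_le_right _ _).trans (min_le_right _ _)))
  have hlam : Continuous fun ω : ℂ => n * ω + l := by fun_prop
  have bV : ∀ i ∈ J, ∀ ω : ℂ, ω.re < s →
      ‖exp (n * ω + l) * U i (exp ω)‖ ≤ 2 := fun i hi ω hω => by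
    have h1 := b₂ i hi ω (hω.trans_le l₂)
    have h2 : ‖exp (n * ω + l)‖ ≤ 2 := by
      rw [Complex.norm_exp, ← Real.le_log_iff_exp_le two_pos]
      exact b₅ ω (hω.trans_le l₅)
    rw [norm_mul]
    nlinarith [norm_nonneg (U i (exp ω)), norm_nonneg (exp (n * ω + l))]
  have per : ∀ ω : ℂ, n * (ω + 2 * π * I) + l = n * ω + l + 2 * π * I * n :=
    fun ω => by ring
  have SV : Strands J (fun i ω => exp (n * ω + l) * U i (exp ω)) s :=
    ⟨fun i hi => (Complex.continuous_exp.comp hlam).continuousOn.mul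
      (((S₂.anti l₂).cont i hi)), fun i hi ω hω => (bV i hi ω hω).trans (by norm_num),
      fun i hi ω _ => by
        rw [exp_add_two_pi, per, Complex.exp_add, mul_comm (2 * (π : ℂ) * I),
          Complex.exp_nat_mul_two_pi_mul_I, mul_one]⟩
  refine claim_trans (s := s) (q := fun ω => q (exp ω)) (S₁.anti l₁) SV
    (fun i hi ω hω => (Complex.im_le_norm _).trans (bV i hi ω hω))
    (c₃.mono fun ω hω => lt_of_lt_of_le hω l₃)
    (fun ω hω => (b₃ ω (hω.trans_le l₃)).trans (by norm_num)) (fun ω _ => by rw [exp_add_two_pi])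
    (fun i hi ω hω => ?_) (claim_scale (s := s) SV (S₂.anti l₂)
      (fun i hi ω hω => (b₂ i hi ω (hω.trans_le l₂)).le.trans (by norm_num)) hlam.continuousOn
      (fun ω hω => b₅ ω (hω.trans_le l₅)) (fun ω _ => per ω) (fun _ _ _ _ => rfl) h)
  rw [b₄ i hi ω (hω.trans_le l₄), Complex.exp_add, Complex.exp_nat_mul]

end Puiseux

section Puiseux

variable {ι : Type} {η : ι → ℂ → ℂ}

/-- The hypotheses on the coefficients of a bundle of strands. -/
structure Bundle (J : Finset ι) (η : ι → ℂ → ℂ) : Prop where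
  an : ∀ i ∈ J, AnalyticAt ℂ (η i) 0
  small : ∀ i ∈ J, ‖η i 0‖ < 1 / 2
  ne : ∀ i ∈ J, ∀ j ∈ J, i ≠ j → ∀ᶠ ξ in 𝓝[≠] 0, η i ξ ≠ η j ξ

lemma Bundle.subset {J J' : Finset ι} (h : Bundle J η) (hJ : J' ⊆ J) : Bundle J' η :=
  ⟨fun i hi => h.an i (hJ hi), fun i hi => h.small i (hJ hi),
    fun i hi j hj => h.ne i (hJ hi) j (hJ hj)⟩

lemma Bundle.claim_singleton {i : ι} (h : Bundle {i} η) :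
    Claim {i} fun i ω => η i (exp ω) := by
  have hi : i ∈ ({i} : Finset ι) := by simp
  refine (claimE_of_affine (n := 0) (l := 0) (U := fun _ _ => 0) (q := η i) h.an h.small
    (fun _ _ => analyticAt_const) (by simp) (h.an i hi) (h.small i hi)
    (Or.inr (by simp [Real.log_nonneg])) (fun j hj => ?_) (claim_single fun _ => rfl)).claim
  obtain rfl : j = i := by simpa using hj
  simp

lemma exists_norm_one_mul_re {z : ℂ} (hz : z ≠ 0) : ∃ d : ℂ, ‖d‖ = 1 ∧ (d * z).re ≠ 0 := by
  refine ⟨starRingEnd ℂ z / ‖z‖, ?_, ?_⟩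
  · have := norm_pos_iff.2 hz
    rw [norm_div, RCLike.norm_conj, Complex.norm_real, norm_norm, div_self this.ne']
  · have h1 := norm_pos_iff.2 hz
    rw [div_mul_eq_mul_div, Complex.div_ofReal_re, mul_comm, Complex.mul_conj, Complex.ofReal_re]
    have := Complex.normSq_pos.2 hz
    positivity

lemma Bundle.claim_split [DecidableEq ι] {J : Finset ι} (h : Bundle J η) {i₀ j₀ : ι} (hi₀ : i₀ ∈ J)
    (hj₀ : j₀ ∈ J) (hne : η i₀ 0 ≠ η j₀ 0)
    (ih : ∀ J' : Finset ι, J' ⊂ J → J'.Nonempty → ∀ η' : ι → ℂ → ℂ, Bundle J' η' →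
      Claim J' fun i ω => η' i (exp ω)) :
    Claim J fun i ω => η i (exp ω) := by
  obtain ⟨d, hd, hre⟩ := exists_norm_one_mul_re (sub_ne_zero.2 hne)
  have hd0 : d ≠ 0 := norm_pos_iff.1 (by rw [hd]; exact one_pos)
  wlog hlt : (d * η i₀ 0).re < (d * η j₀ 0).re generalizing i₀ j₀
  · refine this hj₀ hi₀ hne.symm ?_ ?_
    · rw [← neg_sub, mul_neg, Complex.neg_re]
      exact neg_ne_zero.2 hre
    · refine lt_of_le_of_ne (not_lt.1 hlt) fun he => hre ?_
      rw [mul_sub, Complex.sub_re, he, sub_self]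
  obtain ⟨θ, hθ, hθJ⟩ := ((Ioo_infinite hlt).sdiff
    (J.image fun k => (d * η k 0).re).finite_toSet).nonempty
  have hb : ∀ k ∈ J, |(d * η k 0).re| < 1 / 2 := fun k hk => by
    refine (Complex.abs_re_le_norm _).trans_lt ?_
    rw [norm_mul, hd, one_mul]
    exact h.small k hk
  have hθk : ∀ k ∈ J, (d * η k 0).re ≠ θ := fun k hk he => hθJ (by
    simp only [Finset.coe_image, mem_image, SetLike.mem_coe]
    exact ⟨k, hk, he⟩)
  have hθb : |θ| < 1 / 2 := by
    have h1 := (abs_lt.1 (hb i₀ hi₀)).1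
    have h2 := (abs_lt.1 (hb j₀ hj₀)).2
    exact abs_lt.2 ⟨h1.trans hθ.1, hθ.2.trans h2⟩
  have hθn : ‖(θ : ℂ)‖ < 1 / 2 := by rwa [Complex.norm_real, Real.norm_eq_abs]
  let U : ι → ℂ → ℂ := fun k ξ => (d * η k ξ - θ) / 2
  have hU : Bundle J U := by
    refine ⟨fun i hi => ?_, fun i hi => ?_, fun i hi j hj hij => ?_⟩
    · exact ((analyticAt_const.mul (h.an i hi)).sub analyticAt_const).div_const
    · have h1 := norm_sub_le (d * η i 0) θ
      have h2 := h.small i hi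
      rw [norm_mul, hd, one_mul] at h1
      simp only [U]
      rw [norm_div, Complex.norm_ofNat]
      linarith
    · filter_upwards [h.ne i hi j hj hij] with ξ hξ he
      simp only [U] at he
      exact hξ (mul_left_cancel₀ hd0 (by linear_combination 2 * he))
  refine (claimE_of_affine (n := 0) (l := Complex.log (2 / d)) (U := U) (q := fun _ => θ / d)
    h.an h.small hU.an hU.small analyticAt_const ?_ (Or.inr ?_) (fun i hi => ?_) ?_).claim
  · rwa [norm_div, hd, div_one]
  · rw [Complex.log_re, norm_div, hd, Complex.norm_ofNat, div_one]
  · refine Eventually.of_forall fun ξ => ?_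
    rw [Complex.exp_log (div_ne_zero two_ne_zero hd0)]
    simp only [U]
    field_simp
    ring
  · have key : ∃ δ : ℝ, 0 < δ ∧ ∀ k ∈ J, 2 * δ < |(d * η k 0).re - θ| / 2 := by
      have : ∀ᶠ δ : ℝ in 𝓝[>] 0, ∀ k ∈ J, 2 * δ < |(d * η k 0).re - θ| / 2 := by
        refine (eventually_all_finset J).2 fun k hk => nhdsWithin_le_nhds ?_
        refine (Continuous.tendsto (f := fun δ : ℝ => 2 * δ) (by fun_prop) 0).eventually
          (gt_mem_nhds ?_)
        have := abs_pos.2 (sub_ne_zero.2 (hθk k hk))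
        simp only [mul_zero]
        positivity
      obtain ⟨δ, h1, h2⟩ := (this.and self_mem_nhdsWithin).exists
      exact ⟨δ, h2, h1⟩
    obtain ⟨δ, hδ, hδk⟩ := key
    have hre0 : ∀ k, (U k 0).re = ((d * η k 0).re - θ) / 2 := fun k => by simp [U]
    have hev : ∀ k ∈ J, ∀ᶠ ξ in 𝓝[≠] (0:ℂ), ((d * η k 0).re < θ → (U k ξ).re ≤ -δ) ∧
        (θ < (d * η k 0).re → δ ≤ (U k ξ).re) := fun k hk => by
      have hc : ContinuousAt (fun ξ => (U k ξ).re) 0 :=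
        Complex.continuous_re.continuousAt.comp (hU.an k hk).continuousAt
      have h1 : ∀ᶠ ξ in 𝓝[≠] (0:ℂ), |(U k ξ).re - (U k 0).re| < δ :=
        nhdsWithin_le_nhds (Metric.continuousAt_iff'.1 hc δ hδ)
      filter_upwards [h1] with ξ hξ
      rw [hre0] at hξ
      have h2 := hδk k hk
      have h3 := abs_lt.1 hξ
      refine ⟨fun hlt => ?_, fun hlt => ?_⟩
      · rw [abs_of_neg (by linarith)] at h2
        linarith
      · rw [abs_of_pos (by linarith)] at h2
        linarith
    obtain ⟨s₁, hs₁⟩ := exists_forall_re_lt fun k hk => exists_re_lt (hev k hk)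
    obtain ⟨s₂, hs₂, -⟩ := exists_strands hU.an (R := 1 / 2) (by norm_num) hU.small
    let J₁ := J.filter fun k => (d * η k 0).re < θ
    let J₂ := J.filter fun k => ¬ (d * η k 0).re < θ
    have sub₁ : J₁ ⊆ J := Finset.filter_subset _ _
    have sub₂ : J₂ ⊆ J := Finset.filter_subset _ _
    have m₁ : i₀ ∈ J₁ := Finset.mem_filter.2 ⟨hi₀, hθ.1⟩
    have m₂ : j₀ ∈ J₂ := Finset.mem_filter.2 ⟨hj₀, hθ.2.not_gt⟩
    have un : J₁ ∪ J₂ = J := Finset.filter_union_filter_not_eq _ _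
    have S := hs₂.anti (min_le_right s₁ s₂)
    rw [← un]
    refine claim_wedge (s := min s₁ s₂) hδ (Finset.disjoint_filter_filter_not _ _ _)
      ⟨fun i hi => S.cont i (sub₁ hi), fun i hi => S.bound i (sub₁ hi), fun i hi => S.per i (sub₁ hi)⟩
      ⟨fun i hi => S.cont i (sub₂ hi), fun i hi => S.bound i (sub₂ hi), fun i hi => S.per i (sub₂ hi)⟩
      (fun i hi ω hω => (hs₁ i (sub₁ hi) ω (hω.trans_le (min_le_left _ _))).1
        (Finset.mem_filter.1 hi).2)
      (fun i hi ω hω => (hs₁ i (sub₂ hi) ω (hω.trans_le (min_le_left _ _))).2 ?_)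
      (ih J₁ ⟨sub₁, fun h => ?_⟩ ⟨i₀, m₁⟩ U (hU.subset sub₁))
      (ih J₂ ⟨sub₂, fun h => ?_⟩ ⟨j₀, m₂⟩ U (hU.subset sub₂))
    · exact lt_of_le_of_ne (not_lt.1 (Finset.mem_filter.1 hi).2) (hθk i (sub₂ hi)).symm
    · exact hθ.2.not_gt (Finset.mem_filter.1 (h hj₀)).2
    · exact (Finset.mem_filter.1 (h hi₀)).2 hθ.1

lemma exists_norm_bound {J : Finset ι} (g : ι → ℂ → ℂ) :
    ∃ κ : ℝ, 0 < κ ∧ ∀ i ∈ J, ‖g i 0‖ / κ < 1 / 2 := by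
  have : ∀ᶠ κ : ℝ in atTop, ∀ i ∈ J, ‖g i 0‖ / κ < 1 / 2 :=
    (eventually_all_finset J).2 fun i _ =>
      (tendsto_const_nhds.div_atTop tendsto_id).eventually (gt_mem_nhds (by norm_num))
  obtain ⟨κ, h1, h2⟩ := (this.and (eventually_gt_atTop 0)).exists
  exact ⟨κ, h2, h1⟩

lemma Bundle.claim_contract [DecidableEq ι] {J : Finset ι} (h : Bundle J η) {i₀ i₁ : ι}
    (hi₀ : i₀ ∈ J) (hi₁ : i₁ ∈ J) (h01 : i₁ ≠ i₀) (heq : ∀ i ∈ J, η i 0 = η i₀ 0)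
    (ih : ∀ η' : ι → ℂ → ℂ, Bundle J η' → (∃ i ∈ J, η' i 0 ≠ η' i₀ 0) →
      Claim J fun i ω => η' i (exp ω)) :
    Claim J fun i ω => η i (exp ω) := by
  have hex : ∀ i ∈ J.erase i₀, ∃ (n : ℕ) (g : ℂ → ℂ), AnalyticAt ℂ g 0 ∧ g 0 ≠ 0 ∧
      ∀ᶠ z in 𝓝 (0:ℂ), η i z - η i₀ z = z ^ n * g z := fun i hi => by
    obtain ⟨hi0, hiJ⟩ := Finset.mem_erase.1 hi
    have := ((h.an i hiJ).sub (h.an i₀ hi₀)).exists_eventuallyEq_pow_smul_nonzero_iff.2 fun hz => by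
      obtain ⟨ξ, h1, h2⟩ := ((h.ne i hiJ i₀ hi₀ hi0).and
        (hz.filter_mono nhdsWithin_le_nhds)).exists
      exact h1 (sub_eq_zero.1 h2)
    simpa using this
  choose! n g hg hg0 hgn using hex
  obtain ⟨m, hm, hmin⟩ := (J.erase i₀).exists_min_image n ⟨i₁, Finset.mem_erase.2 ⟨h01, hi₁⟩⟩
  have hmJ := (Finset.mem_erase.1 hm).2
  have hm0 := (Finset.mem_erase.1 hm).1
  have hpos : 1 ≤ n m := by
    by_contra hn
    have h1 := (hgn m hm).self_of_nhds
    rw [heq m hmJ, sub_self, show n m = 0 by omega, pow_zero, one_mul] at h1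
    exact hg0 m hm h1.symm
  let W : ι → ℂ → ℂ := fun i ξ => if i = i₀ then 0 else ξ ^ (n i - n m) * g i ξ
  have hW : ∀ i ∈ J, AnalyticAt ℂ (W i) 0 := fun i hi => by
    by_cases hi0 : i = i₀
    · simp only [W, hi0, if_true]; exact analyticAt_const
    · simp only [W, hi0, if_false]
      exact (analyticAt_id.pow _).mul (hg i (Finset.mem_erase.2 ⟨hi0, hi⟩))
  have hWe : ∀ i ∈ J, ∀ᶠ ξ in 𝓝 (0:ℂ), η i ξ = η i₀ ξ + ξ ^ n m * W i ξ := fun i hi => by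
    by_cases hi0 : i = i₀
    · simp [W, hi0]
    · have hi' := Finset.mem_erase.2 ⟨hi0, hi⟩
      filter_upwards [hgn i hi'] with ξ hξ
      simp only [W, hi0, if_false]
      rw [← mul_assoc, ← pow_add, Nat.add_sub_cancel' (hmin i hi'), ← hξ, add_sub_cancel]
  obtain ⟨κ, hκ, hκJ⟩ := exists_norm_bound (J := J) W
  have hκ0 : (κ : ℂ) ≠ 0 := by exact_mod_cast hκ.ne'
  have hU : Bundle J fun i ξ => W i ξ / κ := by
    refine ⟨fun i hi => (hW i hi).div_const, fun i hi => ?_, fun i hi j hj hij => ?_⟩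
    · rw [norm_div, Complex.norm_real, Real.norm_eq_abs, abs_of_pos hκ]
      exact hκJ i hi
    · filter_upwards [h.ne i hi j hj hij, (hWe i hi).filter_mono nhdsWithin_le_nhds,
        (hWe j hj).filter_mono nhdsWithin_le_nhds] with ξ h1 h2 h3 h4
      rw [h2, h3, (div_left_inj' hκ0).1 h4] at h1
      exact h1 rfl
  refine (claimE_of_affine (n := n m) (l := Real.log κ) (q := η i₀) h.an h.small hU.an hU.small
    (h.an i₀ hi₀) (h.small i₀ hi₀) (Or.inl hpos) (fun i hi => ?_)
    (ih _ hU ⟨m, hmJ, ?_⟩)).claim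
  · filter_upwards [(hWe i hi).filter_mono nhdsWithin_le_nhds] with ξ h1
    rw [h1, ← Complex.ofReal_exp, Real.exp_log hκ]
    field_simp
    ring
  · simp only [W, hm0, if_false, if_true, Nat.sub_self, pow_zero, one_mul, zero_div]
    exact div_ne_zero (hg0 m hm) hκ0

theorem Bundle.claim {J : Finset ι} (hJ : J.Nonempty) (h : Bundle J η) :
    Claim J fun i ω => η i (exp ω) := by
  classical
  induction J using Finset.strongInduction generalizing η with
  | H J ih =>
    obtain ⟨i₀, hi₀⟩ := hJ
    have split : ∀ η' : ι → ℂ → ℂ, Bundle J η' → (∃ i ∈ J, η' i 0 ≠ η' i₀ 0) →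
        Claim J fun i ω => η' i (exp ω) := fun η' h' ⟨i, hi, hne⟩ =>
      h'.claim_split hi hi₀ hne fun J' hJ' hn η'' h'' => ih J' hJ' hn h''
    by_cases h1 : ∃ i ∈ J, η i 0 ≠ η i₀ 0
    · exact split η h h1
    push Not at h1
    by_cases h2 : ∃ i ∈ J, i ≠ i₀
    · obtain ⟨i₁, hi₁, h01⟩ := h2
      exact h.claim_contract hi₀ hi₁ h01 h1 split
    · push Not at h2
      obtain rfl : J = {i₀} := Finset.eq_singleton_iff_unique_mem.2 ⟨hi₀, h2⟩
      exact h.claim_singleton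

/-- Strands sharing their jet up to order `n - 1` have `n` full twists in their monodromy. -/
theorem Bundle.claimE {J : Finset ι} (hJ : J.Nonempty) (h : Bundle J η) {n : ℕ} (hn : 1 ≤ n)
    {q : ℂ → ℂ} (hq : AnalyticAt ℂ q 0) (hq0 : ‖q 0‖ < 1 / 2) {W : ι → ℂ → ℂ}
    (hW : ∀ i ∈ J, AnalyticAt ℂ (W i) 0)
    (hWe : ∀ i ∈ J, ∀ᶠ ξ in 𝓝[≠] (0:ℂ), η i ξ = q ξ + ξ ^ n * W i ξ) :
    ClaimE J (fun i ω => η i (exp ω)) n := by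
  obtain ⟨κ, hκ, hκJ⟩ := exists_norm_bound (J := J) W
  have hκ0 : (κ : ℂ) ≠ 0 := by exact_mod_cast hκ.ne'
  have hU : Bundle J fun i ξ => W i ξ / κ := by
    refine ⟨fun i hi => (hW i hi).div_const, fun i hi => ?_, fun i hi j hj hij => ?_⟩
    · rw [norm_div, Complex.norm_real, Real.norm_eq_abs, abs_of_pos hκ]
      exact hκJ i hi
    · filter_upwards [h.ne i hi j hj hij, hWe i hi, hWe j hj] with ξ h1 h2 h3 h4
      rw [h2, h3, (div_left_inj' hκ0).1 h4] at h1
      exact h1 rfl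
  refine claimE_of_affine (n := n) (l := Real.log κ) (q := q) h.an h.small hU.an hU.small
    hq hq0 (Or.inl hn) (fun i hi => ?_) (hU.claim hJ)
  filter_upwards [hWe i hi] with ξ h1
  rw [h1, ← Complex.ofReal_exp, Real.exp_log hκ]
  field_simp
  ring

end Puiseux

section Descent

variable {G : Type} [Group G] {ι : Type} [Fintype ι] {N : ℕ} {σ : Equiv.Perm ι}
  {y : ι → ℂ → ℂ} {s : ℝ}

lemma Gauge.eqOn {P : Type*} [TopologicalSpace P] {E : Set P} (hE : IsPreconnected E)
    {b b' : P → G} {c c' : P → P → G} (h : Gauge E b c c') (h' : Gauge E b' c c') {x z : P}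
    (hx : x ∈ E) (hz : z ∈ E) (hxe : b x = b' x) : b z = b' z := by
  refine (const_of_locConst hE (f := fun a => b a = b' a) (fun p hp => ?_) hx hz).mp hxe
  obtain ⟨M, hM, h1⟩ := h p hp
  obtain ⟨M', hM', h1'⟩ := h' p hp
  have hp1 := mem_of_mem_nhdsWithin hp hM
  have hp2 := mem_of_mem_nhdsWithin hp hM'
  refine ⟨M ∩ M', inter_mem hM hM', fun a ha => ?_⟩
  have e1 := (h1 a ha.1 p hp1).symm.trans (h1' a ha.2 p hp2)
  ext
  constructor
  · intro h2
    rw [h2] at e1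
    exact mul_left_cancel e1
  · intro h2
    rw [h2] at e1
    exact inv_injective (mul_right_cancel (mul_right_cancel e1))

/-- Deck transformations of the covering `(ω, v) ↦ (exp (N ω), v)`. -/
def sh (N : ℕ) (k : ℤ) (p : ℂ × ℂ) : ℂ × ℂ := (p.1 + k * (2 * π * I / N), p.2)

/-- The covering `(ω, v) ↦ (exp (N ω), v)`. -/
def kx (N : ℕ) (p : ℂ × ℂ) : ℂ × ℂ := (exp (N * p.1), p.2)

lemma sh_zero (p : ℂ × ℂ) : sh N 0 p = p := by simp [sh]

lemma sh_sh (k l : ℤ) (p : ℂ × ℂ) : sh N k (sh N l p) = sh N (k + l) p := by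
  simp only [sh, Prod.mk.injEq, and_true]; push_cast; ring

lemma continuous_sh (k : ℤ) : Continuous (sh N k) := by unfold sh; fun_prop

lemma continuous_kx : Continuous (kx N) := by unfold kx; fun_prop

lemma sh_fst_re (k : ℤ) (p : ℂ × ℂ) : (sh N k p).1.re = p.1.re := by
  have : (k : ℂ) * (2 * π * I / N) = ((k * (2 * π) / N : ℝ) : ℂ) * I := by
    push_cast; ring
  rw [sh, this]
  simp only [Complex.add_re, Complex.re_ofReal_mul, Complex.I_re, mul_zero, add_zero]

lemma kx_sh (hN : 1 ≤ N) (k : ℤ) (p : ℂ × ℂ) : kx N (sh N k p) = kx N p := by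
  have hN' : (N : ℂ) ≠ 0 := by exact_mod_cast (by lia : N ≠ 0)
  simp only [kx, sh, Prod.mk.injEq, and_true]
  rw [Complex.exp_eq_exp_iff_exists_int]
  exact ⟨k, by field_simp⟩

lemma exists_sh_of_kx_eq (hN : 1 ≤ N) {p q : ℂ × ℂ} (h : kx N p = kx N q) :
    ∃ k : ℤ, p = sh N k q := by
  have hN' : (N : ℂ) ≠ 0 := by exact_mod_cast (by lia : N ≠ 0)
  simp only [kx, Prod.mk.injEq] at h
  obtain ⟨k, hk⟩ := Complex.exp_eq_exp_iff_exists_int.1 h.1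
  refine ⟨k, Prod.ext ?_ h.2⟩
  simp only [sh]
  apply mul_left_cancel₀ hN'
  rw [hk]; field_simp

/-- Sheets of a curve over a punctured disc, in logarithmic coordinates. -/
structure Sheets (N : ℕ) (σ : Equiv.Perm ι) (y : ι → ℂ → ℂ) (s K : ℝ) : Prop where
  one_le : 1 ≤ N
  cont : ∀ i, ContinuousOn (y i) {ω | ω.re < s}
  rot : ∀ i, ∀ ω : ℂ, ω.re < s → y i (ω + 2 * π * I / N) = y (σ i) ω
  bound : ∀ i, ∀ ω : ℂ, ω.re < s → ‖y i ω‖ ≤ K * Real.exp (N * ω.re)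
  pos : 0 < K
  small : K * Real.exp (N * s) ≤ 1 / 2
  order : σ ^ N = 1

lemma Sheets.anti {K s' : ℝ} (h : Sheets N σ y s K) (hs : s' ≤ s) : Sheets N σ y s' K where
  one_le := h.one_le
  cont i := (h.cont i).mono fun _ hω => lt_of_lt_of_le hω hs
  rot i ω hω := h.rot i ω (hω.trans_le hs)
  bound i ω hω := h.bound i ω (hω.trans_le hs)
  pos := h.pos
  small := le_trans (by have := h.pos; gcongr) h.small
  order := h.order

lemma Sheets.rot_int {K : ℝ} (h : Sheets N σ y s K) (k : ℤ) :
    ∀ (i : ι) (p : ℂ × ℂ), p.1.re < s → y i (sh N k p).1 = y ((σ ^ k) i) p.1 := by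
  have key : ∀ (i : ι) (p : ℂ × ℂ), p.1.re < s → y i (sh N 1 p).1 = y (σ i) p.1 := by
    intro i p hp
    rw [← h.rot i p.1 hp]
    simp [sh]
  induction k using Int.induction_on with
  | zero => intro i p hp; simp [sh_zero]
  | succ k ih =>
    intro i p hp
    rw [add_comm, ← sh_sh, key _ _ (by rwa [sh_fst_re]), ih _ _ hp, ← Equiv.Perm.mul_apply,
      ← zpow_add_one, add_comm]
  | pred k ih =>
    intro i p hp
    have h1 := key (σ⁻¹ i) (sh N (-(k:ℤ) - 1) p) (by rwa [sh_fst_re])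
    rw [sh_sh, show σ (σ⁻¹ i) = i by simp] at h1
    rw [← h1, show (1 + (-(k:ℤ) - 1)) = -(k:ℤ) by ring, ih _ _ hp, ← Equiv.Perm.mul_apply,
      ← zpow_sub_one]

lemma Sheets.norm_lt {K : ℝ} (h : Sheets N σ y s K) (i : ι) {ω : ℂ} (hω : ω.re < s) :
    ‖y i ω‖ ≤ 1 / 2 := by
  refine (h.bound i ω hω).trans (le_trans ?_ h.small)
  have := h.pos
  gcongr

lemma Sheets.strands {K : ℝ} (h : Sheets N σ y s K) : Strands Finset.univ y s where
  cont i _ := h.cont i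
  bound i _ ω hω := (h.norm_lt i hω).trans (by norm_num)
  per i _ ω hω := by
    have hN' : (N : ℂ) ≠ 0 := by exact_mod_cast (by have := h.one_le; lia : N ≠ 0)
    have := h.rot_int N i (ω, 0) hω
    rw [zpow_natCast, h.order, Equiv.Perm.one_apply] at this
    rw [← this]
    congr 1
    simp only [sh, Int.cast_natCast]
    field_simp

lemma Sheets.sh_mem {K : ℝ} (h : Sheets N σ y s K) (k : ℤ) :
    MapsTo (sh N k) (Efib Finset.univ y s) (Efib Finset.univ y s) := fun p hp =>
  ⟨by rw [sh_fst_re]; exact hp.1, fun i _ => by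
    rw [h.rot_int k i p hp.1]
    exact hp.2 _ (Finset.mem_univ _)⟩

lemma sh_mem_Tfib (k : ℤ) : MapsTo (sh N k) (Tfib s) (Tfib s) := fun p hp =>
  ⟨by rw [sh_fst_re]; exact hp.1, hp.2⟩

/-- The curve with sheets `y`. -/
def Vset (N : ℕ) (y : ι → ℂ → ℂ) (s : ℝ) : Set (ℂ × ℂ) :=
  {0} ∪ {p | ∃ ω : ℂ, ω.re < s ∧ ∃ i, p = (exp (N * ω), y i ω)}

/-- The complement of the curve in a cylinder. -/
def Xset (N : ℕ) (y : ι → ℂ → ℂ) (s₀ s : ℝ) : Set (ℂ × ℂ) :=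
  {p | ‖p.1‖ < Real.exp (N * s) ∧ p ∉ Vset N y s₀}

lemma norm_kx (p : ℂ × ℂ) : ‖(kx N p).1‖ = Real.exp (N * p.1.re) := by
  rw [kx, Complex.norm_exp]
  congr 1
  simp

lemma Sheets.kx_mem_iff {K s₀ : ℝ} (h : Sheets N σ y s₀ K) (hs : s ≤ s₀) (p : ℂ × ℂ) :
    kx N p ∈ Xset N y s₀ s ↔ p ∈ Efib Finset.univ y s := by
  have hN : (0:ℝ) < N := by exact_mod_cast h.one_le
  have e1 : ‖(kx N p).1‖ < Real.exp (N * s) ↔ p.1.re < s := by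
    rw [norm_kx, Real.exp_lt_exp, mul_lt_mul_iff_right₀ hN]
  constructor
  · rintro ⟨h1, h2⟩
    have h1 := e1.1 h1
    refine ⟨h1, fun i _ hi => h2 (Or.inr ⟨p.1, h1.trans_le hs, i, ?_⟩)⟩
    simp [kx, hi]
  · rintro ⟨h1, h2⟩
    refine ⟨e1.2 h1, ?_⟩
    rintro (h0 | ⟨ω, hω, i, hi⟩)
    · have : (kx N p).1 = 0 := by rw [h0]; rfl
      exact exp_ne_zero _ this
    · obtain ⟨k, hk⟩ := exists_sh_of_kx_eq h.one_le (p := (ω, y i ω)) (q := p) (by rw [hi]; rfl)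
      have e2 : p.2 = y i ω := congrArg Prod.snd hi
      have e3 : (sh N k p).1 = ω := by rw [← hk]
      have e4 := h.rot_int k i p (h1.trans_le hs)
      rw [e3, ← e2] at e4
      exact h2 _ (Finset.mem_univ _) e4

/-- The principal section of the covering `kx`. -/
def lg (N : ℕ) (p : ℂ × ℂ) : ℂ × ℂ := (Complex.log p.1 / N, p.2)

/-- The section of the covering `kx` near `p` through `lg p`. -/
def sec (N : ℕ) (p q : ℂ × ℂ) : ℂ × ℂ := (Complex.log p.1 / N + Complex.log (q.1 / p.1) / N, q.2)

lemma kx_lg (hN : 1 ≤ N) {p : ℂ × ℂ} (hp : p.1 ≠ 0) : kx N (lg N p) = p := by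
  have hN' : (N : ℂ) ≠ 0 := by exact_mod_cast (by lia : N ≠ 0)
  simp only [kx, lg, mul_div_cancel₀ _ hN', Complex.exp_log hp]

lemma kx_sec (hN : 1 ≤ N) {p q : ℂ × ℂ} (hp : p.1 ≠ 0) (hq : q.1 ≠ 0) :
    kx N (sec N p q) = q := by
  have hN' : (N : ℂ) ≠ 0 := by exact_mod_cast (by lia : N ≠ 0)
  simp only [kx, sec, mul_add, mul_div_cancel₀ _ hN', Complex.exp_add, Complex.exp_log hp,
    Complex.exp_log (div_ne_zero hq hp)]
  field_simp

lemma continuousAt_sec {p : ℂ × ℂ} (hp : p.1 ≠ 0) : ContinuousAt (sec N p) p := by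
  have h1 : ContinuousAt (fun q : ℂ × ℂ => Complex.log (q.1 / p.1)) p := by
    refine ContinuousAt.clog (by fun_prop) ?_
    simp [div_self hp, Complex.mem_slitPlane_iff]
  unfold sec
  exact (continuousAt_const.add (h1.div_const _)).prodMk continuousAt_snd

/-- The part of `Xset` away from the line `x = 0`. -/
def Xpun (N : ℕ) (y : ι → ℂ → ℂ) (s₀ s : ℝ) : Set (ℂ × ℂ) := {p ∈ Xset N y s₀ s | p.1 ≠ 0}

lemma Sheets.kx_mem {K s₀ : ℝ} (h : Sheets N σ y s₀ K) (hs : s ≤ s₀) :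
    MapsTo (kx N) (Efib Finset.univ y s) (Xpun N y s₀ s) := fun p hp =>
  ⟨(h.kx_mem_iff hs p).2 hp, exp_ne_zero _⟩

lemma sh_invariant {α : Type*} {E : Set (ℂ × ℂ)} (hE : ∀ k, MapsTo (sh N k) E E) {F : ℂ × ℂ → α}
    (hF : ∀ p ∈ E, F (sh N 1 p) = F p) (k : ℤ) : ∀ p ∈ E, F (sh N k p) = F p := by
  induction k using Int.induction_on with
  | zero => intro p _; rw [sh_zero]
  | succ k ih => intro p hp; rw [add_comm, ← sh_sh, hF _ (hE _ hp), ih p hp]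
  | pred k ih =>
    intro p hp
    rw [← hF _ (hE _ hp), sh_sh, show (1 + (-(k:ℤ) - 1)) = -(k:ℤ) by ring, ih p hp]

/-- An invariant gauge transformation descends. -/
lemma Gauge.descend {E X : Set (ℂ × ℂ)} (hN : 1 ≤ N) (hE : ∀ k, MapsTo (sh N k) E E)
    (hX0 : ∀ p ∈ X, p.1 ≠ 0) (hX : ∀ p, kx N p ∈ X → p ∈ E)
    {b : ℂ × ℂ → G} {c c' : ℂ × ℂ → ℂ × ℂ → G}
    (hb : Gauge E b (fun a d => c (kx N a) (kx N d)) fun a d => c' (kx N a) (kx N d))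
    (hinv : ∀ p ∈ E, b (sh N 1 p) = b p) : Gauge X (fun p => b (lg N p)) c c' := by
  intro p hp
  have hs : MapsTo (sec N p) X E := fun q hq => hX _ (by
    rw [kx_sec hN (hX0 p hp) (hX0 q hq)]; exact hq)
  obtain ⟨M, hM, h1⟩ := hb (sec N p p) (hs hp)
  have key : ∀ q ∈ X, b (lg N q) = b (sec N p q) := by
    intro q hq
    obtain ⟨k, hk⟩ := exists_sh_of_kx_eq hN (p := lg N q) (q := sec N p q) (by
      rw [kx_sec hN (hX0 p hp) (hX0 q hq), kx_lg hN (hX0 q hq)])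
    rw [hk, sh_invariant hE hinv k _ (hs hq)]
  refine ⟨X ∩ sec N p ⁻¹' M, inter_mem self_mem_nhdsWithin
    ((continuousAt_sec (hX0 p hp)).continuousWithinAt.tendsto_nhdsWithin hs hM),
    fun a ha d hd => ?_⟩
  have := h1 _ ha.2 _ hd.2
  simp only [kx_sec hN (hX0 p hp) (hX0 a ha.1), kx_sec hN (hX0 p hp) (hX0 d hd.1)] at this
  simp only [key a ha.1, key d hd.1, this]

/-- The point over `q` nearest to `a`. -/
def near (N : ℕ) (a q : ℂ × ℂ) : ℂ × ℂ :=
  (a.1 + Complex.log (q.1 / exp (N * a.1)) / N, q.2)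

/-- Local invariance under deck transformations. -/
def ShInv (N : ℕ) (E : Set (ℂ × ℂ)) (c : ℂ × ℂ → ℂ × ℂ → G) : Prop :=
  ∀ p ∈ E, ∃ M ∈ 𝓝[E] p, ∀ a ∈ M, ∀ d ∈ M, c (sh N 1 a) (sh N 1 d) = c a d

lemma ShInv.zpow {E : Set (ℂ × ℂ)} (hE : ∀ k, MapsTo (sh N k) E E) {c : ℂ × ℂ → ℂ × ℂ → G}
    (h : ShInv N E c) (k : ℤ) :
    ∀ p ∈ E, ∃ M ∈ 𝓝[E] p, ∀ a ∈ M, ∀ d ∈ M, c (sh N k a) (sh N k d) = c a d := by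
  have cont : ∀ (k : ℤ), ∀ p ∈ E, ∀ M ∈ 𝓝[E] (sh N k p), sh N k ⁻¹' M ∈ 𝓝[E] p :=
    fun k p hp M hM => (continuous_sh k).continuousWithinAt.tendsto_nhdsWithin (hE k) hM
  induction k using Int.induction_on with
  | zero => intro p _; exact ⟨univ, univ_mem, fun a _ d _ => by rw [sh_zero, sh_zero]⟩
  | succ k ih =>
    intro p hp
    obtain ⟨M, hM, h1⟩ := ih p hp
    obtain ⟨M', hM', h2⟩ := h _ (hE k hp)
    refine ⟨M ∩ sh N k ⁻¹' M', inter_mem hM (cont k p hp _ hM'), fun a ha d hd => ?_⟩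
    rw [add_comm, ← sh_sh, ← sh_sh, h2 _ ha.2 _ hd.2, h1 _ ha.1 _ hd.1]
  | pred k ih =>
    intro p hp
    obtain ⟨M, hM, h1⟩ := ih p hp
    obtain ⟨M', hM', h2⟩ := h _ (hE (-(k:ℤ) - 1) hp)
    refine ⟨M ∩ sh N (-(k:ℤ) - 1) ⁻¹' M', inter_mem hM (cont _ p hp _ hM'), fun a ha d hd => ?_⟩
    rw [← h2 _ ha.2 _ hd.2, sh_sh, sh_sh, show (1 + (-(k:ℤ) - 1)) = -(k:ℤ) by ring,
      h1 _ ha.1 _ hd.1]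

lemma log_div_of_small {x z : ℂ} (hx : x ≠ 0) (hz : z ≠ 0)
    (h1 : |(Complex.log x).im| < π / 2) (h2 : |(Complex.log z).im| < π / 2) :
    Complex.log (z / x) = Complex.log z - Complex.log x := by
  rw [abs_lt] at h1 h2
  conv_lhs => rw [← Complex.exp_log hx, ← Complex.exp_log hz, ← Complex.exp_sub]
  rw [Complex.log_exp] <;> rw [Complex.sub_im] <;> linarith

/-- A locally invariant cocycle descends. -/
lemma LocCoc.descend {E X : Set (ℂ × ℂ)} (hN : 1 ≤ N) (hE : ∀ k, MapsTo (sh N k) E E)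
    (hX0 : ∀ p ∈ X, p.1 ≠ 0) (hX : ∀ p, kx N p ∈ X ↔ p ∈ E)
    {c : ℂ × ℂ → ℂ × ℂ → G} (hc : LocCoc E c) (h : ShInv N E c) :
    ∃ U : ℂ × ℂ → ℂ × ℂ → G, LocCoc X U ∧
      Gauge E (fun _ => 1) c fun a d => U (kx N a) (kx N d) := by
  have hN' : (N : ℂ) ≠ 0 := by exact_mod_cast (by lia : N ≠ 0)
  set U : ℂ × ℂ → ℂ × ℂ → G := fun p q => c (lg N p) (near N (lg N p) q) with hU
  have hs : ∀ p ∈ X, MapsTo (sec N p) X E := fun p hp q hq => (hX _).1 (by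
    rw [kx_sec hN (hX0 p hp) (hX0 q hq)]; exact hq)
  have key : ∀ p ∈ X, ∃ M ∈ 𝓝[X] p, ∀ a ∈ M, ∀ d ∈ M, U a d = c (sec N p a) (sec N p d) := by
    intro p hp
    have hp0 := hX0 p hp
    obtain ⟨M0, hM0, h0⟩ := h.zpow hE 0 _ (hs p hp hp)
    obtain ⟨M1, hM1, h1⟩ := h.zpow hE 1 _ (hs p hp hp)
    obtain ⟨M2, hM2, h2⟩ := h.zpow hE (-1) _ (hs p hp hp)
    have hL : {q : ℂ × ℂ | |(Complex.log (q.1 / p.1)).im| < π / 2} ∈ 𝓝 p := by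
      have : ContinuousAt (fun q : ℂ × ℂ => |(Complex.log (q.1 / p.1)).im|) p := by
        refine (Complex.continuous_im.continuousAt.comp (ContinuousAt.clog (by fun_prop) ?_)).abs
        simp [div_self hp0, Complex.mem_slitPlane_iff]
      refine this.eventually_lt continuousAt_const ?_
      simp [div_self hp0, Real.pi_pos]
    refine ⟨(X ∩ sec N p ⁻¹' (M0 ∩ M1 ∩ M2)) ∩ {q | |(Complex.log (q.1 / p.1)).im| < π / 2},
      inter_mem (inter_mem self_mem_nhdsWithin
        ((continuousAt_sec hp0).continuousWithinAt.tendsto_nhdsWithin (hs p hp)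
          (inter_mem (inter_mem hM0 hM1) hM2))) (mem_nhdsWithin_of_mem_nhds hL),
      fun a ha d hd => ?_⟩
    have ha0 := hX0 a ha.1.1
    have hd0 := hX0 d hd.1.1
    obtain ⟨k, hk⟩ := exists_sh_of_kx_eq hN (p := lg N a) (q := sec N p a) (by
      rw [kx_sec hN hp0 ha0, kx_lg hN ha0])
    have e2 : near N (lg N a) d = sh N k (sec N p d) := by
      have e0 : (lg N a).1 = (sh N k (sec N p a)).1 := by rw [hk]
      have e1 : exp (N * (lg N a).1) = a.1 := congrArg Prod.fst (kx_lg hN ha0)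
      refine Prod.ext ?_ rfl
      simp only [near]
      rw [e1, e0, show d.1 / a.1 = (d.1 / p.1) / (a.1 / p.1) by field_simp,
        log_div_of_small (div_ne_zero ha0 hp0) (div_ne_zero hd0 hp0) ha.2 hd.2]
      simp only [sh, sec]
      ring
    have hk1 : k = 0 ∨ k = 1 ∨ k = -1 := by
      have e0 : Complex.log a.1 = Complex.log p.1 + Complex.log (a.1 / p.1) +
          ((k * (2 * π) : ℝ) : ℂ) * I := by
        have := congrArg Prod.fst hk
        simp only [lg, sh, sec] at this
        field_simp at this
        rw [this]; push_cast; ring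
      have e1 := congrArg Complex.im e0
      rw [Complex.add_im, Complex.add_im, Complex.im_ofReal_mul, Complex.I_im, mul_one] at e1
      have b1 := Complex.neg_pi_lt_log_im a.1
      have b2 := Complex.log_im_le_pi a.1
      have b3 := Complex.neg_pi_lt_log_im p.1
      have b4 := Complex.log_im_le_pi p.1
      have b5 := abs_lt.1 (show |(Complex.log (a.1 / p.1)).im| < π / 2 from ha.2)
      have hpi := Real.pi_pos
      have u1 : (k:ℝ) < 2 := by
        by_contra hcon
        push Not at hcon
        nlinarith
      have u2 : (-2:ℝ) < k := by
        by_contra hcon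
        push Not at hcon
        nlinarith
      have u1' : k < 2 := by exact_mod_cast u1
      have u2' : -2 < k := by exact_mod_cast u2
      lia
    simp only [hU]
    rw [e2, hk]
    rcases hk1 with rfl | rfl | rfl
    · exact h0 _ ha.1.2.1.1 _ hd.1.2.1.1
    · exact h1 _ ha.1.2.1.2 _ hd.1.2.1.2
    · exact h2 _ ha.1.2.2 _ hd.1.2.2
  refine ⟨U, fun p hp => ?_, fun p hp => ?_⟩
  · obtain ⟨M, hM, h1⟩ := key p hp
    obtain ⟨M', hM', h2⟩ := hc _ (hs p hp hp)
    refine ⟨M ∩ sec N p ⁻¹' M', inter_mem hM ((continuousAt_sec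
      (hX0 p hp)).continuousWithinAt.tendsto_nhdsWithin (hs p hp) hM'), fun a ha b hb d hd => ?_⟩
    rw [h1 a ha.1 b hb.1, h1 b hb.1 d hd.1, h1 a ha.1 d hd.1, h2 _ ha.2 _ hb.2 _ hd.2]
  · have hpX := (hX p).2 hp
    have hp0 := hX0 _ hpX
    obtain ⟨M, hM, h1⟩ := key _ hpX
    obtain ⟨k, hk⟩ := exists_sh_of_kx_eq hN (p := lg N (kx N p)) (q := p) (kx_lg hN hp0)
    obtain ⟨M', hM', h2⟩ := h.zpow hE k p hp
    have hk1 : Complex.log (exp (N * p.1)) / N = p.1 + k * (2 * π * I / N) :=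
      congrArg Prod.fst hk
    have hpi := Real.pi_pos
    have hL : {a : ℂ × ℂ | |(N * a.1 - N * p.1).im| < π} ∈ 𝓝 p := by
      have : ContinuousAt (fun a : ℂ × ℂ => |(N * a.1 - N * p.1).im|) p := by fun_prop
      exact this.eventually_lt continuousAt_const (by simpa using Real.pi_pos)
    refine ⟨kx N ⁻¹' M ∩ M' ∩ {a | |(N * a.1 - N * p.1).im| < π}, inter_mem (inter_mem
      (continuous_kx.continuousWithinAt.tendsto_nhdsWithin (fun a ha => (hX a).2 ha) hM) hM')
      (mem_nhdsWithin_of_mem_nhds hL), ?_⟩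
    have e1 : ∀ a ∈ {a : ℂ × ℂ | |(N * a.1 - N * p.1).im| < π},
        sec N (kx N p) (kx N a) = sh N k a := by
      intro a ha
      have ha := abs_lt.1 (show |(N * a.1 - N * p.1).im| < π from ha)
      simp only [sec, sh, kx, Prod.mk.injEq, and_true]
      rw [← Complex.exp_sub, Complex.log_exp ha.1 ha.2.le, hk1]
      field_simp
      ring
    intro a ha d hd
    simp only [h1 _ ha.1.1 _ hd.1.1, e1 a ha.2, e1 d hd.2, h2 a ha.1.2 d hd.1.2, inv_one, one_mul,
      mul_one]

end Descent

section Extension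

variable {G : Type} [Group G] {ι : Type} [Fintype ι] {N : ℕ} {σ : Equiv.Perm ι}
  {y : ι → ℂ → ℂ} {s s₀ K : ℝ}

/-- The permutation of `(ℂ × ℂ) × G` defined by a multiplier over the deck transformation. -/
def shiftPerm (N : ℕ) (d : ℂ × ℂ → G) : Equiv.Perm ((ℂ × ℂ) × G) where
  toFun x := (sh N 1 x.1, (d x.1)⁻¹ * x.2)
  invFun x := (sh N (-1) x.1, d (sh N (-1) x.1) * x.2)
  left_inv x := by simp [sh_sh, sh_zero]
  right_inv x := by simp [sh_sh, sh_zero]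

lemma shiftPerm_fst (d : ℂ × ℂ → G) (k : ℤ) : ∀ x, ((shiftPerm N d ^ k) x).1 = sh N k x.1 := by
  have h1 : ∀ x, (shiftPerm N d x).1 = sh N 1 x.1 := fun x => rfl
  have h2 : ∀ x, ((shiftPerm N d)⁻¹ x).1 = sh N (-1) x.1 := fun x => rfl
  induction k using Int.induction_on with
  | zero => intro x; simp [sh_zero]
  | succ k ih => intro x; rw [zpow_add_one, Equiv.Perm.mul_apply, ih, h1, sh_sh]
  | pred k ih => intro x; rw [zpow_sub_one, Equiv.Perm.mul_apply, ih, h2, sh_sh]; rfl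

lemma shiftPerm_one {d : ℂ × ℂ → G} {T : Set (ℂ × ℂ)} (hT : ∀ k, MapsTo (sh N k) T T)
    (hd : ∀ p ∈ T, d p = 1) (k : ℤ) : ∀ p ∈ T, ((shiftPerm N d ^ k) (p, 1)).2 = 1 := by
  induction k using Int.induction_on with
  | zero => intro p _; simp
  | succ k ih =>
    intro p hp
    have : shiftPerm N d (p, 1) = (sh N 1 p, 1) := by simp [shiftPerm, hd p hp]
    rw [zpow_add_one, Equiv.Perm.mul_apply, this, ih _ (hT _ hp)]
  | pred k ih =>
    intro p hp
    have : (shiftPerm N d)⁻¹ (p, 1) = (sh N (-1) p, 1) := by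
      change (sh N (-1) p, d (sh N (-1) p) * 1) = _
      simp [hd _ (hT _ hp)]
    rw [zpow_sub_one, Equiv.Perm.mul_apply, this, ih _ (hT _ hp)]

lemma exists_multiplier (hN : 1 ≤ N) (d : ℂ × ℂ → G) {T : Set (ℂ × ℂ)}
    (hT : ∀ k, MapsTo (sh N k) T T) (hd : ∀ p ∈ T, d p = 1) :
    ∃ e : ℂ × ℂ → G, (∀ p, e (sh N 1 p) = (d p)⁻¹ * e p) ∧ ∀ p ∈ T, e p = 1 := by
  set k : ℂ × ℂ → ℤ := fun p => ⌊p.1.im * N / (2 * π)⌋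
  have hk : ∀ p, k (sh N 1 p) = k p + 1 := by
    intro p
    have hN' : (N : ℝ) ≠ 0 := by exact_mod_cast (by lia : N ≠ 0)
    have h1 : ((1:ℤ) : ℂ) * (2 * π * I / N) = ((2 * π / N : ℝ) : ℂ) * I := by
      push_cast; ring
    simp only [k, sh, h1, Complex.add_im, Complex.im_ofReal_mul, Complex.I_im, mul_one]
    rw [← Int.floor_add_one]
    congr 1
    have := Real.pi_ne_zero
    field_simp
  refine ⟨fun p => ((shiftPerm N d ^ k p) (sh N (-k p) p, 1)).2, fun p => ?_, fun p hp =>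
    shiftPerm_one hT hd _ _ (hT _ hp)⟩
  simp only [hk, sh_sh]
  rw [show -(k p + 1) + 1 = -k p by ring, add_comm, zpow_one_add, Equiv.Perm.mul_apply]
  have := shiftPerm_fst (N := N) d (k p) (sh N (-k p) p, 1)
  rw [sh_sh, add_neg_cancel, sh_zero] at this
  change (d _)⁻¹ * _ = _
  rw [this]

/-- Descent of a cocycle which is equivalent to its translate. -/
lemma LocCoc.descend_multiplier {E X T : Set (ℂ × ℂ)} (hN : 1 ≤ N)
    (hE : ∀ k, MapsTo (sh N k) E E) (hX0 : ∀ p ∈ X, p.1 ≠ 0) (hX : ∀ p, kx N p ∈ X ↔ p ∈ E)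
    (hT : ∀ k, MapsTo (sh N k) T T) {c : ℂ × ℂ → ℂ × ℂ → G} (hc : LocCoc E c) {d : ℂ × ℂ → G}
    (hd : ∀ p ∈ T, d p = 1) (h : Gauge E d c fun a b => c (sh N 1 a) (sh N 1 b)) :
    ∃ (U : ℂ × ℂ → ℂ × ℂ → G) (e : ℂ × ℂ → G), LocCoc X U ∧ (∀ p, e (sh N 1 p) = (d p)⁻¹ * e p) ∧
      (∀ p ∈ T, e p = 1) ∧ Gauge E e c fun a b => U (kx N a) (kx N b) := by
  obtain ⟨e, he, heT⟩ := exists_multiplier hN d hT hd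
  have hinv : ShInv N E fun a b => (e a)⁻¹ * c a b * e b := by
    intro p hp
    obtain ⟨M, hM, h1⟩ := h p hp
    refine ⟨M, hM, fun a ha b hb => ?_⟩
    simp only [he, h1 a ha b hb]
    group
  obtain ⟨U, hU, hg⟩ := LocCoc.descend hN hE hX0 hX ((gauge_self E e c).locCoc hc) hinv
  refine ⟨U, e, hU, he, heT, ?_⟩
  simpa using (gauge_self E e c).trans hg

/-- The region outside a cone around the sheets. -/
def Out (N : ℕ) (K s : ℝ) : Set (ℂ × ℂ) := {p | p.1.re < s ∧ K * Real.exp (N * p.1.re) < ‖p.2‖}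

lemma norm_mul_one_add {v : ℂ} (hv : v ≠ 0) {t : ℝ} (ht : 0 ≤ t) :
    ‖v * ((1 + t / ‖v‖ : ℝ) : ℂ)‖ = ‖v‖ + t := by
  have := norm_pos_iff.2 hv
  rw [norm_mul, Complex.norm_real, Real.norm_eq_abs, abs_of_nonneg (by positivity)]
  field_simp

lemma im_mul_one_add {v : ℂ} (hv : 0 ≤ v.im) {t : ℝ} (ht : 0 ≤ t) :
    v.im ≤ (v * ((1 + t / ‖v‖ : ℝ) : ℂ)).im := by
  rw [Complex.im_mul_ofReal]
  have : 0 ≤ t / ‖v‖ := by positivity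
  nlinarith

lemma Out_subset (hK : 0 ≤ K) : Out N K s ⊆ {p | p.1.re < s ∧ p.2 ≠ 0} := fun p hp => ⟨hp.1, by
  have h2 : K * Real.exp (N * p.1.re) < ‖p.2‖ := hp.2
  have : 0 ≤ K * Real.exp (N * p.1.re) := by positivity
  exact norm_pos_iff.1 (this.trans_lt h2)⟩

lemma three_lt_norm {v : ℂ} (h : 3 < v.im) : 3 < ‖v‖ :=
  h.trans_le ((le_abs_self _).trans (Complex.abs_im_le_norm v))

lemma mul_exp_lt (hK : 0 < K) (hs : K * Real.exp (N * s) ≤ 1 / 2) {ω : ℂ} (hω : ω.re < s) :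
    K * Real.exp (N * ω.re) ≤ 1 / 2 := by
  refine le_trans ?_ hs
  gcongr

lemma out_gauge (hK : 0 < K) (hs : K * Real.exp (N * s) ≤ 1 / 2) {c : ℂ × ℂ → ℂ × ℂ → G}
    (hc : RCoc (Out N K s) (Tfib s) c) :
    ∃ g : G, REq (Out N K s) (Tfib s) c fun a d => g ^ wnd a.2 d.2 := by
  classical
  have hTO : Tfib s ⊆ Out N K s := fun p hp => ⟨hp.1, by
    have := mul_exp_lt hK hs (show p.1.re < s from hp.1)
    have := three_lt_norm hp.2
    linarith⟩
  set E₁ := Efib ({()} : Finset Unit) (fun _ _ => 0) s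
  set h : ℂ × ℂ → ℝ → ℂ × ℂ := fun p t => (p.1, p.2 * ((1 + t / ‖p.2‖ : ℝ) : ℂ)) with hh
  have hT : ∀ t ∈ Icc (0:ℝ) 1, ∀ p ∈ Tfib s, h p t ∈ Tfib s := fun t ht p hp => ⟨hp.1,
    lt_of_lt_of_le hp.2 (im_mul_one_add (by have : 3 < p.2.im := hp.2; linarith) ht.1)⟩
  have hE₁ : ∀ p ∈ E₁, p.2 ≠ 0 := fun p hp => hp.2 () (by simp)
  have hc' : ∀ S : Set (ℂ × ℂ), (∀ p ∈ S, p.2 ≠ 0) →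
      ContinuousOn (fun x : (ℂ × ℂ) × ℝ => h x.1 x.2) (S ×ˢ Icc (0:ℝ) 1) := by
    intro S hS
    have hd : ContinuousOn (fun x : (ℂ × ℂ) × ℝ => x.2 / ‖x.1.2‖) (S ×ˢ Icc (0:ℝ) 1) :=
      ContinuousOn.div (by fun_prop) (by fun_prop) fun x hx => by
        simpa using hS _ hx.1
    refine ContinuousOn.prodMk (by fun_prop) ?_
    refine ContinuousOn.mul (by fun_prop) ?_
    exact Complex.continuous_ofReal.comp_continuousOn (continuousOn_const.add hd)
  have m1 : MapsTo (fun p => h p 1) E₁ (Out N K s) := fun p hp => ⟨hp.1, by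
    have h1 := norm_mul_one_add (hE₁ p hp) zero_le_one
    have h2 := mul_exp_lt hK hs (show p.1.re < s from hp.1)
    have h3 := norm_nonneg p.2
    simp only [hh]
    rw [h1]
    linarith⟩
  have c1 : ContinuousOn (fun p => h p 1) E₁ := by
    have : ContinuousOn (fun p : ℂ × ℂ => (p, (1:ℝ))) E₁ := by fun_prop
    exact (hc' E₁ hE₁).comp this fun p hp => ⟨hp, by simp⟩
  have hTE₁ : Tfib s ⊆ E₁ := fun p hp => ⟨hp.1, fun _ _ h0 => by
    have : 3 < p.2.im := hp.2
    rw [h0] at this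
    norm_num at this⟩
  obtain ⟨g, hg⟩ := (repr_single (ι := Unit) (i := ()) (y := fun _ _ => 0) (s := s)
    fun _ => rfl).exists_lift _ (hc.comp c1 m1 (fun p hp => hT 1 (by simp) p hp) hTE₁)
  have hOE : Out N K s ⊆ E₁ := fun p hp => ⟨hp.1, fun _ _ => (Out_subset hK.le hp).2⟩
  obtain ⟨b, hb, hbg⟩ := hc.1.homotopy (h := h) (hc' _ fun p hp => (Out_subset hK.le hp).2)
    (fun p hp t ht => ⟨hp.1, by
      simp only [hh]
      rw [norm_mul_one_add (Out_subset hK.le hp).2 ht.1]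
      have : K * Real.exp (N * p.1.re) < ‖p.2‖ := hp.2
      linarith [ht.1]⟩)
  have h0 : ∀ p, h p 0 = p := fun p => by simp [hh]
  simp only [h0] at hbg
  refine ⟨g (), REq.trans ⟨b, fun p hp => ?_, hbg⟩
    (((hg.mono hOE subset_rfl).symm).trans ?_)⟩
  · refine (hb p (hTO hp)).unique (Hol.one fun t ht => ?_)
    have hcont : ContinuousOn (h p) (Icc 0 1) := by
      have : ContinuousOn (fun t : ℝ => (p, t)) (Icc 0 1) := by fun_prop
      exact (hc' {p} (by
        rintro _ rfl; exact (Out_subset hK.le (hTO hp)).2)).comp this fun t ht => ⟨rfl, ht⟩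
    obtain ⟨M, hM, h1⟩ := hc.2 (h p t) (hT t ht p hp)
    exact ⟨h p ⁻¹' M, (hcont t ht).tendsto_nhdsWithin (fun r hr => hTO (hT r hr p hp)) hM,
      fun a ha d hd => h1 _ ha _ hd⟩
  · simp only [singleCoc, map_zpow, FreeGroup.lift_apply_of]
    exact REq.refl _

lemma isPreconnected_Out : IsPreconnected (Out N K s) := by
  have h1 : IsPreconnected ({ω : ℂ | ω.re < s} ×ˢ (Ioi (0:ℝ) ×ˢ (univ : Set ℝ))) :=
    ((convex_halfSpace_re_lt s).isPreconnected).prod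
      ((convex_Ioi 0).isPreconnected.prod isPreconnected_univ)
  by_cases hK : 0 ≤ K
  · convert h1.image (fun x : ℂ × ℝ × ℝ => ((x.1, ((K * Real.exp (N * x.1.re) + x.2.1 : ℝ) : ℂ) *
      exp (x.2.2 * I)) : ℂ × ℂ)) (by fun_prop) using 1
    ext p
    constructor
    · rintro ⟨hp1, hp2⟩
      have hp2 : K * Real.exp (N * p.1.re) < ‖p.2‖ := hp2
      refine ⟨(p.1, ‖p.2‖ - K * Real.exp (N * p.1.re), p.2.arg), ⟨hp1, by simpa using hp2,
        mem_univ _⟩, Prod.ext rfl ?_⟩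
      simp only [add_sub_cancel]
      exact Complex.norm_mul_exp_arg_mul_I _
    · rintro ⟨⟨ω, r, θ⟩, ⟨hω, hr, -⟩, rfl⟩
      have hr : 0 < r := hr
      have : 0 ≤ K * Real.exp (N * ω.re) := by positivity
      refine ⟨hω, ?_⟩
      simp only [norm_mul, Complex.norm_exp_ofReal_mul_I, Complex.norm_real, mul_one,
        Real.norm_eq_abs]
      rw [abs_of_nonneg (by linarith)]
      linarith
  · push Not at hK
    have h2 : Out N K s = {ω : ℂ | ω.re < s} ×ˢ univ := by
      ext p
      refine ⟨fun h => ⟨h.1, mem_univ _⟩, fun h => ⟨h.1, lt_of_lt_of_le ?_ (norm_nonneg _)⟩⟩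
      exact mul_neg_of_neg_of_pos hK (Real.exp_pos _)
    rw [h2]
    exact (convex_halfSpace_re_lt s).isPreconnected.prod isPreconnected_univ

/-- The image of `Tfib`, together with its closure over `x = 0`. -/
def TX (N : ℕ) (s : ℝ) : Set (ℂ × ℂ) := {p | ‖p.1‖ < Real.exp (N * s) ∧ 3 < p.2.im}

lemma Sheets.Tfib_subset_Out (h : Sheets N σ y s K) : Tfib s ⊆ Out N K s := fun p hp => ⟨hp.1, by
  have h1 := mul_exp_lt h.pos h.small (show p.1.re < s from hp.1)
  have h2 := three_lt_norm hp.2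
  linarith⟩

lemma Sheets.Out_subset_Efib (h : Sheets N σ y s K) : Out N K s ⊆ Efib Finset.univ y s :=
  fun p hp => ⟨hp.1, fun i _ hi => by
    have h1 := h.bound i p.1 hp.1
    have h2 : K * Real.exp (N * p.1.re) < ‖p.2‖ := hp.2
    rw [hi] at h2
    linarith⟩

lemma sh_mem_Out (k : ℤ) : MapsTo (sh N k) (Out N K s) (Out N K s) := fun p hp => by
  refine ⟨by rw [sh_fst_re]; exact hp.1, ?_⟩
  rw [sh_fst_re]
  exact hp.2

lemma Sheets.kx_re_lt (h : Sheets N σ y s K) (p : ℂ × ℂ) :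
    ‖(kx N p).1‖ < Real.exp (N * s) ↔ p.1.re < s := by
  have hN : (0:ℝ) < N := by exact_mod_cast h.one_le
  rw [norm_kx, Real.exp_lt_exp, mul_lt_mul_iff_right₀ hN]

lemma mem_Tfib_base (s : ℝ) : (((s - 1 : ℝ) : ℂ), 4 * I) ∈ Tfib s := by
  constructor <;> norm_num

lemma kx_mem_TX (hN : 1 ≤ N) : MapsTo (kx N) (Tfib s) (TX N s) := fun p hp => by
  refine ⟨?_, hp.2⟩
  rw [norm_kx, Real.exp_lt_exp, mul_lt_mul_iff_right₀ (by exact_mod_cast hN)]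
  exact hp.1

lemma Sheets.two_mul_lt (h : Sheets N σ y s K) {p : ℂ × ℂ} (hp : p ∈ TX N s) :
    2 * K * ‖p.1‖ < ‖p.2‖ := by
  have h1 : ‖p.1‖ < Real.exp (N * s) := hp.1
  have h2 := three_lt_norm hp.2
  have h3 := h.small
  have h4 := h.pos
  nlinarith

lemma Sheets.Xset_of_lt (h : Sheets N σ y s₀ K) {p : ℂ × ℂ}
    (hp : ‖p.1‖ < Real.exp (N * s)) (hp2 : K * ‖p.1‖ < ‖p.2‖) : p ∈ Xset N y s₀ s := by
  refine ⟨hp, ?_⟩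
  rintro (h0 | ⟨ω, hω, i, rfl⟩)
  · have : p = 0 := h0
    rw [this] at hp2
    simp at hp2
  · have := h.bound i ω hω
    rw [show exp (N * ω) = (kx N (ω, 0)).1 from rfl, norm_kx] at hp2
    dsimp only at hp2
    linarith

lemma Sheets.TX_subset (h : Sheets N σ y s₀ K) (hs : s ≤ s₀) : TX N s ⊆ Xset N y s₀ s :=
  fun p hp => h.Xset_of_lt hp.1 (by
    have := (h.anti hs).two_mul_lt hp
    have := h.pos
    have := norm_nonneg p.1
    nlinarith)

lemma snd_ne_zero_of_mem_Xset {p : ℂ × ℂ} (hp : p ∈ Xset N y s₀ s)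
    (h0 : p.1 = 0) : p.2 ≠ 0 := fun h1 => hp.2 (Or.inl (Prod.ext h0 h1))

lemma Xpun_mem_nhdsWithin {p : ℂ × ℂ} (h0 : p.1 ≠ 0) : Xpun N y s₀ s ∈ 𝓝[Xset N y s₀ s] p :=
  inter_mem self_mem_nhdsWithin
    (mem_nhdsWithin_of_mem_nhds ((isOpen_ne_fun continuous_fst continuous_const).mem_nhds h0))

lemma nhdsWithin_Xpun {p : ℂ × ℂ} (h0 : p.1 ≠ 0) :
    𝓝[Xpun N y s₀ s] p = 𝓝[Xset N y s₀ s] p :=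
  le_antisymm (nhdsWithin_mono p fun _ h => h.1) (nhdsWithin_le_iff.2 (Xpun_mem_nhdsWithin h0))

/-- Cocycles invariant under the deck transformation extend over the line `x = 0`. -/
lemma exists_extension (h : Sheets N σ y s₀ K) (hs : s ≤ s₀) {c : ℂ × ℂ → ℂ × ℂ → G}
    (hc : RCoc (Efib Finset.univ y s) (Tfib s) c)
    (hsh : REq (Efib Finset.univ y s) (Tfib s) c fun a d => c (sh N 1 a) (sh N 1 d)) :
    ∃ U : ℂ × ℂ → ℂ × ℂ → G, RCoc (Xset N y s₀ s) (TX N s) U ∧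
      REq (Efib Finset.univ y s) (Tfib s) c fun a d => U (kx N a) (kx N d) := by
  classical
  obtain ⟨d, hd, hg⟩ := hsh
  have hN := h.one_le
  have hss := h.anti hs
  obtain ⟨U, e, hU, he, heT, heU⟩ := LocCoc.descend_multiplier (X := Xpun N y s₀ s) hN hss.sh_mem
    (fun p hp => hp.2) (fun p => ⟨fun hp => (h.kx_mem_iff hs p).1 hp.1, fun hp => h.kx_mem hs hp⟩)
    sh_mem_Tfib hc.1 hd hg
  have hTO := hss.Tfib_subset_Out
  have hOE := hss.Out_subset_Efib
  obtain ⟨g, β, hβT, hβ⟩ := out_gauge hss.pos hss.small ⟨hc.1.mono hOE, hc.2.mono hOE⟩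
  have hβsh : ∀ p ∈ Out N K s, β (sh N 1 p) = (d p)⁻¹ * β p := by
    intro p hp
    have h1 := hβ.comp (continuous_sh (N := N) 1).continuousOn (sh_mem_Out 1)
    have h2 := (hg.mono hOE).symm.trans hβ
    refine Gauge.eqOn isPreconnected_Out h1 h2 (hTO (mem_Tfib_base s)) hp ?_
    rw [hd _ (mem_Tfib_base s), hβT _ (mem_Tfib_base s),
      hβT _ (sh_mem_Tfib 1 (mem_Tfib_base s)), inv_one, one_mul]
  set γ : ℂ × ℂ → G := fun p => (e p)⁻¹ * β p with hγ
  have hγsh : ∀ p ∈ Out N K s, γ (sh N 1 p) = γ p := fun p hp => by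
    simp only [hγ, he, hβsh p hp]
    group
  set XO : Set (ℂ × ℂ) := {p | (‖p.1‖ < Real.exp (N * s) ∧ p.1 ≠ 0) ∧ K * ‖p.1‖ < ‖p.2‖} with hXO
  have hkO : ∀ p, kx N p ∈ XO → p ∈ Out N K s := fun p hp => by
    refine ⟨(hss.kx_re_lt p).1 hp.1.1, ?_⟩
    have := hp.2
    rwa [norm_kx] at this
  have hγU : Gauge XO (fun p => γ (lg N p)) U fun a d => g ^ wnd a.2 d.2 :=
    Gauge.descend hN sh_mem_Out (fun p hp => hp.1.2) hkO
      ((heU.mono hOE).symm.trans hβ) hγsh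
  set b : ℂ × ℂ → G := fun p => if p ∈ XO then γ (lg N p) else 1 with hb
  set A : Set (ℂ × ℂ) := {p | 2 * K * ‖p.1‖ < ‖p.2‖} with hA
  have hAo : IsOpen A := isOpen_lt (by fun_prop) (by fun_prop)
  set U' : ℂ × ℂ → ℂ × ℂ → G := fun a d =>
    if a ∈ A ∧ d ∈ A then g ^ wnd a.2 d.2 else (b a)⁻¹ * U a d * b d with hU'
  have hXOo : IsOpen XO := by
    have h1 : IsOpen {p : ℂ × ℂ | ‖p.1‖ < Real.exp (N * s)} :=
      isOpen_lt (by fun_prop) (by fun_prop)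
    have h2 : IsOpen {p : ℂ × ℂ | p.1 ≠ 0} := isOpen_ne_fun (by fun_prop) (by fun_prop)
    have h3 : IsOpen {p : ℂ × ℂ | K * ‖p.1‖ < ‖p.2‖} := isOpen_lt (by fun_prop) (by fun_prop)
    exact (h1.inter h2).inter h3
  have hXOX : XO ⊆ Xpun N y s₀ s := fun p hp => ⟨h.Xset_of_lt hp.1.1 hp.2, hp.1.2⟩
  have hbU : Gauge (Xpun N y s₀ s) b U U' := by
    intro p hp
    by_cases hpO : p ∈ XO
    · obtain ⟨M, hM, h1⟩ := hγU p hpO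
      rw [hXOo.nhdsWithin_eq hpO] at hM
      refine ⟨M ∩ XO, mem_nhdsWithin_of_mem_nhds (inter_mem hM (hXOo.mem_nhds hpO)),
        fun a ha d hd => ?_⟩
      have := h1 a ha.1 d hd.1
      simp only [hU', hb, ha.2, hd.2, if_true, this, ite_self]
    · have hpB : ‖p.2‖ < 2 * K * ‖p.1‖ := by
        have h1 : ¬ K * ‖p.1‖ < ‖p.2‖ := fun hcon => hpO ⟨⟨hp.1.1, hp.2⟩, hcon⟩
        have h2 := norm_pos_iff.2 hp.2
        have h3 := h.pos
        nlinarith [mul_pos h3 h2]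
      refine ⟨{p | ‖p.2‖ < 2 * K * ‖p.1‖}, mem_nhdsWithin_of_mem_nhds
        ((isOpen_lt (by fun_prop) (by fun_prop)).mem_nhds hpB), fun a ha d hd => ?_⟩
      have ha : ‖a.2‖ < 2 * K * ‖a.1‖ := ha
      have : a ∉ A := fun hcon => ha.not_gt hcon
      simp [hU', this]
  refine ⟨U', ⟨fun p hp => ?_, fun p hp => ?_⟩, fun p => e p * b (kx N p), fun p hp => ?_, ?_⟩
  · by_cases h0 : p.1 = 0
    · have hp2 := snd_ne_zero_of_mem_Xset hp h0
      obtain ⟨M, hM, h1⟩ := wnd_loc hp2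
      have hpA : p ∈ A := by simpa [hA, h0] using hp2
      refine ⟨A ∩ Prod.snd ⁻¹' M, mem_nhdsWithin_of_mem_nhds (inter_mem (hAo.mem_nhds hpA)
        (continuousAt_snd hM)), fun a ha b hb d hd => ?_⟩
      simp only [hU', ha.1, hb.1, hd.1, and_self, if_true]
      rw [← zpow_add, h1 _ ha.2 _ hb.2 _ hd.2]
    · obtain ⟨M, hM, h1⟩ := hbU.locCoc hU p ⟨hp, h0⟩
      rw [nhdsWithin_Xpun h0] at hM
      exact ⟨M, hM, h1⟩
  · refine ⟨A ∩ {p | 3 < p.2.im}, mem_nhdsWithin_of_mem_nhds (inter_mem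
      (hAo.mem_nhds (hss.two_mul_lt hp)) ((isOpen_lt (by fun_prop) (by fun_prop)).mem_nhds hp.2)),
      fun a ha d hd => ?_⟩
    have ha2 : 3 < a.2.im := ha.2
    simp only [hU', ha.1, hd.1, and_self, if_true]
    rw [wnd, if_neg (by linarith), zpow_zero]
  · have hpO := hTO hp
    have hkp : kx N p ∈ XO := by
      refine ⟨⟨(hss.kx_re_lt p).2 hp.1, exp_ne_zero _⟩, ?_⟩
      rw [norm_kx]
      exact hpO.2
    obtain ⟨k, hk⟩ := exists_sh_of_kx_eq hN (p := lg N (kx N p)) (q := p)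
      (kx_lg hN (exp_ne_zero _))
    simp only [hb, hkp, if_true, hk]
    rw [sh_invariant sh_mem_Out hγsh k p hpO]
    simp [hγ, heT p hp, hβT p hp]
  · exact heU.trans (hbU.comp continuous_kx.continuousOn (h.kx_mem hs))

end Extension

section GaugeExtension

variable {G : Type*} [Group G]

lemma isPreconnected_punctured_ball (r : ℝ) : IsPreconnected {x : ℂ | x ≠ 0 ∧ ‖x‖ < r} := by
  rcases le_or_gt r 0 with hr | hr
  · convert isPreconnected_empty
    ext x
    have := norm_nonneg x
    simp only [ne_eq, mem_ofPred_eq, mem_empty_iff_false, iff_false, not_and, not_lt]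
    exact fun _ => hr.trans this
  · convert ((convex_halfSpace_re_lt (Real.log r)).isPreconnected.image exp
      Complex.continuous_exp.continuousOn) using 1
    ext x
    constructor
    · rintro ⟨h0, h1⟩
      refine ⟨Complex.log x, ?_, Complex.exp_log h0⟩
      change (Complex.log x).re < Real.log r
      rw [Complex.log_re]
      exact Real.log_lt_log (norm_pos_iff.2 h0) h1
    · rintro ⟨w, hw, rfl⟩
      have hw : w.re < Real.log r := hw
      refine ⟨exp_ne_zero _, ?_⟩
      rw [Complex.norm_exp, ← Real.exp_log hr]
      exact Real.exp_lt_exp.2 hw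

lemma frequently_fst_ne_zero (p : ℂ × ℂ) : (𝓝[{q : ℂ × ℂ | q.1 ≠ 0}] p).NeBot := by
  have h1 : {q : ℂ × ℂ | q.1 ≠ 0} = ({0}ᶜ : Set ℂ) ×ˢ univ := by ext; simp
  rw [← mem_closure_iff_nhdsWithin_neBot, h1, closure_prod_eq, (dense_compl_singleton 0).closure_eq]
  simp

/-- Gauge transformations extend over the line `x = 0`. -/
lemma Gauge.extend {X : Set (ℂ × ℂ)} (hX : ∀ p ∈ X, p.1 = 0 → X ∈ 𝓝 p)
    {b : ℂ × ℂ → G} {c c' : ℂ × ℂ → ℂ × ℂ → G} (hc : LocCoc X c) (hc' : LocCoc X c')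
    (h : Gauge {p ∈ X | p.1 ≠ 0} b c c') :
    ∃ b', Gauge X b' c c' ∧ ∀ p, p.1 ≠ 0 → b' p = b p := by
  classical
  have key : ∀ p ∈ X, p.1 = 0 → ∃ B : Set (ℂ × ℂ), IsOpen B ∧ p ∈ B ∧ B ⊆ X ∧
      (∀ x ∈ B, ∀ y ∈ B, ∀ z ∈ B, c x y * c y z = c x z ∧ c' x y * c' y z = c' x z) ∧
      ∀ q ∈ B, ∀ a ∈ B, ∀ d ∈ B, a.1 ≠ 0 → d.1 ≠ 0 →
        c q a * b a * (c' q a)⁻¹ = c q d * b d * (c' q d)⁻¹ := by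
    intro p hp h0
    obtain ⟨M, hM, h1⟩ := hc p hp
    obtain ⟨M', hM', h1'⟩ := hc' p hp
    have hn : X ∩ M ∩ M' ∈ 𝓝 p := by
      rw [nhdsWithin_eq_nhds.2 (hX p hp h0)] at hM hM'
      exact inter_mem (inter_mem (hX p hp h0) hM) hM'
    obtain ⟨ε, hε, hB⟩ := Metric.mem_nhds_iff.1 hn
    have hBe : ball p ε = {x : ℂ | ‖x‖ < ε} ×ˢ ball p.2 ε := by
      rw [← ball_prod_same, h0]
      congr 1
      ext; simp
    have hpc : IsPreconnected {q ∈ ball p ε | q.1 ≠ 0} := by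
      have : {q ∈ ball p ε | q.1 ≠ 0} =
          {x : ℂ | x ≠ 0 ∧ ‖x‖ < ε} ×ˢ ball p.2 ε := by
        rw [hBe]
        ext q
        exact ⟨fun hq => ⟨⟨hq.2, hq.1.1⟩, hq.1.2⟩, fun hq => ⟨⟨hq.1.2, hq.2⟩, hq.1.1⟩⟩
      rw [this]
      exact (isPreconnected_punctured_ball ε).prod (convex_ball _ _).isPreconnected
    refine ⟨ball p ε, Metric.isOpen_ball, Metric.mem_ball_self hε, fun q hq => (hB hq).1.1,
      fun x hx y hy z hz => ⟨h1 x (hB hx).1.2 y (hB hy).1.2 z (hB hz).1.2,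
        h1' x (hB hx).2 y (hB hy).2 z (hB hz).2⟩, fun q hq a ha d hd ha0 hd0 => ?_⟩
    have ha' : a ∈ {q ∈ ball p ε | q.1 ≠ 0} := ⟨ha, ha0⟩
    have hd' : d ∈ {q ∈ ball p ε | q.1 ≠ 0} := ⟨hd, hd0⟩
    refine const_of_locConst hpc (f := fun a => c q a * b a * (c' q a)⁻¹) (fun r hr => ?_) ha' hd'
    have hrX : r ∈ {p ∈ X | p.1 ≠ 0} := ⟨(hB hr.1).1.1, hr.2⟩
    obtain ⟨L, hL, h2⟩ := h r hrX
    have hsub : {q ∈ ball p ε | q.1 ≠ 0} ⊆ {p ∈ X | p.1 ≠ 0} :=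
      fun z hz => ⟨(hB hz.1).1.1, hz.2⟩
    refine ⟨{q ∈ ball p ε | q.1 ≠ 0} ∩ L, inter_mem self_mem_nhdsWithin
      (nhdsWithin_mono r hsub hL), fun z hz => ?_⟩
    have e1 := h2 z hz.2 r (mem_of_mem_nhdsWithin hrX hL)
    have hz1 : z ∈ ball p ε := hz.1.1
    have e2 := h1 q (hB hq).1.2 z (hB hz1).1.2 r (hB hr.1).1.2
    have e3 := h1' q (hB hq).2 z (hB hz1).2 r (hB hr.1).2
    rw [← e2, ← e3, e1]
    group
  have key2 : ∀ p ∈ X, p.1 = 0 → ∃ g : G, ∀ᶠ a in 𝓝[{q : ℂ × ℂ | q.1 ≠ 0}] p,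
      c p a * b a * (c' p a)⁻¹ = g := by
    intro p hp h0
    obtain ⟨B, hBo, hpB, hBX, -, h2⟩ := key p hp h0
    have hB : ∀ᶠ a in 𝓝[{q : ℂ × ℂ | q.1 ≠ 0}] p, a ∈ B ∧ a.1 ≠ 0 :=
      inter_mem (mem_nhdsWithin_of_mem_nhds (hBo.mem_nhds hpB)) self_mem_nhdsWithin
    have := frequently_fst_ne_zero p
    obtain ⟨a, ha⟩ := hB.exists
    exact ⟨_, hB.mono fun d hd => h2 p hpB d hd.1 a ha.1 hd.2 ha.2⟩
  choose! g hg using key2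
  set b' : ℂ × ℂ → G := fun p => if p.1 = 0 then g p else b p with hb'
  have key3 : ∀ p ∈ X, p.1 = 0 → ∃ B ∈ 𝓝 p, ∃ a, ∀ q ∈ B, ∀ r ∈ B,
      b' q = c q a * b a * (c' q a)⁻¹ ∧ c q r * c r a = c q a ∧ c' q r * c' r a = c' q a := by
    intro p hp h0
    obtain ⟨B, hBo, hpB, hBX, h1, h2⟩ := key p hp h0
    have hB : ∀ q ∈ B, ∀ᶠ a in 𝓝[{q : ℂ × ℂ | q.1 ≠ 0}] q, a ∈ B ∧ a.1 ≠ 0 := fun q hq =>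
      inter_mem (mem_nhdsWithin_of_mem_nhds (hBo.mem_nhds hq)) self_mem_nhdsWithin
    have := frequently_fst_ne_zero
    obtain ⟨a, ha⟩ := (hB p hpB).exists
    refine ⟨B, hBo.mem_nhds hpB, a, fun q hq r hr => ⟨?_, (h1 q hq r hr a ha.1).1,
      (h1 q hq r hr a ha.1).2⟩⟩
    by_cases hq0 : q.1 = 0
    · obtain ⟨d, hd, hd'⟩ := ((hB q hq).and (hg q (hBX hq) hq0)).exists
      simp only [hb', hq0, if_true]
      rw [← hd', h2 q hq d hd.1 a ha.1 hd.2 ha.2]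
    · simp only [hb', hq0, if_false]
      rw [h2 q hq a ha.1 q hq ha.2 hq0, hc.self (hBX hq), hc'.self (hBX hq)]
      simp
  refine ⟨b', fun p hp => ?_, fun p hp => by simp [hb', hp]⟩
  by_cases h0 : p.1 = 0
  · obtain ⟨B, hB, a, h1⟩ := key3 p hp h0
    refine ⟨B, mem_nhdsWithin_of_mem_nhds hB, fun q hq r hr => ?_⟩
    obtain ⟨e1, e2, e3⟩ := h1 q hq r hr
    obtain ⟨e4, -, -⟩ := h1 r hr r hr
    rw [e1, e4, ← e2, ← e3]
    group
  · obtain ⟨L, hL, h2⟩ := h p ⟨hp, h0⟩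
    have hS : {q : ℂ × ℂ | q.1 ≠ 0} ∈ 𝓝 p :=
      (isOpen_ne_fun continuous_fst continuous_const).mem_nhds h0
    have hL' : L ∈ 𝓝[X] p := by
      have : {p ∈ X | p.1 ≠ 0} ∈ 𝓝[X] p :=
        inter_mem self_mem_nhdsWithin (mem_nhdsWithin_of_mem_nhds hS)
      exact nhdsWithin_le_iff.2 this hL
    refine ⟨L ∩ {q | q.1 ≠ 0}, inter_mem hL' (mem_nhdsWithin_of_mem_nhds hS),
      fun q hq r hr => ?_⟩
    have hq0 : q.1 ≠ 0 := hq.2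
    have hr0 : r.1 ≠ 0 := hr.2
    simp only [hb', hq0, hr0, if_false]
    exact h2 q hq.1 r hr.1

end GaugeExtension

section Model

variable {G : Type} [Group G] {ι : Type} [Fintype ι] {N : ℕ} {σ : Equiv.Perm ι}
  {y : ι → ℂ → ℂ} {s s₀ K : ℝ} {u : ℂ × ℂ → ℂ × ℂ → FreeGroup ι} {b₁ : ι → FreeGroup ι}

/-- Gauge transformations of the complement of the sheets are determined by their values
near infinity. -/
lemma Sheets.eqOn_Efib (h : Sheets N σ y s K) {b b' : ℂ × ℂ → G} {c c' : ℂ × ℂ → ℂ × ℂ → G}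
    (hb : Gauge (Efib Finset.univ y s) b c c') (hb' : Gauge (Efib Finset.univ y s) b' c c')
    (hT : ∀ p ∈ Tfib s, b p = b' p) : ∀ p ∈ Efib Finset.univ y s, b p = b' p := by
  intro p hp
  have hF : IsPreconnected (range fun i => y i p.1)ᶜ :=
    ((finite_range _).countable.isPathConnected_compl_of_one_lt_rank
      (by rw [Complex.rank_real_complex]; norm_num)).isConnected.isPreconnected
  have hm : MapsTo (fun w : ℂ => (p.1, w)) (range fun i => y i p.1)ᶜ (Efib Finset.univ y s) :=
    fun w hw => ⟨hp.1, fun i _ hi => hw ⟨i, hi.symm⟩⟩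
  have hcont : ContinuousOn (fun w : ℂ => (p.1, w)) (range fun i => y i p.1)ᶜ := by fun_prop
  have h4 : 4 * I ∈ (range fun i => y i p.1)ᶜ := by
    rintro ⟨i, hi⟩
    have := h.norm_lt i hp.1
    simp only [] at hi
    rw [hi] at this
    norm_num at this
  have h5 : p.2 ∈ (range fun i => y i p.1)ᶜ := by
    rintro ⟨i, hi⟩
    exact hp.2 i (Finset.mem_univ _) hi.symm
  exact Gauge.eqOn hF (hb.comp hcont hm) (hb'.comp hcont hm) h4 h5
    (hT (p.1, 4 * I) ⟨hp.1, by norm_num⟩)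

/-- The group of the complement of a branch. -/
abbrev CurveGroup (b₁ : ι → FreeGroup ι) : Type :=
  PresentedGroup (range fun j => (of j)⁻¹ * b₁ j)

/-- The quotient map onto the group of the complement. -/
def curveProj (b₁ : ι → FreeGroup ι) : FreeGroup ι →* CurveGroup b₁ := PresentedGroup.mk _

lemma curveProj_surjective : Function.Surjective (curveProj b₁) := PresentedGroup.mk_surjective _

lemma curveProj_fix (w : FreeGroup ι) : curveProj b₁ (lift b₁ w) = curveProj b₁ w := by
  have : (curveProj b₁).comp (lift b₁) = curveProj b₁ := by
    ext j
    have h1 : curveProj b₁ ((of j)⁻¹ * b₁ j) = 1 := PresentedGroup.one_of_mem ⟨j, rfl⟩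
    rw [map_mul, map_inv, inv_mul_eq_one] at h1
    simp [h1]
  exact DFunLike.congr_fun this w

lemma exists_curve_hom {g : ι → G} (hg : ∀ j, lift g (b₁ j) = g j) :
    ∃ φ : CurveGroup b₁ →* G, ∀ w, φ (curveProj b₁ w) = lift g w := by
  refine ⟨PresentedGroup.toGroup (f := g) ?_, fun w => rfl⟩
  rintro _ ⟨j, rfl⟩
  simp [hg j]

/-- The sheets of a curve together with a universal cocycle and its monodromy. -/
structure Model (N : ℕ) (σ : Equiv.Perm ι) (y : ι → ℂ → ℂ) (s₀ K : ℝ)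
    (u : ℂ × ℂ → ℂ × ℂ → FreeGroup ι) (b₁ : ι → FreeGroup ι) : Prop where
  sheets : Sheets N σ y s₀ K
  repr : ∀ s ≤ s₀, Repr (Efib Finset.univ y s) (Tfib s) Finset.univ u
  mono : REq (Efib Finset.univ y s₀) (Tfib s₀) (fun a d => lift b₁ (u a d))
    fun a d => u (sh N 1 a) (sh N 1 d)

lemma Tfib_mono (hs : s ≤ s₀) : Tfib s ⊆ Tfib s₀ := fun _ hp => ⟨lt_of_lt_of_le hp.1 hs, hp.2⟩

/-- The universal cocycle on the complement of the curve. -/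
def Model.Univ (_ : Model N σ y s₀ K u b₁) (U : ℂ × ℂ → ℂ × ℂ → CurveGroup b₁) : Prop :=
  RCoc (Xset N y s₀ s₀) (TX N s₀) U ∧
    REq (Efib Finset.univ y s₀) (Tfib s₀) (fun a d => curveProj b₁ (u a d))
      fun a d => U (kx N a) (kx N d)

lemma Model.exists_univ (h : Model N σ y s₀ K u b₁) : ∃ U, h.Univ U := by
  refine exists_extension h.sheets le_rfl
    ⟨(h.repr s₀ le_rfl).rcoc.1.map _, (h.repr s₀ le_rfl).rcoc.2.map _⟩ ?_
  have := h.mono.map (curveProj b₁)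
  simpa only [curveProj_fix] using this

lemma Xset_mono (hN : 1 ≤ N) (hs : s ≤ s₀) {s₁ : ℝ} : Xset N y s₁ s ⊆ Xset N y s₁ s₀ :=
  fun p hp => ⟨hp.1.trans_le (Real.exp_le_exp.2 (by gcongr)), hp.2⟩

lemma isOpen_TX : IsOpen (TX N s) := by
  have h1 : IsOpen {p : ℂ × ℂ | ‖p.1‖ < Real.exp (N * s)} := isOpen_lt (by fun_prop) (by fun_prop)
  have h2 : IsOpen {p : ℂ × ℂ | 3 < p.2.im} := isOpen_lt (by fun_prop) (by fun_prop)
  exact h1.inter h2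

lemma convex_TX : Convex ℝ (TX N s) := by
  have h1 : TX N s = ball 0 (Real.exp (N * s)) ×ˢ {z : ℂ | 3 < z.im} := by
    ext; simp [TX]
  rw [h1]
  exact (convex_ball _ _).prod (convex_halfSpace_im_gt 3)

lemma zero_mem_TX : ((0 : ℂ), 4 * I) ∈ TX N s := by
  constructor
  · simpa using Real.exp_pos _
  · norm_num

lemma Sheets.Xset_mem_nhds (h : Sheets N σ y s₀ K) {p : ℂ × ℂ} (hp : p ∈ Xset N y s₀ s)
    (h0 : p.1 = 0) : Xset N y s₀ s ∈ 𝓝 p := by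
  have h1 : IsOpen {p : ℂ × ℂ | ‖p.1‖ < Real.exp (N * s)} := isOpen_lt (by fun_prop) (by fun_prop)
  have h3 : IsOpen {p : ℂ × ℂ | K * ‖p.1‖ < ‖p.2‖} := isOpen_lt (by fun_prop) (by fun_prop)
  refine mem_of_superset (inter_mem (h1.mem_nhds hp.1) (h3.mem_nhds ?_))
    fun q hq => h.Xset_of_lt hq.1 hq.2
  simpa [h0] using snd_ne_zero_of_mem_Xset hp h0

/-- Every cocycle on the complement of the curve is induced from the universal one. -/
lemma Model.exists_hom (h : Model N σ y s₀ K u b₁) {U} (hU : h.Univ U) (hs : s ≤ s₀)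
    {c : ℂ × ℂ → ℂ × ℂ → G} (hc : LocCoc (Xset N y s₀ s) c) :
    ∃ (φ : CurveGroup b₁ →* G) (b : ℂ × ℂ → G),
      Gauge (Xset N y s₀ s) b (fun p q => φ (U p q)) c := by
  classical
  have hN := h.sheets.one_le
  have hss := h.sheets.anti hs
  have hTX := h.sheets.TX_subset hs
  obtain ⟨b, hb⟩ := (hc.mono hTX).exists_gauge_of_star (convex_TX.starConvex zero_mem_TX)
  set b' : ℂ × ℂ → G := fun p => if p ∈ TX N s then (b p)⁻¹ else 1 with hb'
  set c₁ : ℂ × ℂ → ℂ × ℂ → G := fun p q => (b' p)⁻¹ * c p q * b' q with hc₁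
  have hg₁ : Gauge (Xset N y s₀ s) b' c c₁ := gauge_self _ _ _
  have hc₁L := hg₁.locCoc hc
  have hc₁T : TrivOn (Xset N y s₀ s) (TX N s) c₁ := by
    intro p hp
    obtain ⟨M, hM, h1⟩ := hb p hp
    rw [isOpen_TX.nhdsWithin_eq hp] at hM
    refine ⟨M ∩ TX N s, mem_nhdsWithin_of_mem_nhds (inter_mem hM (isOpen_TX.mem_nhds hp)),
      fun a ha d hd => ?_⟩
    simp only [hc₁, hb', ha.2, hd.2, if_true, h1 a ha.1 d hd.1]
    group
  have hkc := continuous_kx (N := N)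
  have hkm : MapsTo (kx N) (Efib Finset.univ y s) (Xset N y s₀ s) :=
    fun p hp => (h.sheets.kx_mem hs hp).1
  have hR := h.repr s hs
  obtain ⟨g, hg⟩ := hR.exists_lift _
    ⟨hc₁L.comp hkc.continuousOn hkm, hc₁T.comp hkc.continuousOn hkm (kx_mem_TX hN)
      (Tfib_subset_Efib hss.strands.bound)⟩
  have hgb : ∀ j, lift g (b₁ j) = g j := by
    have e1 := (h.mono.mono (Efib_anti hs) (Tfib_mono hs)).map (lift g)
    have e2 := hg.comp (continuous_sh (N := N) 1).continuousOn (hss.sh_mem 1) (sh_mem_Tfib 1)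
    simp only [kx_sh hN] at e2
    have e3 := (e1.trans e2).trans hg.symm
    simp only [lift_lift] at e3
    exact fun j => hR.unique _ _ e3 j (Finset.mem_univ _)
  obtain ⟨φ, hφ⟩ := exists_curve_hom hgb
  have e1 := (hU.2.mono (Efib_anti hs) (Tfib_mono hs)).map φ
  simp only [hφ] at e1
  obtain ⟨B, hBT, hB⟩ := e1.symm.trans hg
  have hBsh := hB.comp (continuous_sh (N := N) 1).continuousOn (hss.sh_mem 1)
  simp only [kx_sh hN] at hBsh
  have hBinv := hss.eqOn_Efib hBsh hB fun p hp => by rw [hBT p hp, hBT _ (sh_mem_Tfib 1 hp)]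
  have hd : Gauge {p ∈ Xset N y s₀ s | p.1 ≠ 0} (fun p => B (lg N p)) (fun p q => φ (U p q)) c₁ :=
    Gauge.descend hN hss.sh_mem (fun p hp => hp.2)
      (fun p hp => (h.sheets.kx_mem_iff hs p).1 hp.1) hB hBinv
  obtain ⟨B', hB', -⟩ := hd.extend (fun p => h.sheets.Xset_mem_nhds)
    ((hU.1.1.mono (Xset_mono hN hs)).map φ) hc₁L
  exact ⟨φ, _, hB'.trans hg₁.symm⟩

/-- A homomorphism is determined up to conjugation by the induced cocycle. -/
lemma Model.hom_unique (h : Model N σ y s₀ K u b₁) {U} (hU : h.Univ U) (hs : s ≤ s₀)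
    {φ φ' : CurveGroup b₁ →* G} {b : ℂ × ℂ → G}
    (hb : Gauge (Xset N y s₀ s) b (fun p q => φ (U p q)) fun p q => φ' (U p q)) :
    ∃ k : G, ∀ x, φ' x = k⁻¹ * φ x * k := by
  have hss := h.sheets.anti hs
  have hkm : MapsTo (kx N) (Efib Finset.univ y s) (Xset N y s₀ s) :=
    fun p hp => (h.sheets.kx_mem hs hp).1
  have hR := h.repr s hs
  obtain ⟨β, hβT, hβ⟩ := hU.2.mono (Efib_anti hs) (Tfib_mono hs)
  have e1 := ((hβ.map φ).trans (hb.comp continuous_kx.continuousOn hkm)).trans (hβ.map φ').symm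
  have hTE := (Tfib_subset_Efib hss.strands.bound)
  set B : ℂ × ℂ → G := fun p => φ (β p) * b (kx N p) * (φ' (β p))⁻¹
  set k := B (((s - 1 : ℝ) : ℂ), 4 * I)
  have hk : ∀ p ∈ Tfib s, B p = k := fun p hp => by
    exact Gauge.const_of_triv e1 (convex_Tfib s).isPreconnected hTE ((hR.rcoc.2.map _).map _)
      ((hR.rcoc.2.map _).map _) hp (mem_Tfib_base s)
  refine ⟨k, fun x => ?_⟩
  obtain ⟨w, rfl⟩ := curveProj_surjective x
  have e2 : REq (Efib Finset.univ y s) (Tfib s)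
      (fun a d => (k⁻¹ * φ (curveProj b₁ (u a d)) * k)) fun a d => φ' (curveProj b₁ (u a d)) := by
    refine ⟨fun p => k⁻¹ * B p, fun p hp => by
      change k⁻¹ * B p = 1
      rw [hk p hp, inv_mul_cancel], fun p hp => ?_⟩
    obtain ⟨M, hM, h1⟩ := e1 p hp
    refine ⟨M, hM, fun a ha d hd => ?_⟩
    rw [h1 a ha d hd]
    group
  have e3 : ∀ w, k⁻¹ * φ (curveProj b₁ w) * k =
      lift (fun i => k⁻¹ * φ (curveProj b₁ (of i)) * k) w := fun w => by
    have : ((MulAut.conj k⁻¹).toMonoidHom.comp (φ.comp (curveProj b₁))) =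
      lift (fun i => k⁻¹ * φ (curveProj b₁ (of i)) * k) := by ext; simp
    rw [← this]; simp
  have e4 : ∀ w, φ' (curveProj b₁ w) = lift (fun i => φ' (curveProj b₁ (of i))) w := fun w => by
    have : φ'.comp (curveProj b₁) = lift (fun i => φ' (curveProj b₁ (of i))) := by ext; simp
    rw [← this]; simp
  have e5 : REq (Efib Finset.univ y s) (Tfib s)
      (fun a d => lift (fun i => k⁻¹ * φ (curveProj b₁ (of i)) * k) (u a d))
      fun a d => lift (fun i => φ' (curveProj b₁ (of i))) (u a d) := by
    convert e2 using 3
    · exact (e3 _).symm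
    · exact (e4 _).symm
  rw [e3, e4]
  congr 2
  funext i
  exact (hR.unique _ _ e5 i (Finset.mem_univ _)).symm

end Model

section Monodromy
variable {G : Type} [Group G] {ι : Type} [Fintype ι] {N : ℕ} {σ : Equiv.Perm ι} {y : ι → ℂ → ℂ}
  {s s₀ K : ℝ} {u : ℂ × ℂ → ℂ × ℂ → FreeGroup ι} {b b₁ : ι → FreeGroup ι} {C : FreeGroup ι}

lemma Gauge.congr_right {P : Type*} [TopologicalSpace P] {E : Set P} {β : P → G} {c c' c'' : P → P → G}
    (h : Gauge E β c c') (he : ∀ a ∈ E, ∀ d ∈ E, c' a d = c'' a d) : Gauge E β c c'' := by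
  intro p hp
  obtain ⟨M, hM, h1⟩ := h p hp
  exact ⟨M ∩ E, inter_mem hM self_mem_nhdsWithin, fun a ha d hd => by
    rw [← he a ha.2 d hd.2, h1 a ha.1 d hd.1]⟩

lemma Gauge.const_mul_comm {H P : Type*} [CommGroup H] [TopologicalSpace P] {E : Set P} {β : P → H}
    {c c' : P → P → H} (h : Gauge E β c c') (k : H) : Gauge E (fun p => k * β p) c c' := by
  intro p hp
  obtain ⟨M, hM, h1⟩ := h p hp
  refine ⟨M, hM, fun a ha d hd => ?_⟩
  simp only [h1 a ha d hd, mul_inv_rev]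
  rw [mul_assoc _ k⁻¹, mul_assoc, mul_assoc, mul_left_comm _ k, mul_assoc k⁻¹, mul_inv_cancel_left]

lemma iterate_lift (b₁ : ι → FreeGroup ι) (k : ℕ) (w : FreeGroup ι) :
    (lift b₁)^[k] w = lift (fun i => (lift b₁)^[k] (of i)) w := by
  induction k with
  | zero => simpa using (lift_of_eq w).symm
  | succ k ih => simp only [Function.iterate_succ_apply', ih, map_lift]

lemma Model.iterate (h : Model N σ y s₀ K u b₁) (k : ℕ) :
    REq (Efib Finset.univ y s₀) (Tfib s₀) (fun a d => (lift b₁)^[k] (u a d))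
      fun a d => u (sh N k a) (sh N k d) := by
  induction k with
  | zero => simpa [sh_zero] using REq.refl _
  | succ k ih =>
    have e1 := ih.map (lift b₁)
    have e2 := h.mono.comp (continuous_sh (N := N) k).continuousOn (h.sheets.sh_mem k)
      (sh_mem_Tfib k)
    have e3 := e1.trans e2
    simp only [sh_sh] at e3
    simpa only [Function.iterate_succ_apply', Nat.cast_succ, add_comm] using e3

lemma sh_self (hN : 1 ≤ N) (p : ℂ × ℂ) : sh N N p = tau p := by
  have hN' : (N : ℂ) ≠ 0 := by exact_mod_cast (by lia : N ≠ 0)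
  simp only [sh, tau, Int.cast_natCast, Prod.mk.injEq, and_true]
  field_simp

lemma circ_mem (h : Sheets N σ y s K) {ω : ℂ} (hω : ω.re < s) (t : ℝ) :
    circ ω t ∈ Efib Finset.univ y s := circ_mem_Efib h.strands.bound hω t

lemma exists_model (h : Sheets N σ y s₀ K) (hg : ∀ s ≤ s₀, Good Finset.univ y s u C b) :
    ∃ b₁, Model N σ y s₀ K u b₁ ∧ lift b₁ C = C ∧ (∀ i, (lift b₁)^[N] (of i) = b i) ∧
      ∀ i j, lift (dl i) (b₁ j) = dl (σ i) j := by
  have g := hg s₀ le_rfl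
  have hTE := Tfib_subset_Efib h.strands.bound
  obtain ⟨b₁, hb₁⟩ := g.repr.exists_lift _
    ⟨g.repr.rcoc.1.comp (continuous_sh (N := N) 1).continuousOn (h.sh_mem 1),
      g.repr.rcoc.2.comp (continuous_sh (N := N) 1).continuousOn (h.sh_mem 1) (sh_mem_Tfib 1) hTE⟩
  have hM : Model N σ y s₀ K u b₁ := ⟨h, fun s hs => (hg s hs).repr, hb₁⟩
  refine ⟨b₁, hM, ?_, fun i => ?_, fun i j => ?_⟩
  · have hω : (((s₀ - 1 : ℝ) : ℂ)).re < s₀ := by simp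
    have h1 := (g.circ _ hω).map (lift b₁)
    have h2 := g.circ (((s₀ - 1 : ℝ) : ℂ) + (1 : ℤ) * (2 * π * I / N))
      ((sh_fst_re (N := N) 1 ((((s₀ - 1 : ℝ) : ℂ)), 0)).trans_lt hω)
    exact hb₁.hol_eq (continuous_circ _).continuousOn (fun t _ => circ_mem h hω t)
      (circ_mem_Tfib hω).1 (circ_mem_Tfib hω).2 h1 h2
  · have e1 := (hM.iterate N).trans (by simpa only [Int.cast_natCast, sh_self h.one_le] using g.tau)
    refine g.repr.unique (fun i => (lift b₁)^[N] (of i)) b ?_ i (Finset.mem_univ _)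
    convert e1 using 3
    exact (iterate_lift b₁ N _).symm
  · obtain ⟨β, hβ⟩ := g.wind i (Finset.mem_univ _)
    obtain ⟨β', hβ'⟩ := g.wind (σ i) (Finset.mem_univ _)
    obtain ⟨γ, -, hγ⟩ := hb₁.map (lift (dl i))
    have e1 := (hγ.trans ((hβ.comp (continuous_sh (N := N) 1).continuousOn
      (h.sh_mem 1)).congr_right fun a ha d hd => ?_)).trans hβ'.symm
    swap
    · have key : ∀ a ∈ Efib Finset.univ y s₀, (sh N 1 a).2 - y i (sh N 1 a).1 =
          a.2 - y (σ i) a.1 := fun a ha => by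
        rw [h.rot_int 1 i a ha.1, zpow_one]; rfl
      change wcoc (fun p : ℂ × ℂ => p.2 - y i p.1) (sh N 1 a) (sh N 1 d) =
        wcoc (fun p : ℂ × ℂ => p.2 - y (σ i) p.1) a d
      rw [wcoc, wcoc, key a ha, key d hd]
    simp only [lift_lift] at e1
    set B : ℂ × ℂ → Multiplicative ℤ := _
    change Gauge _ B _ _ at e1
    have hk : ∀ p ∈ Tfib s₀, B p = B (((s₀ - 1 : ℝ) : ℂ), 4 * I) := fun p hp =>
      Gauge.const_of_triv e1 (convex_Tfib s₀).isPreconnected hTE (g.repr.rcoc.2.map _)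
        (g.repr.rcoc.2.map _) hp (mem_Tfib_base s₀)
    refine g.repr.unique (fun j => lift (dl i) (b₁ j)) (dl (σ i)) ⟨fun p =>
      (B (((s₀ - 1 : ℝ) : ℂ), 4 * I))⁻¹ * B p, fun p hp => ?_, fun p hp => ?_⟩ j
      (Finset.mem_univ _)
    · change (B _)⁻¹ * B p = 1
      rw [hk p hp, inv_mul_cancel]
    · exact e1.const_mul_comm _ p hp

end Monodromy

section Germs

section Abstract
variable {P Q R : Type*} [TopologicalSpace P] [TopologicalSpace Q] [TopologicalSpace R]
  {o : P} {o' : Q} {o'' : R} {V : Set P} {V' : Set Q} {V'' : Set R} {Γ Γ' : Type} [Group Γ] [Group Γ']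
  {U : P → P → Γ} {U' : Q → Q → Γ'} {f : P → Q} {g : Q → P}

/-- A universal cocycle for the germ at `o` of the complement of `V`. -/
structure GRep (o : P) (V : Set P) (U : P → P → Γ) : Prop where
  loc : ∃ W ∈ 𝓝 o, LocCoc (W \ V) U
  exists_hom : ∀ {G : Type} [Group G] (c : P → P → G), ∀ W ∈ 𝓝 o, LocCoc (W \ V) c →
    ∃ φ : Γ →* G, ∃ b, ∃ W' ∈ 𝓝 o, Gauge (W' \ V) b (fun a d => φ (U a d)) c
  hom_unique : ∀ {G : Type} [Group G] (φ φ' : Γ →* G) (b : P → G), ∀ W ∈ 𝓝 o,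
    Gauge (W \ V) b (fun a d => φ (U a d)) (fun a d => φ' (U a d)) →
    ∃ k : G, ∀ x, φ' x = k⁻¹ * φ x * k

/-- A germ of continuous map compatible with the subsets `V` and `V'`. -/
def GMap (o : P) (V : Set P) (o' : Q) (V' : Set Q) (f : P → Q) : Prop :=
  f o = o' ∧ ∃ W ∈ 𝓝 o, ContinuousOn f W ∧ ∀ p ∈ W, f p ∈ V' ↔ p ∈ V

/-- A germ of homeomorphism of pairs, with inverse. -/
structure GHomeo (o : P) (V : Set P) (o' : Q) (V' : Set Q) (f : P → Q) (g : Q → P) : Prop where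
  map : GMap o V o' V' f
  inv : GMap o' V' o V g
  left : ∀ᶠ p in 𝓝 o, g (f p) = p
  right : ∀ᶠ p in 𝓝 o', f (g p) = p

lemma GHomeo.symm (h : GHomeo o V o' V' f g) : GHomeo o' V' o V g f :=
  ⟨h.inv, h.map, h.right, h.left⟩

lemma GMap.tendsto (h : GMap o V o' V' f) : Tendsto f (𝓝 o) (𝓝 o') := by
  obtain ⟨h0, W, hW, hc, -⟩ := h
  rw [← h0]
  exact hc.continuousAt hW

lemma GMap.exists_nhds (hf : GMap o V o' V' f) {W' : Set Q} (hW' : W' ∈ 𝓝 o') :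
    ∃ W ∈ 𝓝 o, ContinuousOn f (W \ V) ∧ MapsTo f (W \ V) (W' \ V') := by
  obtain ⟨W, hW, fc, fi⟩ := hf.2
  exact ⟨W ∩ f ⁻¹' W', inter_mem hW (hf.tendsto hW'),
    fc.mono (sdiff_subset.trans inter_subset_left),
    fun p hp => ⟨hp.1.2, fun h => hp.2 ((fi p hp.1.1).1 h)⟩⟩

/-- `a` is induced by the germ of continuous map `f`. -/
def Induced (o : P) (V : Set P) (U : P → P → Γ) (U' : Q → Q → Γ') (f : P → Q) (a : Γ →* Γ') : Prop :=
  ∃ b, ∃ W ∈ 𝓝 o, Gauge (W \ V) b (fun p q => a (U p q)) fun p q => U' (f p) (f q)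

lemma GRep.exists_induced (hU : GRep o V U) (hU' : GRep o' V' U') (hf : GMap o V o' V' f) :
    ∃ a : Γ →* Γ', Induced o V U U' f a := by
  obtain ⟨W', hW', hL⟩ := hU'.loc
  obtain ⟨W, hW, fc, fm⟩ := hf.exists_nhds hW'
  exact hU.exists_hom _ W hW (hL.comp fc fm)

lemma Induced.comp {Γ'' : Type} [Group Γ''] {U'' : R → R → Γ''} {f' : Q → R} {a : Γ →* Γ'}
    {a' : Γ' →* Γ''} (h : Induced o V U U' f a) (hf : GMap o V o' V' f)
    (h' : Induced o' V' U' U'' f' a') : Induced o V U U'' (fun p => f' (f p)) (a'.comp a) := by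
  obtain ⟨b, W, hW, hb⟩ := h
  obtain ⟨b', W', hW', hb'⟩ := h'
  obtain ⟨W₁, hW₁, fc, fm⟩ := hf.exists_nhds hW'
  refine ⟨_, W ∩ W₁, inter_mem hW hW₁, ((hb.map a').mono ?_).trans ((hb'.comp fc fm).mono ?_)⟩
  · exact sdiff_subset_sdiff_left inter_subset_left
  · exact sdiff_subset_sdiff_left inter_subset_right

lemma Induced.congr {f' : P → Q} {a : Γ →* Γ'} (h : Induced o V U U' f a)
    (hf : ∀ᶠ p in 𝓝 o, f p = f' p) : Induced o V U U' f' a := by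
  obtain ⟨b, W, hW, hb⟩ := h
  refine ⟨b, W ∩ {p | f p = f' p}, inter_mem hW hf, (hb.mono (sdiff_subset_sdiff_left
    inter_subset_left)).congr_right fun p hp q hq => ?_⟩
  have h1 : f p = f' p := hp.1.2
  have h2 : f q = f' q := hq.1.2
  rw [h1, h2]

lemma GRep.induced_unique (hU : GRep o V U) {a a' : Γ →* Γ'} (h : Induced o V U U' f a)
    (h' : Induced o V U U' f a') : ∃ k, ∀ x, a' x = k⁻¹ * a x * k := by
  obtain ⟨b, W, hW, hb⟩ := h
  obtain ⟨b', W', hW', hb'⟩ := h'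
  exact hU.hom_unique _ _ _ (W ∩ W') (inter_mem hW hW')
    ((hb.mono (sdiff_subset_sdiff_left inter_subset_left)).trans
      (hb'.mono (sdiff_subset_sdiff_left inter_subset_right)).symm)

lemma induced_id : Induced o V U U (fun p => p) (MonoidHom.id Γ) :=
  ⟨_, univ, univ_mem, Gauge.refl _ _⟩

/-- A homomorphism induced by a germ of homeomorphism is bijective. -/
lemma GRep.bijective (hU : GRep o V U) (hU' : GRep o' V' U') (h : GHomeo o V o' V' f g)
    {a : Γ →* Γ'} (ha : Induced o V U U' f a) : Function.Bijective a := by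
  obtain ⟨a', ha'⟩ := hU'.exists_induced hU h.inv
  obtain ⟨k, hk⟩ := hU.induced_unique induced_id ((ha.comp h.map ha').congr h.left)
  obtain ⟨k', hk'⟩ := hU'.induced_unique induced_id ((ha'.comp h.inv ha).congr h.right)
  constructor
  · rw [injective_iff_map_eq_one]
    intro x hx
    have := hk x
    simp only [MonoidHom.comp_apply, hx, map_one, MonoidHom.id_apply] at this
    have h1 : x = k * (k⁻¹ * x * k) * k⁻¹ := by group
    rw [h1, ← this]
    simp
  · intro x
    refine ⟨a' (k' * x * k'⁻¹), ?_⟩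
    have := hk' (k' * x * k'⁻¹)
    simp only [MonoidHom.comp_apply, MonoidHom.id_apply] at this
    rw [this]
    group

end Abstract

variable {G : Type} [Group G] {ι : Type} [Fintype ι] {N : ℕ} {σ : Equiv.Perm ι} {y : ι → ℂ → ℂ}
  {s s₀ K : ℝ} {u : ℂ × ℂ → ℂ × ℂ → FreeGroup ι} {b b₁ : ι → FreeGroup ι} {C : FreeGroup ι}

/-- The vertical retraction onto the tube of radius `ρ`. -/
def squeeze (ρ : ℝ) (p : ℂ × ℂ) (t : ℝ) : ℂ × ℂ :=
  (p.1, ((1 - t + t * (ρ / max ρ ‖p.2‖) : ℝ) : ℂ) * p.2)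

lemma squeeze_zero (ρ : ℝ) (p : ℂ × ℂ) : squeeze ρ p 0 = p := by simp [squeeze]

lemma squeeze_of_le {ρ : ℝ} (hρ : 0 < ρ) {p : ℂ × ℂ} (hp : ‖p.2‖ ≤ ρ) (t : ℝ) :
    squeeze ρ p t = p := by
  simp [squeeze, max_eq_left hp, div_self hρ.ne']

lemma continuous_squeeze {ρ : ℝ} (hρ : 0 < ρ) :
    Continuous fun x : (ℂ × ℂ) × ℝ => squeeze ρ x.1 x.2 := by
  have : ∀ x : (ℂ × ℂ) × ℝ, max ρ ‖x.1.2‖ ≠ 0 := fun x => (lt_max_of_lt_left hρ).ne'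
  unfold squeeze
  refine (by fun_prop : Continuous fun x : (ℂ × ℂ) × ℝ => x.1.1).prodMk (Continuous.mul ?_ (by fun_prop))
  refine Complex.continuous_ofReal.comp ((by fun_prop : Continuous fun x : (ℂ × ℂ) × ℝ => 1 - x.2).add ?_)
  refine Continuous.mul (by fun_prop) (Continuous.div (by fun_prop) (by fun_prop) this)

lemma norm_squeeze_snd {ρ : ℝ} (hρ : 0 < ρ) {p : ℂ × ℂ} (hp : ρ ≤ ‖p.2‖) {t : ℝ}
    (ht : t ∈ Icc (0:ℝ) 1) : ‖(squeeze ρ p t).2‖ = (1 - t) * ‖p.2‖ + t * ρ := by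
  have hp0 : 0 < ‖p.2‖ := hρ.trans_le hp
  have h1 : 0 ≤ 1 - t + t * (ρ / ‖p.2‖) :=
    add_nonneg (by linarith [ht.2]) (mul_nonneg ht.1 (by positivity))
  simp only [squeeze, norm_mul, Complex.norm_real, Real.norm_eq_abs, max_eq_right hp,
    abs_of_nonneg h1]
  field_simp

lemma Sheets.squeeze_mem (h : Sheets N σ y s₀ K) {ρ : ℝ} (hρ : K * Real.exp (N * s) ≤ ρ)
    {p : ℂ × ℂ} (hp : p ∈ Xset N y s₀ s) {t : ℝ} (ht : t ∈ Icc (0:ℝ) 1) :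
    squeeze ρ p t ∈ Xset N y s₀ s := by
  have hρ0 : 0 < ρ := (mul_pos h.pos (Real.exp_pos _)).trans_le hρ
  rcases le_total ‖p.2‖ ρ with h1 | h1
  · rwa [squeeze_of_le hρ0 h1]
  · refine h.Xset_of_lt hp.1 ?_
    rw [norm_squeeze_snd hρ0 h1 ht]
    have h2 : K * ‖p.1‖ < ρ := (mul_lt_mul_of_pos_left hp.1 h.pos).trans_le hρ
    change K * ‖p.1‖ < _
    nlinarith [ht.1, ht.2]

lemma Sheets.squeeze_one_norm {ρ : ℝ} (hρ : 0 < ρ) (p : ℂ × ℂ) : ‖(squeeze ρ p 1).2‖ ≤ ρ := by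
  rcases le_total ‖p.2‖ ρ with h1 | h1
  · rwa [squeeze_of_le hρ h1]
  · rw [norm_squeeze_snd hρ h1 (by simp)]
    simp

lemma cylinder_mem_nhds (N : ℕ) (s : ℝ) :
    {p : ℂ × ℂ | ‖p.1‖ < Real.exp (N * s)} ∈ 𝓝 (0 : ℂ × ℂ) := by
  have h1 : IsOpen {p : ℂ × ℂ | ‖p.1‖ < Real.exp (N * s)} := isOpen_lt (by fun_prop) (by fun_prop)
  exact h1.mem_nhds (show ‖(0 : ℂ)‖ < Real.exp (N * s) by simpa using Real.exp_pos _)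

lemma Sheets.exists_small (h : Sheets N σ y s₀ K) {ε : ℝ} (hε : 0 < ε) :
    ∃ s ≤ s₀, Real.exp (N * s) ≤ ε ∧ K * Real.exp (N * s) ≤ ε := by
  have hN : (0:ℝ) < N := by exact_mod_cast h.one_le
  have hN1 : (1:ℝ) ≤ N := by exact_mod_cast h.one_le
  have key : Tendsto (fun s : ℝ => Real.exp (N * s)) atBot (𝓝 0) :=
    Real.tendsto_exp_atBot.comp (tendsto_id.const_mul_atBot hN)
  have key' : Tendsto (fun s : ℝ => K * Real.exp (N * s)) atBot (𝓝 0) := by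
    simpa using key.const_mul K
  obtain ⟨s, h1, h2, h3⟩ := ((eventually_le_atBot s₀).and
    ((key.eventually (eventually_le_nhds hε)).and (key'.eventually (eventually_le_nhds hε)))).exists
  exact ⟨s, h1, h2, h3⟩

lemma Sheets.exists_squeeze (h : Sheets N σ y s₀ K) {W : Set (ℂ × ℂ)} (hW : W ∈ 𝓝 (0 : ℂ × ℂ)) :
    ∃ s ≤ s₀, ∃ ρ > 0, K * Real.exp (N * s) ≤ ρ ∧
      MapsTo (fun p => squeeze ρ p 1) (Xset N y s₀ s) (W \ Vset N y s₀) := by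
  obtain ⟨ε, hε, hεW⟩ := Metric.mem_nhds_iff.1 hW
  obtain ⟨s, hs, h1, h2⟩ := h.exists_small (half_pos hε)
  refine ⟨s, hs, ε / 2, half_pos hε, h2, fun p hp => ⟨hεW ?_, (h.squeeze_mem h2 hp (by simp)).2⟩⟩
  rw [mem_ball_zero_iff, Prod.norm_def, max_lt_iff]
  exact ⟨hp.1.trans_le (h1.trans (by linarith)), (Sheets.squeeze_one_norm (half_pos hε) p).trans_lt (by linarith)⟩

/-- The universal cocycle of a model represents the germ of the complement of the curve. -/
lemma Model.gRep (h : Model N σ y s₀ K u b₁) {U} (hU : h.Univ U) :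
    GRep 0 (Vset N y s₀) U where
  loc := ⟨_, cylinder_mem_nhds N s₀, hU.1.1⟩
  exists_hom c W hW hc := by
    obtain ⟨s, hs, ρ, hρ, hKρ, hm⟩ := h.sheets.exists_squeeze hW
    have hcont : Continuous fun p => squeeze ρ p 1 :=
      (continuous_squeeze hρ).comp (continuous_id.prodMk continuous_const)
    obtain ⟨φ, b, hb⟩ := h.exists_hom hU hs (hc.comp hcont.continuousOn hm)
    have h3 : {p : ℂ × ℂ | ‖p.2‖ < ρ} ∈ 𝓝 (0 : ℂ × ℂ) := by
      have h1 : IsOpen {p : ℂ × ℂ | ‖p.2‖ < ρ} := isOpen_lt (by fun_prop) (by fun_prop)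
      exact h1.mem_nhds (show ‖(0 : ℂ)‖ < ρ by simpa using hρ)
    refine ⟨φ, b, {p : ℂ × ℂ | ‖p.1‖ < Real.exp (N * s)} ∩ {p : ℂ × ℂ | ‖p.2‖ < ρ},
      inter_mem (cylinder_mem_nhds N s) h3,
      (hb.mono fun p hp => ⟨hp.1.1, hp.2⟩).congr_right fun p hp q hq => ?_⟩
    have hp2 : ‖p.2‖ < ρ := hp.1.2
    have hq2 : ‖q.2‖ < ρ := hq.1.2
    rw [squeeze_of_le hρ hp2.le, squeeze_of_le hρ hq2.le]
  hom_unique φ φ' b W hW hb := by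
    obtain ⟨s, hs, ρ, hρ, hKρ, hm⟩ := h.sheets.exists_squeeze hW
    have hcont : Continuous fun p => squeeze ρ p 1 :=
      (continuous_squeeze hρ).comp (continuous_id.prodMk continuous_const)
    obtain ⟨β, -, hβ⟩ := (hU.1.1.mono (Xset_mono h.sheets.one_le hs)).homotopy
      (E := Xset N y s₀ s) (h := squeeze ρ) (continuous_squeeze hρ).continuousOn
      fun p hp t ht => h.sheets.squeeze_mem hKρ hp ht
    simp only [squeeze_zero] at hβ
    exact h.hom_unique hU hs
      (((hβ.map φ).trans (hb.comp hcont.continuousOn hm)).trans (hβ.map φ').symm)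

end Germs

section BranchModel
variable {G : Type} [Group G] {ι : Type} [Fintype ι] {N : ℕ} {σ : Equiv.Perm ι} {y : ι → ℂ → ℂ}
  {s s₀ K : ℝ} {u : ℂ × ℂ → ℂ × ℂ → FreeGroup ι} {b b₁ : ι → FreeGroup ι} {C : FreeGroup ι}
  {g : ι → ℂ → ℂ}

/-- The algebraic data of the monodromy of a branch: `b₁` is the monodromy, `C` the big circle. -/
structure Monodromy (N : ℕ) (b₁ : ι → FreeGroup ι) (C : FreeGroup ι) : Prop where
  one_le : 1 ≤ N
  prod : ∃ l : List ι, l.Nodup ∧ (∀ i, i ∈ l) ∧ C = (l.map of).prod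
  fix : lift b₁ C = C
  iter : ∀ i, ∃ P ∈ Submonoid.closure (range (of (α := ι))),
    (lift b₁)^[N] (of i) = (P * C ^ (N + 1))⁻¹ * of i * (P * C ^ (N + 1))
  expo : ∀ j, lift (fun _ => Multiplicative.ofAdd (1:ℤ)) (b₁ j) = Multiplicative.ofAdd 1

/-- The topological model of a branch. -/
structure Branch (N : ℕ) (σ : Equiv.Perm ι) (y : ι → ℂ → ℂ) (s₀ K : ℝ)
    (u : ℂ × ℂ → ℂ × ℂ → FreeGroup ι) (b₁ : ι → FreeGroup ι) (C : FreeGroup ι) : Prop where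
  model : Model N σ y s₀ K u b₁
  mon : Monodromy N b₁ C
  hol_circ : ∀ ω : ℂ, ω.re < s₀ → Hol u (circ ω) C
  dl : ∀ i j, lift (dl i) (b₁ j) = dl (σ i) j
  trans : ∀ i j, ∃ k : ℕ, (σ ^ k) i = j

/-- A branch `x = ξ ^ N`, `y = ξ ^ N * g i ξ`, in Puiseux form. -/
structure Puiseux (N : ℕ) (σ : Equiv.Perm ι) (g : ι → ℂ → ℂ) : Prop where
  one_le : 1 ≤ N
  order : σ ^ N = 1
  trans : ∀ i j, ∃ k : ℕ, (σ ^ k) i = j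
  an : ∀ i, AnalyticAt ℂ (g i) 0
  rot : ∀ i, ∀ᶠ ξ in 𝓝[≠] 0, g i (ξ * exp (2 * π * I / N)) = g (σ i) ξ
  ne : ∀ i j, i ≠ j → ∀ᶠ ξ in 𝓝[≠] 0, g i ξ ≠ g j ξ

/-- The sheets of a branch in Puiseux form. -/
def sheet (N : ℕ) (g : ι → ℂ → ℂ) (i : ι) (ω : ℂ) : ℂ := exp ω ^ N * g i (exp ω)

lemma exp_rot (ω : ℂ) : exp (ω + 2 * π * I / N) =
    exp ω * exp (2 * π * I / N) := Complex.exp_add _ _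

lemma exp_rot_pow (hN : 1 ≤ N) : exp (2 * π * I / N) ^ N = 1 := by
  have hN' : (N : ℂ) ≠ 0 := by exact_mod_cast (by lia : N ≠ 0)
  rw [← Complex.exp_nat_mul, mul_div_cancel₀ _ hN', Complex.exp_two_pi_mul_I]

lemma exists_re_lt_fintype {p : ι → ℂ → Prop} (h : ∀ i, ∀ᶠ ξ in 𝓝[≠] 0, p i ξ) :
    ∃ s : ℝ, ∀ ω : ℂ, ω.re < s → ∀ i, p i (exp ω) := by
  obtain ⟨s, hs⟩ := exists_re_lt (eventually_all.2 h)
  exact ⟨s, hs⟩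

lemma Puiseux.exists_sheets (h : Puiseux N σ g) :
    ∃ s₁ K, ∀ s ≤ s₁, Sheets N σ (sheet N g) s K := by
  have e1 : ∀ i, ∀ᶠ ξ in 𝓝[≠] (0:ℂ), ‖g i ξ‖ < ‖g i 0‖ + 1 := fun i =>
    ((h.an i).continuousAt.norm.eventually (gt_mem_nhds (by simp))).filter_mono nhdsWithin_le_nhds
  have e2 : ∀ i, ∀ᶠ ξ in 𝓝[≠] (0:ℂ), AnalyticAt ℂ (g i) ξ := fun i =>
    (h.an i).eventually_analyticAt.filter_mono nhdsWithin_le_nhds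
  obtain ⟨s₁, h1⟩ := exists_re_lt_fintype e1
  obtain ⟨s₂, h2⟩ := exists_re_lt_fintype e2
  obtain ⟨s₃, h3⟩ := exists_re_lt_fintype h.rot
  set K : ℝ := ∑ i, (‖g i 0‖ + 1) + 1 with hK
  have hK0 : 0 < K := add_pos_of_nonneg_of_pos (Finset.sum_nonneg fun i _ => by positivity) one_pos
  have hN : (0:ℝ) < N := by exact_mod_cast h.one_le
  have key : Tendsto (fun s : ℝ => K * Real.exp (N * s)) atBot (𝓝 0) := by
    simpa using (Real.tendsto_exp_atBot.comp (tendsto_id.const_mul_atBot hN)).const_mul K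
  obtain ⟨s₄, h4⟩ := eventually_atBot.1 (key.eventually (eventually_le_nhds (half_pos one_pos)))
  refine ⟨min (min s₁ s₂) (min s₃ s₄), K, fun s hs => ?_⟩
  have hs1 : s ≤ s₁ := hs.trans ((min_le_left _ _).trans (min_le_left _ _))
  have hs2 : s ≤ s₂ := hs.trans ((min_le_left _ _).trans (min_le_right _ _))
  have hs3 : s ≤ s₃ := hs.trans ((min_le_right _ _).trans (min_le_left _ _))
  have hs4 : s ≤ s₄ := hs.trans ((min_le_right _ _).trans (min_le_right _ _))
  refine ⟨h.one_le, fun i ω hω => ?_, fun i ω hω => ?_, fun i ω hω => ?_, hK0, h4 s hs4, h.order⟩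
  · have := (h2 ω (hω.trans_le hs2) i).continuousAt
    have h5 : ContinuousAt (sheet N g i) ω := by
      unfold sheet
      exact (Complex.continuous_exp.continuousAt.pow N).mul
        (this.comp (f := exp) Complex.continuous_exp.continuousAt)
    exact h5.continuousWithinAt
  · rw [sheet, exp_rot, mul_pow, exp_rot_pow h.one_le, mul_one, h3 ω (hω.trans_le hs3) i, sheet]
  · have h5 : ‖g i (exp ω)‖ ≤ K := by
      have := Finset.single_le_sum (f := fun i => ‖g i 0‖ + 1) (fun i _ => by positivity)
        (Finset.mem_univ i)
      have h6 : ‖g i (exp ω)‖ < ‖g i 0‖ + 1 := h1 ω (hω.trans_le hs1) i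
      linarith
    rw [sheet, norm_mul, norm_pow, Complex.norm_exp, ← Real.exp_nat_mul, mul_comm]
    gcongr

lemma Puiseux.apply_zero (h : Puiseux N σ g) (i j : ι) : g i 0 = g j 0 := by
  have h1 : ∀ i, g i 0 = g (σ i) 0 := fun i => by
    have t1 : Tendsto (fun ξ => g i (ξ * exp (2 * π * I / N))) (𝓝[≠] 0) (𝓝 (g i 0)) := by
      have t2 : Tendsto (fun ξ : ℂ => ξ * exp (2 * π * I / N)) (𝓝[≠] 0) (𝓝 0) := by
        have : Continuous fun ξ : ℂ => ξ * exp (2 * π * I / N) := by fun_prop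
        simpa using (this.tendsto 0).mono_left nhdsWithin_le_nhds
      exact (h.an i).continuousAt.tendsto.comp t2
    exact tendsto_nhds_unique (t1.congr' (h.rot i))
      ((h.an (σ i)).continuousAt.tendsto.mono_left nhdsWithin_le_nhds)
  obtain ⟨k, rfl⟩ := h.trans i j
  induction k with
  | zero => simp
  | succ k ih => rw [ih, pow_succ', Equiv.Perm.mul_apply, ← h1]

lemma Puiseux.claimE [Nonempty ι] (h : Puiseux N σ g) : ClaimE Finset.univ (sheet N g) (N + 1) := by
  obtain ⟨i₀⟩ := ‹Nonempty ι›
  have hN : N ≠ 0 := by have := h.one_le; lia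
  refine Bundle.claimE (η := fun i ξ => ξ ^ N * g i ξ) ⟨i₀, Finset.mem_univ _⟩ ⟨fun i _ => ?_, fun i _ => ?_,
    fun i _ j _ hij => ?_⟩ (q := fun ξ => ξ ^ N * g i₀ 0) (W := fun i => dslope (g i) 0) (by lia)
    (by fun_prop) (by simp [hN]) (fun i _ => ?_) fun i _ => ?_
  · have := h.an i
    fun_prop
  · simp [hN]
  · filter_upwards [h.ne i j hij, self_mem_nhdsWithin] with ξ h1 h0 h2
    exact h1 (mul_left_cancel₀ (pow_ne_zero N h0) h2)
  · obtain ⟨p, hp⟩ := h.an i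
    exact ⟨_, hp.has_fpower_series_dslope_fslope⟩
  · refine Eventually.of_forall fun ξ => ?_
    have := sub_smul_dslope (g i) 0 ξ
    rw [sub_zero, smul_eq_mul] at this
    rw [pow_succ, mul_assoc, this, h.apply_zero i i₀]
    ring

lemma lift_eq_prod_dl {A : Type*} [CommGroup A] (e : ι → A) (w : FreeGroup ι) :
    lift e w = ∏ i, zpowersHom A (e i) (lift (dl i) w) := by
  classical
  have : lift e = ∏ i, (zpowersHom A (e i)).comp (lift (dl i)) := by
    ext j
    simp only [FreeGroup.lift_apply_of, MonoidHom.finsetProd_apply, MonoidHom.comp_apply, dl]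
    rw [Finset.prod_eq_single j]
    · simp
    · intro i _ hi
      simp [Ne.symm hi]
    · simp
  rw [this]
  simp

lemma lift_of_perm {A : Type*} [CommGroup A] (hd : ∀ i j, lift (dl i) (b₁ j) = dl (σ i) j)
    (e : ι → A) (i : ι) : lift e (b₁ (σ i)) = e i := by
  classical
  rw [lift_eq_prod_dl, Finset.prod_eq_single i]
  · simp [hd, dl]
  · intro j _ hj
    simp [hd, dl, Ne.symm hj]
  · simp

lemma Puiseux.exists_branch [Nonempty ι] (h : Puiseux N σ g) :
    ∃ s₁ K, ∀ s₀ ≤ s₁, ∃ u b₁ C, Branch N σ (sheet N g) s₀ K u b₁ C := by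
  obtain ⟨s₁, K, hs⟩ := h.exists_sheets
  obtain ⟨s₂, u, C, b, hg, ⟨l, hl, hl', hC⟩, hP⟩ := h.claimE
  refine ⟨min s₁ s₂, K, fun s₀ h0 => ?_⟩
  obtain ⟨b₁, hM, hfix, hit, hd⟩ := exists_model (hs s₀ (h0.trans (min_le_left _ _)))
    fun s h1 => hg s (h1.trans (h0.trans (min_le_right _ _)))
  refine ⟨u, b₁, C, hM, ⟨h.one_le, ⟨l, hl, fun i => (hl' i).2 (Finset.mem_univ _), hC⟩, hfix,
    fun i => ?_, fun j => ?_⟩, (hg s₀ (h0.trans (min_le_right _ _))).circ, hd, h.trans⟩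
  · obtain ⟨P, hP, h1⟩ := hP i (Finset.mem_univ _)
    exact ⟨P, hP, (hit i).trans h1⟩
  · have := lift_of_perm hd (fun _ => Multiplicative.ofAdd (1:ℤ)) (σ⁻¹ j)
    rwa [← Equiv.Perm.mul_apply, mul_inv_cancel, Equiv.Perm.one_apply] at this

/-- The total exponent on the group of the complement. -/
def IsExpo (b₁ : ι → FreeGroup ι) (α : CurveGroup b₁ →* Multiplicative ℤ) : Prop :=
  ∀ w, α (curveProj b₁ w) = lift (fun _ => Multiplicative.ofAdd 1) w

lemma Monodromy.exists_expo (h : Monodromy N b₁ C) : ∃ α, IsExpo b₁ α := exists_curve_hom h.expo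

lemma Branch.exists_zpow (h : Branch N σ y s₀ K u b₁ C) {α : CurveGroup b₁ →* Multiplicative ℤ}
    (hα : IsExpo b₁ α) (φ : CurveGroup b₁ →* Multiplicative ℤ) : ∃ n : ℤ, ∀ x, φ x = α x ^ n := by
  have h1 : ∀ i, φ (curveProj b₁ (of (σ i))) = φ (curveProj b₁ (of i)) := fun i => by
    have e1 := lift_of_perm h.dl (fun i => φ (curveProj b₁ (of i))) i
    rw [← e1, ← curveProj_fix, FreeGroup.lift_apply_of]
    have : φ.comp (curveProj b₁) = lift fun i => φ (curveProj b₁ (of i)) := by ext; simp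
    rw [← this]; rfl
  have h2 : ∀ i j, φ (curveProj b₁ (of i)) = φ (curveProj b₁ (of j)) := fun i j => by
    obtain ⟨k, rfl⟩ := h.trans i j
    induction k with
    | zero => simp
    | succ k ih => rw [ih, pow_succ', Equiv.Perm.mul_apply, h1]
  rcases isEmpty_or_nonempty ι with hι | ⟨⟨i₀⟩⟩
  · refine ⟨0, fun x => ?_⟩
    obtain ⟨w, rfl⟩ := curveProj_surjective x
    rw [Subsingleton.elim w 1]
    simp
  · refine ⟨(φ (curveProj b₁ (of i₀))).toAdd, fun x => ?_⟩
    obtain ⟨w, rfl⟩ := curveProj_surjective x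
    have : φ.comp (curveProj b₁) =
        (zpowGroupHom (φ (curveProj b₁ (of i₀))).toAdd).comp (α.comp (curveProj b₁)) := by
      ext i
      have hα' := hα (of i)
      simp only [MonoidHom.comp_apply, hα', FreeGroup.lift_apply_of, zpowGroupHom_apply]
      rw [← ofAdd_zsmul, h2 i i₀]
      simp
    exact DFunLike.congr_fun this w

lemma Hol.reverse {P : Type*} [TopologicalSpace P] {c : P → P → G} {γ : ℝ → P} {g : G}
    (h : Hol c γ g) : Hol c (fun t => γ (1 - t)) g⁻¹ := by
  obtain ⟨β, h0, h1, hβ⟩ := h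
  refine ⟨fun t => g⁻¹ * β (1 - t), by simp [h1], by simp [h0], Gauge.const_mul ?_ _⟩
  exact hβ.comp (γ := fun t : ℝ => 1 - t) (by fun_prop) fun t ht => ⟨by linarith [ht.2], by linarith [ht.1]⟩

/-- The circle in the base of the covering. -/
lemma Branch.hol_univ (h : Branch N σ y s₀ K u b₁ C) {U} (hU : h.model.Univ U) {ω : ℂ}
    (hω : ω.re < s₀) : Hol U (fun t => kx N (circ ω t)) (curveProj b₁ C) :=
  hU.2.hol (continuous_circ ω).continuousOn (fun t _ => circ_mem h.model.sheets hω t)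
    (circ_mem_Tfib hω).1 (circ_mem_Tfib hω).2 ((h.hol_circ ω hω).map (curveProj b₁))

lemma Monodromy.lift_one (h : Monodromy N b₁ C) :
    lift (fun _ => Multiplicative.ofAdd (1:ℤ)) C = Multiplicative.ofAdd (Fintype.card ι : ℤ) := by
  classical
  obtain ⟨l, hl, hl', rfl⟩ := h.prod
  have h1 : l.length = Fintype.card ι := by
    rw [← List.toFinset_card_of_nodup hl, ← Finset.card_univ]
    congr 1
    ext i
    simp [hl']
  rw [map_list_prod, List.map_map, ← h1]
  have : (⇑(lift fun _ : ι => Multiplicative.ofAdd (1:ℤ)) ∘ of) = fun _ => Multiplicative.ofAdd (1:ℤ) := by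
    ext; simp
  rw [this, List.map_const', List.prod_replicate, ← ofAdd_nsmul]
  simp

end BranchModel

section ConjugateBranch
open scoped ComplexConjugate
variable {ι ι' : Type} [Fintype ι] [Fintype ι'] {N N' : ℕ} {σ σ'' : Equiv.Perm ι}
  {σ' : Equiv.Perm ι'} {y y'' : ι → ℂ → ℂ} {s s' s₀ K K'' : ℝ}
  {u u'' : ℂ × ℂ → ℂ × ℂ → FreeGroup ι} {b₁ b₁'' : ι → FreeGroup ι} {C C'' : FreeGroup ι}
  {g : ι → ℂ → ℂ} {g' : ι' → ℂ → ℂ}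

/-- Complex conjugation, composed with a sign. -/
def flip (p : ℂ × ℂ) : ℂ × ℂ := (conj p.1, -conj p.2)

lemma flip_flip (p : ℂ × ℂ) : flip (flip p) = p := by simp [flip]

lemma continuous_flip : Continuous flip := by unfold flip; fun_prop

/-- The conjugate of a family of functions. -/
def cj (g : ι → ℂ → ℂ) (i : ι) (ξ : ℂ) : ℂ := -conj (g i (conj ξ))

lemma tendsto_conj_punctured : Tendsto (fun ξ : ℂ => conj ξ) (𝓝[≠] 0) (𝓝[≠] 0) := by
  refine tendsto_nhdsWithin_iff.2 ⟨?_, ?_⟩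
  · have : Continuous fun ξ : ℂ => conj ξ := by fun_prop
    simpa using (this.tendsto 0).mono_left nhdsWithin_le_nhds
  · filter_upwards [self_mem_nhdsWithin] with ξ hξ
    simpa using hξ

lemma analyticAt_conj_conj {f : ℂ → ℂ} (hf : AnalyticAt ℂ f 0) :
    AnalyticAt ℂ (fun ξ => conj (f (conj ξ))) 0 := by
  rw [Complex.analyticAt_iff_eventually_differentiableAt] at hf ⊢
  have : Tendsto (fun ξ : ℂ => conj ξ) (𝓝 0) (𝓝 0) := by
    have : Continuous fun ξ : ℂ => conj ξ := by fun_prop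
    simpa using (this.tendsto 0)
  filter_upwards [this.eventually hf] with ξ hξ
  have := DifferentiableAt.conj_conj hξ
  simpa [Function.comp_def] using this

lemma Puiseux.cj (h : Puiseux N σ g) : Puiseux N σ⁻¹ (cj g) where
  one_le := h.one_le
  order := by rw [inv_pow, h.order, inv_one]
  trans i j := by
    obtain ⟨k, rfl⟩ := h.trans j i
    exact ⟨k, by simp [← Equiv.Perm.mul_apply]⟩
  an i := (analyticAt_conj_conj (h.an i)).neg
  ne i j hij := by
    filter_upwards [tendsto_conj_punctured.eventually (h.ne i j hij)] with ξ h1 h2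
    simp only [BurauZariski.cj, neg_inj] at h2
    exact h1 ((starRingEnd ℂ).injective h2)
  rot i := by
    set ζ : ℂ := exp (2 * π * I / N) with hζ
    have hζ0 : ζ ≠ 0 := exp_ne_zero _
    have hc : conj ζ = ζ⁻¹ := by
      rw [hζ, ← Complex.exp_conj, ← Complex.exp_neg]
      congr 1
      simp [neg_div, map_ofNat]
    have t1 : Tendsto (fun ξ : ℂ => ξ * ζ⁻¹) (𝓝[≠] 0) (𝓝[≠] 0) := by
      refine tendsto_nhdsWithin_iff.2 ⟨?_, ?_⟩
      · have : Continuous fun ξ : ℂ => ξ * ζ⁻¹ := by fun_prop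
        simpa using (this.tendsto 0).mono_left nhdsWithin_le_nhds
      · filter_upwards [self_mem_nhdsWithin] with ξ hξ
        exact mul_ne_zero hξ (inv_ne_zero hζ0)
    filter_upwards [tendsto_conj_punctured.eventually (t1.eventually (h.rot (σ⁻¹ i)))] with ξ h1
    rw [← Equiv.Perm.mul_apply, mul_inv_cancel, Equiv.Perm.one_apply, inv_mul_cancel_right₀ hζ0] at h1
    simp only [BurauZariski.cj, map_mul, hc, h1]

lemma sheet_cj (i : ι) (ω : ℂ) : sheet N (cj g) i ω = -conj (sheet N g i (conj ω)) := by
  simp only [sheet, cj, map_mul, map_pow, ← Complex.exp_conj, Complex.conj_conj, mul_neg]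

lemma flip_mem_Vset (hy : ∀ i ω, y'' i ω = -conj (y i (conj ω))) {p : ℂ × ℂ}
    (hp : p ∈ Vset N y s) : flip p ∈ Vset N y'' s := by
  rcases hp with h0 | ⟨ω, hω, i, rfl⟩
  · left
    rw [show p = 0 from h0]
    simp [flip]
  · exact Or.inr ⟨conj ω, by simpa using hω, i, by simp [flip, hy, ← Complex.exp_conj]⟩

lemma flip_mem_Vset_iff (hy : ∀ i ω, y'' i ω = -conj (y i (conj ω))) (p : ℂ × ℂ) :
    flip p ∈ Vset N y'' s ↔ p ∈ Vset N y s := by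
  refine ⟨fun h => ?_, flip_mem_Vset hy⟩
  rw [← flip_flip p]
  exact flip_mem_Vset (fun i ω => by simp [hy]) h

lemma gHomeo_flip (hy : ∀ i ω, y'' i ω = -conj (y i (conj ω))) :
    GHomeo 0 (Vset N y s) 0 (Vset N y'' s) flip flip := by
  have h0 : flip 0 = 0 := by simp [flip]
  exact ⟨⟨h0, univ, univ_mem, continuous_flip.continuousOn, fun p _ => flip_mem_Vset_iff hy p⟩,
    ⟨h0, univ, univ_mem, continuous_flip.continuousOn,
      fun p _ => flip_mem_Vset_iff (fun i ω => by simp [hy]) p⟩,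
    Eventually.of_forall flip_flip, Eventually.of_forall flip_flip⟩

lemma flip_kx_circ (ω : ℂ) (t : ℝ) : flip (kx N (circ ω t)) = kx N (circ (conj ω) (1 - t)) := by
  have h1 : exp (2 * π * I * ((1 - t : ℝ) : ℂ)) =
      conj (exp (2 * π * I * t)) := by
    have : (2 * π * I * ((1 - t : ℝ) : ℂ)) = conj (2 * π * I * (t:ℂ)) + 2 * π * I := by
      simp [map_ofNat]; ring
    rw [this, Complex.exp_add, Complex.exp_two_pi_mul_I, mul_one, Complex.exp_conj]
  simp only [flip, kx, circ, h1, map_mul, Prod.mk.injEq, ← Complex.exp_conj]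
  simp [map_ofNat]

/-- Conjugation reverses the total exponent. -/
lemma Branch.flip_expo [Nonempty ι] (h : Branch N σ y s₀ K u b₁ C)
    (h'' : Branch N σ'' y'' s₀ K'' u'' b₁'' C'') (hy : ∀ i ω, y'' i ω = -conj (y i (conj ω)))
    {U U''} (hU : h.model.Univ U) (hU'' : h''.model.Univ U'') {a : CurveGroup b₁ →* CurveGroup b₁''}
    (ha : Induced 0 (Vset N y s₀) U U'' flip a) {α α''} (hα : IsExpo b₁ α) (hα'' : IsExpo b₁'' α'')
    (x) : α'' (a x) = (α x)⁻¹ := by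
  have hm : MapsTo flip (Xset N y s₀ s₀) (Xset N y'' s₀ s₀) := fun p hp =>
    ⟨by simpa [flip] using hp.1, fun h => hp.2 ((flip_mem_Vset_iff hy p).1 h)⟩
  obtain ⟨φ, b, hb⟩ := h.model.exists_hom hU le_rfl (hU''.1.1.comp continuous_flip.continuousOn hm)
  have hφ : Induced 0 (Vset N y s₀) U U'' flip φ := ⟨b, _, cylinder_mem_nhds N s₀, hb⟩
  obtain ⟨k, hk⟩ := (h.model.gRep hU).induced_unique ha hφ
  obtain ⟨n, hn⟩ := h.exists_zpow hα (α''.comp φ)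
  have e1 : ∀ x, α'' (φ x) = α'' (a x) := fun x => by
    rw [hk, map_mul, map_mul, map_inv, mul_comm, mul_inv_cancel_left]
  have hω : (((s₀ - 1 : ℝ) : ℂ)).re < s₀ := by simp
  have c1 := (h.hol_univ hU hω).map (α''.comp φ)
  have hc : ∀ t, kx N (circ (((s₀ - 1 : ℝ) : ℂ)) t) ∈ Xset N y s₀ s₀ := fun t =>
    (h.model.sheets.kx_mem le_rfl (circ_mem h.model.sheets hω t)).1
  have c2 := c1.gauge (hb.map α'') (continuous_kx.comp (continuous_circ _)).continuousOn
    fun t _ => hc t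
  have c3 := ((h''.hol_univ hU'' hω).map α'').reverse
  have e2 : ∀ t, flip (kx N (circ (((s₀ - 1 : ℝ) : ℂ)) t)) =
      kx N (circ (((s₀ - 1 : ℝ) : ℂ)) (1 - t)) := fun t => by
    rw [flip_kx_circ, Complex.conj_ofReal]
  obtain ⟨β, β0, β1, hβ⟩ := c2
  have c4 : Hol (fun a d => α'' (U'' a d)) (fun t => kx N (circ (((s₀ - 1 : ℝ) : ℂ)) (1 - t))) _ :=
    ⟨β, β0, β1, by simpa only [e2] using hβ⟩
  have e3 := c4.unique c3
  rw [circ_zero, circ_one, mul_comm, mul_inv_cancel_left, hn, hα, hα'', h.mon.lift_one,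
    h''.mon.lift_one, ← ofAdd_zsmul, ← ofAdd_neg] at e3
  have e4 : n * (Fintype.card ι : ℤ) = -(Fintype.card ι : ℤ) := by
    simpa using Multiplicative.ofAdd.injective e3
  have e5 : n = -1 := by
    have : (Fintype.card ι : ℤ) ≠ 0 := by exact_mod_cast Fintype.card_ne_zero
    exact mul_right_cancel₀ this (by rw [e4]; ring)
  rw [← e1]
  have := hn x
  rw [e5, zpow_neg_one] at this
  exact this

lemma eventually_Vset_iff (N : ℕ) (hN : 1 ≤ N) (y : ι → ℂ → ℂ) (s s' : ℝ) :
    ∀ᶠ p in 𝓝 (0 : ℂ × ℂ), p ∈ Vset N y s ↔ p ∈ Vset N y s' := by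
  have key : ∀ s s' : ℝ, ∀ p : ℂ × ℂ, ‖p.1‖ < Real.exp (N * s') → p ∈ Vset N y s → p ∈ Vset N y s' := by
    rintro s s' p hp (h0 | ⟨ω, hω, i, rfl⟩)
    · exact Or.inl h0
    · refine Or.inr ⟨ω, ?_, i, rfl⟩
      have hN' : (0:ℝ) < N := by exact_mod_cast hN
      have h1 := norm_kx (N := N) (ω, y i ω)
      rw [kx] at h1
      rw [h1, Real.exp_lt_exp, mul_lt_mul_iff_right₀ hN'] at hp
      exact hp
  filter_upwards [cylinder_mem_nhds N s, cylinder_mem_nhds N s'] with p h1 h2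
  exact ⟨key _ _ p h2, key _ _ p h1⟩

lemma GMap.congr {P Q : Type*} [TopologicalSpace P] [TopologicalSpace Q] {o : P} {o' : Q}
    {V V₁ : Set P} {V' V₁' : Set Q} {f : P → Q} (h : GMap o V o' V' f)
    (hV : ∀ᶠ p in 𝓝 o, p ∈ V ↔ p ∈ V₁) (hV' : ∀ᶠ p in 𝓝 o', p ∈ V' ↔ p ∈ V₁') :
    GMap o V₁ o' V₁' f := by
  obtain ⟨W, hW, fc, fi⟩ := h.2
  refine ⟨h.1, W ∩ ({p | p ∈ V ↔ p ∈ V₁} ∩ {p | f p ∈ V' ↔ f p ∈ V₁'}),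
    inter_mem hW (inter_mem hV (h.tendsto.eventually hV')), fc.mono inter_subset_left, fun p hp => ?_⟩
  have h1 : p ∈ V ↔ p ∈ V₁ := hp.2.1
  have h2 : f p ∈ V' ↔ f p ∈ V₁' := hp.2.2
  rw [← h1, ← h2, fi p hp.1]

lemma GHomeo.congr {P Q : Type*} [TopologicalSpace P] [TopologicalSpace Q] {o : P} {o' : Q}
    {V V₁ : Set P} {V' V₁' : Set Q} {f : P → Q} {g : Q → P} (h : GHomeo o V o' V' f g)
    (hV : ∀ᶠ p in 𝓝 o, p ∈ V ↔ p ∈ V₁) (hV' : ∀ᶠ p in 𝓝 o', p ∈ V' ↔ p ∈ V₁') :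
    GHomeo o V₁ o' V₁' f g :=
  ⟨h.map.congr hV hV', h.inv.congr hV' hV, h.left, h.right⟩

/-- An isomorphism between the groups of the complements, compatible with the total exponents. -/
def MonIso (b₁ : ι → FreeGroup ι) (b₁' : ι' → FreeGroup ι') : Prop :=
  ∃ a : CurveGroup b₁ →* CurveGroup b₁', Function.Bijective a ∧
    ∀ α α', IsExpo b₁ α → IsExpo b₁' α' → ∀ x, α' (a x) = α x

/-- Homeomorphic branches have isomorphic groups, compatibly with the total exponents. -/
theorem Puiseux.exists_iso [Nonempty ι] [Nonempty ι'] (h : Puiseux N σ g) (h' : Puiseux N' σ' g')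
    {f f' : ℂ × ℂ → ℂ × ℂ}
    (hf : GHomeo 0 (Vset N (sheet N g) s) 0 (Vset N' (sheet N' g') s') f f') :
    ∃ (b₁ : ι → FreeGroup ι) (C : FreeGroup ι) (b₁' : ι' → FreeGroup ι') (C' : FreeGroup ι'),
      Monodromy N b₁ C ∧ Monodromy N' b₁' C' ∧ MonIso b₁ b₁' := by
  obtain ⟨s₁, K, hs₁⟩ := h.exists_branch
  obtain ⟨s₂, K', hs₂⟩ := h'.exists_branch
  obtain ⟨s₃, K'', hs₃⟩ := h'.cj.exists_branch
  set r := min s₁ (min s₂ s₃)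
  obtain ⟨u, b₁, C, hB⟩ := hs₁ r (min_le_left _ _)
  obtain ⟨u', b₁', C', hB'⟩ := hs₂ r ((min_le_right _ _).trans (min_le_left _ _))
  obtain ⟨u'', b₁'', C'', hB''⟩ := hs₃ r ((min_le_right _ _).trans (min_le_right _ _))
  have hfr := hf.congr (eventually_Vset_iff N h.one_le _ s r) (eventually_Vset_iff N' h'.one_le _ s' r)
  obtain ⟨U, hU⟩ := hB.model.exists_univ
  obtain ⟨U', hU'⟩ := hB'.model.exists_univ
  obtain ⟨U'', hU''⟩ := hB''.model.exists_univ
  have R := hB.model.gRep hU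
  have R' := hB'.model.gRep hU'
  have R'' := hB''.model.gRep hU''
  obtain ⟨α, hα⟩ := hB.mon.exists_expo
  obtain ⟨α', hα'⟩ := hB'.mon.exists_expo
  obtain ⟨α'', hα''⟩ := hB''.mon.exists_expo
  have uniq : ∀ {ι : Type} [Fintype ι] {b : ι → FreeGroup ι} {α β : CurveGroup b →* Multiplicative ℤ},
      IsExpo b α → IsExpo b β → α = β := fun h1 h2 => by
    refine DFunLike.ext _ _ fun x => ?_
    obtain ⟨w, rfl⟩ := curveProj_surjective x
    rw [h1, h2]
  obtain ⟨a, ha⟩ := R.exists_induced R' hfr.map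
  have hbij := R.bijective R' hfr ha
  obtain ⟨n, hn⟩ := hB.exists_zpow hα (α'.comp a)
  have hflip : GHomeo 0 (Vset N' (sheet N' g') r) 0 (Vset N' (sheet N' (BurauZariski.cj g')) r) flip flip :=
    gHomeo_flip sheet_cj
  obtain ⟨d, hd⟩ := R'.exists_induced R'' hflip.map
  have hd' := hB'.flip_expo hB'' sheet_cj hU' hU'' hd hα' hα''
  have hn1 : n = 1 ∨ n = -1 := by
    obtain ⟨i₀⟩ := ‹Nonempty ι'›
    obtain ⟨x, hx⟩ := hbij.2 (curveProj b₁' (of i₀))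
    have := hn x
    simp only [MonoidHom.comp_apply, hx, hα' (of i₀), FreeGroup.lift_apply_of] at this
    have h1 : (1:ℤ) = n * (α x).toAdd := by
      have := congrArg Multiplicative.toAdd this
      simpa using this
    exact Int.eq_one_or_neg_one_of_mul_eq_one h1.symm
  rcases hn1 with rfl | rfl
  · refine ⟨b₁, C, b₁', C', hB.mon, hB'.mon, a, hbij, fun β β' hβ hβ' x => ?_⟩
    rw [uniq hβ hα, uniq hβ' hα']
    simpa using hn x
  · refine ⟨b₁, C, b₁'', C'', hB.mon, hB''.mon, d.comp a, (R'.bijective R'' hflip hd).comp hbij,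
      fun β β' hβ hβ' x => ?_⟩
    rw [uniq hβ hα, uniq hβ' hα'']
    have := hn x
    simp only [MonoidHom.comp_apply, zpow_neg_one] at this ⊢
    rw [hd', this, inv_inv]

end ConjugateBranch

section Fox
open LaurentPolynomial (T)
open Matrix
variable {ι ι' : Type} [Fintype ι] [Fintype ι'] [DecidableEq ι] [DecidableEq ι']
  {M M' : Type} [AddCommGroup M] [AddCommGroup M']

/-- Laurent polynomials with rational coefficients. -/
abbrev Lau := LaurentPolynomial ℚ

variable [Module Lau M] [Module Lau M'] {b b₁ : ι → FreeGroup ι} {b₁' : ι' → FreeGroup ι'}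

/-- Pairs of a total exponent and a value; homomorphisms into this group are crossed homomorphisms. -/
@[ext] structure Cross (M : Type) where
  /-- the exponent -/
  deg : ℤ
  /-- the value -/
  val : M

namespace Cross

instance : Mul (Cross M) := ⟨fun p q => ⟨p.deg + q.deg, (T q.deg : Lau) • p.val + q.val⟩⟩
instance : One (Cross M) := ⟨⟨0, 0⟩⟩
instance : Inv (Cross M) := ⟨fun p => ⟨-p.deg, -((T (-p.deg) : Lau) • p.val)⟩⟩

@[simp] lemma mul_deg (p q : Cross M) : (p * q).deg = p.deg + q.deg := rfl
@[simp] lemma mul_val (p q : Cross M) : (p * q).val = (T q.deg : Lau) • p.val + q.val := rfl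
@[simp] lemma one_deg : (1 : Cross M).deg = 0 := rfl
@[simp] lemma one_val : (1 : Cross M).val = 0 := rfl
@[simp] lemma inv_deg (p : Cross M) : p⁻¹.deg = -p.deg := rfl
@[simp] lemma inv_val (p : Cross M) : p⁻¹.val = -((T (-p.deg) : Lau) • p.val) := rfl

instance : Group (Cross M) where
  mul_assoc p q r := by
    ext
    · simp [add_assoc]
    · simp only [mul_val, mul_deg, smul_add, smul_smul, ← LaurentPolynomial.T_add, add_assoc,
        add_comm r.deg]
  one_mul p := by ext <;> simp
  mul_one p := by ext <;> simp
  inv_mul_cancel p := by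
    ext
    · simp
    · simp only [mul_val, inv_val, smul_neg, smul_smul, ← LaurentPolynomial.T_add, add_neg_cancel,
        LaurentPolynomial.T_zero, one_smul, neg_add_cancel, one_val]

/-- Change of coefficients. -/
def map (L : M →ₗ[Lau] M') : Cross M →* Cross M' where
  toFun p := ⟨p.deg, L p.val⟩
  map_one' := by ext <;> simp
  map_mul' p q := by ext <;> simp

@[simp] lemma map_deg (L : M →ₗ[Lau] M') (p : Cross M) : (map L p).deg = p.deg := rfl
@[simp] lemma map_val (L : M →ₗ[Lau] M') (p : Cross M) : (map L p).val = L p.val := rfl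

variable (M) in
/-- The total exponent. -/
def degHom : Cross M →* Multiplicative ℤ where
  toFun p := Multiplicative.ofAdd p.deg
  map_one' := rfl
  map_mul' _ _ := rfl

end Cross

/-- The crossed homomorphism with given values on the generators. -/
def cross (z : ι → M) : FreeGroup ι →* Cross M := lift fun i => ⟨1, z i⟩

@[simp] lemma cross_of (z : ι → M) (i : ι) : cross z (of i) = ⟨1, z i⟩ := by simp [cross]

/-- The total exponent of a word. -/
def wexp (w : FreeGroup ι) : ℤ := (lift (fun _ : ι => Multiplicative.ofAdd (1:ℤ)) w).toAdd

lemma cross_deg (z : ι → M) (w : FreeGroup ι) : (cross z w).deg = wexp w := by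
  have : (Cross.degHom M).comp (cross z) = lift fun _ : ι => Multiplicative.ofAdd (1:ℤ) := by
    ext i; simp [Cross.degHom]
  rw [wexp, ← this]
  rfl

lemma expo_mul (v w : FreeGroup ι) : wexp (v * w) = wexp v + wexp w := by simp [wexp]
@[simp] lemma expo_of (i : ι) : wexp (of i) = 1 := by simp [wexp]
@[simp] lemma expo_one : wexp (1 : FreeGroup ι) = 0 := by simp [wexp]

/-- The Fox derivatives of a word. -/
def fox (w : FreeGroup ι) : ι → Lau := (cross (fun i => (Pi.single i 1 : ι → Lau)) w).val

lemma cross_val (z : ι → M) (w : FreeGroup ι) : (cross z w).val = ∑ i, fox w i • z i := by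
  have : (Cross.map (Fintype.linearCombination Lau z)).comp
      (cross fun i => (Pi.single i 1 : ι → Lau)) = cross z := by
    ext i
    · simp
    · simp
  rw [← this, fox]
  simp [Fintype.linearCombination_apply]

/-- The Fox matrix of a family of words. -/
def foxMat (b : ι' → FreeGroup ι) : Matrix ι' ι Lau := fun j => fox (b j)

lemma fox_mul (v w : FreeGroup ι) (i : ι) : fox (v * w) i = T (wexp w) * fox v i + fox w i := by
  simp [fox, cross_deg]

lemma fox_of (j : ι) : fox (of j) = Pi.single j 1 := by simp [fox]

@[simp] lemma fox_one : fox (1 : FreeGroup ι) = 0 := by simp [fox]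

lemma cross_comp {b : ι' → FreeGroup ι} (hb : ∀ j, wexp (b j) = 1) (z : ι → M) (w : FreeGroup ι') :
    cross z (lift b w) = cross (fun j => (cross z (b j)).val) w := by
  have : (cross z).comp (lift b) = cross (fun j => (cross z (b j)).val) := by
    ext j
    · simp [cross_deg, hb]
    · simp
  rw [← this]; rfl

lemma fox_lift {b : ι' → FreeGroup ι} (hb : ∀ j, wexp (b j) = 1) (w : FreeGroup ι') :
    fox (lift b w) = fox w ᵥ* foxMat b := by
  ext i
  rw [fox, cross_comp hb, cross_val, Matrix.vecMul, dotProduct, Finset.sum_apply]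
  rfl

lemma fox_iterate (hb : ∀ j, wexp (b j) = 1) (n : ℕ) :
    foxMat (fun i => (lift b)^[n] (of i)) = foxMat b ^ n := by
  induction n with
  | zero =>
    ext i j
    simp [foxMat, fox_of, Matrix.one_apply, Pi.single_apply, eq_comm]
  | succ n ih =>
    rw [pow_succ, ← ih]
    ext i j
    simp only [foxMat, Function.iterate_succ_apply', fox_lift hb]
    rfl

/-- The value on a word of the constant crossed homomorphism. -/
lemma sum_fox_mul (w : FreeGroup ι) : (∑ i, fox w i) * (T 1 - 1) = T (wexp w) - 1 := by
  induction w using FreeGroup.induction_on with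
  | C1 => simp
  | of i => simp [fox_of]
  | inv_of i _ =>
    have h1 : ∀ j, T 1 * fox (of i)⁻¹ j + fox (of i) j = 0 := fun j => by
      rw [← expo_of i, ← fox_mul]; simp
    have h2 : T 1 * (∑ j, fox (of i)⁻¹ j) + 1 = 0 := by
      have := Finset.sum_congr rfl fun j (_ : j ∈ Finset.univ) => h1 j
      rw [Finset.sum_add_distrib, ← Finset.mul_sum] at this
      simpa [fox_of] using this
    have h3 : T (-1) * T 1 = (1 : Lau) := by rw [← LaurentPolynomial.T_add]; simp
    have h4 : wexp (of i)⁻¹ = -1 := by simp [wexp]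
    rw [h4]
    linear_combination (T (-1) * (T 1 - 1)) * h2 - (T 1 - 1) * (∑ j, fox (of i)⁻¹ j) * h3 - h3
  | mul v w hv hw =>
    simp only [fox_mul, expo_mul, Finset.sum_add_distrib, ← Finset.mul_sum, LaurentPolynomial.T_add]
    linear_combination T (wexp w) * hv + hw

lemma T_sub_one_ne : (T 1 - 1 : Lau) ≠ 0 := by
  rw [sub_ne_zero]
  intro h
  rw [← LaurentPolynomial.T_zero] at h
  have := congrArg (fun p : Lau => p.coeff 1) h
  simp only [LaurentPolynomial.T_apply] at this
  norm_num at this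

lemma sum_fox_of_expo {w : FreeGroup ι} (hw : wexp w = 1) : ∑ i, fox w i = 1 :=
  mul_right_cancel₀ T_sub_one_ne (by rw [sum_fox_mul, hw, one_mul])

end Fox

section MatrixAlgebra
open LaurentPolynomial (T)
open Matrix
variable {R : Type} [CommRing R] {ι ι' κ : Type} [Fintype ι] [Fintype ι'] [Fintype κ] [DecidableEq ι]
  [DecidableEq ι']

/-- Two square presentations of the same module have the same determinant up to divisibility. -/
lemma det_dvd_det {P : Matrix ι ι R} {Q : Matrix ι' ι' R} {X : Matrix ι ι' R} {Y : Matrix ι' ι R}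
    {S : Matrix ι' ι R} {A : Matrix ι ι R} (h1 : X * Y = 1 + A * P) (h2 : Q * Y = S * P) :
    P.det ∣ Q.det := by
  have h : fromBlocks 1 (-X) 0 Q = fromBlocks (-A) (-X) S Q * fromBlocks P 0 (-Y) 1 := by
    rw [fromBlocks_multiply]
    simp [h1, h2]
  have h3 := congrArg det h
  rw [det_mul, det_fromBlocks_zero₂₁, det_fromBlocks_zero₁₂] at h3
  simp only [det_one, one_mul, mul_one] at h3
  exact ⟨_, by rw [h3, mul_comm]⟩

/-- If the equations `E z = 0` follow from `Q z = 0` in all modules then they are combinations. -/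
lemma exists_mul_of_forall {Q : Matrix ι' ι' R} {E : Matrix κ ι' R}
    (h : ∀ (M : Type) [AddCommGroup M] [Module R M] (z : ι' → M),
      (∀ j, ∑ k, Q j k • z k = 0) → ∀ i, ∑ k, E i k • z k = 0) : ∃ S : Matrix κ ι' R, E = S * Q := by
  set V : Submodule R (ι' → R) := LinearMap.range Q.vecMulLinear with hV
  have key := h ((ι' → R) ⧸ V) fun k => V.mkQ (Pi.single k 1)
  have h1 : ∀ v : ι' → R, ∑ k, v k • V.mkQ (Pi.single k 1) = V.mkQ v := fun v => by
    simp only [← map_smul, ← map_sum]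
    congr 1
    ext j
    simp [Finset.sum_apply, Pi.single_apply]
  have h2 : ∀ i, ∃ w : ι' → R, w ᵥ* Q = E i := fun i => by
    have := key (fun j => by
      rw [h1, Submodule.mkQ_apply, Submodule.Quotient.mk_eq_zero]
      exact ⟨Pi.single j 1, by rw [vecMulLinear_apply, single_one_vecMul]; rfl⟩) i
    rw [h1, Submodule.mkQ_apply, Submodule.Quotient.mk_eq_zero] at this
    exact this
  choose S hS using h2
  refine ⟨S, ?_⟩
  ext i j
  rw [← hS i]
  rfl

lemma det_updateCol_one (c : ι → R) (i : ι) : (updateCol (1 : Matrix ι ι R) i c).det = c i := by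
  rw [← cramer_apply, cramer_one]; rfl

lemma det_updateRow_one (c : ι → R) (i : ι) : (updateRow (1 : Matrix ι ι R) i c).det = c i := by
  rw [← det_transpose, ← updateCol_transpose, transpose_one, det_updateCol_one]

lemma det_one_sub_restrict [IsDomain R] {B : Matrix ι ι R} {l : ι → R} {j₀ : ι} (hB : B *ᵥ 1 = 1)
    (hl : l ᵥ* B = l) (h0 : l j₀ = 1) :
    (1 - B * (1 - vecMulVec (Pi.single j₀ 1) l)).det =
      (∑ i, l i) * (updateRow (1 - B) j₀ (Pi.single j₀ 1)).det := by
  have e : ∀ i j, (1 - B * (1 - vecMulVec (Pi.single j₀ 1) l)) i j = (1 - B) i j + B i j₀ * l j := by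
    intro i j
    rw [mul_sub, mul_one, mul_vecMulVec]
    simp [vecMulVec_apply]
    ring
  have h1 : updateRow 1 j₀ l * (1 - B * (1 - vecMulVec (Pi.single j₀ 1) l)) =
      updateCol 1 j₀ (fun i => if i = j₀ then 1 else B i j₀) * updateRow (1 - B) j₀ l := by
    ext i j
    have hr : (updateCol 1 j₀ (fun i => if i = j₀ then 1 else B i j₀) * updateRow (1 - B) j₀ l) i j =
        if i = j₀ then l j else (1 - B) i j + B i j₀ * l j := by
      rw [mul_apply, ← Finset.add_sum_erase _ _ (Finset.mem_univ j₀)]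
      have : ∑ k ∈ Finset.univ.erase j₀, (updateCol (1 : Matrix ι ι R) j₀
          (fun i => if i = j₀ then 1 else B i j₀)) i k * (updateRow (1 - B) j₀ l) k j =
          if i = j₀ then 0 else (1 - B) i j := by
        rw [Finset.sum_congr rfl (g := fun k => if k = i then (1 - B) i j else 0)]
        · rw [Finset.sum_ite_eq']; simp
        · intro k hk
          have hk : k ≠ j₀ := by simpa using hk
          rw [updateCol_ne hk, updateRow_ne hk, one_apply]
          rcases eq_or_ne k i with rfl | h <;> simp [*, Ne.symm]
      rw [this, updateCol_self, updateRow_self]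
      split_ifs <;> simp [add_comm]
    rw [hr, mul_apply]
    simp only [e]
    split_ifs with h
    · subst h
      simp only [updateRow_self, mul_add, Finset.sum_add_distrib]
      have h2 : ∑ k, l k * (1 - B) k j = 0 := by
        have : (l ᵥ* (1 - B)) j = 0 := by rw [vecMul_sub, hl, vecMul_one, sub_self]; rfl
        exact this
      have h3 : ∑ k, l k * B k i = 1 := by
        have := congrFun hl i
        rw [h0] at this
        exact this
      simp only [h2, ← mul_assoc, ← Finset.sum_mul, h3, zero_add, one_mul]
    · simp only [updateRow_ne h, one_apply, ite_mul, one_mul, zero_mul]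
      simp
  have h2 := congrArg det h1
  rw [det_mul, det_mul, det_updateRow_one, det_updateCol_one, h0, if_pos rfl, one_mul, one_mul] at h2
  rw [h2]
  have h3 : (updateRow (1 - B) j₀ (l - (∑ i, l i) • Pi.single j₀ 1)).det = 0 := by
    rw [← exists_mulVec_eq_zero_iff]
    refine ⟨1, fun h => one_ne_zero (congrFun h j₀), ?_⟩
    ext i
    rcases eq_or_ne i j₀ with rfl | h
    · simp [mulVec, dotProduct, Pi.single_apply]
    · have : ((1 - B) *ᵥ 1) i = 0 := by rw [sub_mulVec, hB, one_mulVec, sub_self]; rfl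
      simpa [mulVec, updateRow_ne h] using this
  have h4 : l = (l - (∑ i, l i) • Pi.single j₀ 1) + (∑ i, l i) • Pi.single j₀ 1 := by simp
  conv_lhs => rw [h4]
  rw [det_updateRow_add, h3, zero_add, det_updateRow_smul]

end MatrixAlgebra

section Gauss
open LaurentPolynomial (T)
open Polynomial (X C toLaurent evalRingHom)
open Matrix
variable {ι : Type} [Fintype ι] [DecidableEq ι]

lemma exists_polynomial_lift (G : Polynomial Lau) :
    ∃ (n : ℕ) (G' : Polynomial (Polynomial ℚ)), G'.map toLaurent = C (T n) * G := by
  induction G using Polynomial.induction_on' with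
  | add p q hp hq =>
    obtain ⟨n, p', hp'⟩ := hp
    obtain ⟨k, q', hq'⟩ := hq
    refine ⟨n + k, C (X ^ k) * p' + C (X ^ n) * q', ?_⟩
    simp only [Polynomial.map_add, Polynomial.map_mul, Polynomial.map_C, hp', hq',
      Polynomial.toLaurent_X_pow, Nat.cast_add, LaurentPolynomial.T_add, map_mul]
    ring
  | monomial k a =>
    obtain ⟨n, a', ha'⟩ := a.exists_T_pow
    refine ⟨n, Polynomial.monomial k a', ?_⟩
    rw [Polynomial.map_monomial, ha', Polynomial.C_mul_monomial, mul_comm]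

lemma exists_of_map_eval_eq_zero {G : Polynomial (Polynomial ℚ)} (h : G.map (evalRingHom 0) = 0) :
    ∃ G', G = C X * G' := by
  refine Polynomial.C_dvd_iff_dvd_coeff _ _ |>.2 fun i => ?_
  rw [Polynomial.X_dvd_iff, Polynomial.coeff_zero_eq_eval_zero]
  have := congrArg (fun p => p.coeff i) h
  simpa using this

lemma exists_primitive_lift {G : Polynomial Lau} (hG : G.coeff 0 = 1) :
    ∃ (n : ℕ) (G' : Polynomial (Polynomial ℚ)), G'.map toLaurent = C (T n) * G ∧
      G'.map (evalRingHom 0) ≠ 0 := by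
  classical
  have hex := exists_polynomial_lift G
  obtain ⟨G', hG'⟩ := Nat.find_spec hex
  refine ⟨Nat.find hex, G', hG', fun h0 => ?_⟩
  obtain ⟨G₁, rfl⟩ := exists_of_map_eval_eq_zero h0
  rcases hn : Nat.find hex with _ | n
  · rw [hn] at hG'
    have h1 := congrArg (fun p => p.coeff 0) hG'
    simp only [Nat.cast_zero, LaurentPolynomial.T_zero, map_one, one_mul, hG, Polynomial.coeff_map] at h1
    rw [← map_one (toLaurent (R := ℚ)), Polynomial.toLaurent_inj] at h1
    have := congrArg (Polynomial.eval 0) h1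
    simp at this
  · refine Nat.find_min hex (m := n) (by lia) ⟨G₁, ?_⟩
    rw [hn, Polynomial.map_mul, Polynomial.map_C, Polynomial.toLaurent_X, Nat.cast_add,
      LaurentPolynomial.T_add, mul_comm (T (n:ℤ)), map_mul, mul_assoc] at hG'
    rw [Nat.cast_one] at hG'
    refine mul_left_cancel₀ ?_ hG'
    rw [Ne, Polynomial.C_eq_zero]
    exact (LaurentPolynomial.isUnit_T 1).ne_zero

/-- A form of the Gauss lemma at the prime `t`. -/
lemma exists_lift_of_mul_eq {F : Polynomial (Polynomial ℚ)} {G H : Polynomial Lau}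
    (hF : F.map (evalRingHom 0) = 1) (hFG : F.map toLaurent = G * H) (hG : G.coeff 0 = 1)
    (hH : H.coeff 0 = 1) :
    ∃ G' : Polynomial (Polynomial ℚ), G'.map toLaurent = G ∧ G'.map (evalRingHom 0) = 1 := by
  obtain ⟨n, G', hG', hG0⟩ := exists_primitive_lift hG
  obtain ⟨k, H', hH', hH0⟩ := exists_primitive_lift hH
  have inj : Function.Injective (Polynomial.map (toLaurent (R := ℚ))) :=
    Polynomial.map_injective _ Polynomial.toLaurent_injective
  have h1 : G' * H' = C (X ^ (n + k)) * F := by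
    apply inj
    rw [Polynomial.map_mul, Polynomial.map_mul, Polynomial.map_C, hG', hH', hFG,
      Polynomial.toLaurent_X_pow, Nat.cast_add, LaurentPolynomial.T_add, map_mul]
    ring
  have h2 := congrArg (Polynomial.map (evalRingHom (0:ℚ))) h1
  rw [Polynomial.map_mul, Polynomial.map_mul, hF, mul_one, Polynomial.map_C] at h2
  have h3 : n + k = 0 := by
    by_contra h
    rw [map_pow, Polynomial.coe_evalRingHom, Polynomial.eval_X, zero_pow h, map_zero] at h2
    exact (mul_eq_zero.1 h2).elim hG0 hH0
  obtain ⟨rfl, rfl⟩ : n = 0 ∧ k = 0 := by lia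
  simp only [Nat.cast_zero, LaurentPolynomial.T_zero, map_one, one_mul, add_zero, pow_zero] at hG' h2
  refine ⟨G', hG', ?_⟩
  have hu : IsUnit (G'.map (evalRingHom (0:ℚ))) := IsUnit.of_mul_eq_one _ h2
  obtain ⟨c, -, hc⟩ := Polynomial.isUnit_iff.1 hu
  have h4 : G'.coeff 0 = 1 := by
    apply Polynomial.toLaurent_injective
    rw [← Polynomial.coeff_map, hG', hG, map_one]
  have h5 := congrArg (fun p => p.coeff 0) hc
  simp [h4] at h5
  rw [← hc, h5, map_one]

lemma det_one_sub_of_nilpotent {N : ℕ} (hN : 1 ≤ N) {E : Matrix ι ι Lau}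
    {S : Matrix ι ι (Polynomial ℚ)} (hE : E ^ N = (T 1 : Lau) • S.map toLaurent) (m : ℕ) :
    ∃ a : Polynomial ℚ, (1 - (T m : Lau) • E).det = toLaurent (1 + X ^ (m + 1) * a) := by
  set Z : Matrix ι ι (Polynomial Lau) := (X : Polynomial Lau) • E.map C with hZ
  have hZN : Z ^ N = (X ^ N * C (T 1) : Polynomial Lau) • (S.map toLaurent).map C := by
    rw [hZ, smul_pow, ← Matrix.map_pow, hE, mul_smul]
    congr 1
    refine Matrix.ext fun i j => ?_
    rw [Matrix.map_apply, Matrix.smul_apply, Matrix.smul_apply, Matrix.map_apply, smul_eq_mul,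
      smul_eq_mul, map_mul]
    rfl
  set F : Polynomial (Polynomial ℚ) :=
    (1 - (X ^ N * C X : Polynomial (Polynomial ℚ)) • S.map C).det with hF
  have hF0 : F.map (evalRingHom 0) = 1 := by
    rw [hF, ← Polynomial.coe_mapRingHom, RingHom.map_det]
    convert det_one (n := ι) (R := Polynomial ℚ)
    ext i j
    simp [Matrix.one_apply, apply_ite]
  have hF1 : F.map toLaurent = (1 - Z ^ N).det := by
    rw [hF, ← Polynomial.coe_mapRingHom, RingHom.map_det, hZN]
    congr 1
    ext i j
    simp [Matrix.one_apply, apply_ite]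
  rw [← mul_neg_geom_sum, det_mul] at hF1
  have h0 : ∀ A : Matrix ι ι (Polynomial Lau), A.det.coeff 0 = (A.map (Polynomial.eval 0)).det := by
    intro A
    rw [Polynomial.coeff_zero_eq_eval_zero, ← Polynomial.coe_evalRingHom, RingHom.map_det]
    rfl
  have hZ0 : (evalRingHom (0:Lau)).mapMatrix Z = 0 := by
    ext i j
    simp [hZ]
  obtain ⟨G', hG', hG0⟩ := exists_lift_of_mul_eq hF0 hF1
    (by
      rw [Polynomial.coeff_zero_eq_eval_zero, ← Polynomial.coe_evalRingHom, RingHom.map_det, map_sub,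
        hZ0, map_one, sub_zero, det_one])
    (by
      rw [Polynomial.coeff_zero_eq_eval_zero, ← Polynomial.coe_evalRingHom, RingHom.map_det, map_sum]
      simp only [map_pow, hZ0]
      obtain ⟨N, rfl⟩ : ∃ n, N = n + 1 := ⟨N - 1, by lia⟩
      rw [Finset.sum_range_succ']
      simp)
  have hG1 : G'.coeff 0 = 1 := by
    apply Polynomial.toLaurent_injective
    rw [← Polynomial.coeff_map, hG', map_one, Polynomial.coeff_zero_eq_eval_zero,
      ← Polynomial.coe_evalRingHom, RingHom.map_det, map_sub, hZ0, map_one, sub_zero, det_one]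
  obtain ⟨G₁, hG₁⟩ := exists_of_map_eval_eq_zero (G := G' - 1) (by
    rw [Polynomial.map_sub, hG0, Polynomial.map_one, sub_self])
  have hG₂ : (X : Polynomial (Polynomial ℚ)) ∣ G₁ := by
    rw [Polynomial.X_dvd_iff]
    have := congrArg (fun p => p.coeff 0) hG₁
    simpa [hG1] using this
  obtain ⟨G₂, rfl⟩ := hG₂
  refine ⟨G₂.eval (X ^ m), ?_⟩
  have h1 : (1 - (T m : Lau) • E).det = (evalRingHom (T m : Lau)) (1 - Z).det := by
    rw [RingHom.map_det, map_sub, map_one]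
    congr 2
    ext i j
    simp [hZ]
  rw [h1, ← hG', Polynomial.coe_evalRingHom, ← Polynomial.toLaurent_X_pow, Polynomial.eval_map_apply,
    sub_eq_iff_eq_add.1 hG₁]
  simp
  ring

end Gauss

section BranchDegree
open LaurentPolynomial (T)
open Polynomial (X toLaurent)
open Matrix hiding of
variable {ι ι' : Type} [Fintype ι] [Fintype ι'] [DecidableEq ι] [DecidableEq ι']
  {M : Type} [AddCommGroup M] [Module Lau M] {N N' : ℕ}
  {b₁ : ι → FreeGroup ι} {b₁' : ι' → FreeGroup ι'} {C : FreeGroup ι} {C' : FreeGroup ι'}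

lemma exists_fox_positive {w : FreeGroup ι} (hw : w ∈ Submonoid.closure (range (of (α := ι)))) :
    (∃ n : ℕ, wexp w = n) ∧ ∃ p : ι → Polynomial ℚ, ∀ i, fox w i = toLaurent (p i) := by
  induction hw using Submonoid.closure_induction with
  | mem x hx =>
    obtain ⟨j, rfl⟩ := hx
    refine ⟨⟨1, by simp⟩, Pi.single j 1, fun i => ?_⟩
    rw [fox_of, Pi.single_apply, Pi.single_apply]
    split_ifs <;> simp
  | one => exact ⟨⟨0, by simp⟩, 0, fun i => by simp⟩
  | mul x y _ _ hx hy =>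
    obtain ⟨⟨n, hn⟩, p, hp⟩ := hx
    obtain ⟨⟨k, hk⟩, q, hq⟩ := hy
    refine ⟨⟨n + k, by rw [expo_mul, hn, hk]; push_cast; rfl⟩, fun i => X ^ k * p i + q i, fun i => ?_⟩
    rw [fox_mul, hk, hp, hq, map_add, map_mul, Polynomial.toLaurent_X_pow]

lemma prod_mem_positive (l : List ι) : (l.map of).prod ∈ Submonoid.closure (range (of (α := ι))) :=
  Submonoid.list_prod_mem _ fun x hx => by
    obtain ⟨i, -, rfl⟩ := List.mem_map.1 hx
    exact Submonoid.subset_closure ⟨i, rfl⟩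

lemma expo_prod (l : List ι) : wexp (l.map of).prod = l.length := by
  induction l with
  | nil => simp
  | cons i l ih =>
    rw [List.map_cons, List.prod_cons, expo_mul, ih, expo_of, List.length_cons]
    push_cast
    ring

lemma fox_prod_of_notMem (l : List ι) {j : ι} (hj : j ∉ l) : fox (l.map of).prod j = 0 := by
  induction l with
  | nil => simp
  | cons i l ih =>
    rw [List.mem_cons, not_or] at hj
    rw [List.map_cons, List.prod_cons, fox_mul, ih hj.2, fox_of, Pi.single_apply, if_neg hj.1]
    simp

lemma cross_conj_val (z : ι → M) (w : FreeGroup ι) (i : ι) :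
    (cross z (w⁻¹ * of i * w)).val =
      (T (wexp w) : Lau) • z i + (1 - T 1 : Lau) • (cross z w).val := by
  simp only [map_mul, map_inv, cross_of, Cross.mul_val, Cross.inv_val, cross_deg,
    smul_add, smul_neg, smul_smul, ← LaurentPolynomial.T_add, sub_smul, one_smul]
  rw [show wexp w + (1 + -wexp w) = 1 by ring]
  abel

lemma cross_pow_val {z : ι → M} {w : FreeGroup ι} (h : (cross z w).val = 0) (n : ℕ) :
    (cross z (w ^ n)).val = 0 := by
  induction n with
  | zero => simp
  | succ n ih => rw [pow_succ, map_mul, Cross.mul_val, ih, h, smul_zero, add_zero]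

lemma restrict_pow {R : Type} [Ring R] {B Pr : R} (h : Pr * B * Pr = B * Pr) (n : ℕ) :
    (B * Pr) ^ (n + 1) = B ^ (n + 1) * Pr := by
  induction n with
  | zero => simp
  | succ n ih =>
    rw [pow_succ, ih, pow_succ B (n + 1), mul_assoc, ← mul_assoc Pr, h, ← mul_assoc]

lemma expo_pow (w : FreeGroup ι) (n : ℕ) : wexp (w ^ n) = n * wexp w := by
  induction n with
  | zero => simp
  | succ n ih => rw [pow_succ, expo_mul, ih]; push_cast; ring

lemma Monodromy.expo_eq (h : Monodromy N b₁ C) (j : ι) : wexp (b₁ j) = 1 := by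
  rw [wexp, h.expo j]; rfl

lemma Monodromy.fox_mulVec_one (h : Monodromy N b₁ C) : foxMat b₁ *ᵥ 1 = 1 := by
  funext i
  simpa [mulVec, dotProduct, foxMat] using sum_fox_of_expo (h.expo_eq i)

lemma Monodromy.vecMul_fox (h : Monodromy N b₁ C) : fox C ᵥ* foxMat b₁ = fox C := by
  rw [← fox_lift h.expo_eq, h.fix]

lemma Monodromy.expo_big (h : Monodromy N b₁ C) : wexp C = Fintype.card ι := by
  obtain ⟨l, hl, hl', rfl⟩ := h.prod
  rw [expo_prod]
  congr 1
  rw [← List.toFinset_card_of_nodup hl, ← Finset.card_univ]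
  congr 1
  ext i; simp [hl']

lemma Monodromy.sum_fox (h : Monodromy N b₁ C) :
    ∑ i, fox C i = toLaurent (∑ k ∈ Finset.range (Fintype.card ι), X ^ k : Polynomial ℚ) := by
  refine mul_right_cancel₀ T_sub_one_ne ?_
  rw [sum_fox_mul, h.expo_big]
  have := congrArg (toLaurent (R := ℚ)) (geom_sum_mul (X : Polynomial ℚ) (Fintype.card ι))
  rw [map_mul, map_sub, map_sub, map_one, Polynomial.toLaurent_X, Polynomial.toLaurent_X_pow] at this
  exact this.symm

lemma Monodromy.exists_last [Nonempty ι] (h : Monodromy N b₁ C) : ∃ j, fox C j = 1 := by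
  obtain ⟨l, hl, hl', rfl⟩ := h.prod
  rcases List.eq_nil_or_concat l with rfl | ⟨l, j, rfl⟩
  · obtain ⟨i⟩ := ‹Nonempty ι›
    simpa using hl' i
  · refine ⟨j, ?_⟩
    rw [List.concat_eq_append] at hl ⊢
    have hj : j ∉ l := fun hj => by
      rw [List.nodup_append] at hl
      exact hl.2.2 j hj j (by simp) rfl
    rw [List.map_append, List.prod_append, fox_mul, fox_prod_of_notMem _ hj]
    simp [fox_of]

lemma Monodromy.exists_pow_eq (h : Monodromy N b₁ C) {j₀ : ι} (h0 : fox C j₀ = 1) :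
    ∃ S : Matrix ι ι (Polynomial ℚ),
      (foxMat b₁ * (1 - vecMulVec (Pi.single j₀ 1) (fox C))) ^ N =
        (T ((N + 1) * Fintype.card ι) : Lau) • S.map toLaurent := by
  set B := foxMat b₁ with hB
  set Pr : Matrix ι ι Lau := 1 - vecMulVec (Pi.single j₀ 1) (fox C) with hPr
  have hlPr : fox C ᵥ* Pr = 0 := by
    rw [hPr, vecMul_sub, vecMul_one, vecMul_vecMulVec]
    simp [h0]
  have hPrBPr : Pr * B * Pr = B * Pr := by
    conv_lhs => rw [hPr, sub_mul, one_mul, vecMulVec_mul, h.vecMul_fox, sub_mul, vecMulVec_mul, hlPr]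
    simp [hPr]
  obtain ⟨n, rfl⟩ : ∃ n, N = n + 1 := ⟨N - 1, by have := h.one_le; lia⟩
  rw [restrict_pow hPrBPr, ← fox_iterate h.expo_eq]
  have hC : (cross (fun i => Pr i) C).val = 0 := by
    rw [cross_val]
    funext j
    have := congrFun hlPr j
    simpa [vecMul, dotProduct] using this
  have hPrp : ∀ i j, ∃ p : Polynomial ℚ, Pr i j = toLaurent p := fun i j => by
    obtain ⟨l, -, -, hl⟩ := h.prod
    obtain ⟨-, p, hp⟩ := exists_fox_positive (prod_mem_positive l)
    rw [← hl] at hp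
    refine ⟨(1 : Matrix ι ι (Polynomial ℚ)) i j - Pi.single (M := fun _ => Polynomial ℚ) j₀ 1 i * p j, ?_⟩
    rw [hPr, Matrix.sub_apply, vecMulVec_apply, map_sub, map_mul, hp, one_apply, one_apply,
      Pi.single_apply, Pi.single_apply]
    split_ifs <;> simp
  choose p hp using hPrp
  have key : ∀ i j, ∃ q : Polynomial ℚ,
      (foxMat (fun i => (lift b₁)^[n + 1] (of i)) * Pr) i j =
        T (((n + 1 : ℕ) + 1) * Fintype.card ι) * toLaurent q := fun i j => by
    obtain ⟨P, hP, hi⟩ := h.iter i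
    obtain ⟨⟨k, hk⟩, r, hr⟩ := exists_fox_positive hP
    have h1 : (foxMat (fun i => (lift b₁)^[n + 1] (of i)) * Pr) i j =
        (cross (fun i => Pr i) ((lift b₁)^[n + 1] (of i))).val j := by
      rw [cross_val, Finset.sum_apply]; rfl
    have h2 : (cross (fun i => Pr i) (P * C ^ (n + 1 + 1))).val =
        (T (((n + 1 : ℕ) + 1) * Fintype.card ι) : Lau) • ∑ i, fox P i • Pr i := by
      rw [map_mul, Cross.mul_val, cross_pow_val hC, add_zero, cross_deg, cross_val, expo_pow, h.expo_big]
      push_cast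
      rfl
    refine ⟨X ^ k * p i j + (1 - X) * ∑ m, r m * p m j, ?_⟩
    rw [h1, hi, cross_conj_val, h2, expo_mul, expo_pow, h.expo_big, hk]
    simp only [Pi.add_apply, Pi.smul_apply, Finset.sum_apply, smul_eq_mul, hr, hp, map_add, map_mul,
      map_sub, map_one, map_sum, Polynomial.toLaurent_X_pow, Polynomial.toLaurent_X,
      LaurentPolynomial.T_add]
    push_cast
    ring
  choose S hS using key
  refine ⟨Matrix.of S, ?_⟩
  ext1 i j
  rw [hS]
  rfl

lemma Monodromy.exists_det [Nonempty ι] (h : Monodromy N b₁ C) : ∃ (j₀ : ι) (a : Polynomial ℚ),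
    fox C j₀ = 1 ∧ toLaurent (∑ k ∈ Finset.range (Fintype.card ι), X ^ k : Polynomial ℚ) *
      (updateRow (1 - foxMat b₁) j₀ (Pi.single j₀ 1)).det =
        toLaurent (1 + X ^ (Fintype.card ι + 1) * a) := by
  obtain ⟨j₀, h0⟩ := h.exists_last
  obtain ⟨S, hS⟩ := h.exists_pow_eq h0
  set m := Fintype.card ι
  set B₀ := foxMat b₁ * (1 - vecMulVec (Pi.single j₀ 1) (fox C))
  have hm : 1 ≤ m := Fintype.card_pos
  have hE : ((T (-m) : Lau) • B₀) ^ N =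
      (T 1 : Lau) • ((X ^ (m - 1) : Polynomial ℚ) • S).map toLaurent := by
    rw [smul_pow, hS, smul_smul, LaurentPolynomial.T_pow, ← LaurentPolynomial.T_add]
    refine Matrix.ext fun i j => ?_
    rw [Matrix.smul_apply, Matrix.smul_apply, Matrix.map_apply, Matrix.map_apply, Matrix.smul_apply,
      smul_eq_mul, smul_eq_mul, smul_eq_mul, map_mul, Polynomial.toLaurent_X_pow, ← mul_assoc,
      ← LaurentPolynomial.T_add]
    congr 2
    push_cast [Nat.cast_sub hm]
    ring
  obtain ⟨a, ha⟩ := det_one_sub_of_nilpotent h.one_le hE m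
  refine ⟨j₀, a, h0, ?_⟩
  rw [← ha, ← h.sum_fox, ← det_one_sub_restrict h.fox_mulVec_one h.vecMul_fox h0, smul_smul,
    ← LaurentPolynomial.T_add]
  simp [B₀]

end BranchDegree

section CompareDegrees
open LaurentPolynomial (T)
open Polynomial (X toLaurent)
open Matrix hiding of
variable {ι ι' κ : Type} [Fintype ι] [Fintype ι'] [Fintype κ] [DecidableEq ι] [DecidableEq ι']
  {M : Type} [AddCommGroup M] [Module Lau M] {N N' : ℕ}
  {b₁ : ι → FreeGroup ι} {b₁' : ι' → FreeGroup ι'} {C : FreeGroup ι} {C' : FreeGroup ι'}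

/-- The action of a matrix on a family of vectors. -/
def act (A : Matrix ι ι' Lau) (z : ι' → M) (i : ι) : M := ∑ k, A i k • z k

lemma act_mul (A : Matrix κ ι Lau) (B : Matrix ι ι' Lau) (z : ι' → M) :
    act (A * B) z = act A (act B z) := by
  funext i
  simp only [act, Matrix.mul_apply, Finset.sum_smul, Finset.smul_sum, smul_smul]
  exact Finset.sum_comm

lemma act_one (z : ι → M) : act (1 : Matrix ι ι Lau) z = z := by
  funext i
  simp [act, Matrix.one_apply]

lemma act_sub (A B : Matrix ι ι' Lau) (z : ι' → M) : act (A - B) z = act A z - act B z := by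
  funext i
  simp [act, sub_smul]

lemma act_const {A : Matrix ι ι' Lau} (hA : ∀ i, ∑ k, A i k = 1) (z : ι' → M) (c : M) :
    act A (fun k => z k - c) = fun i => act A z i - c := by
  funext i
  simp only [act, smul_sub, Finset.sum_sub_distrib, ← Finset.sum_smul, hA, one_smul]

lemma MonIso.symm (h : MonIso b₁ b₁') : MonIso b₁' b₁ := by
  obtain ⟨a, ha, hα⟩ := h
  set e := MulEquiv.ofBijective a ha
  refine ⟨e.symm.toMonoidHom, e.symm.bijective, fun α' α h' h x => ?_⟩
  rw [← hα α α' h h']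
  congr 1
  exact (e.apply_symm_apply x)

lemma MonIso.exists_transfer (h : MonIso b₁ b₁') (hm : Monodromy N b₁ C) (hm' : Monodromy N' b₁' C') :
    ∃ (Y : Matrix ι' ι Lau) (W : Matrix ι ι' Lau), (∀ k, ∑ i, Y k i = 1) ∧ (∀ i, ∑ k, W i k = 1) ∧
      ∀ (M : Type) [AddCommGroup M] [Module Lau M] (z : ι → M), act (foxMat b₁) z = z →
        act (foxMat b₁') (act Y z) = act Y z ∧ act W (act Y z) = z := by
  obtain ⟨a, ha, hα⟩ := h
  obtain ⟨α, hα₁⟩ := hm.exists_expo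
  obtain ⟨α', hα'⟩ := hm'.exists_expo
  have e1 : ∀ w, (α (curveProj b₁ w)).toAdd = wexp w := fun w => by rw [hα₁, wexp]
  have e2 : ∀ w, (α' (curveProj b₁' w)).toAdd = wexp w := fun w => by rw [hα', wexp]
  set e := MulEquiv.ofBijective a ha with he
  have hc : ∀ k, ∃ w, curveProj b₁ w = e.symm (curveProj b₁' (of k)) := fun k => curveProj_surjective _
  have hw : ∀ i, ∃ w, curveProj b₁' w = a (curveProj b₁ (of i)) := fun i => curveProj_surjective _
  choose v hv using hc
  choose w hw using hw
  have hav : ∀ k, a (curveProj b₁ (v k)) = curveProj b₁' (of k) := fun k => by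
    rw [hv]; exact e.apply_symm_apply _
  have v1 : ∀ k, wexp (v k) = 1 := fun k => by
    rw [← e1, ← hα α α' hα₁ hα', hav, e2, expo_of]
  have w1 : ∀ i, wexp (w i) = 1 := fun i => by
    rw [← e2, hw, hα α α' hα₁ hα', e1, expo_of]
  refine ⟨foxMat v, foxMat w, fun k => sum_fox_of_expo (v1 k), fun i => sum_fox_of_expo (w1 i),
    fun M _ _ z hz => ?_⟩
  have hz' : ∀ j, lift (fun i => (⟨1, z i⟩ : Cross M)) (b₁ j) = ⟨1, z j⟩ := fun j => by
    change cross z (b₁ j) = _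
    ext
    · rw [cross_deg, hm.expo_eq]
    · rw [cross_val]; exact congrFun hz j
  obtain ⟨φ, hφ⟩ := exists_curve_hom hz'
  have hφ : ∀ w, φ (curveProj b₁ w) = cross z w := hφ
  have hy : ∀ k, cross z (v k) = ⟨1, act (foxMat v) z k⟩ := fun k => by
    ext
    · rw [cross_deg, v1]
    · rw [cross_val]; rfl
  have hψ : ∀ u, φ (e.symm (curveProj b₁' u)) = cross (act (foxMat v) z) u := fun u => by
    have : (φ.comp e.symm.toMonoidHom).comp (curveProj b₁') = cross (act (foxMat v) z) := by
      ext k : 1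
      simp only [MonoidHom.comp_apply, MulEquiv.toMonoidHom_eq_coe, MonoidHom.coe_coe, cross_of]
      rw [← hv, hφ, hy]
    exact DFunLike.congr_fun this u
  constructor
  · funext j
    have h1 : cross (act (foxMat v) z) (b₁' j) = cross (act (foxMat v) z) (of j) := by
      rw [← hψ, ← hψ, ← curveProj_fix (of j), FreeGroup.lift_apply_of]
    have h2 := congrArg Cross.val h1
    rw [cross_val, cross_of] at h2
    exact h2
  · funext i
    have h1 : cross (act (foxMat v) z) (w i) = cross z (of i) := by
      rw [← hψ, hw, ← hφ]
      congr 1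
      exact e.symm_apply_apply _
    have h2 := congrArg Cross.val h1
    rw [cross_val, cross_of] at h2
    exact h2

/-- The reduced relation matrix of the Alexander module. -/
def redMat (b₁ : ι → FreeGroup ι) (j₀ : ι) : Matrix ι ι Lau :=
  updateRow (1 - foxMat b₁) j₀ (Pi.single j₀ 1)

lemma act_redMat_eq_zero (b₁ : ι → FreeGroup ι) (j₀ : ι) {z : ι → M} (h : act (foxMat b₁) z = z)
    (h0 : z j₀ = 0) : act (redMat b₁ j₀) z = 0 := by
  funext i
  rcases eq_or_ne i j₀ with rfl | hi
  · simp [act, redMat, h0, Pi.single_apply]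
  · have : act (1 - foxMat b₁) z i = 0 := by rw [act_sub, act_one, h, sub_self]; rfl
    simpa [act, redMat, updateRow_ne hi] using this

lemma Monodromy.act_redMat (hm : Monodromy N b₁ C) {j₀ : ι} (hj : fox C j₀ = 1) {z : ι → M}
    (h : ∀ i, act (redMat b₁ j₀) z i = 0) : act (foxMat b₁) z = z ∧ z j₀ = 0 := by
  have h0 : z j₀ = 0 := by
    have := h j₀
    simpa [act, redMat, Pi.single_apply] using this
  have h1 : ∀ i ≠ j₀, act (1 - foxMat b₁) z i = 0 := fun i hi => by
    have := h i
    simpa [act, redMat, updateRow_ne hi] using this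
  have h2 : ∑ i, fox C i • act (1 - foxMat b₁) z i = 0 := by
    have : ∑ i, fox C i • act (1 - foxMat b₁) z i = ∑ k, (fox C ᵥ* (1 - foxMat b₁)) k • z k := by
      simp only [act, vecMul, dotProduct, Finset.sum_smul, Finset.smul_sum, smul_smul]
      exact Finset.sum_comm
    rw [this, vecMul_sub, vecMul_one, hm.vecMul_fox, sub_self]
    simp
  rw [Finset.sum_eq_single j₀ (fun i _ hi => by rw [h1 i hi, smul_zero]) (by simp), hj, one_smul] at h2
  refine ⟨funext fun i => ?_, h0⟩
  have h3 : act (1 - foxMat b₁) z i = 0 := by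
    rcases eq_or_ne i j₀ with rfl | hi
    exacts [h2, h1 i hi]
  rw [act_sub, act_one, Pi.sub_apply, sub_eq_zero] at h3
  exact h3.symm

lemma MonIso.det_dvd (h : MonIso b₁ b₁') (hm : Monodromy N b₁ C) (hm' : Monodromy N' b₁' C')
    {j₀ : ι} (hj : fox C j₀ = 1) (j₀' : ι') : (redMat b₁ j₀).det ∣ (redMat b₁' j₀').det := by
  obtain ⟨Y, W, hY, hW, hYW⟩ := h.exists_transfer hm hm'
  set Y' : Matrix ι' ι Lau := Y - Matrix.of (fun _ => Y j₀') with hY'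
  set W' : Matrix ι ι' Lau := W - Matrix.of (fun _ => W j₀) with hW'
  have a1 : ∀ (M : Type) [AddCommGroup M] [Module Lau M] (z : ι → M),
      act Y' z = fun k => act Y z k - act Y z j₀' := fun M _ _ z => by
    rw [hY', act_sub]; rfl
  have a2 : ∀ (M : Type) [AddCommGroup M] [Module Lau M] (z : ι' → M),
      act W' z = fun k => act W z k - act W z j₀ := fun M _ _ z => by
    rw [hW', act_sub]; rfl
  obtain ⟨S, hS⟩ := exists_mul_of_forall (Q := redMat b₁ j₀) (E := redMat b₁' j₀' * Y')
    fun M _ _ z hz i => by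
      obtain ⟨h1, h2⟩ := hm.act_redMat hj hz
      obtain ⟨h3, h4⟩ := hYW M z h1
      change act (redMat b₁' j₀' * Y') z i = 0
      rw [act_mul, act_redMat_eq_zero, Pi.zero_apply]
      · rw [a1, act_const (A := foxMat b₁') (fun i => sum_fox_of_expo (hm'.expo_eq i)), h3]
      · rw [a1]; exact sub_self _
  obtain ⟨A, hA⟩ := exists_mul_of_forall (Q := redMat b₁ j₀) (E := W' * Y' - 1)
    fun M _ _ z hz i => by
      obtain ⟨h1, h2⟩ := hm.act_redMat hj hz
      obtain ⟨h3, h4⟩ := hYW M z h1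
      change act (W' * Y' - 1) z i = 0
      rw [act_sub, act_one, act_mul, a2, a1, act_const hW, h4]
      simp [h2]
  exact det_dvd_det (X := W') (Y := Y') (A := A) (S := S) (sub_eq_iff_eq_add'.1 hA) hS

/-- A Laurent polynomial which is a ratio of polynomials not vanishing at zero has no pole. -/
lemma exists_toLaurent_of_mul_eq {U : Lau} {p q : Polynomial ℚ} (hp : p.coeff 0 ≠ 0)
    (h : U * toLaurent p = toLaurent q) : ∃ u : Polynomial ℚ, U = toLaurent u := by
  classical
  have hex := U.exists_T_pow
  obtain ⟨u, hu⟩ := Nat.find_spec hex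
  rcases hn : Nat.find hex with _ | n
  · exact ⟨u, by rw [hu, hn]; simp⟩
  · exfalso
    rw [hn] at hu
    have h1 : u * p = q * X ^ (n + 1) := by
      apply Polynomial.toLaurent_injective
      rw [map_mul, map_mul, hu, Polynomial.toLaurent_X_pow, ← h]
      ring
    have h2 : u.coeff 0 = 0 := by
      have := congrArg (fun p => p.coeff 0) h1
      simp [Polynomial.mul_coeff_zero] at this
      exact this.resolve_right hp
    obtain ⟨u', rfl⟩ := Polynomial.X_dvd_iff.2 h2
    refine Nat.find_min hex (m := n) (by lia) ⟨u', ?_⟩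
    refine mul_left_cancel₀ (LaurentPolynomial.isUnit_T 1).ne_zero (a := (T 1 : Lau)) ?_
    rw [← Polynomial.toLaurent_X, ← map_mul, hu, Polynomial.toLaurent_X, Nat.cast_add,
      LaurentPolynomial.T_add]
    push_cast
    ring

lemma coeff_zero_geom {m : ℕ} (hm : 1 ≤ m) :
    (∑ k ∈ Finset.range m, X ^ k : Polynomial ℚ).coeff 0 = 1 := by
  rw [Polynomial.finsetSum_coeff]
  simp [Polynomial.coeff_X_pow]
  lia

lemma not_lt_of_geom_eq {m m' : ℕ} {a a' : Polynomial ℚ}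
    (h : (1 + X ^ (m + 1) * a) * ∑ k ∈ Finset.range m', X ^ k =
      (1 + X ^ (m' + 1) * a') * ∑ k ∈ Finset.range m, X ^ k) : ¬ m < m' := fun hlt => by
  have h1 := congrArg (fun p => p.coeff m) h
  simp only [add_mul, one_mul, Polynomial.coeff_add, mul_assoc, Polynomial.coeff_X_pow_mul',
    Polynomial.finsetSum_coeff, Polynomial.coeff_X_pow] at h1
  rw [if_neg (by lia), if_neg (by lia)] at h1
  simp [hlt] at h1

/-- The topology of the complement determines the number of sheets of a branch. -/
theorem MonIso.card_eq [Nonempty ι] [Nonempty ι'] (h : MonIso b₁ b₁') (hm : Monodromy N b₁ C)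
    (hm' : Monodromy N' b₁' C') : Fintype.card ι = Fintype.card ι' := by
  obtain ⟨j₀, a, hj, ha⟩ := hm.exists_det
  obtain ⟨j₀', a', hj', ha'⟩ := hm'.exists_det
  change _ * (redMat b₁ j₀).det = _ at ha
  change _ * (redMat b₁' j₀').det = _ at ha'
  set m := Fintype.card ι with hmdef
  set m' := Fintype.card ι' with hmdef'
  have p1 : 1 ≤ m := Fintype.card_pos
  have p2 : 1 ≤ m' := Fintype.card_pos
  set D := (redMat b₁ j₀).det
  set D' := (redMat b₁' j₀').det
  set p : Polynomial ℚ := (1 + X ^ (m + 1) * a) * ∑ k ∈ Finset.range m', X ^ k with hp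
  set q : Polynomial ℚ := (1 + X ^ (m' + 1) * a') * ∑ k ∈ Finset.range m, X ^ k with hq
  have hp0 : p.coeff 0 = 1 := by
    rw [hp, Polynomial.mul_coeff_zero, coeff_zero_geom p2]; simp
  have hq0 : q.coeff 0 = 1 := by
    rw [hq, Polynomial.mul_coeff_zero, coeff_zero_geom p1]; simp
  obtain ⟨U, hU⟩ : D ∣ D' := h.det_dvd hm hm' hj j₀'
  obtain ⟨U', hU'⟩ : D' ∣ D := h.symm.det_dvd hm' hm hj' j₀
  have hpq : U * toLaurent p = toLaurent q := by
    rw [hp, hq, map_mul, map_mul, ← ha, ← ha', hU]; ring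
  have hqp : U' * toLaurent q = toLaurent p := by
    rw [hp, hq, map_mul, map_mul, ← ha, ← ha']
    linear_combination (-(toLaurent (∑ k ∈ Finset.range m', X ^ k : Polynomial ℚ)) *
      (toLaurent (∑ k ∈ Finset.range m, X ^ k : Polynomial ℚ))) * hU'
  obtain ⟨u, rfl⟩ := exists_toLaurent_of_mul_eq (by rw [hp0]; exact one_ne_zero) hpq
  obtain ⟨u', rfl⟩ := exists_toLaurent_of_mul_eq (by rw [hq0]; exact one_ne_zero) hqp
  rw [← map_mul, Polynomial.toLaurent_inj] at hpq hqp
  have hpne : p ≠ 0 := fun h0 => by rw [h0] at hp0; simp at hp0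
  have huu : u * u' = 1 := by
    refine mul_right_cancel₀ hpne ?_
    calc u * u' * p = u' * (u * p) := by ring
      _ = 1 * p := by rw [hpq, hqp, one_mul]
  obtain ⟨c, -, rfl⟩ := Polynomial.isUnit_iff.1 (IsUnit.of_mul_eq_one _ huu)
  have hc : c = 1 := by
    have := congrArg (fun p => p.coeff 0) hpq
    simpa [hp0, hq0] using this
  rw [hc, map_one, one_mul] at hpq
  have h1 := not_lt_of_geom_eq hpq
  have h2 := not_lt_of_geom_eq hpq.symm
  lia

end CompareDegrees

section RootSystems
variable {ι ι' : Type} [Fintype ι] [Fintype ι'] {σ : Equiv.Perm ι} {σ' : Equiv.Perm ι'}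
  {Y : ι → ℂ → ℂ} {Y' : ι' → ℂ → ℂ} {s s' C C' : ℝ} {N N' : ℕ} {g : ι → ℂ → ℂ} {g' : ι' → ℂ → ℂ}

/-- The topology of a branch determines its number of sheets. -/
theorem Puiseux.card_eq [Nonempty ι] [Nonempty ι'] (h : Puiseux N σ g) (h' : Puiseux N' σ' g')
    {f f' : ℂ × ℂ → ℂ × ℂ}
    (hf : GHomeo 0 (Vset N (sheet N g) s) 0 (Vset N' (sheet N' g') s') f f') :
    Fintype.card ι = Fintype.card ι' := by
  classical
  obtain ⟨b₁, K, b₁', K', hm, hm', hi⟩ := h.exists_iso h' hf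
  exact hi.card_eq hm hm'

/-- Holomorphic functions on a logarithmic half-plane, describing the local branches of a plane
curve away from the origin. -/
structure RootSystem (σ : Equiv.Perm ι) (Y : ι → ℂ → ℂ) (s C : ℝ) : Prop where
  an : ∀ i, DifferentiableOn ℂ (Y i) {w | w.re < s}
  ne : ∀ i j w, w.re < s → i ≠ j → Y i w ≠ Y j w
  bound : ∀ i w, w.re < s → ‖Y i w‖ ≤ C * ‖exp w‖
  shift : ∀ i w, w.re < s → Y i (w + 2 * π * I) = Y (σ i) w

/-- The sheets of a root system having a given property. -/
def sheets (Y : ι → ℂ → ℂ) (s : ℝ) (p : ι → Prop) : Set (ℂ × ℂ) :=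
  {z | ∃ w : ℂ, w.re < s ∧ ∃ i, p i ∧ z = (exp w, Y i w)}

lemma re_add_two_pi (w : ℂ) (n : ℤ) : (w + 2 * π * I * n).re = w.re := by simp

lemma RootSystem.shift_pow (h : RootSystem σ Y s C) (n : ℕ) (i : ι) {w : ℂ} (hw : w.re < s) :
    Y i (w + 2 * π * I * n) = Y ((σ ^ n) i) w := by
  induction n generalizing i with
  | zero => simp
  | succ n ih =>
    rw [show w + 2 * π * I * ((n + 1 : ℕ) : ℂ) =
      w + 2 * π * I * n + 2 * π * I by push_cast; ring, h.shift, ih, pow_succ,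
      Equiv.Perm.mul_apply]
    rw [← Int.cast_natCast, re_add_two_pi]
    exact hw

lemma RootSystem.shift_zpow (h : RootSystem σ Y s C) (n : ℤ) (i : ι) {w : ℂ} (hw : w.re < s) :
    Y i (w + 2 * π * I * n) = Y ((σ ^ n) i) w := by
  obtain ⟨n, rfl | rfl⟩ := n.eq_nat_or_neg
  · exact_mod_cast h.shift_pow n i hw
  · have := h.shift_pow n ((σ ^ (-n : ℤ)) i) (w := w + 2 * π * I * ((-n : ℤ) : ℂ))
      (by rw [re_add_two_pi]; exact hw)
    rw [← zpow_natCast, ← Equiv.Perm.mul_apply, ← zpow_add, add_neg_cancel, zpow_zero,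
      Equiv.Perm.one_apply] at this
    rw [← this]
    congr 1
    push_cast
    ring

lemma RootSystem.sameCycle (h : RootSystem σ Y s C) {w w' : ℂ} {i j : ι} (hw : w.re < s)
    (hw' : w'.re < s) (he : (exp w, Y i w) = (exp w', Y j w')) :
    σ.SameCycle i j := by
  obtain ⟨h1, h2⟩ := Prod.mk.inj he
  obtain ⟨n, rfl⟩ := Complex.exp_eq_exp_iff_exists_int.1 h1
  rw [mul_comm (n:ℂ), h.shift_zpow n i hw'] at h2
  by_contra hc
  exact h.ne _ _ w' hw' (fun e => hc ⟨n, e⟩) h2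

lemma RootSystem.mem_sheets (h : RootSystem σ Y s C) {i j : ι} (hij : σ.SameCycle i j) {w : ℂ}
    (hw : w.re < s) : ∃ w' : ℂ, w'.re = w.re ∧
      (exp w', Y i w') = (exp w, Y j w) := by
  obtain ⟨n, rfl⟩ := hij
  refine ⟨w + 2 * π * I * n, re_add_two_pi w n, Prod.ext ?_ (h.shift_zpow n i hw)⟩
  exact Complex.exp_eq_exp_iff_exists_int.2 ⟨n, by ring⟩

/-- The class of the sheet is locally constant on the curve away from the origin. -/
lemma RootSystem.eventually_sameCycle (h : RootSystem σ Y s C) {w : ℂ} (hw : w.re < s) (i : ι) :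
    ∀ᶠ p in 𝓝 (exp w, Y i w), ∀ w' : ℂ, w'.re < s → ∀ j,
      p = (exp w', Y j w') → σ.SameCycle j i := by
  set l : ℂ × ℂ → ℂ := fun p => w + Complex.log (p.1 / exp w) with hl
  have hl0 : l (exp w, Y i w) = w := by simp [hl, exp_ne_zero]
  have hlc : ContinuousAt l (exp w, Y i w) := by
    refine continuousAt_const.add (ContinuousAt.clog (by fun_prop) ?_)
    simp [exp_ne_zero]
  have hlt : Tendsto l (𝓝 (exp w, Y i w)) (𝓝 w) := by simpa [ContinuousAt, hl0] using hlc
  have hop : IsOpen {w : ℂ | w.re < s} := isOpen_lt (by fun_prop) (by fun_prop)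
  have e1 : ∀ᶠ p in 𝓝 (exp w, Y i w), (l p).re < s := hlt (hop.mem_nhds hw)
  have e2 : ∀ j, j ≠ i → ∀ᶠ p in 𝓝 (exp w, Y i w), Y j (l p) ≠ p.2 := fun j hj => by
    have hc : ContinuousAt (Y j) w := ((h.an j).differentiableAt (hop.mem_nhds hw)).continuousAt
    have : Tendsto (fun p => Y j (l p)) (𝓝 (exp w, Y i w)) (𝓝 (Y j w)) :=
      hc.tendsto.comp hlt
    exact ((this.sub (continuous_snd.tendsto (exp w, Y i w))).eventually_ne
      (sub_ne_zero.2 (h.ne j i w hw hj))).mono fun p hp => sub_ne_zero.1 hp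
  have e3 : ∀ᶠ p in 𝓝 (exp w, Y i w), ∀ j, j ≠ i → Y j (l p) ≠ p.2 :=
    eventually_all.2 fun j => by
      by_cases hj : j = i
      · exact Eventually.of_forall fun p hp => absurd hj hp
      · exact (e2 j hj).mono fun p hp _ => hp
  filter_upwards [e1, e3] with p h1 h3 w' hw' j hp
  have he : exp w' = exp (l p) := by
    simp only [hl, Complex.exp_add, hp]
    rw [Complex.exp_log (by simp [exp_ne_zero])]
    field_simp
  obtain ⟨n, hn⟩ := Complex.exp_eq_exp_iff_exists_int.1 he
  have h4 : Y j w' = Y ((σ ^ n) j) (l p) := by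
    rw [← h.shift_zpow n j h1, hn, mul_comm (n:ℂ)]
  refine ⟨n, ?_⟩
  by_contra hc
  exact h3 _ hc (by rw [← h4, hp])

lemma RootSystem.tendsto (h : RootSystem σ Y s C) (i : ι) :
    Tendsto (fun w : ℂ => (exp w, Y i w)) (comap Complex.re atBot) (𝓝 0) := by
  have h1 : Tendsto exp (comap Complex.re atBot) (𝓝 0) :=
    Complex.tendsto_exp_comap_re_atBot
  refine h1.prodMk_nhds (squeeze_zero_norm' (a := fun w => C * ‖exp w‖) ?_ ?_)
  · filter_upwards [preimage_mem_comap (Iio_mem_atBot s)] with w hw using h.bound i w hw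
  · simpa using h1.norm.const_mul C

lemma RootSystem.exists_re_lt (h : RootSystem σ Y s C) (i : ι) {p : ℂ × ℂ → Prop}
    (hp : ∀ᶠ z in 𝓝 0, p z) : ∃ t ≤ s, ∀ w : ℂ, w.re < t → p (exp w, Y i w) := by
  obtain ⟨A, hA, hA'⟩ := (h.tendsto i hp : _ ∈ comap Complex.re atBot)
  obtain ⟨t, ht⟩ := mem_atBot_sets.1 hA
  exact ⟨min t s, min_le_right _ _, fun w hw => hA' (ht _ (hw.le.trans (min_le_left _ _)))⟩

lemma RootSystem.frequently (h : RootSystem σ Y s C) {p : ι → Prop} (i : ι) (hi : p i) :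
    ∃ᶠ z in 𝓝 0, z ∈ sheets Y s p := fun hn => by
  obtain ⟨t, ht, h1⟩ := h.exists_re_lt i hn
  exact h1 ((t - 1 : ℝ) : ℂ) (by simp) ⟨_, by simp; linarith, i, hi, rfl⟩

/-- The curve described by a root system, near the origin. -/
def Describes (Y : ι → ℂ → ℂ) (s : ℝ) (V : Set (ℂ × ℂ)) : Prop :=
  ∀ᶠ z in 𝓝 0, z ∈ V ↔ z = 0 ∨ z ∈ sheets Y s fun _ => True

/-- A germ of homeomorphism maps each branch into a branch. -/
lemma RootSystem.exists_class (h : RootSystem σ Y s C) (h' : RootSystem σ' Y' s' C')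
    {V V' : Set (ℂ × ℂ)} (hV : Describes Y s V) (hV' : Describes Y' s' V')
    {f f' : ℂ × ℂ → ℂ × ℂ} (hf : GHomeo 0 V 0 V' f f') (i : ι) :
    ∃ i', ∀ᶠ z in 𝓝 0, z ∈ sheets Y s (σ.SameCycle i) → f z ∈ sheets Y' s' (σ'.SameCycle i') := by
  obtain ⟨W, hW, hfc, hfV⟩ := hf.map.2
  obtain ⟨W', hW', hWo, h0⟩ := _root_.mem_nhds_iff.1 hW
  have e : ∀ᶠ z in 𝓝 (0 : ℂ × ℂ), z ∈ W' ∧ (z ∈ V ↔ z = 0 ∨ z ∈ sheets Y s fun _ => True) ∧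
      (f z ∈ V' ↔ f z = 0 ∨ f z ∈ sheets Y' s' fun _ => True) ∧ f' (f z) = z :=
    Eventually.and (hWo.mem_nhds h0) (hV.and ((hf.map.tendsto.eventually hV').and hf.left))
  obtain ⟨t, hts, ht⟩ := h.exists_re_lt i e
  have key : ∀ w : ℂ, w.re < t → f (exp w, Y i w) ∈ sheets Y' s' fun _ => True :=
    fun w hw => by
      obtain ⟨h1, h2, h3, h4⟩ := ht w hw
      refine (h3.1 ((hfV _ (hW' h1)).2 (h2.2 (Or.inr ⟨w, hw.trans_le hts, i, trivial, rfl⟩)))).resolve_left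
        fun h5 => ?_
      rw [h5, hf.inv.1] at h4
      exact exp_ne_zero w (congrArg Prod.fst h4).symm
  have hne : Nonempty ι' := let ⟨_, _, j, _⟩ := key ((t - 1 : ℝ) : ℂ) (by simp); ⟨j⟩
  choose! l hl k _ hk using key
  have hcon : ∀ w : ℂ, w.re < t → ∀ v : ℂ, v.re < t → σ'.SameCycle (k w) (k v) :=
      fun w hw v hv => by
    have hpre : IsPreconnected {w : ℂ | w.re < t} := (convex_halfSpace_re_lt t).isPreconnected
    have := const_of_locConst hpre (f := fun w => Quotient.mk (Equiv.Perm.SameCycle.setoid σ') (k w))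
      (fun a ha => ?_) hw hv
    · exact Quotient.exact this
    · have hop : IsOpen {w : ℂ | w.re < t} := isOpen_lt (by fun_prop) (by fun_prop)
      have hops : IsOpen {w : ℂ | w.re < s} := isOpen_lt (by fun_prop) (by fun_prop)
      have hat : a.re < t := ha
      have hYc : ContinuousAt (Y i) a :=
        ((h.an i).differentiableAt (hops.mem_nhds (hat.trans_le hts))).continuousAt
      have hc : ContinuousAt (fun w => f (exp w, Y i w)) a :=
        ContinuousAt.comp (f := fun w => (exp w, Y i w))
          (hfc.continuousAt (mem_of_superset (hWo.mem_nhds (ht a hat).1) hW'))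
          (Complex.continuous_exp.continuousAt.prodMk hYc)
      have h1 := h'.eventually_sameCycle (hl a hat) (k a)
      rw [← hk a hat] at h1
      refine ⟨_, mem_nhdsWithin_of_mem_nhds (inter_mem (hc h1) (hop.mem_nhds hat)), fun b hb => ?_⟩
      exact Quotient.sound (hb.1 _ (hl b hb.2) _ (hk b hb.2))
  have hvt : (((t - 1 : ℝ) : ℂ)).re < t := by simp
  refine ⟨k ((t - 1 : ℝ) : ℂ), ?_⟩
  have e2 : ∀ᶠ z : ℂ × ℂ in 𝓝 0, ‖z.1‖ < Real.exp t :=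
    (continuous_fst.norm.tendsto (0 : ℂ × ℂ)).eventually (gt_mem_nhds (by simp [Real.exp_pos]))
  filter_upwards [e2] with z hz hzs
  obtain ⟨w, hw, j, hj, rfl⟩ := hzs
  rw [Complex.norm_exp, Real.exp_lt_exp] at hz
  obtain ⟨w', hw', he⟩ := h.mem_sheets hj hw
  rw [← he]
  have hwt : w'.re < t := by rw [hw']; exact hz
  exact ⟨_, hl w' hwt, _, hcon _ hvt _ hwt, hk w' hwt⟩

end RootSystems

section RootSystemClasses
variable {ι ι' : Type} [Fintype ι] [Fintype ι'] {σ : Equiv.Perm ι} {σ' : Equiv.Perm ι'}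
  {Y : ι → ℂ → ℂ} {Y' : ι' → ℂ → ℂ} {s s' C C' : ℝ} {N : ℕ}

lemma eventually_log_re_lt (t : ℝ) :
    ∀ᶠ ξ : ℂ in 𝓝[≠] 0, ξ ≠ 0 ∧ (Complex.log ξ).re < t := by
  have e : ∀ᶠ ξ : ℂ in 𝓝 0, ‖ξ‖ < Real.exp t :=
    (continuous_norm.tendsto (0 : ℂ)).eventually (gt_mem_nhds (by simp [Real.exp_pos]))
  filter_upwards [self_mem_nhdsWithin, e.filter_mono nhdsWithin_le_nhds] with ξ h1 h2
  refine ⟨h1, ?_⟩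
  rw [Complex.log_re, Real.log_lt_iff_lt_exp (norm_pos_iff.2 h1)]
  exact h2

/-- Existence of Puiseux parametrisations. -/
lemma RootSystem.exists_puiseux (h : RootSystem σ Y s C) (hN : 1 ≤ N) (hσ : σ ^ N = 1) :
    ∃ g : ι → ℂ → ℂ, (∀ i, AnalyticAt ℂ (g i) 0) ∧
      ∀ i ω, (N * ω : ℂ).re < s → Y i (N * ω) = sheet N g i ω := by
  have hN0 : (N : ℂ) ≠ 0 := by exact_mod_cast (by lia : N ≠ 0)
  have hNr : (0:ℝ) < N := by exact_mod_cast hN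
  have hre : ∀ ω : ℂ, (N * ω : ℂ).re < s ↔ ω.re < s / N := fun ω => by
    rw [lt_div_iff₀ hNr]; simp [mul_comm]
  set k : ι → ℂ → ℂ := fun i ξ => Y i (N * Complex.log ξ) / ξ ^ N with hk
  have key : ∀ i ω, (N * ω : ℂ).re < s → k i (exp ω) = Y i (N * ω) / exp ω ^ N :=
    fun i ω hω => by
      obtain ⟨n, hn⟩ := Complex.exp_eq_exp_iff_exists_int.1 (Complex.exp_log (exp_ne_zero ω))
      have e : (N : ℂ) * Complex.log (exp ω) =
          N * ω + 2 * π * I * ((N * n : ℤ) : ℂ) := by rw [hn]; push_cast; ring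
      simp only [hk]
      rw [e, h.shift_zpow _ _ hω, zpow_mul, zpow_natCast, hσ, one_zpow, Equiv.Perm.one_apply]
  have hop : IsOpen {w : ℂ | w.re < s} := isOpen_lt (by fun_prop) (by fun_prop)
  set D : Set ℂ := ball 0 (Real.exp (s / N)) with hD
  have hD0 : D ∈ 𝓝 0 := Metric.ball_mem_nhds _ (Real.exp_pos _)
  have hlog : ∀ ξ ∈ D \ {0}, ∃ ω, ξ = exp ω ∧ (N * ω : ℂ).re < s := fun ξ hξ => by
    have h0 : ξ ≠ 0 := hξ.2
    refine ⟨Complex.log ξ, (Complex.exp_log h0).symm, (hre _).2 ?_⟩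
    rw [Complex.log_re, Real.log_lt_iff_lt_exp (norm_pos_iff.2 h0)]
    simpa [hD] using hξ.1
  have hd : ∀ i, DifferentiableOn ℂ (k i) (D \ {0}) := fun i ξ hξ => by
    obtain ⟨ω, rfl, hω⟩ := hlog ξ hξ
    refine DifferentiableAt.differentiableWithinAt ?_
    set l : ℂ → ℂ := fun x => ω + Complex.log (x / exp ω) with hl
    have hl0 : l (exp ω) = ω := by simp [hl, exp_ne_zero]
    have hld : DifferentiableAt ℂ l (exp ω) := by
      refine (differentiableAt_const _).add (DifferentiableAt.clog (by fun_prop) ?_)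
      simp [exp_ne_zero]
    have hlN : ∀ᶠ x in 𝓝 (exp ω), (N * l x : ℂ).re < s := by
      have hc : ContinuousAt (fun x => (N * l x : ℂ)) (exp ω) :=
        continuousAt_const.mul hld.continuousAt
      exact hc (hop.mem_nhds (show (N * l (exp ω) : ℂ).re < s by rw [hl0]; exact hω))
    have he : (fun x => Y i (N * l x) / x ^ N) =ᶠ[𝓝 (exp ω)] k i := by
      filter_upwards [hlN, isOpen_ne.mem_nhds (exp_ne_zero ω)] with x hx hx0
      have : exp (l x) = x := by
        simp only [hl, Complex.exp_add]
        rw [Complex.exp_log (div_ne_zero hx0 (exp_ne_zero _))]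
        field_simp [exp_ne_zero]
      have h2 := key i (l x) hx
      rw [this] at h2
      exact h2.symm
    refine DifferentiableAt.congr_of_eventuallyEq ?_ he.symm
    refine DifferentiableAt.div ?_ (by fun_prop) (pow_ne_zero _ (exp_ne_zero _))
    refine DifferentiableAt.comp (g := Y i) (f := fun x => (N * l x : ℂ)) _ ?_ (hld.const_mul _)
    rw [hl0]
    exact (h.an i).differentiableAt (hop.mem_nhds hω)
  have hb : ∀ i, BddAbove (norm ∘ k i '' (D \ {0})) := fun i => ⟨C, by
    rintro _ ⟨ξ, hξ, rfl⟩
    obtain ⟨ω, rfl, hω⟩ := hlog ξ hξ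
    simp only [Function.comp]
    rw [key i ω hω, norm_div, div_le_iff₀ (by simp [exp_ne_zero])]
    have := h.bound i _ hω
    rwa [Complex.exp_nat_mul] at this⟩
  refine ⟨fun i => Function.update (k i) 0 (limUnder (𝓝[≠] 0) (k i)), fun i => ?_, fun i ω hω => ?_⟩
  · exact (Complex.differentiableOn_update_limUnder_of_bddAbove hD0 (hd i) (hb i)).analyticAt hD0
  · simp only [sheet]
    rw [Function.update_of_ne (exp_ne_zero _), key i ω hω]
    field_simp [exp_ne_zero]

lemma RootSystem.puiseux (h : RootSystem σ Y s C) (hN : 1 ≤ N) (hσ : σ ^ N = 1) {g : ι → ℂ → ℂ}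
    (hg : ∀ i, AnalyticAt ℂ (g i) 0)
    (hgY : ∀ i ω, (N * ω : ℂ).re < s → Y i (N * ω) = sheet N g i ω) (i : ι) :
    Puiseux N (σ.subtypePerm (p := σ.SameCycle i) fun _ => Equiv.Perm.sameCycle_apply_right)
      fun j => g j := by
  classical
  have hN0 : (N : ℂ) ≠ 0 := by exact_mod_cast (by lia : N ≠ 0)
  have hNr : (0:ℝ) < N := by exact_mod_cast hN
  have hre : ∀ ω : ℂ, (N * ω : ℂ).re < s ↔ ω.re < s / N := fun ω => by
    rw [lt_div_iff₀ hNr]; simp [mul_comm]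
  have hev := eventually_log_re_lt (s / N)
  refine ⟨hN, ?_, fun a b => ?_, fun j => hg j, fun j => ?_, fun a b hab => ?_⟩
  · ext x
    simp [Equiv.Perm.subtypePerm_pow, hσ]
  · obtain ⟨n, -, -, hn⟩ := (a.2.symm.trans b.2).exists_pow_eq
    exact ⟨n, Subtype.ext (by simpa [Equiv.Perm.subtypePerm_pow] using hn)⟩
  · filter_upwards [hev] with ξ hξ
    have h1 := (hre _).2 hξ.2
    have h2 : (N * (Complex.log ξ + 2 * π * I / N) : ℂ) =
        N * Complex.log ξ + 2 * π * I := by field_simp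
    have e1 := hgY j (Complex.log ξ + 2 * π * I / N) (by
      rw [h2]; simpa using h1)
    have e2 := hgY (σ j) _ h1
    rw [h2, h.shift _ _ h1, e2] at e1
    simp only [sheet] at e1
    rw [exp_rot, mul_pow, exp_rot_pow hN, mul_one, Complex.exp_log hξ.1] at e1
    exact (mul_left_cancel₀ (pow_ne_zero _ hξ.1) e1).symm
  · filter_upwards [hev] with ξ hξ he
    have h1 := (hre _).2 hξ.2
    have e1 := hgY a _ h1
    have e2 := hgY b _ h1
    simp only [sheet] at e1 e2
    rw [Complex.exp_log hξ.1] at e1 e2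
    exact h.ne _ _ _ h1 (fun e => hab (Subtype.ext e)) (by rw [e1, e2, he])

end RootSystemClasses

section CountBranches
variable {ι ι' : Type} [Fintype ι] [Fintype ι'] {σ : Equiv.Perm ι} {σ' : Equiv.Perm ι'}
  {Y : ι → ℂ → ℂ} {Y' : ι' → ℂ → ℂ} {s s' C C' : ℝ} {N : ℕ}
  {V V' S S' : Set (ℂ × ℂ)} {f f' : ℂ × ℂ → ℂ × ℂ}

lemma GHomeo.gmap_restrict (hf : GHomeo 0 V 0 V' f f') (h : ∀ᶠ z in 𝓝 0, z ∈ S → f z ∈ S')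
    (h' : ∀ᶠ z in 𝓝 0, z ∈ S' → f' z ∈ S) : GMap 0 ({0} ∪ S) 0 ({0} ∪ S') f := by
  obtain ⟨h0, W, hW, hc, -⟩ := hf.map
  refine ⟨h0, _, inter_mem hW (h.and ((hf.map.tendsto.eventually h').and hf.left)),
    hc.mono inter_subset_left, ?_⟩
  rintro p ⟨-, h1, h2, h3⟩
  constructor
  · rintro (hp | hp)
    · rw [mem_singleton_iff.1 hp, hf.inv.1] at h3
      exact Or.inl h3.symm
    · exact Or.inr (h3 ▸ h2 hp)
  · rintro (hp | hp)
    · rw [mem_singleton_iff.1 hp, h0]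
      exact Or.inl rfl
    · exact Or.inr (h1 hp)

lemma GHomeo.restrict (hf : GHomeo 0 V 0 V' f f') (h : ∀ᶠ z in 𝓝 0, z ∈ S → f z ∈ S')
    (h' : ∀ᶠ z in 𝓝 0, z ∈ S' → f' z ∈ S) : GHomeo 0 ({0} ∪ S) 0 ({0} ∪ S') f f' :=
  ⟨hf.gmap_restrict h h', hf.symm.gmap_restrict h' h, hf.left, hf.right⟩

lemma sheets_congr {p q : ι → Prop} (h : ∀ i, p i ↔ q i) : sheets Y s p = sheets Y s q := by
  rw [show p = q from funext fun i => propext (h i)]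

lemma RootSystem.sameCycle_of_sheets (h : RootSystem σ Y s C) {i j : ι} {z : ℂ × ℂ}
    (hi : z ∈ sheets Y s (σ.SameCycle i)) (hj : z ∈ sheets Y s (σ.SameCycle j)) :
    σ.SameCycle i j := by
  obtain ⟨w, hw, k, hk, rfl⟩ := hi
  obtain ⟨v, hv, l, hl, he⟩ := hj
  exact hk.trans ((h.sameCycle hw hv he).trans hl.symm)

lemma RootSystem.sameCycle_of_comp (h : RootSystem σ Y s C) (hf : GHomeo 0 V 0 V' f f') {i j : ι}
    (h1 : ∀ᶠ z in 𝓝 0, z ∈ sheets Y s (σ.SameCycle i) → f z ∈ S)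
    (h2 : ∀ᶠ z in 𝓝 0, z ∈ S → f' z ∈ sheets Y s (σ.SameCycle j)) : σ.SameCycle i j := by
  have hfr := h.frequently i (p := σ.SameCycle i) (Equiv.Perm.SameCycle.refl σ i)
  obtain ⟨z, hz, h3, h4, h5⟩ :=
    (hfr.and_eventually (h1.and ((hf.map.tendsto.eventually h2).and hf.left))).exists
  have := h4 (h3 hz)
  rw [h5] at this
  exact h.sameCycle_of_sheets hz this

lemma RootSystem.sheets_eq_Vset (hN : 1 ≤ N) {g : ι → ℂ → ℂ}
    (hgY : ∀ i ω, (N * ω : ℂ).re < s → Y i (N * ω) = sheet N g i ω) (i : ι) :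
    {0} ∪ sheets Y s (σ.SameCycle i) =
      Vset N (sheet N fun j : {j // σ.SameCycle i j} => g j) (s / N) := by
  have hN0 : (N : ℂ) ≠ 0 := by exact_mod_cast (by lia : N ≠ 0)
  have hNr : (0:ℝ) < N := by exact_mod_cast hN
  have hre : ∀ ω : ℂ, (N * ω : ℂ).re < s ↔ ω.re < s / N := fun ω => by
    rw [lt_div_iff₀ hNr]; simp [mul_comm]
  refine congrArg ({0} ∪ ·) (Set.ext fun p => ⟨?_, ?_⟩)
  · rintro ⟨w, hw, j, hj, rfl⟩
    have e : (N * (w / N) : ℂ) = w := by field_simp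
    have e1 := hgY j (w / N) (by rw [e]; exact hw)
    rw [e] at e1
    refine ⟨w / N, (hre _).1 (by rw [e]; exact hw), ⟨j, hj⟩, ?_⟩
    rw [e, e1]; rfl
  · rintro ⟨ω, hω, j, rfl⟩
    refine ⟨N * ω, (hre _).2 hω, j, j.2, ?_⟩
    rw [hgY _ _ ((hre _).2 hω)]; rfl

/-- The number of roots is a topological invariant. -/
theorem RootSystem.card_eq (h : RootSystem σ Y s C) (h' : RootSystem σ' Y' s' C')
    (hV : Describes Y s V) (hV' : Describes Y' s' V') (hf : GHomeo 0 V 0 V' f f') :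
    Fintype.card ι = Fintype.card ι' := by
  classical
  choose a ha using h.exists_class h' hV hV' hf
  choose a' ha' using h'.exists_class h hV' hV hf.symm
  have hcard : ∀ i, Fintype.card {j // σ.SameCycle i j} = Fintype.card {j // σ'.SameCycle (a i) j} :=
      fun i => by
    have e1 : σ.SameCycle i (a' (a i)) := h.sameCycle_of_comp hf (ha i) (ha' (a i))
    have e2 := ha' (a i)
    rw [sheets_congr (p := σ.SameCycle (a' (a i))) (q := σ.SameCycle i)
      fun k => ⟨e1.trans, e1.symm.trans⟩] at e2
    have hr := hf.restrict (ha i) e2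
    have p1 : 1 ≤ orderOf σ := orderOf_pos σ
    have p2 : 1 ≤ orderOf σ' := orderOf_pos σ'
    obtain ⟨g, hg, hgY⟩ := h.exists_puiseux p1 (pow_orderOf_eq_one σ)
    obtain ⟨g', hg', hgY'⟩ := h'.exists_puiseux p2 (pow_orderOf_eq_one σ')
    rw [RootSystem.sheets_eq_Vset p1 hgY, RootSystem.sheets_eq_Vset p2 hgY'] at hr
    have : Nonempty {j // σ.SameCycle i j} := ⟨⟨i, Equiv.Perm.SameCycle.refl σ i⟩⟩
    have : Nonempty {j // σ'.SameCycle (a i) j} := ⟨⟨a i, Equiv.Perm.SameCycle.refl σ' _⟩⟩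
    exact (h.puiseux p1 (pow_orderOf_eq_one σ) hg hgY i).card_eq
      (h'.puiseux p2 (pow_orderOf_eq_one σ') hg' hgY' (a i)) hr
  let Q := Quotient (Equiv.Perm.SameCycle.setoid σ)
  let Q' := Quotient (Equiv.Perm.SameCycle.setoid σ')
  have ho : ∀ i, σ.SameCycle (Quotient.mk (Equiv.Perm.SameCycle.setoid σ) i).out i :=
    fun i => Quotient.mk_out (s := Equiv.Perm.SameCycle.setoid σ) i
  have ho' : ∀ i, σ'.SameCycle (Quotient.mk (Equiv.Perm.SameCycle.setoid σ') i).out i :=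
    fun i => Quotient.mk_out (s := Equiv.Perm.SameCycle.setoid σ') i
  let e : Q ≃ Q' :=
    { toFun := fun q => Quotient.mk _ (a q.out)
      invFun := fun q => Quotient.mk _ (a' q.out)
      left_inv := fun q => by
        have e1 := ho' (a q.out)
        have e2 := ha' (Quotient.mk (Equiv.Perm.SameCycle.setoid σ') (a q.out)).out
        rw [sheets_congr (q := σ'.SameCycle (a q.out)) fun k => ⟨e1.symm.trans, e1.trans⟩] at e2
        have e3 := h.sameCycle_of_comp hf (ha q.out) e2
        exact (Quotient.sound (s := Equiv.Perm.SameCycle.setoid σ) e3.symm).trans q.out_eq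
      right_inv := fun q => by
        have e1 := ho (a' q.out)
        have e2 := ha (Quotient.mk (Equiv.Perm.SameCycle.setoid σ) (a' q.out)).out
        rw [sheets_congr (q := σ.SameCycle (a' q.out)) fun k => ⟨e1.symm.trans, e1.trans⟩] at e2
        have e3 := h'.sameCycle_of_comp hf.symm (ha' q.out) e2
        exact (Quotient.sound (s := Equiv.Perm.SameCycle.setoid σ') e3.symm).trans q.out_eq }
  have hfib : ∀ q : Q, Fintype.card {j // Quotient.mk _ j = q} =
      Fintype.card {j // Quotient.mk _ j = e q} := fun q => by
    have c1 : Fintype.card {j // Quotient.mk _ j = q} = Fintype.card {j // σ.SameCycle q.out j} :=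
      Fintype.card_congr (Equiv.subtypeEquivRight fun j => by
        rw [Quotient.mk_eq_iff_out]; exact ⟨fun h => h.symm, fun h => h.symm⟩)
    have c2 : Fintype.card {j // Quotient.mk _ j = e q} =
        Fintype.card {j // σ'.SameCycle (a q.out) j} :=
      Fintype.card_congr (Equiv.subtypeEquivRight fun j => by
        change Quotient.mk _ j = Quotient.mk _ (a q.out) ↔ _
        rw [Quotient.eq]; exact ⟨fun h => h.symm, fun h => h.symm⟩)
    rw [c1, c2, hcard]
  rw [← Fintype.card_congr (Equiv.sigmaFiberEquiv fun j => (Quotient.mk _ j : Q)),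
    ← Fintype.card_congr (Equiv.sigmaFiberEquiv fun j => (Quotient.mk _ j : Q')),
    Fintype.card_sigma, Fintype.card_sigma]
  exact Fintype.sum_equiv e _ _ hfib

end CountBranches

section Factor

lemma exists_eq_pow_mul {f : ℂ → ℂ} {K : Set ℂ} {a : ℂ} (hf : AnalyticOnNhd ℂ f K)
    (hf0 : ¬ ∀ᶠ y in 𝓝 a, f y = 0) (ha : a ∈ K) : ∃ (k : ℕ) (g : ℂ → ℂ), AnalyticOnNhd ℂ g K ∧
      g a ≠ 0 ∧ ∀ y, y ∈ K → f y = (y - a) ^ k * g y := by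
  classical
  have h1 : analyticOrderAt f a ≠ ⊤ := fun h => hf0 (analyticOrderAt_eq_top.1 h)
  obtain ⟨g, hg, hga, hfg⟩ := (hf a ha).analyticOrderAt_ne_top.1 h1
  set k := analyticOrderNatAt f a
  refine ⟨k, fun y => if y = a then g a else f y / (y - a) ^ k, ?_, by simpa using hga, ?_⟩
  · intro y hy
    by_cases hya : y = a
    · subst hya
      refine hg.congr ?_
      filter_upwards [hfg] with z hz
      split_ifs with h
      · rw [h]
      · rw [hz, smul_eq_mul, mul_div_cancel_left₀ _ (pow_ne_zero _ (sub_ne_zero.2 h))]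
    · have h2 : AnalyticAt ℂ (fun y => f y / (y - a) ^ k) y :=
        (hf y hy).div (by fun_prop) (pow_ne_zero _ (sub_ne_zero.2 hya))
      refine h2.congr ?_
      filter_upwards [isOpen_ne.mem_nhds hya] with z hz
      rw [if_neg hz]
  · intro y hy
    by_cases hya : y = a
    · subst hya
      simpa using hfg.self_of_nhds
    · simp only [if_neg hya]
      rw [mul_div_cancel₀ _ (pow_ne_zero _ (sub_ne_zero.2 hya))]

lemma exists_factor_of_finset {K : Set ℂ} (Z : Finset ℂ) (hZ : ↑Z ⊆ interior K) :
    ∀ f : ℂ → ℂ, AnalyticOnNhd ℂ f K → (∀ a ∈ Z, ¬ ∀ᶠ y in 𝓝 a, f y = 0) →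
      (∀ y ∈ K, f y = 0 → y ∈ Z) → ∃ (l : List ℂ) (U : ℂ → ℂ), (∀ a ∈ l, a ∈ Z) ∧
        AnalyticOnNhd ℂ U K ∧ (∀ y ∈ K, U y ≠ 0) ∧
        ∀ y, y ∈ K → f y = (l.map fun a => y - a).prod * U y := by
  classical
  induction Z using Finset.induction_on with
  | empty => exact fun f hf _ h => ⟨[], f, by simp, hf, fun y hy h0 => by simpa using h y hy h0,
      by simp⟩
  | insert a Z ha ih =>
    intro f hf h0 h
    have haK : a ∈ K := interior_subset (hZ (by simp))
    obtain ⟨k, g, hg, hga, hfg⟩ := exists_eq_pow_mul hf (h0 a (by simp)) haK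
    obtain ⟨l, U, hl, hU, hU0, hgU⟩ := ih (fun z hz => hZ (by simp [Finset.mem_coe.1 hz])) g hg
      (fun b hb hgb => by
        refine h0 b (by simp [hb]) ?_
        filter_upwards [hgb, mem_interior_iff_mem_nhds.1 (hZ (by simp [hb] : b ∈ _))] with y hy hyK
        rw [hfg y hyK, hy, mul_zero])
      (fun y hy hy0 => by
        have h1 := h y hy (by rw [hfg y hy, hy0, mul_zero])
        rcases Finset.mem_insert.1 h1 with h1 | h1
        · exact absurd (h1 ▸ hy0) hga
        · exact h1)
    refine ⟨List.replicate k a ++ l, U, ?_, hU, hU0, fun y hy => ?_⟩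
    · intro b hb
      rcases List.mem_append.1 hb with hb | hb
      · simp [List.eq_of_mem_replicate hb]
      · simp [hl b hb]
    · rw [hfg y hy, hgU y hy]
      simp [mul_assoc]

lemma exists_factor {f : ℂ → ℂ} {ρ : ℝ} (hρ : 0 < ρ) (hf : AnalyticOnNhd ℂ f (closedBall 0 ρ))
    (hs : ∀ y ∈ sphere 0 ρ, f y ≠ 0) : ∃ (n : ℕ) (a : Fin n → ℂ) (U : ℂ → ℂ),
      (∀ i, a i ∈ ball 0 ρ) ∧ AnalyticOnNhd ℂ U (closedBall 0 ρ) ∧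
      (∀ y ∈ closedBall 0 ρ, U y ≠ 0) ∧
      ∀ y, y ∈ closedBall 0 ρ → f y = (∏ i, (y - a i)) * U y := by
  have hpc : IsPreconnected (closedBall (0 : ℂ) ρ) := (convex_closedBall 0 ρ).isPreconnected
  have hρs : (ρ : ℂ) ∈ sphere 0 ρ := by simp [abs_of_pos hρ]
  have h0 : ∀ a ∈ closedBall (0 : ℂ) ρ, ¬ ∀ᶠ y in 𝓝 a, f y = 0 := fun a ha h =>
    hs ρ hρs (hf.eqOn_zero_of_preconnected_of_eventuallyEq_zero hpc ha h
      (sphere_subset_closedBall hρs))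
  have hfin : {y ∈ closedBall (0 : ℂ) ρ | f y = 0}.Finite := by
    by_contra hinf
    obtain ⟨a, ha, hacc⟩ := Set.Infinite.exists_accPt_of_subset_isCompact hinf
      (isCompact_closedBall (0 : ℂ) ρ) (fun y hy => hy.1)
    refine h0 a ha ?_
    rcases (hf a ha).eventually_eq_zero_or_eventually_ne_zero with h | h
    · exact h
    · have h2 := accPt_iff_frequently_nhdsNE.1 hacc
      exact absurd h2 (not_frequently.2 (h.mono fun y hy hyS => hy hyS.2))
  have hball : ∀ y ∈ hfin.toFinset, y ∈ ball (0 : ℂ) ρ := by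
    intro y hy
    have h1 := hfin.mem_toFinset.1 hy
    rcases (mem_closedBall.1 h1.1).lt_or_eq with h | h
    · exact h
    · exact absurd h1.2 (hs _ h)
  obtain ⟨l, U, hl, hU, hU0, hfU⟩ := exists_factor_of_finset hfin.toFinset
    (K := closedBall 0 ρ) (fun y hy => by
      rw [interior_closedBall _ hρ.ne']
      exact hball y hy) f hf (fun a ha => h0 a (hfin.mem_toFinset.1 ha).1)
    (fun y hy h => hfin.mem_toFinset.2 ⟨hy, h⟩)
  refine ⟨l.length, fun i => l.get i, U, fun i => hball _ (hl _ (l.get_mem i)), hU, hU0,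
    fun y hy => ?_⟩
  rw [hfU y hy, ← List.prod_ofFn]
  congr 2
  conv_lhs => rw [← List.ofFn_get l, List.map_ofFn]
  rfl

lemma circleIntegral_pow_mul_logDeriv {f U : ℂ → ℂ} {ρ : ℝ} {n : ℕ} {a : Fin n → ℂ} (hρ : 0 < ρ)
    (ha : ∀ i, a i ∈ ball 0 ρ) (hU : AnalyticOnNhd ℂ U (closedBall 0 ρ))
    (hU0 : ∀ y ∈ closedBall 0 ρ, U y ≠ 0)
    (hf : AnalyticOnNhd ℂ f (closedBall 0 ρ))
    (hfU : ∀ y, y ∈ closedBall 0 ρ → f y = (∏ i, (y - a i)) * U y) (k : ℕ) :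
    (∮ y in C(0, ρ), y ^ k * logDeriv f y) = 2 * π * I * ∑ i, a i ^ k := by
  have hne : ∀ y ∈ sphere (0 : ℂ) ρ, ∀ i, y - a i ≠ 0 := by
    intro y hy i h
    have h1 := mem_ball.1 (ha i)
    rw [← sub_eq_zero.1 h] at h1
    exact h1.ne (mem_sphere.1 hy)
  have hlog : ∀ y ∈ sphere (0 : ℂ) ρ, y ^ k * logDeriv f y =
      (∑ i, (y - a i)⁻¹ * y ^ k) + y ^ k * logDeriv U y := by
    intro y hy
    have hyK := sphere_subset_closedBall hy
    have hUd := (hU y hyK).differentiableAt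
    have hud : UniqueDiffWithinAt ℂ (closedBall (0 : ℂ) ρ) y :=
      uniqueDiffWithinAt_convex_of_isRCLikeNormedField (convex_closedBall 0 ρ)
        (by rw [interior_closedBall _ hρ.ne']; exact nonempty_ball.2 hρ) (subset_closure hyK)
    have hev : deriv f y = deriv (fun y => (∏ i, (y - a i)) * U y) y := by
      have h1 : DifferentiableAt ℂ (fun y => (∏ i, (y - a i)) * U y) y :=
        (by fun_prop : DifferentiableAt ℂ (fun y => ∏ i, (y - a i)) y).mul hUd
      rw [← (hf y hyK).differentiableAt.derivWithin hud, ← h1.derivWithin hud]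
      exact derivWithin_congr hfU (hfU y hyK)
    have h1 : logDeriv f y = logDeriv (fun y => (∏ i, (y - a i)) * U y) y := by
      rw [logDeriv_apply, logDeriv_apply, hev, hfU y hyK]
    rw [h1, logDeriv_mul (f := fun y => ∏ i, (y - a i)) y
      (Finset.prod_ne_zero_iff.2 fun i _ => hne y hy i) (hU0 y hyK) (by fun_prop) hUd,
      logDeriv_prod (fun i _ => hne y hy i) (fun i _ => by fun_prop), mul_add, Finset.mul_sum]
    congr 1
    refine Finset.sum_congr rfl fun i _ => ?_
    rw [logDeriv_apply, deriv_sub_const, deriv_id'', one_div, mul_comm]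
  have hc2 : DiffContOnCl ℂ (fun y => y ^ k * logDeriv U y) (ball 0 ρ) := by
    have : DifferentiableOn ℂ (fun y => y ^ k * logDeriv U y) (closedBall 0 ρ) := fun y hy => by
      have h1 : DifferentiableAt ℂ (fun y => y ^ k * (deriv U y / U y)) y :=
        (by fun_prop : DifferentiableAt ℂ (fun y => y ^ k) y).mul
          ((hU y hy).deriv.differentiableAt.div (hU y hy).differentiableAt (hU0 y hy))
      exact h1.differentiableWithinAt
    exact this.diffContOnCl_ball subset_rfl
  have hci : ∀ i, CircleIntegrable (fun y => (y - a i)⁻¹ * y ^ k) 0 ρ := fun i =>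
    ContinuousOn.circleIntegrable hρ.le (ContinuousOn.mul
      (ContinuousOn.inv₀ (by fun_prop) fun y hy => hne y hy i) (by fun_prop))
  rw [circleIntegral.integral_congr hρ.le hlog, circleIntegral.integral_add
    (CircleIntegrable.fun_sum _ fun i _ => hci i) (ContinuousOn.circleIntegrable hρ.le
      (hc2.continuousOn.mono (by
        rw [closure_ball _ hρ.ne']
        exact sphere_subset_closedBall))), circleIntegral.integral_fun_sum fun i _ => hci i,
    hc2.circleIntegral_eq_zero hρ.le, add_zero, Finset.mul_sum]
  refine Finset.sum_congr rfl fun i _ => ?_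
  have h := (by fun_prop : Differentiable ℂ fun y : ℂ => y ^ k).diffContOnCl (s := ball 0 ρ)
  simpa using h.circleIntegral_sub_inv_smul (ha i)

lemma differentiableOn_circleIntegral {H : ℂ → ℂ → ℂ} {r ρ : ℝ} (hρ : 0 < ρ)
    (hH : ∀ x ∈ ball (0 : ℂ) r, ∀ y ∈ sphere (0 : ℂ) ρ,
      AnalyticAt ℂ (fun p : ℂ × ℂ => H p.1 p.2) (x, y)) :
    DifferentiableOn ℂ (fun x => ∮ y in C(0, ρ), H x y) (ball 0 r) := by
  intro x₀ hx₀
  obtain ⟨ε, hε, hεr⟩ := Metric.nhds_basis_closedBall.mem_iff.1 (isOpen_ball.mem_nhds hx₀)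
  set D : ℂ × ℂ → ℂ := fun p => fderiv ℂ (fun p : ℂ × ℂ => H p.1 p.2) p (1, 0) with hD
  have hm : ∀ θ : ℝ, circleMap 0 ρ θ ∈ sphere (0 : ℂ) ρ := fun θ => circleMap_mem_sphere 0 hρ.le θ
  have hDc : ContinuousOn D (closedBall x₀ ε ×ˢ sphere 0 ρ) := fun p hp =>
    ((hH p.1 (hεr hp.1) p.2 hp.2).fderiv.continuousAt.clm_apply
      continuousAt_const).continuousWithinAt
  obtain ⟨M, hM⟩ := ((isCompact_closedBall x₀ ε).prod (isCompact_sphere (0 : ℂ) ρ)).exists_bound_of_continuousOn hDc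
  have hdc : Continuous (deriv (circleMap (0 : ℂ) ρ)) := by
    have := continuous_circleMap (0 : ℂ) ρ
    have h1 : deriv (circleMap (0 : ℂ) ρ) = fun θ => circleMap 0 ρ θ * I :=
      funext fun θ => deriv_circleMap 0 ρ θ
    rw [h1]
    fun_prop
  have hHc : ∀ x ∈ ball (0 : ℂ) r, Continuous fun θ : ℝ => deriv (circleMap 0 ρ) θ • H x (circleMap 0 ρ θ) := by
    intro x hx
    refine continuous_iff_continuousAt.2 fun θ => ?_
    have h1 := (hH x hx _ (hm θ)).continuousAt
    have h2 : ContinuousAt (fun θ : ℝ => (x, circleMap 0 ρ θ)) θ := by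
      have := continuous_circleMap (0 : ℂ) ρ
      fun_prop
    have h3 : ContinuousAt (fun θ : ℝ => H x (circleMap 0 ρ θ)) θ :=
      ContinuousAt.comp (f := fun θ : ℝ => (x, circleMap 0 ρ θ)) h1 h2
    exact ContinuousAt.smul (hdc.continuousAt) h3
  have key := intervalIntegral.hasDerivAt_integral_of_dominated_loc_of_deriv_le
    (𝕜 := ℂ) (μ := MeasureTheory.volume) (a := 0) (b := 2 * π) (x₀ := x₀)
    (F := fun x θ => deriv (circleMap 0 ρ) θ • H x (circleMap 0 ρ θ))
    (F' := fun x θ => deriv (circleMap 0 ρ) θ • D (x, circleMap 0 ρ θ))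
    (s := ball x₀ ε) (bound := fun _ => ρ * M) (ball_mem_nhds x₀ hε) ?_ ?_ ?_ ?_ ?_ ?_
  · exact key.2.differentiableAt.differentiableWithinAt
  · filter_upwards [isOpen_ball.mem_nhds hx₀] with x hx
    exact (hHc x hx).aestronglyMeasurable
  · exact (hHc x₀ hx₀).intervalIntegrable _ _
  · refine Continuous.aestronglyMeasurable ?_
    refine continuous_iff_continuousAt.2 fun θ => ?_
    have := continuous_circleMap (0 : ℂ) ρ
    refine hdc.continuousAt.smul ?_
    have h1 : ContinuousAt D (x₀, circleMap 0 ρ θ) := (hH x₀ hx₀ _ (hm θ)).fderiv.continuousAt.clm_apply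
      continuousAt_const
    exact ContinuousAt.comp (f := fun θ : ℝ => (x₀, circleMap 0 ρ θ)) h1 (by fun_prop)
  · refine Eventually.of_forall fun θ _ x hx => ?_
    rw [norm_smul, deriv_circleMap]
    have h1 := hM (x, circleMap 0 ρ θ) ⟨ball_subset_closedBall hx, hm θ⟩
    simp only [norm_mul, norm_circleMap_zero, Complex.norm_I, mul_one, abs_of_pos hρ]
    gcongr
  · exact intervalIntegrable_const
  · refine Eventually.of_forall fun θ _ x hx => ?_
    have h1 := (hH x (hεr (ball_subset_closedBall hx)) _ (hm θ)).differentiableAt.hasFDerivAt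
    have h2 : HasDerivAt (fun x : ℂ => (x, circleMap 0 ρ θ)) (1, 0) x :=
      (hasDerivAt_id x).prodMk (hasDerivAt_const x _)
    exact (h1.comp_hasDerivAt x h2).const_smul (deriv (circleMap 0 ρ) θ)
end Factor

section Polydisc
open scoped ContDiff

lemma exists_root {F : ℂ × ℂ → ℂ} {q : ℂ × ℂ} (hF : AnalyticAt ℂ F q) (h0 : F q = 0)
    (hy : fderiv ℂ F q (0, 1) ≠ 0) : ∃ γ : ℂ → ℂ, AnalyticAt ℂ γ q.1 ∧ γ q.1 = q.2 ∧
      ∀ᶠ p in 𝓝 q, F p = 0 ↔ p.2 = γ p.1 := by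
  have h1 : ContDiffAt ℂ ω F q := hF.contDiffAt
  have h2 : (fderiv ℂ F q ∘L .inr ℂ ℂ ℂ).IsInvertible := by
    refine ⟨ContinuousLinearEquiv.unitsEquivAut ℂ (Units.mk0 _ hy), ?_⟩
    ext
    simp
  refine ⟨h1.implicitFunction (by simp) h2, (h1.contDiffAt_implicitFunction _ h2).analyticAt, h1.implicitFunction_apply_self _ h2, ?_⟩
  filter_upwards [h1.eventually_apply_eq_iff_implicitFunction (by simp) h2] with p hp
  rw [← h0, hp, eq_comm]

/-- A polydisc adapted to the zero set of `F`, which meets it inside the cone `‖y‖ ≤ C * ‖x‖`. -/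
structure Adapted (F : ℂ × ℂ → ℂ) (r ρ C : ℝ) : Prop where
  r_pos : 0 < r
  ρ_pos : 0 < ρ
  an : ∀ x y, ‖x‖ < r → ‖y‖ ≤ ρ → AnalyticAt ℂ F (x, y)
  smooth : ∀ x y, ‖x‖ < r → ‖y‖ ≤ ρ → (x, y) ≠ 0 → fderiv ℂ F (x, y) ≠ 0
  cone : ∀ x y, ‖x‖ < r → ‖y‖ ≤ ρ → F (x, y) = 0 → ‖y‖ ≤ C * ‖x‖
  sphere : ∀ x y, ‖x‖ < r → ‖y‖ = ρ → F (x, y) ≠ 0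

namespace Adapted
variable {F : ℂ × ℂ → ℂ} {r ρ C : ℝ} {n : ℕ} {x y : ℂ}

lemma analyticOnNhd (h : Adapted F r ρ C) (hx : ‖x‖ < r) :
    AnalyticOnNhd ℂ (fun y => F (x, y)) (closedBall 0 ρ) := fun y hy =>
  (h.an x y hx (mem_closedBall_zero_iff.1 hy)).along_snd

lemma hasDerivAt (h : Adapted F r ρ C) (hx : ‖x‖ < r) (hy : ‖y‖ ≤ ρ) :
    HasDerivAt (fun y => F (x, y)) (fderiv ℂ F (x, y) (0, 1)) y :=
  (h.an x y hx hy).differentiableAt.hasFDerivAt.comp_hasDerivAt y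
    ((hasDerivAt_const y x).prodMk (hasDerivAt_id y))

lemma exists_factor (h : Adapted F r ρ C) (hx : ‖x‖ < r) : ∃ (n : ℕ) (a : Fin n → ℂ) (U : ℂ → ℂ),
      (∀ i, a i ∈ ball 0 ρ) ∧ AnalyticOnNhd ℂ U (closedBall 0 ρ) ∧
      (∀ y ∈ closedBall 0 ρ, U y ≠ 0) ∧
      ∀ y, y ∈ closedBall 0 ρ → F (x, y) = (∏ i, (y - a i)) * U y :=
  BurauZariski.exists_factor h.ρ_pos (h.analyticOnNhd hx) fun y hy =>
    h.sphere x y hx (mem_sphere_zero_iff_norm.1 hy)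

/-- The `k`-th power sum of the zeros of `F (x, ·)` in the disc of radius `ρ`. -/
def powerSum (F : ℂ × ℂ → ℂ) (ρ : ℝ) (k : ℕ) (x : ℂ) : ℂ :=
  (2 * π * I)⁻¹ * ∮ y in C(0, ρ), y ^ k * (fderiv ℂ F (x, y) (0, 1) / F (x, y))

lemma powerSum_eq (h : Adapted F r ρ C) (hx : ‖x‖ < r) {a : Fin n → ℂ} {U : ℂ → ℂ}
    (ha : ∀ i, a i ∈ ball 0 ρ) (hU : AnalyticOnNhd ℂ U (closedBall 0 ρ))
    (hU0 : ∀ y ∈ closedBall 0 ρ, U y ≠ 0)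
    (hF : ∀ y, y ∈ closedBall 0 ρ → F (x, y) = (∏ i, (y - a i)) * U y) (k : ℕ) :
    powerSum F ρ k x = ∑ i, a i ^ k := by
  have h1 := circleIntegral_pow_mul_logDeriv h.ρ_pos ha hU hU0 (h.analyticOnNhd hx) hF k
  rw [powerSum, inv_mul_eq_iff_eq_mul₀ (by simp [Real.pi_ne_zero]), ← h1]
  refine circleIntegral.integral_congr h.ρ_pos.le fun y hy => ?_
  simp only [logDeriv_apply, (h.hasDerivAt hx (mem_sphere_zero_iff_norm.1 hy).le).deriv]

lemma differentiableOn_powerSum (h : Adapted F r ρ C) (k : ℕ) :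
    DifferentiableOn ℂ (powerSum F ρ k) (ball 0 r) := by
  refine DifferentiableOn.const_mul ?_ _
  refine differentiableOn_circleIntegral h.ρ_pos
    (H := fun x y => y ^ k * (fderiv ℂ F (x, y) (0, 1) / F (x, y))) fun x hx y hy => ?_
  rw [mem_ball_zero_iff] at hx
  rw [mem_sphere_zero_iff_norm] at hy
  have h1 := h.an x y hx hy.le
  have h2 : AnalyticAt ℂ (fun p : ℂ × ℂ => fderiv ℂ F p (0, 1)) (x, y) :=
    ((ContinuousLinearMap.apply ℂ ℂ ((0, 1) : ℂ × ℂ)).analyticAt _).comp h1.fderiv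
  exact (analyticAt_snd.pow k).mul (h2.div h1 (h.sphere x y hx hy))

lemma eq_order (h : Adapted F r ρ C) {ν : ℕ} (hν : analyticOrderAt (fun y => F (0, y)) 0 = ν)
    {a : Fin n → ℂ} {U : ℂ → ℂ} (ha : ∀ i, a i ∈ ball 0 ρ)
    (hU : AnalyticOnNhd ℂ U (closedBall 0 ρ)) (hU0 : ∀ y ∈ closedBall 0 ρ, U y ≠ 0)
    (hF : ∀ y, y ∈ closedBall 0 ρ → F (0, y) = (∏ i, (y - a i)) * U y) : n = ν := by
  have ha0 : ∀ i, a i = 0 := fun i => by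
    have h1 := h.cone 0 (a i) (by simpa using h.r_pos) (mem_ball_zero_iff.1 (ha i)).le
      (by rw [hF _ (ball_subset_closedBall (ha i)), Finset.prod_eq_zero (Finset.mem_univ i)
        (sub_self _), zero_mul])
    simpa using h1
  have h0 : (0 : ℂ) ∈ closedBall (0 : ℂ) ρ := mem_closedBall_self h.ρ_pos.le
  have h2 : analyticOrderAt (fun y => F (0, y)) 0 = n :=
    (h.analyticOnNhd (by simpa using h.r_pos) 0 h0).analyticOrderAt_eq_natCast.2
      ⟨U, hU 0 h0, hU0 0 h0, by
        filter_upwards [closedBall_mem_nhds (0 : ℂ) h.ρ_pos] with y hy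
        rw [hF y hy]
        simp [ha0]⟩
  rw [hν] at h2
  exact_mod_cast h2.symm

/-- The zeros of `F (x, ·)` in the disc of radius `ρ`, listed by `a` with multiplicities. -/
structure Roots (F : ℂ × ℂ → ℂ) (ρ : ℝ) (x : ℂ) (a : Fin n → ℂ) : Prop where
  mem : ∀ i, ‖a i‖ < ρ
  fac : ∃ U : ℂ → ℂ, AnalyticOnNhd ℂ U (closedBall 0 ρ) ∧ (∀ y ∈ closedBall 0 ρ, U y ≠ 0) ∧
      ∀ y, y ∈ closedBall 0 ρ → F (x, y) = (∏ i, (y - a i)) * U y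

lemma exists_roots (h : Adapted F r ρ C) {ν : ℕ}
    (hν : analyticOrderAt (fun y => F (0, y)) 0 = ν) (hx : ‖x‖ < r) :
    ∃ a : Fin ν → ℂ, Roots F ρ x a := by
  have hP : ∀ z, ‖z‖ < r → ∃ n : ℕ, powerSum F ρ 0 z = n ∧
      ∃ a : Fin n → ℂ, Roots F ρ z a := fun z hz => by
    obtain ⟨n, a, U, ha, hU, hU0, hF⟩ := h.exists_factor hz
    exact ⟨n, by simp [h.powerSum_eq hz ha hU hU0 hF 0], a,
      fun i => mem_ball_zero_iff.1 (ha i), U, hU, hU0, hF⟩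
  have h0 : ‖(0 : ℂ)‖ < r := by simpa using h.r_pos
  have hc := (h.differentiableOn_powerSum 0).continuousOn
  have hconst : powerSum F ρ 0 x = powerSum F ρ 0 0 := by
    refine const_of_locConst (E := ball (0 : ℂ) r) (convex_ball _ _).isPreconnected
      (fun p hp => ?_) (mem_ball_zero_iff.2 hx) (mem_ball_zero_iff.2 h0)
    have h1 : {z | dist (powerSum F ρ 0 z) (powerSum F ρ 0 p) < 1} ∈ 𝓝[ball 0 r] p :=
      (hc p hp).eventually (ball_mem_nhds _ one_pos)
    refine ⟨_, inter_mem h1 self_mem_nhdsWithin, fun z hz => ?_⟩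
    obtain ⟨m, hm, -⟩ := hP z (mem_ball_zero_iff.1 hz.2)
    obtain ⟨m', hm', -⟩ := hP p (mem_ball_zero_iff.1 hp)
    have h2 : dist (powerSum F ρ 0 z) (powerSum F ρ 0 p) < 1 := hz.1
    rw [hm, hm', dist_eq_norm] at h2
    have h3 : ‖((m - m' : ℤ) : ℂ)‖ < 1 := by simpa using h2
    rw [Complex.norm_intCast] at h3
    have h4 : |(m - m' : ℤ)| < 1 := by exact_mod_cast h3
    rw [hm, hm']
    have : m = m' := by
      rw [Int.abs_lt_one_iff] at h4
      omega
    rw [this]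
  obtain ⟨m, hm, a, ha⟩ := hP x hx
  obtain ⟨m', hm', a', ha'⟩ := hP 0 h0
  obtain ⟨U, hU, hU0, hF⟩ := ha'.fac
  have h1 := h.eq_order hν (fun i => mem_ball_zero_iff.2 (ha'.mem i)) hU hU0 hF
  rw [hm, hm'] at hconst
  have h2 : m = ν := by rw [← h1]; exact_mod_cast hconst
  subst h2
  exact ⟨a, ha⟩

lemma Roots.eq_zero_iff {a : Fin n → ℂ} (h : Roots F ρ x a) (hy : ‖y‖ ≤ ρ) :
    F (x, y) = 0 ↔ ∃ i, y = a i := by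
  obtain ⟨U, -, hU0, hF⟩ := h.fac
  have hy' : y ∈ closedBall (0 : ℂ) ρ := mem_closedBall_zero_iff.2 hy
  rw [hF y hy', mul_eq_zero, or_iff_left (hU0 y hy'), Finset.prod_eq_zero_iff]
  simp [sub_eq_zero]

lemma Roots.fderiv_eq (h : Adapted F r ρ C) (hx : ‖x‖ < r) {a : Fin n → ℂ}
    (ha : Roots F ρ x a) (i : Fin n) : ∃ u : ℂ, u ≠ 0 ∧
      fderiv ℂ F (x, a i) (0, 1) = (∏ j ∈ Finset.univ.erase i, (a i - a j)) * u := by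
  obtain ⟨U, hU, hU0, hF⟩ := ha.fac
  have hi : a i ∈ ball (0 : ℂ) ρ := mem_ball_zero_iff.2 (ha.mem i)
  have hi' := ball_subset_closedBall hi
  refine ⟨U (a i), hU0 _ hi', (h.hasDerivAt hx (ha.mem i).le).unique ?_⟩
  have h1 : HasDerivAt (fun y => (y - a i) * ((∏ j ∈ Finset.univ.erase i, (y - a j)) * U y))
      (1 * ((∏ j ∈ Finset.univ.erase i, (a i - a j)) * U (a i)) + (a i - a i) *
        deriv (fun y => (∏ j ∈ Finset.univ.erase i, (y - a j)) * U y) (a i)) (a i) :=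
    ((hasDerivAt_id (a i)).sub_const (a i)).mul (DifferentiableAt.hasDerivAt
      ((by fun_prop : DifferentiableAt ℂ (fun y => ∏ j ∈ Finset.univ.erase i, (y - a j)) _).mul
        (hU _ hi').differentiableAt))
  rw [sub_self, zero_mul, add_zero, one_mul] at h1
  refine h1.congr_of_eventuallyEq ?_
  filter_upwards [isOpen_ball.mem_nhds hi] with y hy
  rw [hF y (ball_subset_closedBall hy), ← mul_assoc,
    Finset.mul_prod_erase _ (fun j => y - a j) (Finset.mem_univ i)]

lemma Roots.injective_iff (h : Adapted F r ρ C) (hx : ‖x‖ < r) {a : Fin n → ℂ}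
    (ha : Roots F ρ x a) : Function.Injective a ↔ ∀ i, fderiv ℂ F (x, a i) (0, 1) ≠ 0 := by
  constructor
  · intro hinj i
    obtain ⟨u, hu, h1⟩ := Roots.fderiv_eq h hx ha i
    rw [h1]
    refine mul_ne_zero (Finset.prod_ne_zero_iff.2 fun j hj => sub_ne_zero.2 fun h2 => ?_) hu
    exact (Finset.ne_of_mem_erase hj) (hinj h2).symm
  · intro hd i j hij
    by_contra hne
    obtain ⟨u, hu, h1⟩ := Roots.fderiv_eq h hx ha i
    refine hd i ?_
    rw [h1, Finset.prod_eq_zero (Finset.mem_erase.2 ⟨Ne.symm hne, Finset.mem_univ j⟩)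
      (sub_eq_zero.2 hij), zero_mul]

/-- The discriminant of the zeros of `F (x, ·)`. -/
def disc (F : ℂ × ℂ → ℂ) (ρ : ℝ) (n : ℕ) (x : ℂ) : ℂ :=
  Matrix.det (Matrix.of fun i j : Fin n => powerSum F ρ (i + j) x)

lemma disc_ne_zero_iff (h : Adapted F r ρ C) (hx : ‖x‖ < r) {a : Fin n → ℂ}
    (ha : Roots F ρ x a) : disc F ρ n x ≠ 0 ↔ Function.Injective a := by
  obtain ⟨U, hU, hU0, hF⟩ := ha.fac
  have h1 : (Matrix.of fun i j : Fin n => powerSum F ρ (i + j) x) =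
      (Matrix.vandermonde a).transpose * Matrix.vandermonde a := by
    ext i j
    rw [Matrix.vandermonde_transpose_mul_vandermonde, Matrix.of_apply,
      h.powerSum_eq hx (fun i => mem_ball_zero_iff.2 (ha.mem i)) hU hU0 hF]
  rw [disc, h1, Matrix.det_mul, Matrix.det_transpose, mul_self_ne_zero,
    Matrix.det_vandermonde_ne_zero_iff]

lemma differentiableOn_disc (h : Adapted F r ρ C) (n : ℕ) :
    DifferentiableOn ℂ (disc F ρ n) (ball 0 r) := by
  have h1 : disc F ρ n = fun x => ∑ τ : Equiv.Perm (Fin n),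
      Equiv.Perm.sign τ • ∏ i : Fin n, powerSum F ρ (τ i + i) x := by
    ext x
    rw [disc, Matrix.det_apply]
    rfl
  rw [h1]
  refine DifferentiableOn.fun_sum fun τ _ => ?_
  refine DifferentiableOn.const_smul (c := Equiv.Perm.sign τ) ?_
  exact DifferentiableOn.fun_finsetProd fun i _ => h.differentiableOn_powerSum _

end Adapted
end Polydisc

section NoBadPoints

namespace Adapted
variable {F : ℂ × ℂ → ℂ} {r ρ C : ℝ} {n ν : ℕ} {x y : ℂ}

lemma fderiv_prod_apply (L : ℂ × ℂ →L[ℂ] ℂ) (a b : ℂ) : L (a, b) = a * L (1, 0) + b * L (0, 1) := by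
  have h1 : ((a, b) : ℂ × ℂ) = a • ((1, 0) : ℂ × ℂ) + b • ((0, 1) : ℂ × ℂ) := by simp
  rw [h1, map_add, map_smul, map_smul, smul_eq_mul, smul_eq_mul]

lemma continuousAt_fderiv (hF : AnalyticAt ℂ F (x, y)) (v : ℂ × ℂ) :
    ContinuousAt (fun p => fderiv ℂ F p v) (x, y) :=
  hF.fderiv.continuousAt.clm_apply continuousAt_const

lemma eventually_not_critical (h : Adapted F r ρ C) (hν : analyticOrderAt (fun y => F (0, y)) 0 = ν)
    (hx0 : x ≠ 0) (hx : ‖x‖ < r) (hy : ‖y‖ ≤ ρ) :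
    ∀ᶠ p in 𝓝 (x, y), p.1 ≠ x → ¬ (F p = 0 ∧ fderiv ℂ F p (0, 1) = 0) := by
  have hF := h.an x y hx hy
  by_cases h0 : F (x, y) = 0
  swap
  · exact (hF.continuousAt.eventually_ne h0).mono fun p hp _ h1 => hp h1.1
  by_cases h1 : fderiv ℂ F (x, y) (0, 1) = 0
  swap
  · exact ((continuousAt_fderiv hF _).eventually_ne h1).mono fun p hp _ h1 => hp h1.2
  have hFx : fderiv ℂ F (x, y) (1, 0) ≠ 0 := fun h2 => h.smooth x y hx hy (by simp [hx0]) (by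
    ext
    · simpa using h2
    · simpa using h1)
  have hyρ : ‖y‖ < ρ := hy.lt_of_ne fun h2 => h.sphere x y hx h2 h0
  have hsw : Tendsto (Prod.swap : ℂ × ℂ → ℂ × ℂ) (𝓝 (y, x)) (𝓝 (x, y)) :=
    continuous_swap.tendsto (y, x)
  have hsw' : Tendsto (Prod.swap : ℂ × ℂ → ℂ × ℂ) (𝓝 (x, y)) (𝓝 (y, x)) :=
    continuous_swap.tendsto (x, y)
  obtain ⟨γ, hγ, hγy, hγF⟩ := exists_root (F := F ∘ Prod.swap) (q := (y, x))
    (AnalyticAt.comp (g := F) (by exact hF)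
      ((ContinuousLinearEquiv.prodComm ℂ ℂ ℂ).analyticAt (y, x)))
    h0 (by
      have h2 : HasFDerivAt (F ∘ Prod.swap) ((fderiv ℂ F (x, y)).comp
          (ContinuousLinearEquiv.prodComm ℂ ℂ ℂ : ℂ × ℂ →L[ℂ] ℂ × ℂ)) (y, x) :=
        HasFDerivAt.comp (g := F) (y, x) hF.differentiableAt.hasFDerivAt
          (ContinuousLinearEquiv.prodComm ℂ ℂ ℂ).hasFDerivAt
      rw [h2.fderiv]
      simpa using hFx)
  simp only at hγ hγy
  have hγF' : ∀ᶠ z in 𝓝 y, F (γ z, z) = 0 := by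
    have h2 : Tendsto (fun z => (z, γ z)) (𝓝 y) (𝓝 (y, x)) := by
      have := (continuousAt_id (x := y)).prodMk hγ.continuousAt
      rw [ContinuousAt, hγy] at this
      exact this
    exact (h2.eventually hγF).mono fun z hz => hz.2 rfl
  rcases hγ.deriv.eventually_eq_zero_or_eventually_ne_zero with h2 | h2
  · exfalso
    obtain ⟨ε, hε, hεB⟩ := Metric.eventually_nhds_iff_ball.1 (h2.and (hγ.eventually_analyticAt.and hγF'))
    obtain ⟨a, ha⟩ := h.exists_roots hν hx
    have h3 : ∀ z ∈ ball y ε, γ z = x := fun z hz => by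
      rw [← hγy]
      exact isOpen_ball.is_const_of_deriv_eq_zero (convex_ball y ε).isPreconnected
        (fun z hz => (hεB z hz).2.1.differentiableAt.differentiableWithinAt)
        (fun z hz => (hεB z hz).1) hz (mem_ball_self hε)
    have h4 : range a ∈ 𝓝 y := by
      filter_upwards [ball_mem_nhds y hε, isOpen_ball.mem_nhds (mem_ball_zero_iff.2 hyρ)]
        with z hz hzρ
      have h5 := (hεB z hz).2.2
      rw [h3 z hz] at h5
      obtain ⟨i, hi⟩ := (ha.eq_zero_iff (mem_ball_zero_iff.1 hzρ).le).1 h5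
      exact ⟨i, hi.symm⟩
    exact infinite_of_mem_nhds y h4 (finite_range a)
  · have h3 : ∀ᶠ z in 𝓝 y, z ≠ y → deriv γ z ≠ 0 := eventually_nhdsWithin_iff.1 h2
    have hsnd : Tendsto (Prod.snd : ℂ × ℂ → ℂ) (𝓝 (x, y)) (𝓝 y) := continuous_snd.tendsto (x, y)
    filter_upwards [hsnd.eventually h3, hsnd.eventually hγF'.eventually_nhds,
      hsnd.eventually hγ.eventually_analyticAt, hsw'.eventually hγF,
      (continuousAt_fderiv hF (1, 0)).eventually_ne hFx, hF.eventually_analyticAt]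
      with p hp1 hp2 hp3 hp4 hp5 hp6 hpx hp
    have hpγ : p.1 = γ p.2 := hp4.1 hp.1
    have h4 : HasDerivAt (fun z => F (γ z, z)) (fderiv ℂ F p (deriv γ p.2, 1)) p.2 := by
      have h5 : HasFDerivAt F (fderiv ℂ F p) (γ p.2, p.2) := by
        rw [← hpγ]
        exact hp6.differentiableAt.hasFDerivAt
      exact HasFDerivAt.comp_hasDerivAt (f := fun z => (γ z, z)) p.2 h5 (hp3.differentiableAt.hasDerivAt.prodMk (hasDerivAt_id _))
    have h5 := h4.unique ((hasDerivAt_const p.2 (0 : ℂ)).congr_of_eventuallyEq hp2)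
    rw [fderiv_prod_apply, hp.2, mul_zero, add_zero] at h5
    have h6 : p.2 = y := by
      by_contra hne
      exact mul_ne_zero (hp1 hne) hp5 h5
    exact hpx (by rw [hpγ, h6, hγy])

lemma exists_disc_ne_zero (h : Adapted F r ρ C)
    (hν : analyticOrderAt (fun y => F (0, y)) 0 = ν) :
    ∃ r', 0 < r' ∧ r' ≤ r ∧ ∀ x, x ≠ 0 → ‖x‖ < r' → disc F ρ ν x ≠ 0 := by
  have hA : AnalyticAt ℂ (disc F ρ ν) 0 := (h.differentiableOn_disc ν).analyticAt
    (ball_mem_nhds _ h.r_pos)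
  rcases hA.eventually_eq_zero_or_eventually_ne_zero with h0 | h0
  · exfalso
    obtain ⟨ε, hε, hεB⟩ := Metric.eventually_nhds_iff_ball.1 h0
    set x : ℂ := ((min ε r / 2 : ℝ) : ℂ) with hx
    have hm : 0 < min ε r := lt_min hε h.r_pos
    have hxn : ‖x‖ = min ε r / 2 := by
      rw [hx, Complex.norm_real, Real.norm_of_nonneg (by positivity)]
    have hxε : ‖x‖ < ε := by linarith [min_le_left ε r]
    have hxr : ‖x‖ < r := by linarith [min_le_right ε r]
    have hx0 : x ≠ 0 := norm_pos_iff.1 (by rw [hxn]; positivity)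
    have h1 := (isCompact_closedBall (0 : ℂ) ρ).eventually_forall_of_forall_eventually (x₀ := x)
      (P := fun x' y => x' ≠ x → ¬ (F (x', y) = 0 ∧ fderiv ℂ F (x', y) (0, 1) = 0))
      fun y hy => h.eventually_not_critical hν hx0 hxr (mem_closedBall_zero_iff.1 hy)
    have h2 : ∀ᶠ x' in 𝓝 x, ¬ (x' ≠ x) := by
      filter_upwards [h1, isOpen_ball.mem_nhds (mem_ball_zero_iff.2 hxε),
        isOpen_ball.mem_nhds (mem_ball_zero_iff.2 hxr)] with x' hx' hxε' hxr' hne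
      obtain ⟨a, ha⟩ := h.exists_roots hν (mem_ball_zero_iff.1 hxr')
      refine ((h.disc_ne_zero_iff (mem_ball_zero_iff.1 hxr') ha).2
        ((ha.injective_iff h (mem_ball_zero_iff.1 hxr')).2 fun i hi => ?_)) (hεB x' hxε')
      refine hx' (a i) (mem_closedBall_zero_iff.2 (ha.mem i).le) hne
        ⟨(ha.eq_zero_iff (ha.mem i).le).2 ⟨i, rfl⟩, hi⟩
    have h3 : ({x} : Set ℂ) ∈ 𝓝 x := h2.mono fun z hz => not_not.1 hz
    exact infinite_of_mem_nhds x h3 (finite_singleton x)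
  · obtain ⟨ε, hε, hεB⟩ := Metric.eventually_nhds_iff_ball.1 (eventually_nhdsWithin_iff.1 h0)
    exact ⟨min ε r, lt_min hε h.r_pos, min_le_right _ _, fun x hx0 hx =>
      hεB x (mem_ball_zero_iff.2 (hx.trans_le (min_le_left _ _))) hx0⟩

end Adapted
end NoBadPoints

section Sheets
variable {n : ℕ}

/-- The permutation `τ` matches each point of the first family with the closest one of the second. -/
def Matches (u v : Fin n → ℂ) (τ : Equiv.Perm (Fin n)) : Prop :=
  ∀ i j, j ≠ τ i → ‖u i - v (τ i)‖ < ‖u i - v j‖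

lemma Matches.unique {u v : Fin n → ℂ} {τ τ' : Equiv.Perm (Fin n)} (h : Matches u v τ)
    (h' : Matches u v τ') : τ = τ' := by
  ext i
  by_contra hne
  have hne' : τ i ≠ τ' i := fun h => hne (congrArg _ h)
  exact lt_asymm (h i _ hne'.symm) (h' i _ hne')

/-- The matching of nearby families. -/
def matching (u v : Fin n → ℂ) : Equiv.Perm (Fin n) :=
  open Classical in if h : ∃ τ, Matches u v τ then h.choose else 1

lemma Matches.matching_eq {u v : Fin n → ℂ} {τ : Equiv.Perm (Fin n)} (h : Matches u v τ) :
    matching u v = τ := by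
  have h1 : ∃ τ, Matches u v τ := ⟨τ, h⟩
  rw [matching, dif_pos h1]
  exact h1.choose_spec.unique h

lemma exists_pos_le_norm_sub {u : Fin n → ℂ} (hu : Function.Injective u) :
    ∃ δ, 0 < δ ∧ ∀ j k, j ≠ k → δ ≤ ‖u j - u k‖ := by
  have h1 : ∀ᶠ δ in 𝓝[>] (0 : ℝ), ∀ j k, j ≠ k → δ ≤ ‖u j - u k‖ := by
    refine eventually_all.2 fun j => eventually_all.2 fun k => ?_
    by_cases hjk : j = k
    · exact Eventually.of_forall fun δ h => absurd hjk h
    · have h2 : 0 < ‖u j - u k‖ := norm_pos_iff.2 (sub_ne_zero.2 fun h => hjk (hu h))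
      exact nhdsWithin_le_nhds ((eventually_le_nhds h2).mono fun δ hδ _ => hδ)
  obtain ⟨δ, h2, h3⟩ := (h1.and self_mem_nhdsWithin).exists
  exact ⟨δ, h3, h2⟩

lemma exists_local_numbering {e : ℂ → Fin n → ℂ} {E : Set ℂ}
    (he : ∀ w ∈ E, Function.Injective (e w)) {p : ℂ} (hE : E ∈ 𝓝 p)
    {γ : Fin n → ℂ → ℂ} (hγ : ∀ k, AnalyticAt ℂ (γ k) p) (hγp : ∀ k, γ k p = e p k)
    (hγe : ∀ᶠ w in 𝓝 p, range (e w) = range fun k => γ k w) :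
    ∃ N ∈ 𝓝 p, ∃ α : ℂ → Equiv.Perm (Fin n), (∀ w ∈ N, ∀ i, e w i = γ (α w i) w) ∧
      ∀ a ∈ N, ∀ d ∈ N, (matching (e a) (e d))⁻¹ = (α a)⁻¹ * α d := by
  obtain ⟨δ, hδ, hδe⟩ := exists_pos_le_norm_sub (he p (mem_of_mem_nhds hE))
  have h1 : ∀ᶠ w in 𝓝 p, ∀ k, ‖γ k w - e p k‖ < δ / 4 := by
    refine eventually_all.2 fun k => ?_
    have h2 := (hγ k).continuousAt.eventually (ball_mem_nhds (γ k p) (by positivity : 0 < δ / 4))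
    filter_upwards [h2] with w hw
    rwa [dist_eq_norm, hγp] at hw
  have h2 : ∀ w, ∃ α : Equiv.Perm (Fin n), w ∈ E → (range (e w) = range fun k => γ k w) →
      ∀ i, e w i = γ (α i) w := by
    intro w
    by_cases hw : w ∈ E ∧ range (e w) = range fun k => γ k w
    · have h3 : ∀ i, ∃ k, γ k w = e w i := fun i => by
        have : e w i ∈ range (e w) := mem_range_self i
        rwa [hw.2] at this
      choose k hk using h3
      have hinj : Function.Injective k := fun i j hij => he w hw.1 (by rw [← hk i, ← hk j, hij])
      exact ⟨Equiv.ofBijective k (Finite.injective_iff_bijective.1 hinj),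
        fun _ _ i => (hk i).symm⟩
    · exact ⟨1, fun h h' => absurd ⟨h, h'⟩ hw⟩
  choose α hα using h2
  refine ⟨_, inter_mem hE (h1.and hγe), α, fun w hw => hα w hw.1 hw.2.2, fun a ha d hd => ?_⟩
  have ha' := hα a ha.1 ha.2.2
  have hd' := hα d hd.1 hd.2.2
  have hM : Matches (e a) (e d) ((α d)⁻¹ * α a) := by
    intro i j hj
    have hk : α d (((α d)⁻¹ * α a) i) = α a i := by simp
    have hl : α d j ≠ α a i := fun h => hj (by rw [← hk] at h; exact (α d).injective h)
    rw [ha' i, hd' (((α d)⁻¹ * α a) i), hd' j, hk]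
    have h3 := hδe _ _ hl
    have h4 := ha.2.1 (α a i)
    have h5 := hd.2.1 (α a i)
    have h6 := hd.2.1 (α d j)
    set A := γ (α a i) a
    set B := γ (α a i) d
    set D := γ (α d j) d
    have h7 : ‖A - B‖ ≤ ‖A - e p (α a i)‖ + ‖B - e p (α a i)‖ := by
      rw [← norm_neg (B - _)]
      exact le_trans (le_of_eq (by congr 1; ring)) (norm_add_le _ _)
    have h8 : ‖e p (α d j) - e p (α a i)‖ ≤ ‖D - e p (α d j)‖ + (‖A - D‖ + ‖A - e p (α a i)‖) := by
      have := norm_add₃_le (a := -(D - e p (α d j))) (b := -(A - D)) (c := A - e p (α a i))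
      rw [norm_neg, norm_neg] at this
      refine le_trans (le_of_eq (by congr 1; ring)) (this.trans (by linarith))
    linarith
  rw [hM.matching_eq]
  group

lemma exists_sheets {e : ℂ → Fin n → ℂ} {E : Set ℂ} (hE : Convex ℝ E) (hEo : IsOpen E)
    (he : ∀ w ∈ E, Function.Injective (e w))
    (hγ : ∀ p ∈ E, ∃ γ : Fin n → ℂ → ℂ, (∀ k, AnalyticAt ℂ (γ k) p) ∧ (∀ k, γ k p = e p k) ∧
      ∀ᶠ w in 𝓝 p, range (e w) = range fun k => γ k w) :
    ∃ Y : Fin n → ℂ → ℂ, (∀ i, DifferentiableOn ℂ (Y i) E) ∧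
      ∀ w ∈ E, (Function.Injective fun i => Y i w) ∧ (range fun i => Y i w) = range (e w) := by
  rcases E.eq_empty_or_nonempty with rfl | ⟨x, hx⟩
  · exact ⟨fun _ _ => 0, by simp, by simp⟩
  have hc : LocCoc E fun a d => (matching (e a) (e d))⁻¹ := by
    intro p hp
    obtain ⟨γ, h1, h2, h3⟩ := hγ p hp
    obtain ⟨N, hN, α, -, hα⟩ := exists_local_numbering he (hEo.mem_nhds hp) h1 h2 h3
    refine ⟨N, mem_nhdsWithin_of_mem_nhds hN, fun a ha b hb d hd => ?_⟩
    simp only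
    rw [hα a ha b hb, hα b hb d hd, hα a ha d hd]
    group
  obtain ⟨b, hb⟩ := hc.exists_gauge_of_star (hE.starConvex hx)
  refine ⟨fun i w => e w ((b w)⁻¹ i), fun i p hp => ?_, fun w hw =>
    ⟨fun i j hij => (b w)⁻¹.injective (he w hw hij), (b w)⁻¹.surjective.range_comp _⟩⟩
  obtain ⟨γ, h1, h2, h3⟩ := hγ p hp
  obtain ⟨N, hN, α, hγα, hα⟩ := exists_local_numbering he (hEo.mem_nhds hp) h1 h2 h3
  obtain ⟨N', hN', hbN⟩ := hb p hp
  rw [hEo.nhdsWithin_eq hp] at hN'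
  refine DifferentiableAt.differentiableWithinAt ?_
  refine ((h1 ((α p * (b p)⁻¹) i)).differentiableAt).congr_of_eventuallyEq ?_
  filter_upwards [hN, hN'] with w hw hw'
  have h4 := hbN p (mem_of_mem_nhds hN') w hw'
  simp only at h4
  rw [hα p (mem_of_mem_nhds hN) w hw] at h4
  have h5 : α w * (b w)⁻¹ = α p * (b p)⁻¹ := by
    have := congrArg (fun g => α p * g * (b w)⁻¹) h4
    simpa [mul_assoc] using this
  rw [hγα w hw, ← h5]
  rfl

end Sheets

section AdaptedSheets

namespace Adapted
variable {F : ℂ × ℂ → ℂ} {r ρ C : ℝ} {n ν : ℕ} {x y : ℂ}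

lemma Roots.exists_local (h : Adapted F r ρ C) (hx : ‖x‖ < r) {a : Fin n → ℂ}
    (ha : Roots F ρ x a) (hinj : Function.Injective a) :
    ∃ γ : Fin n → ℂ → ℂ, (∀ k, AnalyticAt ℂ (γ k) x) ∧ (∀ k, γ k x = a k) ∧
      ∀ᶠ x' in 𝓝 x, ∀ y, (‖y‖ ≤ ρ ∧ F (x', y) = 0) ↔ ∃ k, γ k x' = y := by
  have hd := (ha.injective_iff h hx).1 hinj
  have h1 := fun k => exists_root (h.an x (a k) hx (ha.mem k).le)
    ((ha.eq_zero_iff (ha.mem k).le).2 ⟨k, rfl⟩) (hd k)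
  choose γ hγ hγa hγF using h1
  simp only at hγ hγa
  refine ⟨γ, hγ, hγa, ?_⟩
  have h2 := (isCompact_closedBall (0 : ℂ) ρ).eventually_forall_of_forall_eventually (x₀ := x)
    (P := fun x' y => F (x', y) = 0 → ∃ k, γ k x' = y) fun y hy => by
      rw [mem_closedBall_zero_iff] at hy
      by_cases h0 : F (x, y) = 0
      · obtain ⟨k, rfl⟩ := (ha.eq_zero_iff hy).1 h0
        exact (hγF k).mono fun p hp h3 => ⟨k, (hp.1 h3).symm⟩
      · exact ((h.an x y hx hy).continuousAt.eventually_ne h0).mono fun p hp h3 => absurd h3 hp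
  have h3 : ∀ᶠ x' in 𝓝 x, ∀ k, ‖γ k x'‖ ≤ ρ ∧ F (x', γ k x') = 0 := by
    refine eventually_all.2 fun k => ?_
    have h4 : Tendsto (fun z => (z, γ k z)) (𝓝 x) (𝓝 (x, a k)) := by
      have := (continuousAt_id (x := x)).prodMk (hγ k).continuousAt
      rw [ContinuousAt, hγa] at this
      exact this
    have h5 : ∀ᶠ z in 𝓝 x, ‖γ k z‖ < ρ :=
      (hγ k).continuousAt.norm.eventually_lt continuousAt_const (by rw [hγa]; exact ha.mem k)
    filter_upwards [h4.eventually (hγF k), h5] with z hz hz'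
    exact ⟨hz'.le, hz.2 rfl⟩
  filter_upwards [h2, h3] with x' h4 h5 y
  constructor
  · rintro ⟨hy, h0⟩
    exact h4 y (mem_closedBall_zero_iff.2 hy) h0
  · rintro ⟨k, rfl⟩
    exact h5 k

lemma exists_halfPlane_sheets (h : Adapted F r ρ C)
    (hν : analyticOrderAt (fun y => F (0, y)) 0 = ν) : ∃ (s : ℝ) (Y : Fin ν → ℂ → ℂ),
      (∀ w : ℂ, w.re < s → ‖exp w‖ < r) ∧
      (∀ i, DifferentiableOn ℂ (Y i) {w | w.re < s}) ∧
      ∀ w : ℂ, w.re < s → (Function.Injective fun i => Y i w) ∧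
        ∀ y, (∃ i, Y i w = y) ↔ ‖y‖ ≤ ρ ∧ F (exp w, y) = 0 := by
  obtain ⟨r', hr', hr'r, hD⟩ := h.exists_disc_ne_zero hν
  have hexp : ∀ w : ℂ, w.re < Real.log r' → ‖exp w‖ < r' := fun w hw => by
    rw [Complex.norm_exp]
    exact (Real.lt_log_iff_exp_lt hr').1 hw
  have he : ∀ w : ℂ, ∃ a : Fin ν → ℂ, w.re < Real.log r' →
      Roots F ρ (exp w) a ∧ Function.Injective a := fun w => by
    by_cases hw : w.re < Real.log r'
    · have h1 := (hexp w hw).trans_le hr'r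
      obtain ⟨a, ha⟩ := h.exists_roots hν h1
      exact ⟨a, fun _ => ⟨ha, (h.disc_ne_zero_iff h1 ha).1
        (hD _ (exp_ne_zero w) (hexp w hw))⟩⟩
    · exact ⟨0, fun h => absurd h hw⟩
  choose e he using he
  have hEo : IsOpen {w : ℂ | w.re < Real.log r'} := isOpen_lt (by fun_prop) (by fun_prop)
  have hrange : ∀ w : ℂ, w.re < Real.log r' →
      ∀ y, (∃ i, e w i = y) ↔ ‖y‖ ≤ ρ ∧ F (exp w, y) = 0 := fun w hw y => by
    constructor
    · rintro ⟨i, rfl⟩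
      exact ⟨((he w hw).1.mem i).le, ((he w hw).1.eq_zero_iff ((he w hw).1.mem i).le).2 ⟨i, rfl⟩⟩
    · rintro ⟨hy, h0⟩
      obtain ⟨i, hi⟩ := ((he w hw).1.eq_zero_iff hy).1 h0
      exact ⟨i, hi.symm⟩
  obtain ⟨Y, hY, hYe⟩ := exists_sheets (e := e) (convex_halfSpace_re_lt (Real.log r')) hEo
    (fun w hw => (he w hw).2) fun p hp => by
      obtain ⟨γ, h1, h2, h3⟩ := (he p hp).1.exists_local h ((hexp p hp).trans_le hr'r) (he p hp).2
      have hc : ContinuousAt exp p := Complex.continuous_exp.continuousAt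
      refine ⟨fun k w => γ k (exp w), fun k =>
        AnalyticAt.comp (g := γ k) (h1 k) analyticAt_cexp, h2, ?_⟩
      filter_upwards [hc.eventually h3, hEo.mem_nhds hp] with w hw hwE
      ext y
      exact (hrange w hwE y).trans (hw y)
  refine ⟨Real.log r', Y, fun w hw => (hexp w hw).trans_le hr'r, hY, fun w hw =>
    ⟨(hYe w hw).1, fun y => ?_⟩⟩
  rw [← hrange w hw]
  exact Set.ext_iff.1 (hYe w hw).2 y

lemma exists_shift {s : ℝ} {Y : Fin n → ℂ → ℂ}
    (hY : ∀ i, DifferentiableOn ℂ (Y i) {w | w.re < s})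
    (hinj : ∀ w : ℂ, w.re < s → Function.Injective fun i => Y i w)
    (hr : ∀ i (w : ℂ), w.re < s → ∃ j, Y j w = Y i (w + 2 * π * I)) :
    ∃ σ : Equiv.Perm (Fin n), ∀ i (w : ℂ), w.re < s → Y i (w + 2 * π * I) = Y (σ i) w := by
  have hEo : IsOpen {w : ℂ | w.re < s} := isOpen_lt (by fun_prop) (by fun_prop)
  have hre : ∀ w : ℂ, (w + 2 * π * I).re = w.re := fun w => by simp
  have h1 : ∀ i (w : ℂ), ∃ j, w.re < s → Y j w = Y i (w + 2 * π * I) := fun i w => by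
    by_cases hw : w.re < s
    · obtain ⟨j, hj⟩ := hr i w hw
      exact ⟨j, fun _ => hj⟩
    · exact ⟨i, fun h => absurd h hw⟩
  choose j hj using h1
  have hcont : ∀ i (w : ℂ), w.re < s → ContinuousAt (Y i) w := fun i w hw =>
    ((hY i).differentiableAt (hEo.mem_nhds hw)).continuousAt
  have hconst : ∀ i (w w' : ℂ), w.re < s → w'.re < s → j i w = j i w' := by
    intro i w w' hw hw'
    refine const_of_locConst (E := {w : ℂ | w.re < s}) (convex_halfSpace_re_lt s).isPreconnected
      (fun p (hp : p.re < s) => ?_) hw hw'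
    have h2 : ∀ᶠ q in 𝓝 p, ∀ k, k ≠ j i p → Y k q - Y i (q + 2 * π * I) ≠ 0 := by
      refine eventually_all.2 fun k => ?_
      by_cases hk : k = j i p
      · exact Eventually.of_forall fun q h => absurd hk h
      · have h3 : ContinuousAt (fun q => Y i (q + 2 * π * I)) p :=
          ContinuousAt.comp (f := fun q : ℂ => q + 2 * π * I)
            (hcont i _ (by rw [hre]; exact hp)) (by fun_prop)
        refine (((hcont k p hp).sub h3).eventually_ne ?_).mono fun q hq _ => hq
        change Y k p - Y i (p + 2 * π * I) ≠ 0
        rw [← hj i p hp, sub_ne_zero]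
        exact fun h => hk (hinj p hp h)
    refine ⟨_, inter_mem (mem_nhdsWithin_of_mem_nhds h2) self_mem_nhdsWithin, fun q hq => ?_⟩
    by_contra hne
    exact hq.1 _ hne (sub_eq_zero.2 (hj i q hq.2))
  set w₀ : ℂ := ((s - 1 : ℝ) : ℂ)
  have hw₀ : w₀.re < s := by simp [w₀]
  have hσ : Function.Injective fun i => j i w₀ := fun i i' hii => by
    refine hinj (w₀ + 2 * π * I) (by rw [hre]; exact hw₀) ?_
    have h4 : j i w₀ = j i' w₀ := hii
    simp only
    rw [← hj i w₀ hw₀, ← hj i' w₀ hw₀, h4]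
  refine ⟨Equiv.ofBijective _ (Finite.injective_iff_bijective.1 hσ), fun i w hw => ?_⟩
  rw [Equiv.ofBijective_apply, ← hj i w hw, hconst i w w₀ hw hw₀]

/-- The zero set of `F` in an adapted polydisc is described by a system of `ν` sheets. -/
theorem exists_rootSystem (h : Adapted F r ρ C) (hF0 : F 0 = 0)
    (hν : analyticOrderAt (fun y => F (0, y)) 0 = ν) : ∃ (σ : Equiv.Perm (Fin ν))
      (Y : Fin ν → ℂ → ℂ) (s : ℝ), RootSystem σ Y s C ∧ Describes Y s (F ⁻¹' {0}) := by
  obtain ⟨s, Y, hexp, hY, hYr⟩ := h.exists_halfPlane_sheets hν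
  have hper : ∀ w : ℂ, exp (w + 2 * π * I) = exp w :=
    Complex.exp_periodic
  obtain ⟨σ, hσ⟩ := exists_shift hY (fun w hw => (hYr w hw).1) fun i w hw => by
    have h1 := ((hYr (w + 2 * π * I) (by simpa using hw)).2 _).1 ⟨i, rfl⟩
    rw [hper] at h1
    exact ((hYr w hw).2 _).2 h1
  refine ⟨σ, Y, s, ⟨hY, fun i j w hw hij h1 => hij ((hYr w hw).1 h1), fun i w hw => ?_, hσ⟩, ?_⟩
  · obtain ⟨h1, h2⟩ := ((hYr w hw).2 _).1 ⟨i, rfl⟩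
    exact h.cone _ _ (hexp w hw) h1 h2
  · have h1 : ∀ᶠ z : ℂ × ℂ in 𝓝 0, ‖z.1‖ < Real.exp s ∧ ‖z.1‖ < r ∧ ‖z.2‖ < ρ := by
      have hc1 : ContinuousAt (fun z : ℂ × ℂ => ‖z.1‖) 0 := by fun_prop
      have hc2 : ContinuousAt (fun z : ℂ × ℂ => ‖z.2‖) 0 := by fun_prop
      exact (hc1.eventually_lt continuousAt_const (by simpa using Real.exp_pos s)).and
        ((hc1.eventually_lt continuousAt_const (by simpa using h.r_pos)).and
          (hc2.eventually_lt continuousAt_const (by simpa using h.ρ_pos)))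
    filter_upwards [h1] with z hz
    rw [mem_preimage, mem_singleton_iff]
    constructor
    · intro h0
      by_cases hz1 : z.1 = 0
      · left
        have h2 := h.cone z.1 z.2 hz.2.1 hz.2.2.le h0
        rw [hz1, norm_zero, mul_zero, norm_le_zero_iff] at h2
        exact Prod.ext hz1 h2
      · right
        have hw : (Complex.log z.1).re < s := by
          rw [Complex.log_re, Real.log_lt_iff_lt_exp (norm_pos_iff.2 hz1)]
          exact hz.1
        have hw' := Complex.exp_log hz1
        obtain ⟨i, hi⟩ := ((hYr _ hw).2 z.2).2 ⟨hz.2.2.le, by rw [hw']; exact h0⟩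
        exact ⟨_, hw, i, trivial, by rw [hw', hi]⟩
    · rintro (rfl | ⟨w, hw, i, -, rfl⟩)
      · exact hF0
      · exact (((hYr w hw).2 _).1 ⟨i, rfl⟩).2

end Adapted
end AdaptedSheets

section InitialTerm
variable {F : ℂ × ℂ → ℂ} {q : FormalMultilinearSeries ℂ (ℂ × ℂ) ℂ} {ν : ℕ}

/-- If the initial form does not vanish at `(0, 1)`, the restriction of `F` to the second axis
has the same order as `F`. -/
lemma analyticOrderAt_axis (hq : HasFPowerSeriesAt F q 0)
    (hlow : ∀ k < ν, ∀ z : ℂ × ℂ, (q k fun _ => z) = 0)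
    (hH : (q ν fun _ => ((0, 1) : ℂ × ℂ)) ≠ 0) :
    analyticOrderAt (fun y => F (0, y)) 0 = ν := by
  set u : ℂ →L[ℂ] ℂ × ℂ := ContinuousLinearMap.inr ℂ ℂ ℂ
  set p := q.compContinuousLinearMap u
  have hp : HasFPowerSeriesAt (fun y => F (0, y)) p 0 :=
    HasFPowerSeriesAt.compContinuousLinearMap (u := u) (x := 0) (by simpa using hq)
  have hcoeff : ∀ n, p.coeff n = q n fun _ => (0, 1) := fun n => by
    rw [FormalMultilinearSeries.coeff, FormalMultilinearSeries.compContinuousLinearMap_apply]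
    congr 1
  have hpν : p ν ≠ 0 := by
    rw [Ne, ← FormalMultilinearSeries.coeff_eq_zero, hcoeff]
    exact hH
  have hp0 : p ≠ 0 := fun h => hpν (by rw [h]; rfl)
  have hord : p.order = ν := by
    apply le_antisymm
    · by_contra! h
      exact hpν (FormalMultilinearSeries.apply_eq_zero_of_lt_order h)
    · by_contra! h
      apply FormalMultilinearSeries.apply_order_ne_zero hp0
      rw [← FormalMultilinearSeries.coeff_eq_zero, hcoeff]
      exact hlow _ h _
  rw [hp.analyticAt.analyticOrderAt_eq_natCast]
  refine ⟨_, (hp.has_fpower_series_iterate_dslope_fslope p.order).analyticAt,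
    hp.iterate_dslope_fslope_ne_zero hp0, Eventually.of_forall fun z => ?_⟩
  rw [← hord]
  exact hp.eq_pow_order_mul_iterate_dslope z

/-- Near the origin, the zero set of `F` avoids the tangent direction `(0, 1)` when the initial
form does not vanish there. -/
lemma eventually_cone (hq : HasFPowerSeriesAt F q 0)
    (hlow : ∀ k < ν, ∀ z : ℂ × ℂ, (q k fun _ => z) = 0)
    (hH : (q ν fun _ => ((0, 1) : ℂ × ℂ)) ≠ 0) :
    ∃ C : ℝ, 0 < C ∧ ∀ᶠ z in 𝓝 (0 : ℂ × ℂ), F z = 0 → ‖z.2‖ ≤ C * ‖z.1‖ := by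
  obtain ⟨K, hK⟩ := (hq.isBigO_sub_partialSum_pow (ν + 1)).bound
  have hc : Continuous fun x : ℂ => ‖q ν fun _ => ((x, 1) : ℂ × ℂ)‖ :=
    ((q ν).cont.comp (by fun_prop : Continuous fun x : ℂ => fun _ : Fin ν => ((x, 1) : ℂ × ℂ))).norm
  set η := ‖q ν fun _ => ((0, 1) : ℂ × ℂ)‖ / 2 with hη
  have hηp : 0 < η := half_pos (norm_pos_iff.2 hH)
  obtain ⟨ε, hε, hball⟩ := Metric.eventually_nhds_iff.1
    (hc.continuousAt.eventually (lt_mem_nhds (half_lt_self (norm_pos_iff.2 hH))))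
  refine ⟨max 1 (2 / ε), by positivity, ?_⟩
  set K' := max K 1
  have hK' : 0 < K' := by positivity
  have hsmall : ∀ᶠ z in 𝓝 (0 : ℂ × ℂ), ‖z‖ < η / K' :=
    continuous_norm.continuousAt.eventually_lt_const (by simpa using div_pos hηp hK')
  filter_upwards [hK, hsmall] with z hz hs hFz
  by_contra! hlt
  have h1 : ‖z.1‖ ≤ max 1 (2 / ε) * ‖z.1‖ := le_mul_of_one_le_left (norm_nonneg _) (le_max_left _ _)
  have hyx : ‖z.1‖ < ‖z.2‖ := h1.trans_lt hlt
  have hy : 0 < ‖z.2‖ := (norm_nonneg _).trans_lt hyx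
  have hy0 : z.2 ≠ 0 := norm_pos_iff.1 hy
  have hn : ‖z‖ = ‖z.2‖ := by rw [Prod.norm_def]; exact max_eq_right hyx.le
  have h2 : 2 / ε * ‖z.1‖ < ‖z.2‖ :=
    (mul_le_mul_of_nonneg_right (le_max_right _ _) (norm_nonneg _)).trans_lt hlt
  have h3 : dist (z.1 / z.2) 0 < ε := by
    rw [dist_zero_right, norm_div, div_lt_iff₀ hy]
    rw [div_mul_eq_mul_div, div_lt_iff₀ hε] at h2
    nlinarith [norm_nonneg z.1]
  have h4 : η < ‖q ν fun _ => ((z.1 / z.2, 1) : ℂ × ℂ)‖ := hball h3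
  have hsum : q.partialSum (ν + 1) z = q ν fun _ => z := by
    rw [FormalMultilinearSeries.partialSum, Finset.sum_range_succ,
      Finset.sum_eq_zero fun k hk => hlow k (Finset.mem_range.1 hk) z, zero_add]
  have hhom : (q ν fun _ => z) = z.2 ^ ν * q ν fun _ => ((z.1 / z.2, 1) : ℂ × ℂ) := by
    have h5 : z = z.2 • ((z.1 / z.2, 1) : ℂ × ℂ) := by
      ext
      · simp [mul_div_cancel₀ _ hy0]
      · simp
    conv_lhs => rw [h5]
    rw [(q ν).map_smul_univ (fun _ => z.2)]
    simp
  rw [zero_add, hFz, zero_sub, norm_neg, hsum, hhom, norm_mul, norm_pow, norm_pow, norm_norm, hn,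
    pow_succ] at hz
  have h6 : 0 < ‖z.2‖ ^ ν := pow_pos hy ν
  have h7 : K * (‖z.2‖ ^ ν * ‖z.2‖) ≤ ‖z.2‖ ^ ν * η := by
    rw [hn, lt_div_iff₀ hK'] at hs
    have h8 : K * ‖z.2‖ ≤ K' * ‖z.2‖ := mul_le_mul_of_nonneg_right (le_max_left _ _) hy.le
    nlinarith
  nlinarith

/-- An isolated singularity in good coordinates is adapted to some polydisc. -/
lemma exists_adapted (hq : HasFPowerSeriesAt F q 0)
    (hlow : ∀ k < ν, ∀ z : ℂ × ℂ, (q k fun _ => z) = 0)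
    (hH : (q ν fun _ => ((0, 1) : ℂ × ℂ)) ≠ 0)
    (hsing : ∀ᶠ z in 𝓝 (0 : ℂ × ℂ), z ≠ 0 → fderiv ℂ F z ≠ 0) :
    ∃ r ρ C : ℝ, Adapted F r ρ C := by
  obtain ⟨C, hC, hcone⟩ := eventually_cone hq hlow hH
  obtain ⟨δ, hδ, hball⟩ := Metric.eventually_nhds_iff.1
    (hq.analyticAt.eventually_analyticAt.and (hsing.and hcone))
  have key : ∀ x y : ℂ, ‖x‖ < min (δ / 2) (δ / 2 / C) → ‖y‖ ≤ δ / 2 → dist ((x, y) : ℂ × ℂ) 0 < δ := by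
    intro x y hx hy
    rw [dist_zero_right, Prod.norm_def]
    exact max_lt ((lt_min_iff.1 hx).1.trans (half_lt_self hδ)) (hy.trans_lt (half_lt_self hδ))
  refine ⟨min (δ / 2) (δ / 2 / C), δ / 2, C, by positivity, half_pos hδ,
    fun x y hx hy => (hball (key x y hx hy)).1,
    fun x y hx hy => (hball (key x y hx hy)).2.1,
    fun x y hx hy => (hball (key x y hx hy)).2.2, fun x y hx hy h0 => ?_⟩
  have h1 : ‖y‖ ≤ C * ‖x‖ := (hball (key x y hx hy.le)).2.2 h0
  have h2 := (lt_min_iff.1 hx).2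
  rw [lt_div_iff₀ hC] at h2
  linarith

/-- The branches of an isolated plane curve singularity, in suitable linear coordinates, form a
root system indexed by `Fin ν`, where `ν` is the multiplicity. -/
lemma exists_coordinates_rootSystem {f P : En 2 → ℂ} (hf0 : f 0 = 0)
    (hsing : IsolatedSingularityAt0 f) (hfi : HasInitialTerm f ν P) :
    ∃ (L : (ℂ × ℂ) ≃L[ℂ] En 2) (σ : Equiv.Perm (Fin ν)) (Y : Fin ν → ℂ → ℂ) (s C : ℝ),
      RootSystem σ Y s C ∧ Describes Y s ((fun z => f (L z)) ⁻¹' {0}) := by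
  obtain ⟨p, hp, hlow, hP, hP0⟩ := hfi
  obtain ⟨v, hv⟩ := Function.ne_iff.1 hP0
  have hν : ν ≠ 0 := by
    rintro rfl
    rw [hP, hp.coeff_zero, hf0] at hv
    exact hv rfl
  have hv0 : v ≠ 0 := by
    rintro rfl
    have : Nonempty (Fin ν) := ⟨⟨0, Nat.pos_of_ne_zero hν⟩⟩
    apply hv
    rw [hP]
    exact (p ν).map_zero
  have L0 : (ℂ × ℂ) ≃L[ℂ] En 2 := ContinuousLinearEquiv.ofFinrankEq (by simp)
  obtain ⟨A, hA⟩ := SeparatingDual.exists_continuousLinearEquiv_apply_eq (R := ℂ)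
    (x := L0 ((0, 1) : ℂ × ℂ)) (y := v) (by simp) hv0
  set L := L0.trans A
  have hq : HasFPowerSeriesAt (fun z => f (L z))
      (p.compContinuousLinearMap (L : (ℂ × ℂ) →L[ℂ] En 2)) 0 :=
    HasFPowerSeriesAt.compContinuousLinearMap (u := (L : (ℂ × ℂ) →L[ℂ] En 2)) (x := 0)
      (by simpa using hp)
  have hql : ∀ k < ν, ∀ z : ℂ × ℂ,
      (p.compContinuousLinearMap (L : (ℂ × ℂ) →L[ℂ] En 2) k fun _ => z) = 0 := fun k hk z => by
    rw [FormalMultilinearSeries.compContinuousLinearMap_apply]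
    exact hlow k hk (L z)
  have hqH : (p.compContinuousLinearMap (L : (ℂ × ℂ) →L[ℂ] En 2) ν
      fun _ => ((0, 1) : ℂ × ℂ)) ≠ 0 := by
    rw [FormalMultilinearSeries.compContinuousLinearMap_apply]
    rw [hP, ← hA] at hv
    exact hv
  have hs : ∀ᶠ z in 𝓝 (0 : ℂ × ℂ), z ≠ 0 → fderiv ℂ (fun z => f (L z)) z ≠ 0 := by
    obtain ⟨-, U, hU, hUs⟩ := hsing
    have hL : Tendsto L (𝓝 0) (𝓝 0) := by simpa using L.continuous.tendsto 0
    filter_upwards [hL hU] with z hz hz0 h0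
    apply hUs (L z) hz (by simpa using hz0)
    have h1 := L.comp_right_fderiv (f := f) (x := z)
    change fderiv ℂ (fun z => f (L z)) z = _ at h1
    rw [h0] at h1
    ext w
    have h2 := congrArg (fun T : (ℂ × ℂ) →L[ℂ] ℂ => T (L.symm w)) h1
    simpa using h2.symm
  obtain ⟨r, ρ, C, hF⟩ := exists_adapted hq hql hqH hs
  obtain ⟨σ, Y, s, h1, h2⟩ := hF.exists_rootSystem (by simpa using hf0)
    (analyticOrderAt_axis hq hql hqH)
  exact ⟨L, σ, Y, s, C, h1, h2⟩

lemma exists_gHomeo {f g : En 2 → ℂ} (h : TopEquisingular f g) (L L' : (ℂ × ℂ) ≃L[ℂ] En 2) :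
    ∃ Φ Ψ : ℂ × ℂ → ℂ × ℂ,
      GHomeo 0 ((fun z => f (L z)) ⁻¹' {0}) 0 ((fun z => g (L' z)) ⁻¹' {0}) Φ Ψ := by
  obtain ⟨U, U', hU, hU', φ, ψ, hφ0, hφ, hψ, mφ, mψ, hl, hr, him⟩ := h
  have hψ0 : ψ 0 = 0 := by simpa [hφ0] using hl 0 (mem_of_mem_nhds hU)
  have hiff : ∀ z ∈ U, g (φ z) = 0 ↔ f z = 0 := by
    intro z hz
    constructor
    · intro h0
      have h1 : φ z ∈ φ '' (f ⁻¹' {0} ∩ U) := him ▸ ⟨h0, mφ hz⟩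
      obtain ⟨w, ⟨hw0, hw⟩, hwz⟩ := h1
      have h2 : w = z := by rw [← hl w hw, hwz, hl z hz]
      exact h2 ▸ hw0
    · intro h0
      have h1 : φ z ∈ g ⁻¹' {0} ∩ U' := him ▸ mem_image_of_mem φ ⟨h0, hz⟩
      exact h1.1
  have hL : L ⁻¹' U ∈ 𝓝 (0 : ℂ × ℂ) := L.continuous.continuousAt.preimage_mem_nhds (by simpa using hU)
  have hL' : L' ⁻¹' U' ∈ 𝓝 (0 : ℂ × ℂ) :=
    L'.continuous.continuousAt.preimage_mem_nhds (by simpa using hU')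
  refine ⟨fun z => L'.symm (φ (L z)), fun z => L.symm (ψ (L' z)), ⟨by simp [hφ0], _, hL, ?_, ?_⟩,
    ⟨by simp [hψ0], _, hL', ?_, ?_⟩, ?_, ?_⟩
  · exact L'.symm.continuous.comp_continuousOn
      (hφ.comp L.continuous.continuousOn fun z hz => hz)
  · intro z hz
    simpa using hiff (L z) hz
  · exact L.symm.continuous.comp_continuousOn
      (hψ.comp L'.continuous.continuousOn fun z hz => hz)
  · intro z hz
    have h1 := hiff (ψ (L' z)) (mψ hz)
    rw [hr _ hz] at h1
    simpa using h1.symm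
  · filter_upwards [hL] with z hz
    simp [hl _ hz]
  · filter_upwards [hL'] with z hz
    simp [hr _ hz]

end InitialTerm

end BurauZariski

/-- Burau, Zariski. -/
theorem burau_zariski_curves
    (f g : En 2 → ℂ) (hf : AnalyticAt ℂ f 0) (hg : AnalyticAt ℂ g 0)
    (hf0 : f 0 = 0) (hg0 : g 0 = 0)
    (hfsing : IsolatedSingularityAt0 f) (hgsing : IsolatedSingularityAt0 g)
    -- `ν` and `ν'` are the algebraic multiplicities of `f` and `g`
    (ν ν' : ℕ) (P Q : En 2 → ℂ)
    (hfi : HasInitialTerm f ν P) (hgi : HasInitialTerm g ν' Q)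
    (hequi : TopEquisingular f g) :
    ν = ν' := by
  obtain ⟨L, σ, Y, s, C, hR, hD⟩ := BurauZariski.exists_coordinates_rootSystem hf0 hfsing hfi
  obtain ⟨L', σ', Y', s', C', hR', hD'⟩ :=
    BurauZariski.exists_coordinates_rootSystem hg0 hgsing hgi
  obtain ⟨Φ, Ψ, hΦ⟩ := BurauZariski.exists_gHomeo hequi L L'
  simpa using hR.card_eq hR' hD hD' hΦ
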